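/- In the DaC model on the triangular lattice, for every p < 2 sin(π/18) and every ε > 0, limsup_{n→∞} ℙ_{p,1/2+ε}(V^b_{n,3n}) = 1. -/

import Mathlib

/-!
Common definitions for the Divide-and-Colour (DaC) model of
Bálint, Camia and Meester, "Sharp phase transition and critical
behaviour in 2D divide and colour models".

The model is built concretely: a single uniform random variable on `(0,1]`
is decomposed into countably many i.i.d. uniform random variables (via its
binary digits); one family of uniforms drives the Bernoulli(p) bond
percolation (the edge configuration), and an independent family of uniforms
attaches an independent Bernoulli(r) colour to each bond cluster (the colour
of a cluster is determined by the uniform label of its canonical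
representative, the vertex of minimal encoding).  The DaC measure
`ℙ_{p,r}` is the pushforward of Lebesgue measure on `(0,1]` under the map
producing the pair (edge configuration, colour configuration).
-/

open MeasureTheory ENNReal

namespace DaC

/-- Vertices of the lattice. -/
abbrev V : Type := ℤ × ℤ

/-- Square lattice adjacency: Euclidean distance `1`. -/
def SqAdj (u v : V) : Prop := (u.1 - v.1) ^ 2 + (u.2 - v.2) ^ 2 = 1

/-- `*`-adjacency (matching graph of the square lattice):
Euclidean distance `1` or `√2`. -/
def StarAdj (u v : V) : Prop :=
  (u.1 - v.1) ^ 2 + (u.2 - v.2) ^ 2 = 1 ∨ (u.1 - v.1) ^ 2 + (u.2 - v.2) ^ 2 = 2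

/-- Triangular lattice adjacency. -/
def TriAdj (u v : V) : Prop :=
  (u.1 - v.1, u.2 - v.2) ∈
    ({(1, 0), (-1, 0), (0, 1), (0, -1), (1, 1), (-1, -1)} : Set (ℤ × ℤ))

/-- Classical indicator of a proposition, as a boolean. -/
noncomputable def boolOf (P : Prop) : Bool := @decide P (Classical.propDecidable P)

/-- The `n`-th binary digit of a real number `x ∈ (0,1]`. -/
noncomputable def bit (n : ℕ) (x : ℝ) : Bool := boolOf (⌊x * 2 ^ (n + 1)⌋ % 2 = 1)

/-- A countable family of i.i.d. uniform random variables on `[0,1]`, extracted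
from a single uniform sample `x` by splitting its binary digits. -/
noncomputable def unif (i : ℕ) (x : ℝ) : ℝ :=
  ∑' k : ℕ, if bit (Nat.pair i k) x then ((2 : ℝ)⁻¹) ^ (k + 1) else 0

/-- A symmetric encoding of (unordered) pairs of vertices. -/
noncomputable def eIdx (u v : V) : ℕ :=
  min (Encodable.encode (u, v)) (Encodable.encode (v, u))

/-- The uniform label attached to the edge `{u,v}`. -/
noncomputable def edgeU (u v : V) (x : ℝ) : ℝ := unif (2 * eIdx u v) x

/-- The uniform label attached to the vertex `v` (independent of the edge labels). -/
noncomputable def vtxU (v : V) (x : ℝ) : ℝ := unif (2 * Encodable.encode v + 1) x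

/-- Edge configurations: a boolean (open/closed) for each (ordered) pair of
vertices; configurations arising from the model are symmetric and are
supported on pairs of adjacent vertices. -/
abbrev EdgeCfg : Type := V → V → Bool

/-- Colour configurations: a colour (black = `true`, white = `false`) for each vertex. -/
abbrev ColourCfg : Type := V → Bool

/-- Full configurations of the DaC model: an edge configuration together with
a colour configuration. -/
abbrev Config : Type := EdgeCfg × ColourCfg

/-- The Bernoulli(p) edge configuration determined by the uniform sample `x`,
on the lattice with adjacency `adj`: an edge `{u,v}` of the lattice is open
iff its uniform label is `< p`. -/
noncomputable def edgeCfg (adj : V → V → Prop) (p : ℝ) (x : ℝ) : EdgeCfg :=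
  fun u v => boolOf (adj u v) && boolOf (edgeU u v x < p)

/-- Connectivity through open edges of the edge configuration `η`. -/
def Conn (η : EdgeCfg) (u v : V) : Prop :=
  Relation.ReflTransGen (fun a b => η a b = true) u v

/-- The `p`-cluster of the vertex `v`: its connected component in the graph
retaining only open edges. -/
def pCluster (η : EdgeCfg) (v : V) : Set V := {w | Conn η v w}

/-- Canonical representative of the `p`-cluster of `v`: the vertex of the
cluster with minimal encoding. -/
noncomputable def clusterRep (η : EdgeCfg) (v : V) : V :=
  (Encodable.decode (α := V) (sInf (Encodable.encode '' pCluster η v))).getD v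

/-- The colour configuration with parameters `p, r` determined by the uniform
sample `x`: every `p`-cluster is coloured black (with probability `r`)
or white, independently of all other `p`-clusters, according to the uniform
label of its canonical representative. -/
noncomputable def colourCfg (adj : V → V → Prop) (p r : ℝ) (x : ℝ) : ColourCfg :=
  fun v => boolOf (vtxU (clusterRep (edgeCfg adj p x) v) x < r)

/-- The uniform sample: Lebesgue measure on `(0,1]`. -/
noncomputable def base : Measure ℝ := volume.restrict (Set.Ioc 0 1)

/-- `ν_p`: the product Bernoulli(p) measure on edge configurations of the
lattice with adjacency `adj`. -/
noncomputable def edgeMeasure (adj : V → V → Prop) (p : ℝ) : Measure EdgeCfg :=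
  base.map (edgeCfg adj p)

/-- `ℙ_{p,r}`: the DaC measure on pairs (edge configuration, colour
configuration) for the lattice with adjacency `adj`. -/
noncomputable def DaCMeasure (adj : V → V → Prop) (p r : ℝ) : Measure Config :=
  base.map (fun x => (edgeCfg adj p x, colourCfg adj p r x))

/-- Monochromatic connectivity: `u` and `v` are joined by a path (for the
adjacency `adj`) all of whose vertices have colour `c`. -/
def MonoConn (adj : V → V → Prop) (ξ : ColourCfg) (c : Bool) (u v : V) : Prop :=
  Relation.ReflTransGen (fun a b => adj a b ∧ ξ a = c ∧ ξ b = c) u v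

/-- The colour-`c` cluster of `v` (for the adjacency `adj`): empty if `v` does
not have colour `c`, and otherwise the maximal `adj`-connected set of
`c`-coloured vertices containing `v`. -/
def monoCluster (adj : V → V → Prop) (ξ : ColourCfg) (c : Bool) (v : V) : Set V :=
  {w | ξ v = c ∧ MonoConn adj ξ c v w}

/-- The origin. -/
def origin : V := (0, 0)

/-- The size (cardinality) of a set of vertices, with values in `ℝ≥0∞`. -/
noncomputable def sizeE (S : Set V) : ℝ≥0∞ := S.encard

/-- The probability, under the DaC measure with edge adjacency `eadj` and
parameters `p, r`, that the origin lies in an infinite colour-`c` cluster for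
the adjacency `cadj`. -/
noncomputable def percProb (eadj cadj : V → V → Prop) (c : Bool) (p r : ℝ) : ℝ≥0∞ :=
  DaCMeasure eadj p r {ω | (monoCluster cadj ω.2 c origin).Infinite}

/-- `Θ(p,r)` for the square lattice: probability that the origin lies in an
infinite black `r`-cluster. -/
noncomputable def thetaSq (p r : ℝ) : ℝ≥0∞ := percProb SqAdj SqAdj true p r

/-- `Θ*(p,s)` for the square lattice: the `ℙ_{p,1-s}`-probability that the
origin lies in an infinite white `*`-cluster. -/
noncomputable def thetaStarSq (p s : ℝ) : ℝ≥0∞ := percProb SqAdj StarAdj false p (1 - s)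

/-- `Θ(p,r)` for the triangular lattice. -/
noncomputable def thetaTri (p r : ℝ) : ℝ≥0∞ := percProb TriAdj TriAdj true p r

/-- The critical colouring density `r_c(p)` of the square lattice DaC model. -/
noncomputable def rcSq (p : ℝ) : ℝ :=
  sSup {r : ℝ | r ∈ Set.Icc (0 : ℝ) 1 ∧ thetaSq p r = 0}

/-- The critical colouring density `r_c*(p)` for white `*`-percolation. -/
noncomputable def rcStarSq (p : ℝ) : ℝ :=
  sSup {s : ℝ | s ∈ Set.Icc (0 : ℝ) 1 ∧ thetaStarSq p s = 0}

/-- The critical colouring density `r_c(p)` of the triangular lattice DaC model. -/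
noncomputable def rcTri (p : ℝ) : ℝ :=
  sSup {r : ℝ | r ∈ Set.Icc (0 : ℝ) 1 ∧ thetaTri p r = 0}

/-! ### Rectangles and crossings -/

/-- The rectangle `S_{n,m} = ([0,n] × [0,m]) ∩ ℤ²`. -/
def Rect (n m : ℕ) : Set V :=
  {v | 0 ≤ v.1 ∧ v.1 ≤ (n : ℤ) ∧ 0 ≤ v.2 ∧ v.2 ≤ (m : ℤ)}

/-- The top side of `S_{n,m}`. -/
def TopSide (n m : ℕ) : Set V := {v | v ∈ Rect n m ∧ v.2 = (m : ℤ)}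

/-- The bottom side of `S_{n,m}`. -/
def BotSide (n m : ℕ) : Set V := {v | v ∈ Rect n m ∧ v.2 = 0}

/-- The left side of `S_{n,m}`. -/
def LeftSide (n m : ℕ) : Set V := {v | v ∈ Rect n m ∧ v.1 = 0}

/-- The right side of `S_{n,m}`. -/
def RightSide (n m : ℕ) : Set V := {v | v ∈ Rect n m ∧ v.1 = (n : ℤ)}

/-- There is a path (for the adjacency `adj`), all of whose vertices lie in the
region `R` and satisfy the predicate `good`, from the set `A` to the set `B`. -/
def HasCrossing (adj : V → V → Prop) (good : V → Prop) (R A B : Set V) : Prop :=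
  ∃ (k : ℕ) (f : Fin (k + 1) → V),
    (∀ i, f i ∈ R ∧ good (f i)) ∧
    (∀ i : Fin k, adj (f i.castSucc) (f i.succ)) ∧
    f 0 ∈ A ∧ f (Fin.last k) ∈ B

/-- `V^b_{n,m}` as a set of colour configurations: there is a black vertical
crossing of `S_{n,m}` (for the adjacency `adj`). -/
def VertBC (adj : V → V → Prop) (n m : ℕ) : Set ColourCfg :=
  {ξ | HasCrossing adj (fun v => ξ v = true) (Rect n m) (TopSide n m) (BotSide n m)}

/-- `V^{w*}_{n,m}` as a set of colour configurations: there is a white vertical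
`*`-crossing of `S_{n,m}`. -/
def VertWStarC (n m : ℕ) : Set ColourCfg :=
  {ξ | HasCrossing StarAdj (fun v => ξ v = false) (Rect n m) (TopSide n m) (BotSide n m)}

/-- `H^{w*}_{n,m}` as a set of colour configurations: there is a white
horizontal `*`-crossing of `S_{n,m}`. -/
def HorizWStarC (n m : ℕ) : Set ColourCfg :=
  {ξ | HasCrossing StarAdj (fun v => ξ v = false) (Rect n m) (LeftSide n m) (RightSide n m)}

/-- The event (set of full configurations) determined by a set of colour
configurations. -/
def colourEvent (C : Set ColourCfg) : Set Config := {ω | ω.2 ∈ C}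

/-! ### Events depending on colours, increasing events, pivotal clusters -/

/-- The event `A` is defined in terms of the colours of the vertices in `W`. -/
def DependsOnColoursIn (A : Set Config) (W : Set V) : Prop :=
  ∀ ω ω' : Config, (∀ v ∈ W, ω.2 v = ω'.2 v) → (ω ∈ A ↔ ω' ∈ A)

/-- The event `A` is increasing (for the partial order comparing colour
configurations pointwise, black = `true` above white = `false`). -/
def IncreasingColourEvent (A : Set Config) : Prop :=
  ∀ ω ω' : Config, (∀ v : V, ω.2 v = true → ω'.2 v = true) → ω ∈ A → ω' ∈ A

/-- Flip the colours of the vertices of `C`. -/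
noncomputable def flipOn (C : Set V) (ξ : ColourCfg) : ColourCfg :=
  fun v => @ite _ (v ∈ C) (Classical.propDecidable _) (!ξ v) (ξ v)

/-- The set `C` is a pivotal `p`-cluster for the event `A` in the
configuration `ω`: `C` is a `p`-cluster of the edge configuration of `ω`, and
flipping the colour of (all the vertices of) `C` changes whether the
configuration belongs to `A`. -/
def IsPivotal (A : Set Config) (ω : Config) (C : Set V) : Prop :=
  (∃ v : V, C = pCluster ω.1 v) ∧ ¬ (ω ∈ A ↔ (ω.1, flipOn C ω.2) ∈ A)

/-- `n(A)`: the number of pivotal `p`-clusters for the event `A`, with values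
in `ℝ≥0∞`. -/
noncomputable def numPivotal (A : Set Config) (ω : Config) : ℝ≥0∞ :=
  {C : Set V | IsPivotal A ω C}.encard

/-! ### Barriers -/

/-- Connectivity in the square lattice avoiding the edges of `E`. -/
def AvoidConn (E : Set (V × V)) (u v : V) : Prop :=
  Relation.ReflTransGen (fun a b => SqAdj a b ∧ (a, b) ∉ E ∧ (b, a) ∉ E) u v

/-- `E` is a barrier: a set of edges of the square lattice whose removal
(keeping the end-vertices) separates `ℤ²` into two or more connected
components, exactly one of which is infinite. -/
def IsBarrier (E : Set (V × V)) : Prop :=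
  (∀ e ∈ E, SqAdj e.1 e.2) ∧
  (∃ v, {w | AvoidConn E v w}.Infinite) ∧
  (∀ v w, {x | AvoidConn E v x}.Infinite → {x | AvoidConn E w x}.Infinite → AvoidConn E v w) ∧
  (∃ v, {w | AvoidConn E v w}.Finite)

/-- The exterior of a barrier: its unique infinite complementary component. -/
def barrierExt (E : Set (V × V)) : Set V := {v | {w | AvoidConn E v w}.Infinite}

/-- The interior of a barrier: the union of the finite complementary components. -/
def barrierInt (E : Set (V × V)) : Set V := {v | {w | AvoidConn E v w}.Finite}

/-- The event `A ⊆ EdgeCfg` is increasing (opening edges preserves it). -/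
def IncreasingEdgeEvent (A : Set EdgeCfg) : Prop :=
  ∀ η η' : EdgeCfg, (∀ a b : V, η a b = true → η' a b = true) → η ∈ A → η' ∈ A

/-- The event `A ⊆ EdgeCfg` depends only on the states of the edges both of
whose endpoints lie in `W`. -/
def DependsOnEdgesIn (A : Set EdgeCfg) (W : Set V) : Prop :=
  ∀ η η' : EdgeCfg, (∀ a b : V, a ∈ W → b ∈ W → η a b = η' a b) → (η ∈ A ↔ η' ∈ A)

/-! ### Translations -/

/-- Translation of configurations by the vector `u`. -/
def shift (u : V) (ω : Config) : Config :=
  (fun a b => ω.1 (a + u) (b + u), fun a => ω.2 (a + u))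

end DaC

set_option linter.all false

namespace DaC

/-! ### Paths in subsets of the triangular lattice -/

theorem tri_iff (u v : V) : TriAdj u v ↔
    (v.1 = u.1 + 1 ∧ v.2 = u.2) ∨ (v.1 = u.1 - 1 ∧ v.2 = u.2) ∨
    (v.1 = u.1 ∧ v.2 = u.2 + 1) ∨ (v.1 = u.1 ∧ v.2 = u.2 - 1) ∨
    (v.1 = u.1 + 1 ∧ v.2 = u.2 + 1) ∨ (v.1 = u.1 - 1 ∧ v.2 = u.2 - 1) := by
  simp only [TriAdj, Set.mem_insert_iff, Set.mem_singleton_iff, Prod.mk.injEq]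
  constructor
  · rintro (h | h | h | h | h | h) <;> omega
  · rintro (h | h | h | h | h | h) <;> omega

theorem tri_symm {u v : V} (h : TriAdj u v) : TriAdj v u := by
  rw [tri_iff] at *
  omega

/-- `u` and `v` are joined by a path in `S`. -/
def J (S : Set V) (u v : V) : Prop :=
  u ∈ S ∧ Relation.ReflTransGen (fun a b => TriAdj a b ∧ b ∈ S) u v

theorem J.refl {S : Set V} {u : V} (h : u ∈ S) : J S u u := ⟨h, .refl⟩

theorem J.left {S : Set V} {u v : V} (h : J S u v) : u ∈ S := h.1

theorem J.right {S : Set V} {u v : V} (h : J S u v) : v ∈ S := by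
  obtain ⟨h1, h2⟩ := h
  cases h2 with
  | refl => exact h1
  | tail _ h => exact h.2

theorem J.step {S : Set V} {u v w : V} (h : J S u v) (a : TriAdj v w) (hw : w ∈ S) : J S u w :=
  ⟨h.1, h.2.tail ⟨a, hw⟩⟩

theorem J.trans {S : Set V} {u v w : V} (h : J S u v) (h' : J S v w) : J S u w :=
  ⟨h.1, h.2.trans h'.2⟩

/-- Induction principle for `J`. -/
theorem J.ind {S : Set V} {u : V} {P : V → Prop} (h0 : P u)
    (hs : ∀ v w, J S u v → P v → TriAdj v w → w ∈ S → P w) {v : V} (h : J S u v) : P v := by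
  obtain ⟨h1, h2⟩ := h
  induction h2 with
  | refl => exact h0
  | tail hab hbc ih => exact hs _ _ ⟨h1, hab⟩ ih hbc.1 hbc.2

theorem J.symm {S : Set V} {u v : V} (h : J S u v) : J S v u := by
  refine J.ind (P := fun v => J S v u) (J.refl h.1) ?_ h
  intro v w h1 h2 a hw
  exact ((J.refl hw).step (tri_symm a) h1.right).trans h2

theorem J.mono {S T : Set V} (hST : S ⊆ T) {u v : V} (h : J S u v) : J T u v :=
  
  J.ind (P := fun v => J T u v) (J.refl (hST h.1)) (fun _ _ _ h2 a hw => h2.step a (hST hw)) h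

/-- A path from `u` stays in the component of `u`. -/
theorem J.comp {S : Set V} {u v : V} (h : J S u v) : J {w | J S u w} u v :=
  J.ind (P := fun v => J {w | J S u w} u v) (J.refl (J.refl h.1))
    (fun _ _ h1 h2 a hw => h2.step a (h1.step a hw)) h

theorem J.map {S T : Set V} (f : V → V) (hf : ∀ u v, TriAdj u v → TriAdj (f u) (f v))
    (hST : ∀ u ∈ S, f u ∈ T) {u v : V} (h : J S u v) : J T (f u) (f v) :=
  J.ind (P := fun v => J T (f u) (f v)) (J.refl (hST _ h.1))
    (fun _ _ _ h2 a hw => h2.step (hf _ _ a) (hST _ hw)) h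

theorem J.finite {S : Set V} {u v : V} (h : J S u v) : ∃ F : Finset V, ↑F ⊆ S ∧ J F u v := by
  refine J.ind (P := fun v => ∃ F : Finset V, ↑F ⊆ S ∧ J F u v) ?_ ?_ h
  · exact ⟨{u}, by simpa using h.1, J.refl (by simp)⟩
  · rintro v w - ⟨F, hF, hJ⟩ a hw
    refine ⟨insert w F, ?_, (hJ.mono (by simp)).step a (by simp)⟩
    rw [Finset.coe_insert]
    exact Set.insert_subset hw hF

/-- A path in `S` is a path in a bounded part of `S`. -/
theorem J.bounded {S : Set V} {u v : V} (h : J S u v) :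
    ∃ M : ℤ, J (S ∩ {w | |w.1| ≤ M ∧ |w.2| ≤ M}) u v := by
  obtain ⟨F, hF, hJ⟩ := h.finite
  refine ⟨∑ w ∈ F, (|w.1| + |w.2|), hJ.mono ?_⟩
  intro w hw
  refine ⟨hF hw, ?_⟩
  have := Finset.single_le_sum (f := fun w : V => |w.1| + |w.2|)
    (fun i _ => by positivity) (Finset.mem_coe.1 hw)
  simp only [Set.mem_ofPred_eq]
  have h1 := abs_nonneg w.1
  have h2 := abs_nonneg w.2
  constructor <;> linarith

/-- Sub-path of a path on which `f` runs from `a` to `b`, if `f` changes by at most `d`. -/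
theorem J.strip {S : Set V} {p e : V} (h : J S p e) (f : V → ℤ) (d a b : ℤ)
    (hf : ∀ u v, TriAdj u v → f v ≤ f u + d) (hd : 1 ≤ d) (hab : a ≤ b) (hp : f p ≤ a) (he : b ≤ f e) :
    ∃ u v, J S p u ∧ J (S ∩ {w | a ≤ f w ∧ f w ≤ b + d - 1}) u v ∧ f u ≤ a + d - 1 ∧ b ≤ f v := by
  by_contra hcon
  push Not at hcon
  have key : ∀ v, J S p v → f v < b ∧ (f v < a ∨ ∃ u, J S p u ∧ f u ≤ a + d - 1 ∧
      J (S ∩ {w | a ≤ f w ∧ f w ≤ b + d - 1}) u v) := by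
    intro v hv
    have base : ∀ w, J S p w → a ≤ f w → f w ≤ a + d - 1 → (f w < b ∧ (f w < a ∨ ∃ u, J S p u ∧ f u ≤ a + d - 1 ∧
      J (S ∩ {w | a ≤ f w ∧ f w ≤ b + d - 1}) u w)) := by
      intro w hw h1 h2
      have hm : J (S ∩ {w | a ≤ f w ∧ f w ≤ b + d - 1}) w w := J.refl ⟨hw.right, h1, by linarith⟩
      exact ⟨hcon w w hw hm h2, Or.inr ⟨w, hw, h2, hm⟩⟩
    refine J.ind (P := fun v => f v < b ∧ (f v < a ∨ ∃ u, J S p u ∧ f u ≤ a + d - 1 ∧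
      J (S ∩ {w | a ≤ f w ∧ f w ≤ b + d - 1}) u v)) ?_ ?_ hv
    · rcases hp.lt_or_eq with h1 | h1
      · exact ⟨by linarith, Or.inl h1⟩
      · exact base p (J.refl h.1) h1.ge (by linarith)
    · rintro v w hv ⟨h1, h2⟩ ad hw
      have hfw := hf _ _ ad
      by_cases haw : f w < a
      · exact ⟨by linarith, Or.inl haw⟩
      push Not at haw
      rcases h2 with h2 | ⟨u, hu1, hu2, hu3⟩
      · exact base w (hv.step ad hw) haw (by linarith)
      · have : J (S ∩ {w | a ≤ f w ∧ f w ≤ b + d - 1}) u w := hu3.step ad ⟨hw, haw, by linarith⟩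
        exact ⟨hcon u w hu1 this hu2, Or.inr ⟨u, hu1, hu2, this⟩⟩
  exact absurd (key e h).1 (not_lt.2 he)

/-! ### The intersection lemma -/

open Classical in
private noncomputable def crs (a b w : V) : ZMod 2 :=
  if (a.1 = w.1 ∧ b.1 = w.1 + 1 ∧ a.2 < w.2) ∨ (b.1 = w.1 ∧ a.1 = w.1 + 1 ∧ b.2 < w.2) then 1 else 0

open Classical in
private noncomputable def ph (w w' a : V) : ZMod 2 :=
  if (w'.1 = w.1 + 1 ∧ a.1 = w'.1 ∧ a.2 < w'.2) ∨ (w.1 = w'.1 + 1 ∧ a.1 = w.1 ∧ a.2 < w.2) then 1 else 0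

private theorem crs_comm (a b w : V) : crs a b w = crs b a w := by
  unfold crs
  congr 1
  exact propext or_comm

private theorem ph_comm (a w w' : V) : ph w w' a = ph w' w a := by
  unfold ph
  congr 1
  exact propext or_comm

private theorem crs_ph0 {a b w w' : V} (hab : (b.1 = a.1 + 1 ∧ b.2 = a.2) ∨ (b.1 = a.1 ∧ b.2 = a.2 + 1) ∨
    (b.1 = a.1 + 1 ∧ b.2 = a.2 + 1)) (hw : (w'.1 = w.1 + 1 ∧ w'.2 = w.2) ∨ (w'.1 = w.1 ∧ w'.2 = w.2 + 1) ∨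
    (w'.1 = w.1 + 1 ∧ w'.2 = w.2 + 1)) (h1 : a ≠ w) (h2 : a ≠ w')
    (h3 : b ≠ w) (h4 : b ≠ w') : crs a b w + crs a b w' = ph w w' a + ph w w' b := by
  obtain ⟨a1, a2⟩ := a
  obtain ⟨b1, b2⟩ := b
  obtain ⟨w1, w2⟩ := w
  obtain ⟨x1, x2⟩ := w'
  simp only [ne_eq, Prod.mk.injEq, not_and_or] at *
  unfold crs ph
  simp only
  have e2 : (1 : ZMod 2) + 1 = 0 := by decide
  have hc : a1 = w1 ∨ a1 = w1 + 1 ∨ a1 + 1 = w1 ∨ (a1 ≠ w1 ∧ a1 ≠ w1 + 1 ∧ a1 + 1 ≠ w1) := by omega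
  rcases hc with rfl | rfl | rfl | ⟨n1, n2, n3⟩ <;>
  rcases hw with hw | hw | hw <;> obtain ⟨rfl, rfl⟩ := hw <;>
    rcases hab with hab | hab | hab <;> obtain ⟨rfl, rfl⟩ := hab <;>
    simp_all [add_assoc] <;>
    split_ifs <;> first | rfl | exact e2 | exact e2.symm | (exfalso; omega)

private theorem crs_ph {a b w w' : V} (hab : TriAdj a b) (hw : TriAdj w w') (h1 : a ≠ w) (h2 : a ≠ w')
    (h3 : b ≠ w) (h4 : b ≠ w') : crs a b w + crs a b w' = ph w w' a + ph w w' b := by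
  have key : ∀ w w' : V, ((w'.1 = w.1 + 1 ∧ w'.2 = w.2) ∨ (w'.1 = w.1 ∧ w'.2 = w.2 + 1) ∨
    (w'.1 = w.1 + 1 ∧ w'.2 = w.2 + 1)) → a ≠ w → a ≠ w' → b ≠ w → b ≠ w' →
    crs a b w + crs a b w' = ph w w' a + ph w w' b := by
    intro w w' hw h1 h2 h3 h4
    rw [tri_iff] at hab
    by_cases hc : (b.1 = a.1 + 1 ∧ b.2 = a.2) ∨ (b.1 = a.1 ∧ b.2 = a.2 + 1) ∨
        (b.1 = a.1 + 1 ∧ b.2 = a.2 + 1)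
    · exact crs_ph0 hc hw h1 h2 h3 h4
    · rw [crs_comm a b w, crs_comm a b w', add_comm (ph w w' a)]
      exact crs_ph0 (by omega) hw h3 h4 h1 h2
  rw [tri_iff] at hw
  by_cases hc : (w'.1 = w.1 + 1 ∧ w'.2 = w.2) ∨ (w'.1 = w.1 ∧ w'.2 = w.2 + 1) ∨
    (w'.1 = w.1 + 1 ∧ w'.2 = w.2 + 1)
  · exact key w w' hc h1 h2 h3 h4
  · rw [ph_comm a w w', ph_comm b w w', add_comm (crs a b w)]
    exact key w' w (by omega) h2 h1 h4 h3

open Classical in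
/-- Parity function attached to a path. -/
private theorem parity {S : Set V} {p e : V} (h : J S p e) : ∃ c : V → ZMod 2,
    (∀ w w', w ∉ S → w' ∉ S → TriAdj w w' → c w + c w' = ph w w' p + ph w w' e) ∧
    (∀ w : V, (∀ v ∈ S, w.2 < v.2) → c w = 0) ∧
    (∀ w : V, (∀ v ∈ S, v.2 < w.2) → c w = (if p.1 ≤ w.1 then 1 else 0) + (if e.1 ≤ w.1 then 1 else 0)) := by
  have two : ∀ z : ZMod 2, z + z = 0 := by decide
  refine J.ind (P := fun e => ∃ c : V → ZMod 2,
    (∀ w w', w ∉ S → w' ∉ S → TriAdj w w' → c w + c w' = ph w w' p + ph w w' e) ∧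
    (∀ w : V, (∀ v ∈ S, w.2 < v.2) → c w = 0) ∧
    (∀ w : V, (∀ v ∈ S, v.2 < w.2) → c w = (if p.1 ≤ w.1 then 1 else 0) + (if e.1 ≤ w.1 then 1 else 0))) ?_ ?_ h
  · exact ⟨fun _ => 0, fun w w' _ _ _ => by rw [two, two], fun _ _ => rfl, fun w _ => by rw [two]⟩
  · rintro a b ha ⟨c, c1, c2, c3⟩ hab hb
    have hS : ∀ {a w : V}, a ∈ S → w ∉ S → a ≠ w := by
      rintro a w ha hw rfl
      exact hw ha
    have haS := ha.right
    refine ⟨fun w => c w + crs a b w, ?_, ?_, ?_⟩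
    · intro w w' hw hw' hww
      have e1 := c1 w w' hw hw' hww
      have e2 := crs_ph hab hww (hS haS hw) (hS haS hw') (hS hb hw) (hS hb hw')
      calc c w + crs a b w + (c w' + crs a b w') = (c w + c w') + (crs a b w + crs a b w') := by ring
        _ = (ph w w' p + ph w w' b) + (ph w w' a + ph w w' a) := by rw [e1, e2]; ring
        _ = _ := by rw [two, add_zero]
    · intro w hw
      have h1 := hw a haS
      have h2 := hw b hb
      simp only [c2 w hw, zero_add, crs]
      rw [if_neg (by omega)]
    · intro w hw
      have h1 := hw a haS
      have h2 := hw b hb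
      rw [tri_iff] at hab
      have e2 : (1 : ZMod 2) + 1 = 0 := by decide
      simp only [c3 w hw, crs, add_assoc]
      congr 1
      split_ifs <;> first | rfl | exact e2 | (exfalso; omega)

/-- Base intersection lemma. -/
theorem meet_base {S T : Set V} {p e u v : V} (h : J S p e) (h' : J T u v)
    (hT : ∀ w ∈ T, p.1 < w.1 ∧ w.1 < e.1) (hS : ∀ w ∈ S, u.2 < w.2 ∧ w.2 < v.2) :
    ∃ w, J S p w ∧ J T u w := by
  by_contra hcon
  push Not at hcon
  obtain ⟨c, c1, c2, c3⟩ := parity h.comp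
  have hno : ∀ w, J T u w → w ∉ {w | J S p w} := fun w hw hw' => hcon w hw' hw
  have two : ∀ y z : ZMod 2, y + z = 0 → z = y := by decide
  have hc : c v = c u := by
    refine J.ind (P := fun v => c v = c u) rfl ?_ h'
    intro a b ha iha hab hb
    rw [← iha]
    apply two
    have hJb := ha.step hab hb
    rw [c1 a b (hno a ha) (hno b hJb) hab]
    have h1 := hT a ha.right
    have h2 := hT b hb
    simp only [ph]
    rw [if_neg (by omega), if_neg (by omega), add_zero]
  have hu := c2 u (fun w (hw : J S p w) => (hS w hw.right).1)
  have hv := c3 v (fun w (hw : J S p w) => (hS w hw.right).2)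
  have h1 := hT v h'.right
  rw [hc, hu, if_pos (by omega), if_neg (by omega), add_zero] at hv
  exact absurd hv (by decide)

end DaC

namespace DaC

theorem J.first {S : Set V} {p e : V} (h : J S p e) (f : V → ℤ) (d b : ℤ)
    (hf : ∀ u v, TriAdj u v → f v ≤ f u + d) (hp : f p ≤ b + d - 1) (he : b ≤ f e) :
    ∃ v, J (S ∩ {w | f w ≤ b + d - 1}) p v ∧ b ≤ f v := by
  by_contra hcon
  push Not at hcon
  have key : J (S ∩ {w | f w ≤ b + d - 1}) p e := by
    refine J.ind (P := fun e => J (S ∩ {w | f w ≤ b + d - 1}) p e) (J.refl ⟨h.1, hp⟩) ?_ h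
    intro v w _ hv ad hw
    have h1 := hcon v hv
    have h2 := hf _ _ ad
    exact hv.step ad ⟨hw, by simp only [Set.mem_ofPred_eq]; linarith⟩
  exact absurd he (not_le.2 (hcon e key))

/-- Straight path from `p` with `n` steps in direction `d`. -/
theorem ray_path (p d : V) (hd : TriAdj (0, 0) d) (n : ℕ) :
    J {w | ∃ k : ℤ, 0 ≤ k ∧ k ≤ n ∧ w.1 = p.1 + k * d.1 ∧ w.2 = p.2 + k * d.2} p
      (p.1 + n * d.1, p.2 + n * d.2) := by
  induction n with
  | zero => simpa using J.refl (S := {w : V | ∃ k : ℤ, 0 ≤ k ∧ k ≤ ((0 : ℕ) : ℤ) ∧ w.1 = p.1 + k * d.1 ∧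
      w.2 = p.2 + k * d.2}) (u := p) ⟨0, by simp⟩
  | succ n ih =>
    refine (ih.mono ?_).step ?_ ⟨n + 1, by omega, by push_cast; omega, by push_cast; ring, by push_cast; ring⟩
    · rintro w ⟨k, h1, h2, h3⟩
      exact ⟨k, h1, by push_cast; omega, h3⟩
    · rw [tri_iff] at *
      push_cast
      simp only [add_mul, one_mul]
      simp only at hd
      omega

theorem meet_ext {S T R₁ R₂ R₃ R₄ : Set V} {p e u v p' e' u' v' : V} (h : J S p e) (h' : J T u v)
    (r1 : J R₁ p p') (r2 : J R₂ e e') (r3 : J R₃ u u') (r4 : J R₄ v v')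
    (hT : ∀ w, J T u w ∨ w ∈ R₃ ∨ w ∈ R₄ → p'.1 < w.1 ∧ w.1 < e'.1)
    (hS : ∀ w, J S p w ∨ w ∈ R₁ ∨ w ∈ R₂ → u'.2 < w.2 ∧ w.2 < v'.2)
    (hR : ∀ w, w ∈ R₁ ∨ w ∈ R₂ → J T u w ∨ w ∈ R₃ ∨ w ∈ R₄ → w = p ∨ w = e)
    (hR' : ∀ w, w ∈ R₃ ∨ w ∈ R₄ → J S p w ∨ w ∈ R₁ ∨ w ∈ R₂ → w = u ∨ w = v) :
    ∃ w, J S p w ∧ J T u w := by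
  have j1 : J {w | J S p w ∨ w ∈ R₁ ∨ w ∈ R₂} p' e' :=
    ((r1.mono fun w hw => Or.inr (Or.inl hw)).symm.trans (h.comp.mono fun w hw => Or.inl hw)).trans
      (r2.mono fun w hw => Or.inr (Or.inr hw))
  have j2 : J {w | J T u w ∨ w ∈ R₃ ∨ w ∈ R₄} u' v' :=
    ((r3.mono fun w hw => Or.inr (Or.inl hw)).symm.trans (h'.comp.mono fun w hw => Or.inl hw)).trans
      (r4.mono fun w hw => Or.inr (Or.inr hw))
  obtain ⟨w, hw1, hw2⟩ := meet_base j1 j2 hT hS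
  have hw1 := hw1.right
  have hw2 := hw2.right
  have k1 : J S p w := by
    rcases hw1 with k | k
    · exact k
    · rcases hR w k hw2 with rfl | rfl
      exacts [J.refl h.1, h]
  have k2 : J T u w := by
    rcases hw2 with k | k
    · exact k
    · rcases hR' w k hw1 with rfl | rfl
      exacts [J.refl h'.1, h']
  exact ⟨w, k1, k2⟩

/-- `2x - y`. -/
def ell (v : V) : ℤ := 2 * v.1 - v.2

theorem ell_step {u v : V} (h : TriAdj u v) : ell v ≤ ell u + 2 := by
  rw [tri_iff] at h
  unfold ell
  omega

theorem ell_step' {u v : V} (h : TriAdj u v) : -ell v ≤ -ell u + 2 := by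
  rw [tri_iff] at h
  unfold ell
  omega

theorem meetX {S T : Set V} {p e u v : V} (x0 x1 y0 y1 : ℤ) (h : J S p e) (h' : J T u v)
    (hS : ∀ w ∈ S, y0 ≤ w.2 ∧ w.2 ≤ y1) (hT : ∀ w ∈ T, x0 ≤ w.1 ∧ w.1 ≤ x1)
    (hp : p.1 ≤ x0) (he : x1 ≤ e.1) (hu : u.2 ≤ y0) (hv : y1 ≤ v.2) : ∃ w, J S p w ∧ J T u w := by
  have d1 : TriAdj (0, 0) (-1, 0) := by rw [tri_iff]; simp
  have d2 : TriAdj (0, 0) (1, 0) := by rw [tri_iff]; simp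
  have d3 : TriAdj (0, 0) (0, -1) := by rw [tri_iff]; simp
  have d4 : TriAdj (0, 0) (0, 1) := by rw [tri_iff]; simp
  have kS : ∀ w, J S p w → y0 ≤ w.2 ∧ w.2 ≤ y1 := fun w hw => hS w hw.right
  have kT : ∀ w, J T u w → x0 ≤ w.1 ∧ w.1 ≤ x1 := fun w hw => hT w hw.right
  have b1 := hS p h.1
  have b2 := hS e h.right
  have b3 := hT u h'.1
  have b4 := hT v h'.right
  refine meet_ext h h' (ray_path p (-1, 0) d1 1) (ray_path e (1, 0) d2 1) (ray_path u (0, -1) d3 1)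
    (ray_path v (0, 1) d4 1) ?_ ?_ ?_ ?_
  · rintro w (hw | ⟨k, h1, h2, h3, h4⟩ | ⟨k, h1, h2, h3, h4⟩)
    · have := kT w hw
      simp; omega
    · simp only [mul_neg, mul_one, mul_zero, add_zero, Nat.cast_one] at *; omega
    · simp only [mul_neg, mul_one, mul_zero, add_zero, Nat.cast_one] at *; omega
  · rintro w (hw | ⟨k, h1, h2, h3, h4⟩ | ⟨k, h1, h2, h3, h4⟩)
    · have := kS w hw
      simp; omega
    · simp only [mul_neg, mul_one, mul_zero, add_zero, Nat.cast_one] at *; omega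
    · simp only [mul_neg, mul_one, mul_zero, add_zero, Nat.cast_one] at *; omega
  · rintro w (⟨k, h1, h2, h3, h4⟩ | ⟨k, h1, h2, h3, h4⟩) (hw | ⟨k', h1', h2', h3', h4'⟩ | ⟨k', h1', h2', h3', h4'⟩)
    all_goals try have := kT w hw
    all_goals simp only [Prod.ext_iff, mul_neg, mul_one, mul_zero, add_zero, Nat.cast_one] at *; omega
  · rintro w (⟨k, h1, h2, h3, h4⟩ | ⟨k, h1, h2, h3, h4⟩) (hw | ⟨k', h1', h2', h3', h4'⟩ | ⟨k', h1', h2', h3', h4'⟩)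
    all_goals try have := kS w hw
    all_goals simp only [Prod.ext_iff, mul_neg, mul_one, mul_zero, add_zero, Nat.cast_one] at *; omega

theorem exists_nat_ge2 (a b : ℤ) : ∃ n : ℕ, a ≤ n ∧ b ≤ n :=
  ⟨(max a b).toNat, (le_max_left a b).trans (Int.self_le_toNat _), (le_max_right a b).trans (Int.self_le_toNat _)⟩

theorem meetL {S T : Set V} {p e u v : V} (l0 l1 y0 y1 : ℤ) (h : J S p e) (h' : J T u v)
    (hS : ∀ w ∈ S, y0 ≤ w.2 ∧ w.2 ≤ y1) (hT : ∀ w ∈ T, l0 ≤ ell w ∧ ell w ≤ l1)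
    (hp : ell p ≤ l0) (he : l1 ≤ ell e) (hu : u.2 ≤ y0) (hv : y1 ≤ v.2) : ∃ w, J S p w ∧ J T u w := by
  obtain ⟨M, hM⟩ := h'.bounded
  suffices ∃ w, J S p w ∧ J (T ∩ {w | |w.1| ≤ M ∧ |w.2| ≤ M}) u w by
    obtain ⟨w, h1, h2⟩ := this
    exact ⟨w, h1, h2.mono Set.inter_subset_left⟩
  have d1 : TriAdj (0, 0) (-1, 0) := by rw [tri_iff]; simp
  have d2 : TriAdj (0, 0) (1, 0) := by rw [tri_iff]; simp
  have d3 : TriAdj (0, 0) (0, -1) := by rw [tri_iff]; simp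
  have d4 : TriAdj (0, 0) (0, 1) := by rw [tri_iff]; simp
  have kS : ∀ w, J S p w → y0 ≤ w.2 ∧ w.2 ≤ y1 := fun w hw => hS w hw.right
  have kT : ∀ w, J (T ∩ {w | |w.1| ≤ M ∧ |w.2| ≤ M}) u w → l0 ≤ ell w ∧ ell w ≤ l1 ∧ -M ≤ w.1 ∧ w.1 ≤ M := by
    intro w hw
    have h1 := hw.right
    exact ⟨(hT w h1.1).1, (hT w h1.1).2, (abs_le.1 h1.2.1).1, (abs_le.1 h1.2.1).2⟩
  unfold ell at *
  have b1 := hS p h.1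
  have b2 := hS e h.right
  have b3 := kT u (J.refl hM.1)
  have b4 := kT v hM
  obtain ⟨n, hn1, hn2⟩ := exists_nat_ge2 (p.1 + M + 1) (M + 1 - e.1)
  refine meet_ext h hM (ray_path p (-1, 0) d1 n) (ray_path e (1, 0) d2 n) (ray_path u (0, -1) d3 1)
    (ray_path v (0, 1) d4 1) ?_ ?_ ?_ ?_
  · rintro w (hw | ⟨k, h1, h2, h3, h4⟩ | ⟨k, h1, h2, h3, h4⟩)
    · have := kT w hw
      simp; omega
    · simp only [mul_neg, mul_one, mul_zero, add_zero, Nat.cast_one] at *; omega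
    · simp only [mul_neg, mul_one, mul_zero, add_zero, Nat.cast_one] at *; omega
  · rintro w (hw | ⟨k, h1, h2, h3, h4⟩ | ⟨k, h1, h2, h3, h4⟩)
    · have := kS w hw
      simp; omega
    · simp only [mul_neg, mul_one, mul_zero, add_zero, Nat.cast_one] at *; omega
    · simp only [mul_neg, mul_one, mul_zero, add_zero, Nat.cast_one] at *; omega
  · rintro w (⟨k, h1, h2, h3, h4⟩ | ⟨k, h1, h2, h3, h4⟩) (hw | ⟨k', h1', h2', h3', h4'⟩ | ⟨k', h1', h2', h3', h4'⟩)
    all_goals try have := kT w hw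
    all_goals simp only [Prod.ext_iff, mul_neg, mul_one, mul_zero, add_zero, Nat.cast_one] at *; omega
  · rintro w (⟨k, h1, h2, h3, h4⟩ | ⟨k, h1, h2, h3, h4⟩) (hw | ⟨k', h1', h2', h3', h4'⟩ | ⟨k', h1', h2', h3', h4'⟩)
    all_goals try have := kS w hw
    all_goals simp only [Prod.ext_iff, mul_neg, mul_one, mul_zero, add_zero, Nat.cast_one] at *; omega

/-- Separation: a path reaching the line `ell = R` inside the gap of an arc meets the arc. -/
theorem meetSep {S T : Set V} {p e u v : V} (L R : ℤ) (h : J S p e) (h' : J T u v)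
    (hS : ∀ w ∈ S, ell w ≤ R + 1) (hT : ∀ w ∈ T, L ≤ ell w ∧ ell w ≤ R + 1)
    (hp : ell p < L) (he : R ≤ ell e) (hu : R ≤ ell u) (hv : R ≤ ell v) (hue : u.2 ≤ e.2) (hev : e.2 ≤ v.2) :
    ∃ w, J S p w ∧ J T u w := by
  have hSe := hS e h.right
  have hTu := hT u h'.1
  have hTv := hT v h'.right
  have id : ∀ w : V, R ≤ ell w → ell w ≤ R + 1 → w.2 = e.2 → w = e := by
    intro w h1 h2 h3
    unfold ell at *
    ext <;> omega
  by_cases hc1 : u.2 = e.2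
  · rw [← id u hu hTu.2 hc1] at h
    exact ⟨u, h, J.refl h'.1⟩
  by_cases hc2 : v.2 = e.2
  · rw [← id v hv hTv.2 hc2] at h
    exact ⟨v, h, h'⟩
  obtain ⟨M₁, hM₁⟩ := h'.bounded
  obtain ⟨M₂, hM₂⟩ := h.bounded
  suffices ∃ w, J (S ∩ {w | |w.1| ≤ M₂ ∧ |w.2| ≤ M₂}) p w ∧ J (T ∩ {w | |w.1| ≤ M₁ ∧ |w.2| ≤ M₁}) u w by
    obtain ⟨w, h1, h2⟩ := this
    exact ⟨w, h1.mono Set.inter_subset_left, h2.mono Set.inter_subset_left⟩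
  have kT : ∀ w, J (T ∩ {w | |w.1| ≤ M₁ ∧ |w.2| ≤ M₁}) u w → L ≤ ell w ∧ ell w ≤ R + 1 ∧ -M₁ ≤ w.1 ∧ w.1 ≤ M₁ := by
    intro w hw
    have h1 := hw.right
    exact ⟨(hT w h1.1).1, (hT w h1.1).2, (abs_le.1 h1.2.1).1, (abs_le.1 h1.2.1).2⟩
  have kS : ∀ w, J (S ∩ {w | |w.1| ≤ M₂ ∧ |w.2| ≤ M₂}) p w → ell w ≤ R + 1 ∧ -M₂ ≤ w.2 ∧ w.2 ≤ M₂ := by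
    intro w hw
    have h1 := hw.right
    exact ⟨hS w h1.1, (abs_le.1 h1.2.2).1, (abs_le.1 h1.2.2).2⟩
  have d1 : TriAdj (0, 0) (-1, 0) := by rw [tri_iff]; simp
  have d2 : TriAdj (0, 0) (1, 0) := by rw [tri_iff]; simp
  have d3 : TriAdj (0, 0) (0, -1) := by rw [tri_iff]; simp
  have d4 : TriAdj (0, 0) (1, 1) := by rw [tri_iff]; simp
  unfold ell at *
  have b1 := kS p (J.refl hM₂.1)
  have b2 := kS e hM₂
  have b3 := kT u (J.refl hM₁.1)
  have b4 := kT v hM₁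
  obtain ⟨m, hm1, hm2⟩ := exists_nat_ge2 (u.2 + M₂ + 1) (M₂ + 1 - v.2)
  obtain ⟨n, hn1, hn2⟩ := exists_nat_ge2 (p.1 + M₁ + 1) (M₁ + m + 2 - e.1)
  have r3 : J {w | w = u ∨ ∃ k : ℤ, 0 ≤ k ∧ k ≤ m ∧ w.1 = u.1 + 1 ∧ w.2 = u.2 - k} u (u.1 + 1, u.2 - m) := by
    have := ray_path (u.1 + 1, u.2) (0, -1) d3 m
    have a : J {w | w = u ∨ ∃ k : ℤ, 0 ≤ k ∧ k ≤ m ∧ w.1 = u.1 + 1 ∧ w.2 = u.2 - k} u (u.1 + 1, u.2) :=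
      (J.refl (Or.inl rfl)).step (by rw [tri_iff]; simp) (Or.inr ⟨0, by simp⟩)
    refine a.trans ?_
    have e : ((u.1 + 1, u.2 - (m : ℤ)) : V) = (u.1 + 1 + m * 0, u.2 + m * (-1)) := by ext <;> simp; ring
    rw [e]
    refine this.mono ?_
    rintro w ⟨k, h1, h2, h3, h4⟩
    exact Or.inr ⟨k, h1, h2, by simpa using h3, by simp at h4; omega⟩
  have r4 : J {w | w = v ∨ ∃ k : ℤ, 0 ≤ k ∧ k ≤ m ∧ w.1 = v.1 + 1 + k ∧ w.2 = v.2 + k} v (v.1 + 1 + m, v.2 + m) := by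
    have := ray_path (v.1 + 1, v.2) (1, 1) d4 m
    have a : J {w | w = v ∨ ∃ k : ℤ, 0 ≤ k ∧ k ≤ m ∧ w.1 = v.1 + 1 + k ∧ w.2 = v.2 + k} v (v.1 + 1, v.2) :=
      (J.refl (Or.inl rfl)).step (by rw [tri_iff]; simp) (Or.inr ⟨0, by simp⟩)
    refine a.trans ?_
    have e : ((v.1 + 1 + (m : ℤ), v.2 + (m : ℤ)) : V) = (v.1 + 1 + m * 1, v.2 + m * 1) := by ext <;> simp
    rw [e]
    refine this.mono ?_
    rintro w ⟨k, h1, h2, h3, h4⟩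
    exact Or.inr ⟨k, h1, h2, by simpa using h3, by simpa using h4⟩
  refine meet_ext hM₂ hM₁ (ray_path p (-1, 0) d1 n) (ray_path e (1, 0) d2 n) r3 r4 ?_ ?_ ?_ ?_ <;> clear hS hT id hSe hTu hTv hM₁ hM₂ r3 r4 d1 d2 d3 d4 h h'
  · rintro w (hw | (rfl | ⟨k, h1, h2, h3, h4⟩) | (rfl | ⟨k, h1, h2, h3, h4⟩))
    · have := kT w hw
      simp; omega
    all_goals simp only [mul_neg, mul_one, mul_zero, add_zero, Nat.cast_one] at *; omega
  · rintro w (hw | ⟨k, h1, h2, h3, h4⟩ | ⟨k, h1, h2, h3, h4⟩)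
    · have := kS w hw
      simp; omega
    · simp only [mul_neg, mul_one, mul_zero, add_zero, Nat.cast_one] at *; omega
    · simp only [mul_neg, mul_one, mul_zero, add_zero, Nat.cast_one] at *; omega
  · rintro w (⟨k, h1, h2, h3, h4⟩ | ⟨k, h1, h2, h3, h4⟩)
      (hw | (rfl | ⟨k', h1', h2', h3', h4'⟩) | (rfl | ⟨k', h1', h2', h3', h4'⟩))
    all_goals try have := kT w hw
    all_goals simp only [Prod.ext_iff, mul_neg, mul_one, mul_zero, add_zero, Nat.cast_one] at *; omega
  · rintro w ((rfl | ⟨k, h1, h2, h3, h4⟩) | (rfl | ⟨k, h1, h2, h3, h4⟩))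
      (hw | ⟨k', h1', h2', h3', h4'⟩ | ⟨k', h1', h2', h3', h4'⟩)
    all_goals first | exact Or.inl rfl | exact Or.inr rfl | skip
    all_goals try have := kS w hw
    all_goals simp only [Prod.ext_iff, mul_neg, mul_one, mul_zero, add_zero, Nat.cast_one] at *; omega

end DaC

namespace DaC

/-! ### Symmetries, strips, circuits -/

def R1 (v : V) : V := (v.2 - v.1, v.2)
def R2 (v : V) : V := (v.1 - v.2, -v.2)
def sw (v : V) : V := (v.2, v.1)
def tr (z v : V) : V := (v.1 + z.1, v.2 + z.2)

theorem R1_adj (u v : V) (h : TriAdj u v) : TriAdj (R1 u) (R1 v) := by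
  rw [tri_iff] at *; simp only [R1]; omega
theorem R2_adj (u v : V) (h : TriAdj u v) : TriAdj (R2 u) (R2 v) := by
  rw [tri_iff] at *; simp only [R2]; omega
theorem sw_adj (u v : V) (h : TriAdj u v) : TriAdj (sw u) (sw v) := by
  rw [tri_iff] at *; simp only [sw]; omega
theorem tr_adj (z u v : V) (h : TriAdj u v) : TriAdj (tr z u) (tr z v) := by
  rw [tri_iff] at *; simp only [tr]; omega
theorem R1_R1 (v : V) : R1 (R1 v) = v := by simp [R1]
theorem R2_R2 (v : V) : R2 (R2 v) = v := by simp [R2]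
theorem sw_sw (v : V) : sw (sw v) = v := by simp [sw]

/-- Transport a path by a symmetry. -/
theorem J.pre {O B C : Set V} (f : V → V) (hf : ∀ u v, TriAdj u v → TriAdj (f u) (f v))
    (hB : ∀ v ∈ B, f v ∈ C) {p e : V} (h : J (f ⁻¹' O ∩ B) p e) : J (O ∩ C) (f p) (f e) :=
  h.map f hf (by rintro u ⟨h1, h2⟩; exact Set.mem_inter h1 (hB _ h2))

theorem meetSep' {S T : Set V} {p e u v : V} (L R : ℤ) (h : J S p e) (h' : J T u v)
    (hS : ∀ w ∈ S, R - 1 ≤ ell w) (hT : ∀ w ∈ T, ell w ≤ L ∧ R - 1 ≤ ell w)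
    (hp : L < ell p) (he : ell e ≤ R) (hu : ell u ≤ R) (hv : ell v ≤ R) (hue : u.2 ≤ e.2) (hev : e.2 ≤ v.2) :
    ∃ w, J S p w ∧ J T u w := by
  have E : ∀ w, ell (R1 w) = - ell w := fun w => by simp only [ell, R1]; ring
  have h1 : J (R1 ⁻¹' S) (R1 p) (R1 e) := h.map R1 R1_adj fun w hw => by
    simpa [R1_R1] using hw
  have h2 : J (R1 ⁻¹' T) (R1 u) (R1 v) := h'.map R1 R1_adj fun w hw => by
    simpa [R1_R1] using hw
  obtain ⟨w, k1, k2⟩ := meetSep (-L) (-R) h1 h2 (fun w hw => by have := hS _ hw; rw [E] at this; linarith)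
    (fun w hw => by have := hT _ hw; rw [E] at this; constructor <;> linarith) (by rw [E]; linarith)
    (by rw [E]; linarith) (by rw [E]; linarith) (by rw [E]; linarith) hue hev
  refine ⟨R1 w, ?_, ?_⟩
  · have := k1.map (T := S) R1 R1_adj fun w hw => hw
    rwa [R1_R1] at this
  · have := k2.map (T := T) R1 R1_adj fun w hw => hw
    rwa [R1_R1] at this

/-- Sup norm. -/
def nrm (v : V) : ℤ := max (max v.1 (-v.1)) (max v.2 (-v.2))

theorem nrm_le {v : V} {n : ℤ} : nrm v ≤ n ↔ (-n ≤ v.1 ∧ v.1 ≤ n) ∧ (-n ≤ v.2 ∧ v.2 ≤ n) := by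
  unfold nrm
  simp only [max_le_iff]
  constructor <;> rintro ⟨⟨_, _⟩, _, _⟩ <;> refine ⟨⟨?_, ?_⟩, ?_, ?_⟩ <;> linarith

theorem le_nrm {v : V} {n : ℤ} : n ≤ nrm v ↔ (n ≤ v.1 ∨ n ≤ -v.1) ∨ (n ≤ v.2 ∨ n ≤ -v.2) := by
  unfold nrm
  simp only [le_max_iff]

theorem nrm_step (u v : V) (h : TriAdj u v) : nrm v ≤ nrm u + 1 := by
  have := (nrm_le (v := u)).1 le_rfl
  rw [tri_iff] at h
  rw [nrm_le]
  omega

theorem exit_top {S : Set V} {p e : V} (s : ℤ) (hs : 0 ≤ s) (h : J S p e) (hp : nrm p ≤ s) (he : 2 * s ≤ e.2)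
    (hS : ∀ w ∈ S, nrm w ≤ 2 * s) :
    ∃ u v, J S p u ∧ J (S ∩ {w | s ≤ w.2 ∧ w.2 ≤ 2 * s ∧ -(2 * s) ≤ w.1 ∧ w.1 ≤ 2 * s}) u v ∧
      u.2 ≤ s ∧ 2 * s ≤ v.2 := by
  rw [nrm_le] at hp
  obtain ⟨u, v, h1, h2, h3, h4⟩ := h.strip (fun w => w.2) 1 s (2 * s)
    (fun u v a => by rw [tri_iff] at a; omega) le_rfl (by linarith) (by linarith) he
  refine ⟨u, v, h1, h2.mono ?_, by linarith, h4⟩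
  rintro w ⟨hw, hw1⟩
  have := nrm_le.1 (hS w hw)
  simp only [Set.mem_ofPred_eq] at hw1
  exact ⟨hw, by linarith, by linarith, this.1.1, this.1.2⟩

/-- A long horizontal crossing of the strip `s ≤ y ≤ 2s`. -/
def Strip (O : Set V) (s : ℤ) : Prop :=
  ∃ u v, J (O ∩ {w | s ≤ w.2 ∧ w.2 ≤ 2 * s ∧ -(40 * s) ≤ w.1 ∧ w.1 ≤ 40 * s}) u v ∧ u.1 ≤ -(2 * s) ∧ 2 * s ≤ v.1

def ng (v : V) : V := (-v.1, -v.2)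
theorem ng_adj (u v : V) (h : TriAdj u v) : TriAdj (ng u) (ng v) := by
  rw [tri_iff] at *; simp only [ng]; omega
theorem ng_ng (v : V) : ng (ng v) = v := by simp [ng]

/-- Open circuit event: the four strips around the box of radius `s` are crossed. -/
def CEv (O : Set V) (s : ℤ) : Prop :=
  Strip O s ∧ Strip (ng ⁻¹' O) s ∧ Strip (sw ⁻¹' O) s ∧ Strip (sw ⁻¹' (ng ⁻¹' O)) s

/-- Points of the boundary of the annulus are reached in one of four directions. -/
theorem CEv.ring {O : Set V} {s : ℤ} (hs : 0 ≤ s) (hC : CEv O s) : ∃ g, ∀ (S : Set V) (p e : V), J S p e → nrm p ≤ s →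
    2 * s ≤ nrm e → ∃ w, J S p w ∧ J (O ∩ {w | nrm w ≤ 40 * s}) g w := by
  obtain ⟨⟨a, b, hT, ha, hb⟩, ⟨a', b', hB, ha', hb'⟩, ⟨c, d, hR, hc, hd⟩, ⟨c', d', hL, hc', hd'⟩⟩ := hC
  -- the four crossings as paths in `O`
  have hB1 := hB.pre (C := {w | s ≤ -w.2 ∧ -w.2 ≤ 2 * s ∧ -(40 * s) ≤ w.1 ∧ w.1 ≤ 40 * s}) ng ng_adj
    (fun v hv => by simp only [ng, Set.mem_ofPred_eq] at *; omega)
  have hR1 := hR.pre (C := {w | s ≤ w.1 ∧ w.1 ≤ 2 * s ∧ -(40 * s) ≤ w.2 ∧ w.2 ≤ 40 * s}) sw sw_adj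
    (fun v hv => by simp only [sw, Set.mem_ofPred_eq] at *; omega)
  have hL1 := (hL.pre (C := {w | s ≤ w.1 ∧ w.1 ≤ 2 * s ∧ -(40 * s) ≤ w.2 ∧ w.2 ≤ 40 * s}) sw sw_adj
    (fun v hv => by simp only [sw, Set.mem_ofPred_eq] at *; omega)).pre
    (C := {w | s ≤ -w.1 ∧ -w.1 ≤ 2 * s ∧ -(40 * s) ≤ w.2 ∧ w.2 ≤ 40 * s}) ng ng_adj
    (fun v hv => by simp only [ng, Set.mem_ofPred_eq] at *; omega)
  have big : ∀ {B : Set V} {p e : V}, (∀ w ∈ B, nrm w ≤ 40 * s) → J (O ∩ B) p e → J (O ∩ {w | nrm w ≤ 40 * s}) p e :=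
    fun hB h => h.mono (by rintro w ⟨h1, h2⟩; exact Set.mem_inter h1 (hB _ h2))
  have bT : ∀ w ∈ {w : V | s ≤ w.2 ∧ w.2 ≤ 2 * s ∧ -(40 * s) ≤ w.1 ∧ w.1 ≤ 40 * s}, nrm w ≤ 40 * s := by
    intro w hw; simp only [Set.mem_ofPred_eq] at hw; rw [nrm_le]; omega
  have bB : ∀ w ∈ {w : V | s ≤ -w.2 ∧ -w.2 ≤ 2 * s ∧ -(40 * s) ≤ w.1 ∧ w.1 ≤ 40 * s}, nrm w ≤ 40 * s := by
    intro w hw; simp only [Set.mem_ofPred_eq] at hw; rw [nrm_le]; omega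
  have bR : ∀ w ∈ {w : V | s ≤ w.1 ∧ w.1 ≤ 2 * s ∧ -(40 * s) ≤ w.2 ∧ w.2 ≤ 40 * s}, nrm w ≤ 40 * s := by
    intro w hw; simp only [Set.mem_ofPred_eq] at hw; rw [nrm_le]; omega
  have bL : ∀ w ∈ {w : V | s ≤ -w.1 ∧ -w.1 ≤ 2 * s ∧ -(40 * s) ≤ w.2 ∧ w.2 ≤ 40 * s}, nrm w ≤ 40 * s := by
    intro w hw; simp only [Set.mem_ofPred_eq] at hw; rw [nrm_le]; omega
  simp only [sw, ng] at hB1 hR1 hL1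
  -- meeting points
  obtain ⟨w1, t1, t2⟩ := meetX s (2 * s) s (2 * s) hT hR1 (fun w hw => ⟨hw.2.1, hw.2.2.1⟩)
    (fun w hw => ⟨hw.2.1, hw.2.2.1⟩) (by omega) (by omega) (by simp only; omega) (by simp only; omega)
  obtain ⟨w2, t3, t4⟩ := meetX (-(2 * s)) (-s) s (2 * s) hT hL1.symm (fun w hw => ⟨hw.2.1, hw.2.2.1⟩)
    (fun w hw => by have := hw.2; simp only [Set.mem_ofPred_eq] at this; omega) (by omega) (by omega)
    (by simp only; omega) (by simp only; omega)
  obtain ⟨w3, t5, t6⟩ := meetX s (2 * s) (-(2 * s)) (-s) hB1.symm hR1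
    (fun w hw => by have := hw.2; simp only [Set.mem_ofPred_eq] at this; omega)
    (fun w hw => ⟨hw.2.1, hw.2.2.1⟩) (by simp only; omega) (by simp only; omega) (by simp only; omega) (by simp only; omega)
  have jR : J (O ∩ {w | nrm w ≤ 40 * s}) a (c.2, c.1) := (big bT t1).trans (big bR t2).symm
  have jL : J (O ∩ {w | nrm w ≤ 40 * s}) a (-d'.2, -d'.1) := (big bT t3).trans (big bL t4).symm
  have jB : J (O ∩ {w | nrm w ≤ 40 * s}) a (-b'.1, -b'.2) := (jR.trans (big bR t6)).trans (big bB t5).symm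
  refine ⟨a, fun S p e h hp he => ?_⟩
  obtain ⟨e1, h1, h2⟩ := h.first nrm 1 (2 * s) nrm_step (by linarith) he
  have hm : ∀ {w}, J (S ∩ {w | nrm w ≤ 2 * s + 1 - 1}) p w → J S p w := fun h => h.mono Set.inter_subset_left
  have hn : ∀ w ∈ S ∩ {w | nrm w ≤ 2 * s + 1 - 1}, nrm w ≤ 2 * s := fun w hw => by
    have := hw.2; simp only [Set.mem_ofPred_eq] at this; linarith
  generalize S ∩ {w | nrm w ≤ 2 * s + 1 - 1} = S' at h1 hm hn
  rcases le_nrm.1 h2 with (h3 | h3) | (h3 | h3)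
  · obtain ⟨u, v, k1, k2, k3, k4⟩ := exit_top s hs (h1.map (T := sw ⁻¹' S') sw sw_adj fun w hw => by simpa [sw_sw] using hw)
      (by simpa [nrm, max_comm, sw] using hp) (by simpa [sw] using h3)
      (fun w hw => by have := hn _ hw; rw [nrm_le] at this ⊢; simp only [sw] at this; omega)
    have k1' := k1.map (T := S') sw sw_adj fun w hw => hw
    have k2' := k2.pre (C := {w | s ≤ w.1 ∧ w.1 ≤ 2 * s ∧ -(2 * s) ≤ w.2 ∧ w.2 ≤ 2 * s}) sw sw_adj
      (fun v hv => by simp only [sw, Set.mem_ofPred_eq] at *; omega)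
    rw [sw_sw] at k1'
    obtain ⟨w, m1, m2⟩ := meetX s (2 * s) (-(2 * s)) (2 * s) k2' hR1 (fun w hw => ⟨hw.2.2.2.1, hw.2.2.2.2⟩)
      (fun w hw => ⟨hw.2.1, hw.2.2.1⟩) (by simp only [sw]; omega) (by simp only [sw]; omega) (by simp only; omega) (by simp only; omega)
    exact ⟨w, hm (k1'.trans (m1.mono Set.inter_subset_left)), jR.trans (big bR m2)⟩
  · have hsn : ∀ w, ng (sw (sw (ng w))) = w := fun w => by simp [ng, sw]
    obtain ⟨u, v, k1, k2, k3, k4⟩ := exit_top s hs (h1.map (T := (fun w => ng (sw w)) ⁻¹' S') (fun w => sw (ng w))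
      (fun u v h => sw_adj _ _ (ng_adj _ _ h)) fun w hw => by simpa [hsn] using hw)
      (by rw [nrm_le] at hp ⊢; simp only [sw, ng]; omega) (by simpa [sw, ng] using h3)
      (fun w hw => by have := hn _ hw; rw [nrm_le] at this ⊢; simp only [sw, ng] at this; omega)
    have k1' := k1.map (T := S') (fun w => ng (sw w)) (fun u v h => ng_adj _ _ (sw_adj _ _ h)) fun w hw => hw
    have k2' := k2.pre (C := {w | s ≤ -w.1 ∧ -w.1 ≤ 2 * s ∧ -(2 * s) ≤ w.2 ∧ w.2 ≤ 2 * s}) (fun w => ng (sw w))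
      (fun u v h => ng_adj _ _ (sw_adj _ _ h)) (fun v hv => by simp only [sw, ng, Set.mem_ofPred_eq] at *; omega)
    rw [hsn] at k1'
    obtain ⟨w, m1, m2⟩ := meetX (-(2 * s)) (-s) (-(2 * s)) (2 * s) k2'.symm hL1.symm (fun w hw => ⟨hw.2.2.2.1, hw.2.2.2.2⟩)
      (fun w hw => by have := hw.2; simp only [Set.mem_ofPred_eq] at this; omega) (by simp only [sw, ng]; omega)
      (by simp only [sw, ng]; omega) (by simp only; omega) (by simp only; omega)
    exact ⟨w, hm (k1'.trans ((k2'.trans m1).mono Set.inter_subset_left)), jL.trans (big bL m2)⟩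
  · obtain ⟨u, v, k1, k2, k3, k4⟩ := exit_top s hs h1 hp h3 hn
    obtain ⟨w, m1, m2⟩ := meetX (-(2 * s)) (2 * s) s (2 * s) hT k2 (fun w hw => ⟨hw.2.1, hw.2.2.1⟩)
      (fun w hw => ⟨hw.2.2.2.1, hw.2.2.2.2⟩) ha hb k3 k4
    exact ⟨w, hm (k1.trans (m2.mono Set.inter_subset_left)), big bT m1⟩
  · obtain ⟨u, v, k1, k2, k3, k4⟩ := exit_top s hs (h1.map (T := ng ⁻¹' S') ng ng_adj fun w hw => by simpa [ng_ng] using hw)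
      (by rw [nrm_le] at hp ⊢; simp only [ng]; omega) (by simpa [ng] using h3)
      (fun w hw => by have := hn _ hw; rw [nrm_le] at this ⊢; simp only [ng] at this; omega)
    have k1' := k1.map (T := S') ng ng_adj fun w hw => hw
    have k2' := k2.pre (C := {w | s ≤ -w.2 ∧ -w.2 ≤ 2 * s ∧ -(2 * s) ≤ w.1 ∧ w.1 ≤ 2 * s}) ng ng_adj
      (fun v hv => by simp only [ng, Set.mem_ofPred_eq] at *; omega)
    rw [ng_ng] at k1'
    obtain ⟨w, m1, m2⟩ := meetX (-(2 * s)) (2 * s) (-(2 * s)) (-s) hB1.symm k2'.symm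
      (fun w hw => by have := hw.2; simp only [Set.mem_ofPred_eq] at this; omega)
      (fun w hw => by have := hw.2; simp only [Set.mem_ofPred_eq] at this; omega) (by simp only; omega) (by simp only; omega)
      (by simp only [ng]; omega) (by simp only [ng]; omega)
    exact ⟨w, hm (k1'.trans ((k2'.trans m2).mono Set.inter_subset_left)), jB.trans (big bB m1)⟩

/-- The left half of the circuit: an arc from the line `ell = 0` below to the line `ell = 0` above. -/
theorem CEv.arc {O : Set V} {s : ℤ} (hs : 0 ≤ s) (hC : CEv O s) : ∃ u v,
    J (O ∩ {w | nrm w ≤ 40 * s ∧ ell w ≤ 1 ∧ -(2 * s) ≤ w.2 ∧ w.2 ≤ 2 * s}) u v ∧ 0 ≤ ell u ∧ 0 ≤ ell v ∧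
    u.2 ≤ -s ∧ s ≤ v.2 := by
  obtain ⟨⟨a, b, hT, ha, hb⟩, ⟨a', b', hB, ha', hb'⟩, -, ⟨c', d', hL, hc', hd'⟩⟩ := hC
  have hB1 := (hB.pre (C := {w | s ≤ -w.2 ∧ -w.2 ≤ 2 * s ∧ -(40 * s) ≤ w.1 ∧ w.1 ≤ 40 * s}) ng ng_adj
    (fun v hv => by simp only [ng, Set.mem_ofPred_eq] at *; omega)).symm
  have hL1 := ((hL.pre (C := {w | s ≤ w.1 ∧ w.1 ≤ 2 * s ∧ -(40 * s) ≤ w.2 ∧ w.2 ≤ 40 * s}) sw sw_adj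
    (fun v hv => by simp only [sw, Set.mem_ofPred_eq] at *; omega)).pre
    (C := {w | s ≤ -w.1 ∧ -w.1 ≤ 2 * s ∧ -(40 * s) ≤ w.2 ∧ w.2 ≤ 40 * s}) ng ng_adj
    (fun v hv => by simp only [ng, Set.mem_ofPred_eq] at *; omega)).symm
  simp only [sw, ng] at hB1 hL1
  have hTa := hT.1.2
  have hTb := hT.right.2
  have hBa := hB1.1.2
  have hBb := hB1.right.2
  simp only [Set.mem_ofPred_eq] at hTa hTb hBa hBb
  obtain ⟨t, t1, t2⟩ := hT.first ell 2 0 (fun _ _ => ell_step) (by simp only [ell]; omega) (by simp only [ell]; omega)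
  obtain ⟨t', t1', t2'⟩ := hB1.first ell 2 0 (fun _ _ => ell_step) (by simp only [ell]; omega) (by simp only [ell]; omega)
  obtain ⟨l, l', -, l1, l2, l3⟩ := hL1.strip (fun w => w.2) 1 (-(2 * s)) (2 * s)
    (fun u v a => by rw [tri_iff] at a; omega) le_rfl (by linarith) (by simp only; omega) (by simp only; omega)
  have ht := t1.right.1.2
  have ht' := t1'.right.1.2
  have hl := l1.1.1.2
  simp only [Set.mem_ofPred_eq] at ht ht' hl
  obtain ⟨w, m1, m2⟩ := meetX (-(2 * s)) (-s) s (2 * s) t1 l1 (fun w hw => ⟨hw.1.2.1, hw.1.2.2.1⟩)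
    (fun w hw => by have := hw.1.2; simp only [Set.mem_ofPred_eq] at this; omega) ha
    (by simp only [ell] at t2; omega) (by omega) (by omega)
  obtain ⟨w', m1', m2'⟩ := meetX (-(2 * s)) (-s) (-(2 * s)) (-s) t1' l1
    (fun w hw => by have := hw.1.2; simp only [Set.mem_ofPred_eq] at this; omega)
    (fun w hw => by have := hw.1.2; simp only [Set.mem_ofPred_eq] at this; omega) (by simp only; omega)
    (by simp only [ell] at t2'; omega) (by omega) (by omega)
  refine ⟨t', t, ?_, t2', t2, by omega, by omega⟩
  have i1 : ∀ {p e}, J (O ∩ {w | s ≤ w.2 ∧ w.2 ≤ 2 * s ∧ -(40 * s) ≤ w.1 ∧ w.1 ≤ 40 * s} ∩ {w | ell w ≤ 0 + 2 - 1}) p e →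
      J (O ∩ {w | nrm w ≤ 40 * s ∧ ell w ≤ 1 ∧ -(2 * s) ≤ w.2 ∧ w.2 ≤ 2 * s}) p e := fun h => h.mono (by
    rintro w ⟨⟨h1, h2⟩, h3⟩
    simp only [Set.mem_ofPred_eq] at h2 h3
    exact ⟨h1, by rw [nrm_le]; omega, by omega, by omega, by omega⟩)
  have i2 : ∀ {p e}, J (O ∩ {w | s ≤ -w.2 ∧ -w.2 ≤ 2 * s ∧ -(40 * s) ≤ w.1 ∧ w.1 ≤ 40 * s} ∩ {w | ell w ≤ 0 + 2 - 1}) p e →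
      J (O ∩ {w | nrm w ≤ 40 * s ∧ ell w ≤ 1 ∧ -(2 * s) ≤ w.2 ∧ w.2 ≤ 2 * s}) p e := fun h => h.mono (by
    rintro w ⟨⟨h1, h2⟩, h3⟩
    simp only [Set.mem_ofPred_eq] at h2 h3
    exact ⟨h1, by rw [nrm_le]; omega, by omega, by omega, by omega⟩)
  have i3 : ∀ {p e}, J (O ∩ {w | s ≤ -w.1 ∧ -w.1 ≤ 2 * s ∧ -(40 * s) ≤ w.2 ∧ w.2 ≤ 40 * s} ∩
      {w | -(2 * s) ≤ w.2 ∧ w.2 ≤ 2 * s + 1 - 1}) p e →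
      J (O ∩ {w | nrm w ≤ 40 * s ∧ ell w ≤ 1 ∧ -(2 * s) ≤ w.2 ∧ w.2 ≤ 2 * s}) p e := fun h => h.mono (by
    rintro w ⟨⟨h1, h2⟩, h3⟩
    simp only [Set.mem_ofPred_eq] at h2 h3
    exact ⟨h1, by rw [nrm_le]; omega, by simp only [ell]; omega, by omega, by omega⟩)
  exact (((i2 t1').symm.trans (i2 m1')).trans ((i3 m2').symm.trans (i3 m2))).trans ((i1 m1).symm.trans (i1 t1))

end DaC

namespace DaC

/-! ### Deterministic gluing for the box crossing theory -/

def HB (a b : ℤ) : Set V := {w | -(a + 1) ≤ ell w ∧ ell w ≤ a + 1 ∧ -b ≤ w.2 ∧ w.2 ≤ b}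

def HEv (O : Set V) (a b i j : ℤ) : Prop :=
  ∃ p e, J (O ∩ HB a b) p e ∧ ell p ≤ -a ∧ a ≤ ell e ∧ i ≤ e.2 ∧ e.2 ≤ j

def VEv (O : Set V) (a b : ℤ) : Prop :=
  ∃ u v, J (O ∩ {w | -a ≤ ell w ∧ ell w ≤ a ∧ -b ≤ w.2 ∧ w.2 ≤ b}) u v ∧ u.2 ≤ -b ∧ b ≤ v.2

def PEv (O : Set V) (a b i j : ℤ) : Prop :=
  ∃ p e, J (O ∩ HB a b) p e ∧ ell p ≤ -a ∧ a ≤ ell e ∧ i ≤ p.2 ∧ p.2 ≤ j ∧ i ≤ e.2 ∧ e.2 ≤ j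

def XEv (O : Set V) (a b α : ℤ) : Prop :=
  ∃ g u v u' v', J (O ∩ HB a b) g u ∧ J (O ∩ HB a b) g v ∧ J (O ∩ HB a b) g u' ∧ J (O ∩ HB a b) g v' ∧
    a ≤ ell u ∧ u.2 ≤ -α ∧ a ≤ ell v ∧ α ≤ v.2 ∧ ell u' ≤ -a ∧ u'.2 ≤ -α ∧ ell v' ≤ -a ∧ α ≤ v'.2

/-- A horizontal crossing is connected to the vertical one. -/
theorem HEv.conn {O : Set V} {a b i j : ℤ} (h : HEv O a b i j) {u v : V}
    (hV : J (O ∩ {w | -a ≤ ell w ∧ ell w ≤ a ∧ -b ≤ w.2 ∧ w.2 ≤ b}) u v) (hu : u.2 ≤ -b) (hv : b ≤ v.2) :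
    ∃ e, J (O ∩ HB a b) u e ∧ a ≤ ell e ∧ i ≤ e.2 ∧ e.2 ≤ j := by
  obtain ⟨p, e, h1, h2, h3, h4, h5⟩ := h
  obtain ⟨w, k1, k2⟩ := meetL (-a) a (-b) b h1 hV (fun w hw => ⟨hw.2.2.2.1, hw.2.2.2.2⟩)
    (fun w hw => ⟨hw.2.1, hw.2.2.1⟩) h2 h3 hu hv
  refine ⟨e, ((k2.mono ?_).trans k1.symm).trans h1, h3, h4, h5⟩
  rintro w ⟨hw, hw1⟩
  simp only [Set.mem_ofPred_eq] at hw1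
  exact ⟨hw, by linarith, by linarith, by linarith, by linarith⟩

theorem ell_R1 (w : V) : ell (R1 w) = -ell w := by simp only [ell, R1]; ring
theorem ell_R2 (w : V) : ell (R2 w) = ell w := by simp only [ell, R2]; ring
theorem ell_ng (w : V) : ell (ng w) = -ell w := by simp only [ell, ng]; ring
theorem ell_tr (z w : V) : ell (tr z w) = ell w + ell z := by simp only [ell, tr]; ring

theorem HB_R1 {a b : ℤ} (w : V) (h : w ∈ HB a b) : R1 w ∈ HB a b := by
  simp only [HB, Set.mem_ofPred_eq, ell_R1] at *; simp only [R1]; omega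
theorem HB_R2 {a b : ℤ} (w : V) (h : w ∈ HB a b) : R2 w ∈ HB a b := by
  simp only [HB, Set.mem_ofPred_eq, ell_R2] at *; simp only [R2]; omega
theorem HB_ng {a b : ℤ} (w : V) (h : w ∈ HB a b) : ng w ∈ HB a b := by
  simp only [HB, Set.mem_ofPred_eq, ell_ng] at *; simp only [ng]; omega

theorem VB_R1 {a b : ℤ} (w : V) (h : w ∈ {w : V | -a ≤ ell w ∧ ell w ≤ a ∧ -b ≤ w.2 ∧ w.2 ≤ b}) :
    R1 w ∈ {w : V | -a ≤ ell w ∧ ell w ≤ a ∧ -b ≤ w.2 ∧ w.2 ≤ b} := by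
  simp only [Set.mem_ofPred_eq, ell_R1] at *; simp only [R1]; omega
theorem VB_R2 {a b : ℤ} (w : V) (h : w ∈ {w : V | -a ≤ ell w ∧ ell w ≤ a ∧ -b ≤ w.2 ∧ w.2 ≤ b}) :
    R2 w ∈ {w : V | -a ≤ ell w ∧ ell w ≤ a ∧ -b ≤ w.2 ∧ w.2 ≤ b} := by
  simp only [Set.mem_ofPred_eq, ell_R2] at *; simp only [R2]; omega
theorem VB_ng {a b : ℤ} (w : V) (h : w ∈ {w : V | -a ≤ ell w ∧ ell w ≤ a ∧ -b ≤ w.2 ∧ w.2 ≤ b}) :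
    ng w ∈ {w : V | -a ≤ ell w ∧ ell w ≤ a ∧ -b ≤ w.2 ∧ w.2 ≤ b} := by
  simp only [Set.mem_ofPred_eq, ell_ng] at *; simp only [ng]; omega

theorem HEv.connR1 {O : Set V} {a b i j : ℤ} (h : HEv (R1 ⁻¹' O) a b i j) {u v : V}
    (hV : J (O ∩ {w | -a ≤ ell w ∧ ell w ≤ a ∧ -b ≤ w.2 ∧ w.2 ≤ b}) u v) (hu : u.2 ≤ -b) (hv : b ≤ v.2) :
    ∃ e, J (O ∩ HB a b) u e ∧ ell e ≤ -a ∧ i ≤ e.2 ∧ e.2 ≤ j := by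
  obtain ⟨e, h1, h2, h3, h4⟩ := h.conn (u := R1 u) (v := R1 v)
    (hV.map R1 R1_adj (by rintro w ⟨k1, k2⟩; exact ⟨by simpa [R1_R1] using k1, VB_R1 w k2⟩)) hu hv
  have := h1.pre R1 R1_adj HB_R1
  rw [R1_R1] at this
  exact ⟨R1 e, this, by rw [ell_R1]; linarith, h3, h4⟩

theorem HEv.connR2 {O : Set V} {a b i j : ℤ} (h : HEv (R2 ⁻¹' O) a b i j) {u v : V}
    (hV : J (O ∩ {w | -a ≤ ell w ∧ ell w ≤ a ∧ -b ≤ w.2 ∧ w.2 ≤ b}) u v) (hu : u.2 ≤ -b) (hv : b ≤ v.2) :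
    ∃ e, J (O ∩ HB a b) v e ∧ a ≤ ell e ∧ -j ≤ e.2 ∧ e.2 ≤ -i := by
  obtain ⟨e, h1, h2, h3, h4⟩ := h.conn (u := R2 v) (v := R2 u)
    (hV.symm.map R2 R2_adj (by rintro w ⟨k1, k2⟩; exact ⟨by simpa [R2_R2] using k1, VB_R2 w k2⟩))
    (by simp only [R2]; linarith) (by simp only [R2]; linarith)
  have := h1.pre R2 R2_adj HB_R2
  rw [R2_R2] at this
  exact ⟨R2 e, this, by rw [ell_R2]; linarith, by simp only [R2]; linarith, by simp only [R2]; linarith⟩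

theorem HEv.connng {O : Set V} {a b i j : ℤ} (h : HEv (ng ⁻¹' O) a b i j) {u v : V}
    (hV : J (O ∩ {w | -a ≤ ell w ∧ ell w ≤ a ∧ -b ≤ w.2 ∧ w.2 ≤ b}) u v) (hu : u.2 ≤ -b) (hv : b ≤ v.2) :
    ∃ e, J (O ∩ HB a b) v e ∧ ell e ≤ -a ∧ -j ≤ e.2 ∧ e.2 ≤ -i := by
  obtain ⟨e, h1, h2, h3, h4⟩ := h.conn (u := ng v) (v := ng u)
    (hV.symm.map ng ng_adj (by rintro w ⟨k1, k2⟩; exact ⟨by simpa [ng_ng] using k1, VB_ng w k2⟩))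
    (by simp only [ng]; linarith) (by simp only [ng]; linarith)
  have := h1.pre ng ng_adj HB_ng
  rw [ng_ng] at this
  exact ⟨ng e, this, by rw [ell_ng]; linarith, by simp only [ng]; linarith, by simp only [ng]; linarith⟩

theorem VEv.big {O : Set V} {a b : ℤ} {u v : V}
    (hV : J (O ∩ {w | -a ≤ ell w ∧ ell w ≤ a ∧ -b ≤ w.2 ∧ w.2 ≤ b}) u v) : J (O ∩ HB a b) u v := by
  refine hV.mono ?_
  rintro w ⟨hw, hw1⟩
  simp only [Set.mem_ofPred_eq] at hw1
  exact ⟨hw, by linarith, by linarith, by linarith, by linarith⟩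

theorem PEv_of {O : Set V} {a b i j : ℤ} (h1 : HEv O a b i j) (h2 : HEv (R1 ⁻¹' O) a b i j) (h3 : VEv O a b) :
    PEv O a b i j := by
  obtain ⟨u, v, hV, hu, hv⟩ := h3
  obtain ⟨e, e1, e2, e3, e4⟩ := h1.conn hV hu hv
  obtain ⟨p, p1, p2, p3, p4⟩ := h2.connR1 hV hu hv
  exact ⟨p, e, p1.symm.trans e1, p2, e2, p3, p4, e3, e4⟩

theorem XEv_of {O : Set V} {a b α : ℤ} (h1 : HEv O a b α b) (h2 : HEv (R1 ⁻¹' O) a b α b)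
    (h3 : HEv (R2 ⁻¹' O) a b α b) (h4 : HEv (ng ⁻¹' O) a b α b) (h5 : VEv O a b) : XEv O a b α := by
  obtain ⟨u, v, hV, hu, hv⟩ := h5
  obtain ⟨e1, a1, a2, a3, -⟩ := h1.conn hV hu hv
  obtain ⟨e2, b1, b2, b3, -⟩ := h2.connR1 hV hu hv
  obtain ⟨e3, c1, c2, -, c4⟩ := h3.connR2 hV hu hv
  obtain ⟨e4, d1, d2, -, d4⟩ := h4.connng hV hu hv
  have hb := VEv.big hV
  exact ⟨u, e3, e1, e4, e2, hb.trans c1, a1, hb.trans d1, b1, c2, c4, a2, a3, d2, d4, b2, b3⟩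

def Long (O : Set V) (b : ℤ) : Prop :=
  ∃ p e, J (O ∩ {w | -(2 * b) ≤ w.2 ∧ w.2 ≤ 2 * b ∧ -(160 * b) ≤ w.1 ∧ w.1 ≤ 160 * b}) p e ∧
    p.1 ≤ -(8 * b) ∧ 8 * b ≤ e.1

theorem strip_of_long {O : Set V} {b : ℤ} (h : Long (tr (0, 6 * b) ⁻¹' O) b) : Strip O (4 * b) := by
  obtain ⟨p, e, h1, h2, h3⟩ := h
  refine ⟨_, _, h1.pre (tr (0, 6 * b)) (tr_adj _) ?_, ?_, ?_⟩
  · intro v hv; simp only [tr, Set.mem_ofPred_eq] at *; omega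
  · simp only [tr]; omega
  · simp only [tr]; omega

theorem chain {S : Set V} (p : ℕ → V) (n : ℕ) (h0 : p 0 ∈ S) (h : ∀ k < n, J S (p k) (p (k + 1))) : J S (p 0) (p n) := by
  induction n with
  | zero => exact J.refl h0
  | succ n ih => exact (ih fun k hk => h k (by omega)).trans (h n (by omega))

def BigB (b : ℤ) : Set V := {w | -(2 * b) ≤ w.2 ∧ w.2 ≤ 2 * b ∧ -(160 * b) ≤ w.1 ∧ w.1 ≤ 160 * b}

/-- A piece: crossing of the box centred at `ell = c`, endpoints with `i ≤ y ≤ j`. -/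
def Pc (O : Set V) (a b c i j : ℤ) (p e : V) : Prop :=
  J (O ∩ {w | c - (a + 1) ≤ ell w ∧ ell w ≤ c + a + 1 ∧ -b ≤ w.2 ∧ w.2 ≤ b}) p e ∧ ell p ≤ c - a ∧ c + a ≤ ell e ∧
    i ≤ p.2 ∧ p.2 ≤ j ∧ i ≤ e.2 ∧ e.2 ≤ j

theorem PEv.toPc {O : Set V} {a b x c i j : ℤ} (h : PEv (tr (x, 0) ⁻¹' O) a b i j) (hc : c = 2 * x) :
    ∃ p e, Pc O a b c i j p e := by
  obtain ⟨p, e, h1, h2, h3, h4, h5, h6, h7⟩ := h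
  subst hc
  refine ⟨tr (x, 0) p, tr (x, 0) e, h1.pre _ (tr_adj _) ?_, ?_, ?_, ?_, ?_, ?_, ?_⟩
  · intro w hw
    simp only [HB, Set.mem_ofPred_eq, ell_tr] at *
    simp only [ell, tr] at *
    omega
  all_goals simp only [ell, tr] at *; omega

/-- Pieces joined by connectors. -/
theorem long_chain {O : Set V} {b a D : ℤ} (i j : ℤ) (hb : 0 ≤ b) (hab : b ≤ 2 * a) (hab' : a ≤ 4 * b)
    (hD : 7 * b ≤ 16 * D) (hD' : D ≤ a)
    (hP : ∀ n : ℕ, n ≤ 48 → PEv (tr (((n : ℤ) - 24) * D, 0) ⁻¹' O) a b i j)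
    (hJ : ∀ (n : ℕ), n < 48 → ∀ p e p' e', Pc O a b (2 * (((n : ℤ) - 24) * D)) i j p e →
      Pc O a b (2 * (((n : ℤ) - 24) * D) + 2 * D) i j p' e' → J (O ∩ BigB b) p p') :
    Long O b := by
  have h1 : ∀ n : ℕ, ∃ p e, n ≤ 48 → Pc O a b (2 * (((n : ℤ) - 24) * D)) i j p e := by
    intro n
    by_cases hn : n ≤ 48
    · obtain ⟨p, e, h⟩ := (hP n hn).toPc rfl
      exact ⟨p, e, fun _ => h⟩
    · exact ⟨0, 0, fun h => absurd h hn⟩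
  choose p e hpe using h1
  have hsub : ∀ n : ℕ, n ≤ 48 → J (O ∩ BigB b) (p n) (e n) := by
    intro n hn
    refine (hpe n hn).1.mono ?_
    rintro w ⟨hw, hw1⟩
    refine ⟨hw, ?_⟩
    have : -(24 * D) ≤ ((n : ℤ) - 24) * D ∧ ((n : ℤ) - 24) * D ≤ 24 * D := by
      have : (n : ℤ) ≤ 48 := by exact_mod_cast hn
      have : (0 : ℤ) ≤ n := by positivity
      constructor <;> nlinarith
    generalize ((n : ℤ) - 24) * D = c at *
    simp only [BigB, Set.mem_ofPred_eq, ell] at *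
    omega
  have h2 := chain p 48 (hsub 0 (by omega)).1 (fun k hk => hJ k hk _ _ _ _ (hpe k (by omega)) (by
    have := hpe (k + 1) (by omega)
    rwa [show 2 * ((((k + 1 : ℕ) : ℤ) - 24) * D) = 2 * (((k : ℤ) - 24) * D) + 2 * D by push_cast; ring] at this))
  refine ⟨p 0, e 48, h2.trans (hsub 48 le_rfl), ?_, ?_⟩
  · have h3 := hpe 0 (by omega)
    have h4 := h3.1.1.2
    have h5 := h3.2.1
    simp only [Set.mem_ofPred_eq, ell, Nat.cast_zero] at h4 h5
    omega
  · have h3 := hpe 48 (by omega)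
    have h4 := h3.1.right.2
    have h5 := h3.2.2.1
    simp only [Set.mem_ofPred_eq, ell, Nat.cast_ofNat] at h4 h5
    omega

/-- Scale change with cross-shaped connectors. -/
theorem long_of_X {O : Set V} {a b a' b' y α h : ℤ} (hb : 1 ≤ b') (hbb : 64 * b' ≤ b) (hab : b ≤ 2 * a) (hab' : a ≤ 4 * b)
    (ha' : 0 ≤ a') (ha'' : a' ≤ 4 * b') (hy : -b ≤ y ∧ y ≤ b) (hh : 2 * h = a - a' + y)
    (hP : ∀ n : ℕ, n ≤ 48 → PEv (tr (((n : ℤ) - 24) * (a - a'), 0) ⁻¹' O) a b (y - α) (y + α))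
    (hX : ∀ n : ℕ, n < 48 → XEv (tr (((n : ℤ) - 24) * (a - a') + h, y) ⁻¹' O) a' b' α) : Long O b := by
  refine long_chain (y - α) (y + α) (by omega) hab hab' (D := a - a') (by omega) (by omega) hP ?_
  intro n hn p e p' e' h1 h2
  obtain ⟨g, u, v, u', v', k1, k2, k3, k4, k5, k6, k7, k8, k9, k10, k11, k12⟩ := hX n hn
  have hc : -(24 * (a - a')) ≤ ((n : ℤ) - 24) * (a - a') ∧ ((n : ℤ) - 24) * (a - a') ≤ 24 * (a - a') := by
    have : (n : ℤ) ≤ 48 := by exact_mod_cast hn.le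
    have : (0 : ℤ) ≤ n := by positivity
    constructor <;> nlinarith
  generalize hcc : ((n : ℤ) - 24) * (a - a') = c at *
  have key : ∀ w ∈ HB a' b', tr (c + h, y) w ∈ {w : V | 2 * c + a - 2 * a' - 1 ≤ ell w ∧ ell w ≤ 2 * c + a + 1 ∧
      y - b' ≤ w.2 ∧ w.2 ≤ y + b'} := by
    intro w hw
    simp only [HB, Set.mem_ofPred_eq, ell, tr] at *
    omega
  replace k1 := k1.pre _ (tr_adj _) key
  replace k2 := k2.pre _ (tr_adj _) key
  replace k3 := k3.pre _ (tr_adj _) key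
  replace k4 := k4.pre _ (tr_adj _) key
  clear key
  obtain ⟨h1, h1a, h1b, h1c, h1d, h1e, h1f⟩ := h1
  obtain ⟨h2, h2a, h2b, h2c, h2d, h2e, h2f⟩ := h2
  have e1 : ∀ w, ell (tr (c + h, y) w) = ell w + (2 * c + a - a') := fun w => by
    simp only [ell, tr]; omega
  have e2 : ∀ w, (tr (c + h, y) w).2 = w.2 + y := fun w => rfl
  obtain ⟨w, m1, m2⟩ := meetSep (2 * c + a - 2 * a' - 1) (2 * c + a) h1 (k1.symm.trans k2)
    (fun w hw => by have := hw.2; simp only [Set.mem_ofPred_eq] at this; omega)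
    (fun w hw => by have := hw.2; simp only [Set.mem_ofPred_eq] at this; omega)
    (by omega) h1b (by rw [e1]; omega) (by rw [e1]; omega) (by rw [e2]; omega) (by rw [e2]; omega)
  obtain ⟨w', m1', m2'⟩ := meetSep' (2 * c + a + 1) (2 * c + a - 2 * a') h2.symm (k3.symm.trans k4)
    (fun w hw => by have := hw.2; simp only [Set.mem_ofPred_eq] at this; omega)
    (fun w hw => by have := hw.2; simp only [Set.mem_ofPred_eq] at this; omega)
    (by omega) (by omega) (by rw [e1]; omega) (by rw [e1]; omega) (by rw [e2]; omega) (by rw [e2]; omega)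
  have b1 : ∀ {p e}, J (O ∩ {w | 2 * c - (a + 1) ≤ ell w ∧ ell w ≤ 2 * c + a + 1 ∧ -b ≤ w.2 ∧ w.2 ≤ b}) p e →
      J (O ∩ BigB b) p e := fun h => h.mono (by
    rintro w ⟨hw, hw1⟩
    refine ⟨hw, ?_⟩
    simp only [BigB, Set.mem_ofPred_eq, ell] at *
    omega)
  have b2 : ∀ {p e}, J (O ∩ {w | 2 * c + 2 * (a - a') - (a + 1) ≤ ell w ∧ ell w ≤ 2 * c + 2 * (a - a') + a + 1 ∧ -b ≤ w.2 ∧ w.2 ≤ b}) p e →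
      J (O ∩ BigB b) p e := fun h => h.mono (by
    rintro w ⟨hw, hw1⟩
    refine ⟨hw, ?_⟩
    simp only [BigB, Set.mem_ofPred_eq, ell] at *
    omega)
  have b3 : ∀ {p e}, J (O ∩ {w : V | 2 * c + a - 2 * a' - 1 ≤ ell w ∧ ell w ≤ 2 * c + a + 1 ∧
      y - b' ≤ w.2 ∧ w.2 ≤ y + b'}) p e →
      J (O ∩ BigB b) p e := fun h => h.mono (by
    rintro w ⟨hw, hw1⟩
    refine ⟨hw, ?_⟩
    simp only [BigB, Set.mem_ofPred_eq, ell] at *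
    omega)
  exact ((b1 m1).trans (b3 (k1.trans m2)).symm).trans ((b3 (k3.trans m2')).trans
    ((b2 m1').symm.trans (b2 h2.symm)))

/-- Scale change with circuits as connectors. -/
theorem long_of_C {O : Set V} {a b s h α : ℤ} (hs : 1 ≤ s) (hbs : 25 * s ≤ b) (hab : b ≤ 2 * a) (hab' : a ≤ 4 * b)
    (hα : α ≤ s) (hh : 2 * h = a)
    (hP : ∀ n : ℕ, n ≤ 48 → PEv (tr (((n : ℤ) - 24) * a, 0) ⁻¹' O) a b (-α) α)
    (hX : ∀ n : ℕ, n < 48 → CEv (tr (((n : ℤ) - 24) * a + h, 0) ⁻¹' O) s) : Long O b := by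
  refine long_chain (-α) α (by omega) hab hab' (D := a) (by omega) (by omega) hP ?_
  intro n hn p e p' e' h1 h2
  obtain ⟨g, hg⟩ := (hX n hn).ring (by omega)
  have hc : -(24 * a) ≤ ((n : ℤ) - 24) * a ∧ ((n : ℤ) - 24) * a ≤ 24 * a := by
    have : (n : ℤ) ≤ 48 := by exact_mod_cast hn.le
    have : (0 : ℤ) ≤ n := by positivity
    constructor <;> nlinarith
  generalize hcc : ((n : ℤ) - 24) * a = c at *
  obtain ⟨h1, h1a, h1b, h1c, h1d, h1e, h1f⟩ := h1
  obtain ⟨h2, h2a, h2b, h2c, h2d, h2e, h2f⟩ := h2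
  have b1 : ∀ {p e}, J (O ∩ {w | 2 * c - (a + 1) ≤ ell w ∧ ell w ≤ 2 * c + a + 1 ∧ -b ≤ w.2 ∧ w.2 ≤ b}) p e →
      J (O ∩ BigB b) p e := fun h => h.mono (by
    rintro w ⟨hw, hw1⟩
    refine ⟨hw, ?_⟩
    simp only [BigB, Set.mem_ofPred_eq, ell] at *
    omega)
  have b2 : ∀ {p e}, J (O ∩ {w | 2 * c + 2 * a - (a + 1) ≤ ell w ∧ ell w ≤ 2 * c + 2 * a + a + 1 ∧ -b ≤ w.2 ∧ w.2 ≤ b}) p e →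
      J (O ∩ BigB b) p e := fun h => h.mono (by
    rintro w ⟨hw, hw1⟩
    refine ⟨hw, ?_⟩
    simp only [BigB, Set.mem_ofPred_eq, ell] at *
    omega)
  have b3 : ∀ {p e}, J (tr (c + h, 0) ⁻¹' O ∩ {w | nrm w ≤ 40 * s}) p e → J (O ∩ BigB b) (tr (c + h, 0) p) (tr (c + h, 0) e) :=
    fun hh => hh.pre _ (tr_adj _) (by
      intro w hw
      simp only [BigB, Set.mem_ofPred_eq, nrm_le, tr] at *
      omega)
  have t1 : ∀ w, tr (c + h, 0) (tr (-(c + h), 0) w) = w := fun w => by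
    simp only [tr]; exact Prod.ext (by ring) (by ring)
  have e1 := h1.1.2
  have e2 := h1.right.2
  have e3 := h2.1.2
  have e4 := h2.right.2
  simp only [Set.mem_ofPred_eq, ell] at e1 e2 e3 e4 h1a h1b h2a h2b
  obtain ⟨w, m1, m2⟩ := hg (tr (c + h, 0) ⁻¹' (O ∩ BigB b)) (tr (-(c + h), 0) e) (tr (-(c + h), 0) p)
    ((b1 h1).symm.map _ (tr_adj _) (fun w hw => by rw [Set.mem_preimage, t1]; exact hw))
    (by rw [nrm_le]; simp only [tr]; omega) (by rw [le_nrm]; simp only [tr]; omega)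
  obtain ⟨w', m1', m2'⟩ := hg (tr (c + h, 0) ⁻¹' (O ∩ BigB b)) (tr (-(c + h), 0) p') (tr (-(c + h), 0) e')
    ((b2 h2).map _ (tr_adj _) (fun w hw => by rw [Set.mem_preimage, t1]; exact hw))
    (by rw [nrm_le]; simp only [tr]; omega) (by rw [le_nrm]; simp only [tr]; omega)
  have n1 := m1.map (T := O ∩ BigB b) _ (tr_adj (c + h, 0)) (fun w hw => hw)
  have n2 := m1'.map (T := O ∩ BigB b) _ (tr_adj (c + h, 0)) (fun w hw => hw)
  rw [t1] at n1 n2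
  exact ((b1 h1).trans n1).trans ((b3 (m2.symm.trans m2')).trans n2.symm)

/-- A crossing ending in the gap and a circuit around the end point give a crossing ending outside. -/
theorem HEv.circuit {O : Set V} {a b s t h : ℤ} (hU : HEv O a b (-s) s) (hC : CEv (tr (h, 0) ⁻¹' O) t) (hh : 2 * h = a)
    (ht : s ≤ t) (hs : 1 ≤ s) (htb : 200 * t ≤ b) (hab : b ≤ 2 * a) : HEv O a b s b := by
  obtain ⟨p, e, h1, h2, h3, h4, h5⟩ := hU
  obtain ⟨u, v, k1, k2, k3, k4, k5⟩ := hC.arc (by omega)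
  have e1 : ∀ w, ell (tr (h, 0) w) = ell w + a := fun w => by
    simp only [ell, tr]; omega
  have e2 : ∀ w, (tr (h, 0) w).2 = w.2 := fun w => by simp [tr]
  replace k1 := k1.pre (C := {w | a - 82 * t ≤ ell w ∧ ell w ≤ a + 1 ∧ -(2 * t) ≤ w.2 ∧ w.2 ≤ 2 * t}) _ (tr_adj _) (by
    intro w hw
    simp only [Set.mem_ofPred_eq, e1, e2, nrm_le] at *
    simp only [ell] at *
    omega)
  obtain ⟨w, m1, m2⟩ := meetSep (a - 82 * t) a h1 k1
    (fun w hw => by have := hw.2; simp only [HB, Set.mem_ofPred_eq] at this; omega)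
    (fun w hw => by have := hw.2; simp only [Set.mem_ofPred_eq] at this; omega)
    (by omega) h3 (by rw [e1]; omega) (by rw [e1]; omega) (by rw [e2]; omega) (by rw [e2]; omega)
  have hv := k1.right.2
  simp only [Set.mem_ofPred_eq] at hv
  refine ⟨p, _, m1.trans ((m2.symm.trans k1).mono ?_), h2, by rw [e1]; omega, by rw [e2]; omega, by omega⟩
  rintro w ⟨hw, hw1⟩
  refine ⟨hw, ?_⟩
  simp only [HB, Set.mem_ofPred_eq] at *
  omega

end DaC

namespace DaC

/-! ### Planar duality (Y-theorem and Hex) -/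

def Tri (n : ℤ) : Set V := {w | 0 ≤ w.2 ∧ w.2 ≤ w.1 ∧ w.1 ≤ n}

def YEv (S : Set V) (n : ℤ) : Prop :=
  ∃ g a b c, J (S ∩ Tri n) g a ∧ J (S ∩ Tri n) g b ∧ J (S ∩ Tri n) g c ∧ a.2 = 0 ∧ b.1 = b.2 ∧ c.1 = n

def inT (w q : V) : Prop := (q.1 = w.1 ∧ q.2 = w.2) ∨ (q.1 = w.1 + 1 ∧ q.2 = w.2) ∨ (q.1 = w.1 + 1 ∧ q.2 = w.2 + 1)

def maj (S : Set V) : Set V := {w | (w ∈ S ∧ (w.1 + 1, w.2) ∈ S) ∨ (w ∈ S ∧ (w.1 + 1, w.2 + 1) ∈ S) ∨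
  ((w.1 + 1, w.2) ∈ S ∧ (w.1 + 1, w.2 + 1) ∈ S)}

theorem maj_compl (S : Set V) : maj Sᶜ = (maj S)ᶜ := by
  ext w
  simp only [maj, Set.mem_ofPred_eq, Set.mem_compl_iff]
  tauto

theorem inT_tri {n : ℤ} {w q : V} (h : inT w q) (hw : w ∈ Tri n) : q ∈ Tri (n + 1) := by
  simp only [Tri, Set.mem_ofPred_eq, inT] at *
  omega

theorem inT_J {S : Set V} {n : ℤ} {w q q' : V} (hw : w ∈ Tri n) (h : inT w q) (h' : inT w q') (hq : q ∈ S) (hq' : q' ∈ S) :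
    J (S ∩ Tri (n + 1)) q q' := by
  have m := Set.mem_inter hq (inT_tri h hw)
  by_cases e : q = q'
  · subst e; exact J.refl m
  · refine (J.refl m).step ?_ ⟨hq', inT_tri h' hw⟩
    rw [tri_iff]
    rw [Prod.ext_iff] at e
    simp only [inT] at *
    omega

theorem maj_step {S : Set V} {n : ℤ} {w w' : V} (hw : w ∈ Tri n) (hw' : w' ∈ Tri n) (h : w ∈ maj S) (h' : w' ∈ maj S)
    (a : TriAdj w w') : ∃ q q', inT w q ∧ inT w' q' ∧ q ∈ S ∧ q' ∈ S ∧ J (S ∩ Tri (n + 1)) q q' := by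
  have main : ∀ w w' : V, w ∈ Tri n → w' ∈ Tri n → w ∈ maj S → w' ∈ maj S →
      ((w'.1 = w.1 + 1 ∧ w'.2 = w.2) ∨ (w'.1 = w.1 ∧ w'.2 = w.2 + 1) ∨ (w'.1 = w.1 + 1 ∧ w'.2 = w.2 + 1)) →
      ∃ q q', inT w q ∧ inT w' q' ∧ q ∈ S ∧ q' ∈ S ∧ J (S ∩ Tri (n + 1)) q q' := by
    clear a h h' hw hw' w w'
    intro w w' hw hw' h h' a
    have gen : ∀ s t t' : V, inT w s → inT w' s → inT w t → inT w' t' → TriAdj t t' →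
        (s ∈ S ∨ (t ∈ S ∧ t' ∈ S)) → ∃ q q', inT w q ∧ inT w' q' ∧ q ∈ S ∧ q' ∈ S ∧ J (S ∩ Tri (n + 1)) q q' := by
      intro s t t' h1 h2 h3 h4 h5 h6
      rcases h6 with h6 | ⟨h6, h7⟩
      · exact ⟨s, s, h1, h2, h6, h6, J.refl (Set.mem_inter h6 (inT_tri h1 hw))⟩
      · exact ⟨t, t', h3, h4, h6, h7, (J.refl (Set.mem_inter h6 (inT_tri h3 hw))).step h5 ⟨h7, inT_tri h4 hw'⟩⟩
    obtain ⟨x, y⟩ := w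
    obtain ⟨x', y'⟩ := w'
    simp only [maj, Set.mem_ofPred_eq] at h h'
    simp only at a
    rcases a with ⟨e1, e2⟩ | ⟨e1, e2⟩ | ⟨e1, e2⟩ <;> rw [e1, e2] at gen h' hw' ⊢
    · exact gen (x + 1, y) (x + 1, y + 1) (x + 1 + 1, y + 1) (by simp [inT]) (by simp [inT]) (by simp [inT])
        (by simp [inT]) (by rw [tri_iff]; simp) (by tauto)
    · exact gen (x + 1, y + 1) (x, y) (x, y + 1) (by simp [inT]) (by simp [inT]) (by simp [inT])
        (by simp [inT]) (by rw [tri_iff]; simp) (by tauto)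
    · exact gen (x + 1, y + 1) (x + 1, y) (x + 1 + 1, y + 1) (by simp [inT]) (by simp [inT]) (by simp [inT])
        (by simp [inT]) (by rw [tri_iff]; simp) (by tauto)
  rw [tri_iff] at a
  by_cases c : ((w'.1 = w.1 + 1 ∧ w'.2 = w.2) ∨ (w'.1 = w.1 ∧ w'.2 = w.2 + 1) ∨ (w'.1 = w.1 + 1 ∧ w'.2 = w.2 + 1))
  · exact main _ _ hw hw' h h' c
  · obtain ⟨q, q', h1, h2, h3, h4, h5⟩ := main _ _ hw' hw h' h (by omega)
    exact ⟨q', q, h2, h1, h4, h3, h5.symm⟩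

theorem maj_lift {S : Set V} {n : ℤ} {w w' : V} (h : J (maj S ∩ Tri n) w w') : ∀ q q', inT w q → inT w' q' → q ∈ S → q' ∈ S →
    J (S ∩ Tri (n + 1)) q q' := by
  refine J.ind (P := fun w' => ∀ q q', inT w q → inT w' q' → q ∈ S → q' ∈ S → J (S ∩ Tri (n + 1)) q q') ?_ ?_ h
  · intro q q' h1 h2 h3 h4
    exact inT_J h.1.2 h1 h2 h3 h4
  · intro v v' k1 k2 a k3 q q' h1 h2 h3 h4
    obtain ⟨r, r', m1, m2, m3, m4, m5⟩ := maj_step k1.right.2 k3.2 k1.right.1 k3.1 a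
    exact ((k2 q r h1 m1 h3 m3).trans m5).trans (inT_J k3.2 m2 h2 m4 h4)

theorem YEv_lift {S : Set V} {n : ℤ} (h : YEv (maj S) n) : YEv S (n + 1) := by
  obtain ⟨g, a, b, c, h1, h2, h3, h4, h5, h6⟩ := h
  have hg : ∃ q, inT g q ∧ q ∈ S := by
    rcases h1.1.1 with ⟨h, -⟩ | ⟨h, -⟩ | ⟨h, -⟩
    · exact ⟨_, by simp [inT], h⟩
    · exact ⟨_, by simp [inT], h⟩
    · exact ⟨_, by simp [inT], h⟩
  obtain ⟨q, q1, q2⟩ := hg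
  have ha : ∃ q, inT a q ∧ q ∈ S ∧ q.2 = 0 := by
    rcases h1.right.1 with ⟨h, -⟩ | ⟨h, -⟩ | ⟨h, -⟩
    · exact ⟨_, by simp [inT], h, by simp [h4]⟩
    · exact ⟨_, by simp [inT], h, by simp [h4]⟩
    · exact ⟨_, by simp [inT], h, by simp [h4]⟩
  have hb : ∃ q, inT b q ∧ q ∈ S ∧ q.1 = q.2 := by
    rcases h2.right.1 with ⟨h, -⟩ | ⟨h, -⟩ | ⟨-, h⟩
    · exact ⟨_, by simp [inT], h, by simp [h5]⟩
    · exact ⟨_, by simp [inT], h, by simp [h5]⟩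
    · exact ⟨_, by simp [inT], h, by simp [h5]⟩
  have hc : ∃ q, inT c q ∧ q ∈ S ∧ q.1 = n + 1 := by
    rcases h3.right.1 with ⟨-, h⟩ | ⟨-, h⟩ | ⟨-, h⟩
    · exact ⟨_, by simp [inT], h, by simp [h6]⟩
    · exact ⟨_, by simp [inT], h, by simp [h6]⟩
    · exact ⟨_, by simp [inT], h, by simp [h6]⟩
  obtain ⟨a', a1, a2, a3⟩ := ha
  obtain ⟨b', b1, b2, b3⟩ := hb
  obtain ⟨c', c1, c2, c3⟩ := hc
  exact ⟨q, a', b', c', maj_lift h1 _ _ q1 a1 q2 a2, maj_lift h2 _ _ q1 b1 q2 b2, maj_lift h3 _ _ q1 c1 q2 c2, a3, b3, c3⟩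

theorem YEv_or (n : ℕ) : ∀ S : Set V, YEv S n ∨ YEv Sᶜ n := by
  induction n with
  | zero =>
    intro S
    have ht : ((0, 0) : V) ∈ Tri (0 : ℕ) := by simp [Tri]
    by_cases h : ((0, 0) : V) ∈ S
    · left
      have := J.refl (Set.mem_inter h ht)
      exact ⟨_, _, _, _, this, this, this, rfl, rfl, rfl⟩
    · right
      have := J.refl (Set.mem_inter (show ((0, 0) : V) ∈ Sᶜ from h) ht)
      exact ⟨_, _, _, _, this, this, this, rfl, rfl, rfl⟩
  | succ n ih =>
    intro S
    rcases ih (maj S) with h | h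
    · left; have := YEv_lift h; exact_mod_cast this
    · right; rw [← maj_compl] at h; have := YEv_lift h; exact_mod_cast this

/-- The linear form `k x - (k-1) y`, for `k = 1` it is `x`, for `k = 2` it is `ell`. -/
def lf (k : ℤ) (v : V) : ℤ := k * v.1 - (k - 1) * v.2

theorem hex0 (W : Set V) (k l0 l1 y0 y1 : ℤ) (hk : k = 1 ∨ k = 2) (hy0 : 1 ≤ y0) (hy : y0 ≤ y1) (hl : y1 < l0) (hll : l0 + k ≤ l1 + 1) :
    (∃ p e, J (W ∩ {w | l0 ≤ lf k w ∧ lf k w ≤ l1 ∧ y0 ≤ w.2 ∧ w.2 ≤ y1}) p e ∧ lf k p ≤ l0 + k - 1 ∧ l1 - k + 1 ≤ lf k e) ∨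
    (∃ u v, J (Wᶜ ∩ {w | l0 ≤ lf k w ∧ lf k w ≤ l1 ∧ y0 ≤ w.2 ∧ w.2 ≤ y1}) u v ∧ u.2 ≤ y0 ∧ y1 ≤ v.2) := by
  have hst : ∀ u v, TriAdj u v → lf k v ≤ lf k u + k := by
    intro u v h; rw [tri_iff] at h; rcases hk with rfl | rfl <;> simp only [lf] <;> omega
  obtain ⟨n, hn⟩ : ∃ n : ℕ, l1 < n := ⟨(l1 + 1).toNat, by omega⟩
  rcases YEv_or n {w | lf k w < l0 ∨ (y0 ≤ w.2 ∧ w.2 ≤ y1 ∧ (l1 < lf k w ∨ w ∈ W))} with h | h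
  · left
    obtain ⟨g, a, b, c, h1, h2, h3, h4, h5, h6⟩ := h
    have ha := h1.right
    have hc := h3.right
    simp only [Tri, Set.mem_inter_iff, Set.mem_ofPred_eq] at ha hc
    obtain ⟨u, v, m1, m2, m3, m4⟩ := (h1.symm.trans h3).strip (lf k) k l0 (l1 - k + 1) hst (by omega) (by omega)
      (by rcases ha.1 with h | h <;> omega) (by rcases hk with rfl | rfl <;> simp only [lf] at * <;> omega)
    refine ⟨u, v, m2.mono ?_, m3, m4⟩
    rintro w ⟨⟨hw1, hw2⟩, hw3⟩
    simp only [Set.mem_inter_iff, Set.mem_ofPred_eq] at *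
    have : ¬ lf k w < l0 := by omega
    have : ¬ l1 < lf k w := by omega
    refine ⟨?_, ?_⟩
    · tauto
    · omega
  · right
    obtain ⟨g, a, b, c, h1, h2, h3, h4, h5, h6⟩ := h
    have hb := h2.right
    simp only [Tri, Set.mem_inter_iff, Set.mem_ofPred_eq, Set.mem_compl_iff, not_or] at hb
    obtain ⟨u, v, m1, m2, m3, m4⟩ := (h1.symm.trans h2).strip (fun w => w.2) 1 y0 y1
      (fun u v a => by rw [tri_iff] at a; omega) (by omega) (by omega) (by omega)
      (by rcases hk with rfl | rfl <;> simp only [lf] at * <;> omega)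
    refine ⟨u, v, m2.mono ?_, by omega, m4⟩
    rintro w ⟨⟨hw1, hw2⟩, hw3⟩
    simp only [Set.mem_inter_iff, Set.mem_ofPred_eq, Set.mem_compl_iff, not_or] at *
    have e1 : y0 ≤ w.2 := by omega
    have e2 : w.2 ≤ y1 := by omega
    have e3 : ¬ (l1 < lf k w ∨ w ∈ W) := fun h => hw1.2 ⟨e1, e2, h⟩
    rw [not_or] at e3
    refine ⟨e3.2, ?_⟩
    omega

/-- Hex: a box is crossed one way by `W` or the other way by its complement. -/
theorem hex (W : Set V) (k l0 l1 y0 y1 : ℤ) (hk : k = 1 ∨ k = 2) (hy : y0 ≤ y1) (hll : l0 + k ≤ l1 + 1) :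
    (∃ p e, J (W ∩ {w | l0 ≤ lf k w ∧ lf k w ≤ l1 ∧ y0 ≤ w.2 ∧ w.2 ≤ y1}) p e ∧ lf k p ≤ l0 + k - 1 ∧ l1 - k + 1 ≤ lf k e) ∨
    (∃ u v, J (Wᶜ ∩ {w | l0 ≤ lf k w ∧ lf k w ≤ l1 ∧ y0 ≤ w.2 ∧ w.2 ≤ y1}) u v ∧ u.2 ≤ y0 ∧ y1 ≤ v.2) := by
  obtain ⟨z, hz1, hz2⟩ : ∃ z : V, z.2 = 1 - y0 ∧ y1 + z.2 < l0 + lf k z := by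
    refine ⟨((|y1| + |y0| + |l0| + 5), 1 - y0), rfl, ?_⟩
    have := abs_nonneg y1; have := abs_nonneg y0; have := abs_nonneg l0
    have := le_abs_self y1; have := neg_abs_le y0; have := neg_abs_le l0; have := le_abs_self y0
    rcases hk with rfl | rfl <;> simp only [lf] <;> linarith
  have hz : ∀ w, lf k (tr z w) = lf k w + lf k z := fun w => by simp only [lf, tr]; ring
  have hz' : ∀ w, lf k (tr (ng z) w) = lf k w - lf k z := fun w => by simp only [lf, tr, ng]; ring
  have ht : ∀ w, tr z (tr (ng z) w) = w := fun w => by simp [tr, ng]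
  have hmap : ∀ {W : Set V} {p e : V}, J (tr (ng z) ⁻¹' W ∩ {w | l0 + lf k z ≤ lf k w ∧ lf k w ≤ l1 + lf k z ∧ y0 + z.2 ≤ w.2 ∧ w.2 ≤ y1 + z.2}) p e →
      J (W ∩ {w | l0 ≤ lf k w ∧ lf k w ≤ l1 ∧ y0 ≤ w.2 ∧ w.2 ≤ y1}) (tr (ng z) p) (tr (ng z) e) := by
    intro W p e h
    refine h.pre _ (tr_adj _) ?_
    intro w hw
    simp only [Set.mem_ofPred_eq, hz'] at *
    simp only [tr, ng]
    omega
  rcases hex0 (tr (ng z) ⁻¹' W) k (l0 + lf k z) (l1 + lf k z) (y0 + z.2) (y1 + z.2) hk (by omega) (by omega) (by omega) (by omega)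
    with ⟨p, e, h1, h2, h3⟩ | ⟨p, e, h1, h2, h3⟩
  · left
    exact ⟨_, _, hmap h1, by rw [hz']; omega, by rw [hz']; omega⟩
  · right
    rw [← Set.preimage_compl] at h1
    exact ⟨_, _, hmap h1, by simp only [tr, ng]; omega, by simp only [tr, ng]; omega⟩

end DaC

namespace DaC

/-! ### Finite product Bernoulli measures -/

open Classical in
noncomputable def ind (P : Prop) : ℝ := if P then 1 else 0

theorem ind_true {P : Prop} (h : P) : ind P = 1 := by simp [ind, h]
theorem ind_false {P : Prop} (h : ¬ P) : ind P = 0 := by simp [ind, h]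
theorem ind_nonneg (P : Prop) : 0 ≤ ind P := by unfold ind; split_ifs <;> norm_num
theorem ind_le_one (P : Prop) : ind P ≤ 1 := by unfold ind; split_ifs <;> norm_num
theorem ind_mono {P Q : Prop} (h : P → Q) : ind P ≤ ind Q := by
  by_cases hp : P
  · rw [ind_true hp, ind_true (h hp)]
  · rw [ind_false hp]; exact ind_nonneg _
theorem ind_and (P Q : Prop) : ind (P ∧ Q) = ind P * ind Q := by
  by_cases hp : P <;> by_cases hq : Q <;> simp [ind, hp, hq]
theorem ind_not (P : Prop) : ind (¬ P) = 1 - ind P := by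
  by_cases hp : P <;> simp [ind, hp]
theorem ind_or_le (P Q : Prop) : ind (P ∨ Q) ≤ ind P + ind Q := by
  by_cases hp : P <;> by_cases hq : Q <;> simp [ind, hp, hq]
theorem ind_congr {P Q : Prop} (h : P ↔ Q) : ind P = ind Q := by rw [propext h]

section
variable {ι κ : Type} [Fintype ι] [Fintype κ]

noncomputable def wt (q : ι → ℝ) (ω : ι → Bool) : ℝ := ∏ i, (if ω i then q i else 1 - q i)

open Classical in
noncomputable def ex (q : ι → ℝ) (f : (ι → Bool) → ℝ) : ℝ := ∑ ω, wt q ω * f ω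

noncomputable def pr (q : ι → ℝ) (E : (ι → Bool) → Prop) : ℝ := ex q fun ω => ind (E ω)

def Pq (q : ι → ℝ) : Prop := ∀ i, 0 ≤ q i ∧ q i ≤ 1

theorem wt_nonneg {q : ι → ℝ} (hq : Pq q) (ω : ι → Bool) : 0 ≤ wt q ω :=
  Finset.prod_nonneg fun i _ => by have := hq i; split_ifs <;> linarith

open Classical in
theorem sum_wt (q : ι → ℝ) : ∑ ω, wt q ω = 1 := by
  have := Finset.prod_univ_sum (fun _ : ι => (Finset.univ : Finset Bool)) (fun i b => if b then q i else 1 - q i)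
  simp only [Fintype.sum_bool, if_true, Bool.false_eq_true, if_false, Fintype.piFinset_univ] at this
  unfold wt
  rw [← this]; simp

theorem ex_add (q : ι → ℝ) (f g : (ι → Bool) → ℝ) : ex q (fun ω => f ω + g ω) = ex q f + ex q g := by
  simp [ex, mul_add, Finset.sum_add_distrib]
theorem ex_sub (q : ι → ℝ) (f g : (ι → Bool) → ℝ) : ex q (fun ω => f ω - g ω) = ex q f - ex q g := by
  simp [ex, mul_sub, Finset.sum_sub_distrib]
theorem ex_mul (q : ι → ℝ) (c : ℝ) (f : (ι → Bool) → ℝ) : ex q (fun ω => c * f ω) = c * ex q f := by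
  simp only [ex, Finset.mul_sum]; exact Finset.sum_congr rfl fun _ _ => by ring
theorem ex_mul' (q : ι → ℝ) (c : ℝ) (f : (ι → Bool) → ℝ) : ex q (fun ω => f ω * c) = ex q f * c := by
  simp only [ex, Finset.sum_mul]; exact Finset.sum_congr rfl fun _ _ => by ring
theorem ex_const (q : ι → ℝ) (c : ℝ) : ex q (fun _ => c) = c := by
  simp only [ex, ← Finset.sum_mul, sum_wt, one_mul]
theorem ex_sum {α : Type*} (q : ι → ℝ) (s : Finset α) (f : α → (ι → Bool) → ℝ) :
    ex q (fun ω => ∑ a ∈ s, f a ω) = ∑ a ∈ s, ex q (f a) := by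
  simp only [ex, Finset.mul_sum]; exact Finset.sum_comm
theorem ex_mono {q : ι → ℝ} (hq : Pq q) {f g : (ι → Bool) → ℝ} (h : ∀ ω, f ω ≤ g ω) : ex q f ≤ ex q g :=
  Finset.sum_le_sum fun ω _ => mul_le_mul_of_nonneg_left (h ω) (wt_nonneg hq ω)
theorem ex_nonneg {q : ι → ℝ} (hq : Pq q) {f : (ι → Bool) → ℝ} (h : ∀ ω, 0 ≤ f ω) : 0 ≤ ex q f := by
  have := ex_mono hq h; rwa [ex_const] at this
theorem ex_congr (q : ι → ℝ) {f g : (ι → Bool) → ℝ} (h : ∀ ω, f ω = g ω) : ex q f = ex q g := by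
  rw [show f = g from funext h]
theorem abs_ex_le {q : ι → ℝ} (hq : Pq q) (f : (ι → Bool) → ℝ) : |ex q f| ≤ ex q fun ω => |f ω| := by
  rw [abs_le]
  constructor
  · have := ex_mono hq (f := fun ω => (-1) * |f ω|) (g := f) fun ω => by have := neg_abs_le (f ω); linarith
    rw [ex_mul] at this; linarith
  · exact ex_mono hq fun ω => le_abs_self _

theorem pr_mono {q : ι → ℝ} (hq : Pq q) {E F : (ι → Bool) → Prop} (h : ∀ ω, E ω → F ω) : pr q E ≤ pr q F :=
  ex_mono hq fun ω => ind_mono (h ω)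
theorem pr_nonneg {q : ι → ℝ} (hq : Pq q) (E : (ι → Bool) → Prop) : 0 ≤ pr q E := ex_nonneg hq fun _ => ind_nonneg _
theorem pr_le_one {q : ι → ℝ} (hq : Pq q) (E : (ι → Bool) → Prop) : pr q E ≤ 1 := by
  have := ex_mono hq (f := fun ω => ind (E ω)) (g := fun _ => 1) fun ω => ind_le_one _
  rwa [ex_const] at this
theorem pr_not (q : ι → ℝ) (E : (ι → Bool) → Prop) : pr q (fun ω => ¬ E ω) = 1 - pr q E := by
  simp only [pr, ind_not, ex_sub, ex_const]
theorem pr_or {q : ι → ℝ} (hq : Pq q) (E F : (ι → Bool) → Prop) : pr q (fun ω => E ω ∨ F ω) ≤ pr q E + pr q F := by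
  rw [pr, pr, pr, ← ex_add]; exact ex_mono hq fun ω => ind_or_le _ _
theorem pr_congr {q : ι → ℝ} {E F : (ι → Bool) → Prop} (h : ∀ ω, E ω ↔ F ω) : pr q E = pr q F :=
  ex_congr q fun ω => ind_congr (h ω)
theorem pr_exists {q : ι → ℝ} (hq : Pq q) {α : Type*} (s : Finset α) (E : α → (ι → Bool) → Prop) :
    pr q (fun ω => ∃ a ∈ s, E a ω) ≤ ∑ a ∈ s, pr q (E a) := by
  simp only [pr, ← ex_sum]
  refine ex_mono hq fun ω => ?_
  by_cases h : ∃ a ∈ s, E a ω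
  · obtain ⟨a, ha, h'⟩ := h
    calc ind _ ≤ 1 := ind_le_one _
      _ = ind (E a ω) := (ind_true h').symm
      _ ≤ _ := Finset.single_le_sum (f := fun a => ind (E a ω)) (fun _ _ => ind_nonneg _) ha
  · rw [ind_false h]; exact Finset.sum_nonneg fun _ _ => ind_nonneg _

/-! Two independent copies and swapping coordinates. -/

open Classical in
noncomputable def mix (S : Set ι) (x y : ι → Bool) : ι → Bool := fun i => if i ∈ S then x i else y i

theorem mix_in {S : Set ι} {i : ι} (x y : ι → Bool) (h : i ∈ S) : mix S x y i = x i := by simp [mix, h]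
theorem mix_out {S : Set ι} {i : ι} (x y : ι → Bool) (h : i ∉ S) : mix S x y i = y i := by simp [mix, h]

theorem wt_mix (q : ι → ℝ) (S : Set ι) (x y : ι → Bool) : wt q (mix S x y) * wt q (mix S y x) = wt q x * wt q y := by
  classical
  simp only [wt, ← Finset.prod_mul_distrib]
  refine Finset.prod_congr rfl fun i _ => ?_
  by_cases h : i ∈ S
  · simp only [mix, h, if_true]
  · simp only [mix, h, if_false]; ring

theorem mix_mix (S : Set ι) (x y : ι → Bool) : mix S (mix S x y) (mix S y x) = x := by
  funext i; by_cases h : i ∈ S <;> simp [mix, h]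

theorem ex_swap (q : ι → ℝ) (S : Set ι) (F : (ι → Bool) → (ι → Bool) → ℝ) :
    ex q (fun x => ex q fun y => F (mix S x y) (mix S y x)) = ex q (fun x => ex q fun y => F x y) := by
  classical
  simp only [ex, Finset.mul_sum]
  rw [← Fintype.sum_prod_type', ← Fintype.sum_prod_type']
  refine Fintype.sum_equiv ⟨fun p => (mix S p.1 p.2, mix S p.2 p.1), fun p => (mix S p.1 p.2, mix S p.2 p.1),
    fun p => by simp [mix_mix], fun p => by simp [mix_mix]⟩ _ _ fun p => ?_
  simp only [Equiv.coe_fn_mk, ← mul_assoc, wt_mix]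

/-- `f` only depends on the coordinates in `S`. -/
def Dep {α : Type*} (S : Set ι) (f : (ι → Bool) → α) : Prop := ∀ x y, (∀ i ∈ S, x i = y i) → f x = f y

theorem ex_indep (q : ι → ℝ) {S T : Set ι} (hST : Disjoint S T) {f g : (ι → Bool) → ℝ} (hf : Dep S f) (hg : Dep T g) :
    ex q (fun ω => f ω * g ω) = ex q f * ex q g := by
  have h := ex_swap q S (fun x y => f x * g y)
  have e : ∀ x y, f (mix S x y) * g (mix S y x) = f x * g x := fun x y => by
    rw [hf (mix S x y) x fun i hi => mix_in _ _ hi,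
      hg (mix S y x) x fun i hi => mix_out _ _ fun h => Set.disjoint_left.1 hST h hi]
  simp only [e, ex_const] at h
  rw [h]
  simp only [ex_mul, ex_mul']

open Classical in
/-- Resampling the coordinates outside `S`. -/
theorem ex_mix (q : ι → ℝ) (S : Set ι) (f : (ι → Bool) → ℝ) : ex q (fun x => ex q fun y => f (mix S x y)) = ex q f := by
  rw [ex_swap q S (fun x _ => f x)]
  simp only [ex_const]

open Classical in
noncomputable def st (i : ι) (b : Bool) (ω : ι → Bool) : ι → Bool := Function.update ω i b

theorem st_same (i : ι) (b : Bool) (ω : ι → Bool) : st i b ω i = b := by simp [st]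
theorem st_ne {i j : ι} (h : j ≠ i) (b : Bool) (ω : ι → Bool) : st i b ω j = ω j := by simp [st, h]
theorem st_self (i : ι) (ω : ι → Bool) : st i (ω i) ω = ω := by simp [st]

/-- Averaging over one coordinate. -/
theorem ex_st (q : ι → ℝ) (i : ι) (f : (ι → Bool) → ℝ) :
    ex q f = q i * ex q (fun ω => f (st i true ω)) + (1 - q i) * ex q (fun ω => f (st i false ω)) := by
  classical
  have key : ∀ b : Bool, ex q (fun ω => ind (ω i = b) * f (st i b ω)) = (if b then q i else 1 - q i) * ex q (fun ω => f (st i b ω)) := by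
    intro b
    rw [ex_indep q (S := {i}) (T := {i}ᶜ) (disjoint_compl_right) (f := fun ω => ind (ω i = b)) (g := fun ω => f (st i b ω))]
    · congr 1
      have h1 : ∀ ω : ι → Bool, wt q ω * ind (ω i = b) = ∏ j, (fun j c => (if c then q j else 1 - q j) * (if j = i then ind (c = b) else 1)) j (ω j) := by
        intro ω
        simp only [Finset.prod_mul_distrib, wt, Finset.prod_ite_eq', Finset.mem_univ, if_true]
      have := Finset.prod_univ_sum (fun _ : ι => (Finset.univ : Finset Bool)) (fun j c => (if c then q j else 1 - q j) * (if j = i then ind (c = b) else 1))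
      rw [Fintype.piFinset_univ] at this
      simp only [ex, h1]
      convert this.symm using 1
      simp only [Fintype.sum_bool]
      rw [Finset.prod_eq_single i]
      · cases b <;> simp [ind]
      · intro j _ hj; simp [hj]
      · simp
    · intro x y h; simp only [h i rfl]
    · intro x y h
      dsimp only
      congr 1
      funext j
      by_cases hj : j = i
      · subst hj; simp [st_same]
      · simp only [st_ne hj]; exact h j hj
  have e : ∀ ω, f ω = ind (ω i = true) * f (st i true ω) + ind (ω i = false) * f (st i false ω) := by
    intro ω
    have := st_self i ω
    cases h : ω i <;> rw [h] at this <;> simp [ind, this]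
  rw [ex_congr q e, ex_add, key, key]
  simp

end
end DaC

namespace DaC

section
variable {ι κ : Type} [Fintype ι] [Fintype κ]

def Agr (S : Set ι) (x y : ι → Bool) : Prop := ∀ i ∈ S, y i = x i

theorem agr_mix (S : Set ι) (x y : ι → Bool) : Agr S x (mix S x y) := fun i hi => mix_in x y hi

theorem mix_insert (S : Set ι) {i : ι} (hi : i ∉ S) (b : Bool) (x y : ι → Bool) :
    mix (insert i S) (st i b x) y = mix S x (st i b y) := by
  funext j
  by_cases hj : j = i
  · subst hj; rw [mix_in _ _ (Set.mem_insert _ _), mix_out _ _ hi, st_same, st_same]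
  · by_cases hS : j ∈ S
    · rw [mix_in _ _ (Set.mem_insert_of_mem _ hS), mix_in _ _ hS, st_ne hj]
    · rw [mix_out _ _ (by simp [hj, hS]), mix_out _ _ hS, st_ne hj]

theorem st_st (i : ι) (b c : Bool) (x : ι → Bool) : st i b (st i c x) = st i b x := by
  funext j
  by_cases hj : j = i
  · subst hj; rw [st_same, st_same]
  · rw [st_ne hj, st_ne hj, st_ne hj]

theorem agr_insert {S : Set ι} {i : ι} (hi : i ∉ S) {b : Bool} {x y : ι → Bool}
    (h : Agr (insert i S) (st i b x) y) : Agr S x y := fun j hj => by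
  rw [h j (Set.mem_insert_of_mem _ hj), st_ne (fun e => hi (by rw [← e]; exact hj))]

/-- Influence of a coordinate. -/
noncomputable def infl (q : ι → ℝ) (f : (ι → Bool) → ℝ) (i : ι) : ℝ :=
  q i * (1 - q i) * ex q fun ω => |f (st i true ω) - f (st i false ω)|

theorem infl_nonneg {q : ι → ℝ} (hq : Pq q) (f : (ι → Bool) → ℝ) (i : ι) : 0 ≤ infl q f i :=
  mul_nonneg (mul_nonneg (hq i).1 (by linarith [(hq i).2])) (ex_nonneg hq fun _ => abs_nonneg _)

open Classical in
noncomputable def cof (S : Set ι) : Finset ι := Finset.univ.filter (fun i => i ∉ S)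

theorem mem_cof {S : Set ι} {i : ι} : i ∈ cof S ↔ i ∉ S := by simp [cof]

open Classical in
theorem osss_aux {q : ι → ℝ} (hq : Pq q) (f g : (ι → Bool) → ℝ) (hg : ∀ ω, 0 ≤ g ω ∧ g ω ≤ 1)
    (Q : (ι → Bool) → Set ι)
    (hQ : ∀ S x, (∀ y, Agr S x y → S ⊆ Q y) → (∀ y, Agr S x y → g y = g x) ∨ ∃ i, i ∉ S ∧ ∀ y, Agr S x y → i ∈ Q y) :
    ∀ n : ℕ, ∀ S : Set ι, ∀ x : ι → Bool, (cof S).card ≤ n → (∀ y, Agr S x y → S ⊆ Q y) →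
    |ex q (fun y => f y * g (mix S x y)) - ex q f * ex q (fun y => g (mix S x y))| ≤
      ∑ i ∈ cof S, pr q (fun y => i ∈ Q (mix S x y)) * infl q f i := by
  intro n
  induction n with
  | zero =>
    intro S x hn hS
    have hall : ∀ i, i ∈ S := by
      intro i; by_contra hi
      rw [Nat.le_zero, Finset.card_eq_zero] at hn
      have : i ∈ cof S := mem_cof.2 hi
      rw [hn] at this; simp at this
    have e : ∀ y, mix S x y = x := fun y => funext fun i => mix_in _ _ (hall i)
    simp only [e, ex_const, ex_mul', sub_self, abs_zero]
    exact Finset.sum_nonneg fun i _ => mul_nonneg (pr_nonneg hq _) (infl_nonneg hq _ _)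
  | succ n ih =>
    intro S x hn hS
    rcases hQ S x hS with hdet | ⟨i, hi, hiQ⟩
    · have e : ∀ y, g (mix S x y) = g x := fun y => hdet _ (agr_mix S x y)
      simp only [e, ex_const, ex_mul', sub_self, abs_zero]
      exact Finset.sum_nonneg fun i _ => mul_nonneg (pr_nonneg hq _) (infl_nonneg hq _ _)
    · have hfil : cof S = insert i (cof (insert i S)) := by
        ext j; by_cases hj : j = i
        · subst hj; simp [hi, mem_cof]
        · simp [hj, mem_cof]
      have hni : i ∉ cof (insert i S) := by simp [mem_cof]
      have hcard : (cof (insert i S)).card ≤ n := by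
        rw [hfil, Finset.card_insert_of_notMem hni] at hn; omega
      have hS' : ∀ b, ∀ y, Agr (insert i S) (st i b x) y → insert i S ⊆ Q y := fun b y hy => by
        have h := agr_insert hi hy
        exact Set.insert_subset (hiQ y h) (hS y h)
      have I1 := ih _ _ hcard (hS' true)
      have I0 := ih _ _ hcard (hS' false)
      rw [hfil, Finset.sum_insert hni]
      have hp1 : pr q (fun y => i ∈ Q (mix S x y)) = 1 := by
        unfold pr
        rw [ex_congr q (g := fun _ => 1) fun y => ind_true (hiQ _ (agr_mix S x y)), ex_const]
      rw [hp1, one_mul]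
      simp only [mix_insert S hi] at I1 I0
      have hsum : ∑ j ∈ cof (insert i S), pr q (fun y => j ∈ Q (mix S x y)) * infl q f j =
          q i * (∑ j ∈ cof (insert i S), pr q (fun y => j ∈ Q (mix S x (st i true y))) * infl q f j) +
          (1 - q i) * (∑ j ∈ cof (insert i S), pr q (fun y => j ∈ Q (mix S x (st i false y))) * infl q f j) := by
        rw [Finset.mul_sum, Finset.mul_sum, ← Finset.sum_add_distrib]
        refine Finset.sum_congr rfl fun j _ => ?_
        unfold pr
        rw [ex_st q i]; ring
      rw [hsum]
      have hG := ex_st q i (fun y => g (mix S x y))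
      have hFG := ex_st q i (fun y => f y * g (mix S x y))
      have hFG1 := ex_st q i (fun y => f y * g (mix S x (st i true y)))
      have hFG0 := ex_st q i (fun y => f y * g (mix S x (st i false y)))
      simp only [st_st] at hG hFG hFG1 hFG0
      have hq0 := (hq i).1
      have hq1 := (hq i).2
      have hdiff : |ex q (fun y => (f (st i true y) - f (st i false y)) * (g (mix S x (st i true y)) - g (mix S x (st i false y))))| ≤
          ex q fun ω => |f (st i true ω) - f (st i false ω)| := by
        refine (abs_ex_le hq _).trans (ex_mono hq fun y => ?_)
        rw [abs_mul]
        refine mul_le_of_le_one_right (abs_nonneg _) ?_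
        rw [abs_le]
        have h1 := hg (mix S x (st i true y)); have h2 := hg (mix S x (st i false y))
        constructor <;> linarith [h1.1, h1.2, h2.1, h2.2]
      have hexp : ex q (fun y => (f (st i true y) - f (st i false y)) * (g (mix S x (st i true y)) - g (mix S x (st i false y)))) =
          ex q (fun y => f (st i true y) * g (mix S x (st i true y))) - ex q (fun y => f (st i false y) * g (mix S x (st i true y)))
          - ex q (fun y => f (st i true y) * g (mix S x (st i false y))) + ex q (fun y => f (st i false y) * g (mix S x (st i false y))) := by
        rw [← ex_sub, ← ex_sub, ← ex_add]
        exact ex_congr q fun y => by ring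
      rw [show infl q f i = q i * (1 - q i) * ex q (fun ω => |f (st i true ω) - f (st i false ω)|) from rfl]
      set D := ex q (fun y => (f (st i true y) - f (st i false y)) * (g (mix S x (st i true y)) - g (mix S x (st i false y))))
      set W := ex q fun ω => |f (st i true ω) - f (st i false ω)|
      set A1 := ex q (fun y => f y * g (mix S x (st i true y)))
      set A0 := ex q (fun y => f y * g (mix S x (st i false y)))
      set s1 := ∑ j ∈ cof (insert i S), pr q (fun y => j ∈ Q (mix S x (st i true y))) * infl q f j with hs1
      set s0 := ∑ j ∈ cof (insert i S), pr q (fun y => j ∈ Q (mix S x (st i false y))) * infl q f j with hs0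
      set B1 := ex q (fun y => g (mix S x (st i true y)))
      set B0 := ex q (fun y => g (mix S x (st i false y)))
      have hid : ex q (fun y => f y * g (mix S x y)) - ex q f * ex q (fun y => g (mix S x y)) =
          q i * (1 - q i) * D + q i * (A1 - ex q f * B1) + (1 - q i) * (A0 - ex q f * B0) := by
        rw [hG, hFG, hFG1, hFG0, hexp]; ring
      rw [hid]
      have hqq : 0 ≤ q i * (1 - q i) := mul_nonneg hq0 (by linarith)
      have hq1' : 0 ≤ 1 - q i := by linarith
      rw [abs_le] at I1 I0 hdiff ⊢
      have a1 := mul_le_mul_of_nonneg_left hdiff.1 hqq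
      have a2 := mul_le_mul_of_nonneg_left hdiff.2 hqq
      have b1 := mul_le_mul_of_nonneg_left I1.1 hq0
      have b2 := mul_le_mul_of_nonneg_left I1.2 hq0
      have c1 := mul_le_mul_of_nonneg_left I0.1 hq1'
      have c2 := mul_le_mul_of_nonneg_left I0.2 hq1'
      constructor <;> linarith

/-- The OSSS inequality. -/
theorem osss {q : ι → ℝ} (hq : Pq q) (f g : (ι → Bool) → ℝ) (hg : ∀ ω, 0 ≤ g ω ∧ g ω ≤ 1)
    (Q : (ι → Bool) → Set ι)
    (hQ : ∀ S x, (∀ y, Agr S x y → S ⊆ Q y) → (∀ y, Agr S x y → g y = g x) ∨ ∃ i, i ∉ S ∧ ∀ y, Agr S x y → i ∈ Q y) :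
    |ex q (fun y => f y * g y) - ex q f * ex q g| ≤ ∑ i, pr q (fun y => i ∈ Q y) * infl q f i := by
  classical
  have h := osss_aux hq f g hg Q hQ _ ∅ (fun _ => false) le_rfl (fun y _ => Set.empty_subset _)
  have e : ∀ y : ι → Bool, mix ∅ (fun _ => false) y = y := fun y => funext fun i => mix_out _ _ (Set.notMem_empty i)
  have hc : cof (∅ : Set ι) = Finset.univ := by ext i; simp [mem_cof]
  simpa only [e, hc] using h

/-- Adaptive exploration along which `f` and `g` move in the same direction. -/
inductive Good (f g : (ι → Bool) → ℝ) : Set ι → (ι → Bool) → Prop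
  | done {S x} (h : ∀ y, Agr S x y → f y = f x) : Good f g S x
  | step {S x} (i : ι) (hi : i ∉ S) (h1 : Good f g (insert i S) (st i true x)) (h0 : Good f g (insert i S) (st i false x))
      (hm : (∀ y, Agr S x y → f (st i false y) ≤ f (st i true y) ∧ g (st i false y) ≤ g (st i true y)) ∨
        (∀ y, Agr S x y → f (st i true y) ≤ f (st i false y) ∧ g (st i true y) ≤ g (st i false y))) : Good f g S x

theorem Good.fkg {q : ι → ℝ} (hq : Pq q) {f g : (ι → Bool) → ℝ} {S : Set ι} {x : ι → Bool} (h : Good f g S x) :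
    ex q (fun y => f (mix S x y)) * ex q (fun y => g (mix S x y)) ≤ ex q (fun y => f (mix S x y) * g (mix S x y)) := by
  induction h with
  | @done S x h =>
    have e : ∀ y, f (mix S x y) = f x := fun y => h _ (agr_mix S x y)
    simp only [e, ex_const, ex_mul, le_refl]
  | @step S x i hi h1 h0 hm ih1 ih0 =>
    simp only [mix_insert S hi] at ih1 ih0
    rw [ex_st q i (fun y => f (mix S x y)), ex_st q i (fun y => g (mix S x y)), ex_st q i (fun y => f (mix S x y) * g (mix S x y))]
    have hcomm : ∀ b y, mix S x (st i b y) = st i b (mix S x y) := by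
      intro b y; funext j
      by_cases hj : j = i
      · subst hj; rw [mix_out _ _ hi, st_same, st_same]
      · rw [st_ne hj]
        by_cases hS : j ∈ S
        · rw [mix_in _ _ hS, mix_in _ _ hS]
        · rw [mix_out _ _ hS, mix_out _ _ hS, st_ne hj]
    have hq0 := (hq i).1
    have hq1 : 0 ≤ 1 - q i := by linarith [(hq i).2]
    have key : 0 ≤ (ex q (fun y => f (mix S x (st i true y))) - ex q (fun y => f (mix S x (st i false y)))) *
        (ex q (fun y => g (mix S x (st i true y))) - ex q (fun y => g (mix S x (st i false y)))) := by
      simp only [hcomm]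
      rcases hm with hm | hm
      · refine mul_nonneg ?_ ?_ <;> rw [sub_nonneg] <;> refine ex_mono hq fun y => ?_
        · exact (hm _ (agr_mix S x y)).1
        · exact (hm _ (agr_mix S x y)).2
      · refine mul_nonneg_of_nonpos_of_nonpos ?_ ?_ <;> rw [sub_nonpos] <;> refine ex_mono hq fun y => ?_
        · exact (hm _ (agr_mix S x y)).1
        · exact (hm _ (agr_mix S x y)).2
    have k2 := mul_nonneg (mul_nonneg hq0 hq1) key
    have k3 := mul_le_mul_of_nonneg_left ih1 hq0
    have k4 := mul_le_mul_of_nonneg_left ih0 hq1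
    nlinarith

/-! Push-forward, marginals -/

open Classical in
theorem push_sum {A B : Type} [Fintype A] [Fintype B] [DecidableEq B] (w : ι → A → ℝ) (σ : ι → A → B) (F : (ι → B) → ℝ) :
    ∑ x : ι → A, (∏ i, w i (x i)) * F (fun i => σ i (x i)) =
      ∑ y : ι → B, (∏ i, ∑ a, if σ i a = y i then w i a else 0) * F y := by
  have h : ∀ y : ι → B, (∏ i, ∑ a, if σ i a = y i then w i a else 0) =
      ∑ x : ι → A, ∏ i, if σ i (x i) = y i then w i (x i) else 0 := by
    intro y
    rw [Finset.prod_univ_sum, Fintype.piFinset_univ]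
  simp only [h, Finset.sum_mul]
  rw [Finset.sum_comm]
  refine Finset.sum_congr rfl fun x _ => ?_
  rw [Finset.sum_eq_single (fun i => σ i (x i))]
  · simp
  · intro y _ hy
    obtain ⟨i, hi⟩ := Function.ne_iff.1 hy
    rw [Finset.prod_eq_zero (Finset.mem_univ i), zero_mul]
    rw [if_neg (fun e => hi e.symm)]
  · simp

theorem ex_equiv (e : ι ≃ κ) (q : κ → ℝ) (F : (ι → Bool) → ℝ) :
    ex q (fun ω => F (fun i => ω (e i))) = ex (fun i => q (e i)) F := by
  classical
  unfold ex
  refine Fintype.sum_equiv (Equiv.arrowCongr e.symm (Equiv.refl Bool)) _ _ fun ω => ?_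
  have : (Equiv.arrowCongr e.symm (Equiv.refl Bool)) ω = fun i => ω (e i) := by funext i; simp
  rw [this]
  congr 1
  unfold wt
  exact (Fintype.prod_equiv e _ _ fun i => rfl).symm

theorem ex_def [inst : Fintype (ι → Bool)] (q : ι → ℝ) (f : (ι → Bool) → ℝ) : ex q f = ∑ ω, wt q ω * f ω := by
  unfold ex
  congr!

theorem ex_sum_type (q : ι ⊕ κ → ℝ) (F : (ι ⊕ κ → Bool) → ℝ) :
    ex q F = ex (fun i => q (.inl i)) fun x => ex (fun k => q (.inr k)) fun y => F (Sum.elim x y) := by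
  classical
  rw [ex_def q F]
  unfold ex
  simp only [Finset.mul_sum]
  refine Eq.trans ?_ (Fintype.sum_prod_type' (fun (x : ι → Bool) (y : κ → Bool) => wt (fun i => q (.inl i)) x * (wt (fun k => q (.inr k)) y * F (Sum.elim x y))))
  refine Fintype.sum_equiv (Equiv.sumArrowEquivProdArrow ι κ Bool) (fun ω => wt q ω * F ω)
    (fun p => wt (fun i => q (.inl i)) p.1 * (wt (fun k => q (.inr k)) p.2 * F (Sum.elim p.1 p.2))) fun ω => ?_
  have : Sum.elim ((Equiv.sumArrowEquivProdArrow ι κ Bool) ω).1 ((Equiv.sumArrowEquivProdArrow ι κ Bool) ω).2 = ω := by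
    funext i; cases i <;> rfl
  rw [this, ← mul_assoc]
  congr 1
  simp only [wt, Fintype.prod_sum_type]
  rfl

theorem ex_inj (j : ι → κ) (hj : Function.Injective j) (q : κ → ℝ) (F : (ι → Bool) → ℝ) :
    ex q (fun ω => F (fun i => ω (j i))) = ex (fun i => q (j i)) F := by
  classical
  let e : ι ⊕ {k // k ∉ Set.range j} ≃ κ :=
    (Equiv.sumCongr (Equiv.ofInjective j hj) (Equiv.refl _)).trans (Equiv.sumCompl (fun k => k ∈ Set.range j))
  have he : ∀ i, e (.inl i) = j i := fun i => by simp [e]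
  have h := ex_equiv e q (fun ω => F (fun i => ω (.inl i)))
  simp only [he] at h
  rw [h, ex_sum_type]
  simp only [Sum.elim_inl, ex_const, he]

theorem ex_dep {S : Set ι} {q q' : ι → ℝ} (hqq : ∀ i ∈ S, q i = q' i) {f : (ι → Bool) → ℝ} (hf : Dep S f) : ex q f = ex q' f := by
  classical
  let F : (S → Bool) → ℝ := fun x => f (fun i => if h : i ∈ S then x ⟨i, h⟩ else false)
  have e : ∀ ω, f ω = F (fun i => ω i.1) := fun ω => hf _ _ fun i hi => by simp [hi]
  rw [ex_congr q e, ex_congr q' e, ex_inj _ Subtype.val_injective, ex_inj _ Subtype.val_injective]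
  congr 1
  funext i
  exact hqq _ i.2

theorem Dep.mono {α : Type*} {S T : Set ι} {f : (ι → Bool) → α} (h : Dep S f) (hST : S ⊆ T) : Dep T f :=
  fun x y hxy => h x y fun i hi => hxy i (hST hi)

theorem dep_st (i : ι) (b : Bool) (f : (ι → Bool) → ℝ) : Dep {i}ᶜ (fun ω => f (st i b ω)) := by
  intro x y h
  dsimp only
  congr 1
  funext j
  by_cases hj : j = i
  · subst hj; simp [st_same]
  · simp only [st_ne hj]; exact h j hj

/-- Combining two independent configurations coordinatewise with `&&`. -/
theorem ex_and (q r : ι → ℝ) (F : (ι → Bool) → ℝ) :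
    ex q (fun x => ex r fun z => F (fun i => x i && z i)) = ex (fun i => q i * r i) F := by
  classical
  have h := push_sum (ι := ι) (A := Bool × Bool) (B := Bool)
    (fun i a => (if a.1 then q i else 1 - q i) * (if a.2 then r i else 1 - r i)) (fun _ a => a.1 && a.2) F
  have hr : ∀ y : ι → Bool, (∏ i, ∑ a : Bool × Bool, if (a.1 && a.2) = y i then
      (if a.1 then q i else 1 - q i) * (if a.2 then r i else 1 - r i) else 0) = wt (fun i => q i * r i) y := by
    intro y
    unfold wt
    refine Finset.prod_congr rfl fun i _ => ?_
    rw [Fintype.sum_prod_type]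
    cases y i <;> simp [Fintype.sum_bool] <;> ring
  simp only [hr] at h
  have e : ex (fun i => q i * r i) F = ∑ y : ι → Bool, wt (fun i => q i * r i) y * F y := by unfold ex; rfl
  rw [e, ← h]
  unfold ex
  simp only [Finset.mul_sum]
  rw [← Fintype.sum_prod_type' (fun (x : ι → Bool) (z : ι → Bool) => wt q x * (wt r z * F (fun i => x i && z i)))]
  refine Fintype.sum_equiv (Equiv.arrowProdEquivProdArrow ι (fun _ => Bool) (fun _ => Bool)).symm _ _ fun p => ?_
  rw [← mul_assoc]
  simp only [wt, ← Finset.prod_mul_distrib]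
  rfl

/-- Russo's formula. -/
theorem russo (q : ℝ → ι → ℝ) (q' : ι → ℝ) (s : ℝ) (hd : ∀ i, HasDerivAt (fun t => q t i) (q' i) s) (f : (ι → Bool) → ℝ) :
    HasDerivAt (fun t => ex (q t) f) (∑ i, q' i * ex (q s) (fun ω => f (st i true ω) - f (st i false ω))) s := by
  classical
  have key : ∀ i, ex (q s) (fun ω => f (st i true ω) - f (st i false ω)) =
      ∑ ω : ι → Bool, (∏ j ∈ Finset.univ.erase i, (if ω j then q s j else 1 - q s j)) * (if ω i then 1 else -1) * f ω := by
    intro i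
    have e1 : ∀ c : ℝ, ex (Function.update (q s) i c) f =
        c * ex (q s) (fun ω => f (st i true ω)) + (1 - c) * ex (q s) (fun ω => f (st i false ω)) := by
      intro c
      rw [ex_st _ i, Function.update_self]
      have hh : ∀ b, ex (Function.update (q s) i c) (fun ω => f (st i b ω)) = ex (q s) (fun ω => f (st i b ω)) := fun b =>
        ex_dep (S := {i}ᶜ) (fun j hj => Function.update_of_ne hj _ _) (dep_st i b f)
      rw [hh, hh]
    have e2 : ex (q s) (fun ω => f (st i true ω) - f (st i false ω)) = ex (Function.update (q s) i 1) f - ex (Function.update (q s) i 0) f := by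
      rw [e1, e1, ex_sub]; ring
    have e3 : ex (Function.update (q s) i 1) f - ex (Function.update (q s) i 0) f =
        ∑ ω : ι → Bool, (wt (Function.update (q s) i 1) ω - wt (Function.update (q s) i 0) ω) * f ω := by
      simp only [ex, sub_mul, Finset.sum_sub_distrib]
    rw [e2, e3]
    refine Finset.sum_congr rfl fun ω _ => ?_
    congr 1
    have hw : ∀ c : ℝ, wt (Function.update (q s) i c) ω = (if ω i then c else 1 - c) * ∏ j ∈ Finset.univ.erase i, (if ω j then q s j else 1 - q s j) := by
      intro c
      unfold wt
      rw [← Finset.mul_prod_erase _ _ (Finset.mem_univ i), Function.update_self]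
      congr 1
      refine Finset.prod_congr rfl fun j hj => ?_
      rw [Function.update_of_ne (Finset.ne_of_mem_erase hj)]
    rw [hw, hw]
    cases ω i <;> simp
  have hd' : ∀ ω : ι → Bool, HasDerivAt (fun t => wt (q t) ω * f ω)
      ((∑ i, (∏ j ∈ Finset.univ.erase i, (if ω j then q s j else 1 - q s j)) * ((if ω i then 1 else -1) * q' i)) * f ω) s := by
    intro ω
    refine HasDerivAt.mul_const ?_ _
    have := HasDerivAt.fun_finset_prod (u := Finset.univ) (f := fun i t => if ω i then q t i else 1 - q t i)
      (f' := fun i => (if ω i then 1 else -1) * q' i) (x := s) (fun i _ => by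
        cases ω i
        · simpa using (hd i).const_sub 1
        · simpa using hd i)
    simpa [wt, smul_eq_mul] using this
  have := HasDerivAt.fun_sum (u := Finset.univ) fun ω _ => hd' ω
  unfold ex at *
  refine this.congr_deriv ?_
  simp only [key, Finset.mul_sum, Finset.sum_mul]
  rw [Finset.sum_comm]
  refine Finset.sum_congr rfl fun i _ => Finset.sum_congr rfl fun ω _ => by ring

end
end DaC

namespace DaC

/-! ### Abstract RSW theory -/

def Inc (E : Set V → Prop) : Prop := ∀ O O', O ⊆ O' → E O → E O'
def LocIn (S : Set V) (E : Set V → Prop) : Prop := ∀ O O', O ∩ S = O' ∩ S → E O → E O'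

structure Law where
  P : (Set V → Prop) → ℝ
  mono : ∀ {E F : Set V → Prop}, (∀ O, E O → F O) → P E ≤ P F
  tt : P (fun _ => True) = 1
  nt : ∀ E, P (fun O => ¬ E O) = 1 - P E
  or : ∀ E F, P (fun O => E O ∨ F O) ≤ P E + P F
  fkg : ∀ E F, Inc E → Inc F → P E * P F ≤ P (fun O => E O ∧ F O)
  iT : ∀ x y : ℤ, 2 ∣ x → 2 ∣ y → ∀ E, P (fun O => E (tr (x, y) ⁻¹' O)) = P E
  iR1 : ∀ E, P (fun O => E (R1 ⁻¹' O)) = P E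
  iR2 : ∀ E, P (fun O => E (R2 ⁻¹' O)) = P E
  isw : ∀ E, P (fun O => E (sw ⁻¹' O)) = P E

namespace Law
variable (μ : Law)

theorem nonneg (E) : 0 ≤ μ.P E := by
  have h1 := μ.nt (fun _ => True)
  rw [μ.tt, sub_self] at h1
  rw [← h1]
  exact μ.mono fun O h => absurd trivial h
theorem le_one (E) : μ.P E ≤ 1 := by rw [← μ.tt]; exact μ.mono fun _ _ => trivial

theorem ing (E : Set V → Prop) : μ.P (fun O => E (ng ⁻¹' O)) = μ.P E := by
  have h := μ.iR2 (fun O => E (R1 ⁻¹' O))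
  rw [μ.iR1] at h
  rw [← h]
  congr 1
  funext O
  rw [← Set.preimage_comp]
  congr 2
  funext v; simp [ng, R1, R2, Function.comp]

theorem or_list (n : ℕ) (E : ℕ → Set V → Prop) : μ.P (fun O => ∃ i < n, E i O) ≤ ∑ i ∈ Finset.range n, μ.P (E i) := by
  induction n with
  | zero =>
    have h1 := μ.nt (fun _ => True)
    rw [μ.tt, sub_self] at h1
    rw [Finset.range_zero, Finset.sum_empty, ← h1]
    exact μ.mono fun O ⟨i, hi, _⟩ => absurd hi (by omega)
  | succ n ih =>
    rw [Finset.sum_range_succ]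
    refine le_trans (μ.mono ?_) ((μ.or (fun O => ∃ i < n, E i O) (E n)).trans (by linarith))
    rintro O ⟨i, hi, h⟩
    rcases Nat.lt_succ_iff_lt_or_eq.1 hi with h' | rfl
    · exact Or.inl ⟨i, h', h⟩
    · exact Or.inr h

theorem fkg' {E F G : Set V → Prop} (hE : Inc E) (hF : Inc F) (h : ∀ O, E O → F O → G O) {x y : ℝ} (hx : 0 ≤ x) (hy : 0 ≤ y)
    (h1 : x ≤ μ.P E) (h2 : y ≤ μ.P F) : x * y ≤ μ.P G :=
  (mul_le_mul h1 h2 hy (hx.trans h1)).trans ((μ.fkg E F hE hF).trans (μ.mono fun O h' => h O h'.1 h'.2))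

theorem fkg_list (n : ℕ) (E : ℕ → Set V → Prop) (hE : ∀ i, Inc (E i)) {x : ℝ} (hx : 0 ≤ x) (h : ∀ i < n, x ≤ μ.P (E i)) :
    x ^ n ≤ μ.P (fun O => ∀ i < n, E i O) := by
  induction n with
  | zero => simp [μ.tt]
  | succ n ih =>
    rw [pow_succ]
    refine μ.fkg' (E := fun O => ∀ i < n, E i O) (F := E n) (fun O O' hO h i hi => hE i O O' hO (h i hi)) (hE n) ?_
      (pow_nonneg hx n) hx (ih fun i hi => h i (by omega)) (h n (by omega))
    intro O h1 h2 i hi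
    rcases Nat.lt_succ_iff_lt_or_eq.1 hi with h' | rfl
    · exact h1 i h'
    · exact h2

end Law

theorem inc_pre {E : Set V → Prop} (h : Inc E) (f : V → V) : Inc (fun O => E (f ⁻¹' O)) :=
  fun O O' hO => h _ _ (Set.preimage_mono hO)
theorem inc_and {E F : Set V → Prop} (h : Inc E) (h' : Inc F) : Inc (fun O => E O ∧ F O) :=
  fun O O' hO k => ⟨h _ _ hO k.1, h' _ _ hO k.2⟩
theorem inc_HEv (a b i j : ℤ) : Inc (fun O => HEv O a b i j) := by
  rintro O O' hO ⟨p, e, h, r⟩; exact ⟨p, e, h.mono (Set.inter_subset_inter_left _ hO), r⟩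
theorem inc_VEv (a b : ℤ) : Inc (fun O => VEv O a b) := by
  rintro O O' hO ⟨p, e, h, r⟩; exact ⟨p, e, h.mono (Set.inter_subset_inter_left _ hO), r⟩
theorem inc_PEv (a b i j : ℤ) : Inc (fun O => PEv O a b i j) := by
  rintro O O' hO ⟨p, e, h, r⟩; exact ⟨p, e, h.mono (Set.inter_subset_inter_left _ hO), r⟩
theorem inc_XEv (a b α : ℤ) : Inc (fun O => XEv O a b α) := by
  rintro O O' hO ⟨g, u, v, u', v', h1, h2, h3, h4, r⟩
  have := Set.inter_subset_inter_left (HB a b) hO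
  exact ⟨g, u, v, u', v', h1.mono this, h2.mono this, h3.mono this, h4.mono this, r⟩
theorem inc_Strip (s : ℤ) : Inc (fun O => Strip O s) := by
  rintro O O' hO ⟨p, e, h, r⟩; exact ⟨p, e, h.mono (Set.inter_subset_inter_left _ hO), r⟩
theorem inc_CEv (s : ℤ) : Inc (fun O => CEv O s) :=
  inc_and (inc_Strip s) (inc_and (inc_pre (inc_Strip s) ng) (inc_and (inc_pre (inc_Strip s) sw)
    (inc_pre (E := fun O => Strip (sw ⁻¹' O) s) (inc_pre (inc_Strip s) sw) ng)))

theorem J_congr {O O' S : Set V} (h : O ∩ S = O' ∩ S) {B : Set V} (hB : B ⊆ S) {p e : V} (hJ : J (O ∩ B) p e) : J (O' ∩ B) p e := by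
  refine hJ.mono ?_
  rintro w ⟨h1, h2⟩
  have : w ∈ O ∩ S := ⟨h1, hB h2⟩
  rw [h] at this
  exact ⟨this.1, h2⟩

theorem loc_Strip {s : ℤ} (hs : 0 ≤ s) : LocIn {w | s ≤ nrm w ∧ nrm w ≤ 40 * s} (fun O => Strip O s) := by
  rintro O O' hO ⟨p, e, h, r⟩
  refine ⟨p, e, J_congr hO ?_ h, r⟩
  intro w hw
  simp only [Set.mem_ofPred_eq] at hw ⊢
  rw [nrm_le, le_nrm]; omega

theorem loc_pre {S : Set V} {E : Set V → Prop} (h : LocIn S E) (f : V → V) (hf : ∀ w ∈ S, f w ∈ S) : LocIn S (fun O => E (f ⁻¹' O)) := by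
  intro O O' hO
  refine h _ _ ?_
  ext w
  simp only [Set.mem_inter_iff, Set.mem_preimage]
  constructor <;> rintro ⟨h1, h2⟩ <;> refine ⟨?_, h2⟩
  · exact (hO ▸ (⟨h1, hf w h2⟩ : f w ∈ O ∩ S) : f w ∈ O' ∩ S).1
  · exact (hO ▸ (⟨h1, hf w h2⟩ : f w ∈ O' ∩ S) : f w ∈ O ∩ S).1

theorem nrm_ng (w : V) : nrm (ng w) = nrm w := by
  simp only [nrm, ng, neg_neg]; rw [max_comm, max_comm (-w.2)]; simp [max_comm]
theorem nrm_sw (w : V) : nrm (sw w) = nrm w := by simp only [nrm, sw]; rw [max_comm]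

theorem loc_CEv {s : ℤ} (hs : 0 ≤ s) : LocIn {w | s ≤ nrm w ∧ nrm w ≤ 40 * s} (fun O => CEv O s) := by
  have hng : ∀ w ∈ {w : V | s ≤ nrm w ∧ nrm w ≤ 40 * s}, ng w ∈ {w : V | s ≤ nrm w ∧ nrm w ≤ 40 * s} := by
    intro w hw; simpa only [Set.mem_ofPred_eq, nrm_ng] using hw
  have hsw : ∀ w ∈ {w : V | s ≤ nrm w ∧ nrm w ≤ 40 * s}, sw w ∈ {w : V | s ≤ nrm w ∧ nrm w ≤ 40 * s} := by
    intro w hw; simpa only [Set.mem_ofPred_eq, nrm_sw] using hw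
  rintro O O' hO ⟨h1, h2, h3, h4⟩
  exact ⟨loc_Strip hs _ _ hO h1, loc_pre (loc_Strip hs) ng hng _ _ hO h2, loc_pre (loc_Strip hs) sw hsw _ _ hO h3,
    loc_pre (loc_pre (loc_Strip hs) sw hsw) ng hng _ _ hO h4⟩

theorem loc_mono {S T : Set V} (hST : S ⊆ T) {E : Set V → Prop} (h : LocIn S E) : LocIn T E := by
  intro O O' hO
  refine h O O' ?_
  rw [← Set.inter_eq_self_of_subset_right hST, ← Set.inter_assoc, ← Set.inter_assoc, hO]
theorem loc_and {S : Set V} {E F : Set V → Prop} (h : LocIn S E) (h' : LocIn S F) : LocIn S (fun O => E O ∧ F O) :=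
  fun O O' hO k => ⟨h _ _ hO k.1, h' _ _ hO k.2⟩
theorem loc_not {S : Set V} {E : Set V → Prop} (h : LocIn S E) : LocIn S (fun O => ¬ E O) :=
  fun O O' hO k k' => k (h _ _ hO.symm k')

/-- Mixing with rate `D/m` up to scale `M`. -/
def Mix (μ : Law) (D : ℝ) (M : ℤ) : Prop := ∀ m : ℤ, 1 ≤ m → ∀ E F, LocIn {w | nrm w ≤ m} E →
  LocIn {w | 2 * m ≤ nrm w ∧ nrm w ≤ M} F → μ.P (fun O => E O ∧ F O) ≤ μ.P E * μ.P F + D / m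

/-- The data at scale `b`. -/
structure Al (μ : Law) (c0 : ℝ) (b a α : ℤ) : Prop where
  a4 : 4 ∣ a
  ba : b ≤ 2 * a
  ab : a ≤ 4 * b
  v : c0 ≤ μ.P (fun O => VEv O a b)
  α0 : 0 ≤ α
  αb : α ≤ b
  w : c0 / 8 ≤ μ.P (fun O => HEv O a b α b)
  u : ∀ α', α < α' → μ.P (fun O => HEv O a b α' b) + c0 / 2 ≤ μ.P (fun O => HEv O a b (-α') α')

theorem HEv_R2 {O : Set V} {a b α : ℤ} (h : HEv O a b (-b) (-α)) : HEv (R2 ⁻¹' O) a b α b := by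
  obtain ⟨p, e, h1, h2, h3, h4, h5⟩ := h
  refine ⟨R2 p, R2 e, h1.map R2 R2_adj ?_, by rw [ell_R2]; exact h2, by rw [ell_R2]; exact h3, ?_, ?_⟩
  · rintro w ⟨k1, k2⟩; exact ⟨by simpa [R2_R2] using k1, HB_R2 w k2⟩
  · simp only [R2]; omega
  · simp only [R2]; omega

theorem exists_Al (μ : Law) {c0 : ℝ} (hc : 0 < c0) {b a : ℤ} (hb : 0 ≤ b) (a4 : 4 ∣ a) (ba : b ≤ 2 * a) (ab : a ≤ 4 * b)
    (hH : c0 ≤ μ.P (fun O => HEv O a b (-b) b)) (hV : c0 ≤ μ.P (fun O => VEv O a b)) : ∃ α, Al μ c0 b a α := by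
  classical
  let W : ℤ → ℝ := fun α => μ.P (fun O => HEv O a b α b ∨ HEv O a b (-b) (-α))
  let U : ℤ → ℝ := fun α => μ.P (fun O => HEv O a b (-α) α)
  have hW : ∀ α, μ.P (fun O => HEv O a b α b) ≤ W α := fun α => μ.mono fun O h => Or.inl h
  have hbd : ∀ O i j, HEv O a b i j → ∀ k l, (∀ y : ℤ, -b ≤ y → y ≤ b → i ≤ y → y ≤ j → k ≤ y ∧ y ≤ l) → HEv O a b k l := by
    rintro O i j ⟨p, e, h1, h2, h3, h4, h5⟩ k l hkl
    have := h1.right.2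
    simp only [HB, Set.mem_ofPred_eq] at this
    exact ⟨p, e, h1, h2, h3, hkl _ this.2.2.1 this.2.2.2 h4 h5⟩
  have D0 : U 0 < W 0 + c0 / 2 := by
    have : U 0 ≤ W 0 := μ.mono fun O h => Or.inl (hbd O _ _ h _ _ (by intros; omega))
    linarith
  let s := (Finset.Icc (0 : ℤ) b).filter (fun α => U α < W α + c0 / 2)
  have hs : s.Nonempty := ⟨0, by simp [s, hb, D0]⟩
  obtain ⟨α, hα, hmax⟩ := s.exists_max_image id hs
  simp only [s, Finset.mem_filter, Finset.mem_Icc, id] at hα hmax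
  refine ⟨α, a4, ba, ab, hV, hα.1.1, hα.1.2, ?_, ?_⟩
  · have h1 : μ.P (fun O => HEv O a b (-b) b) ≤ U α + W α := by
      refine le_trans (μ.mono ?_) (μ.or _ _)
      rintro O ⟨p, e, h1, h2, h3, h4, h5⟩
      by_cases k1 : -α ≤ e.2
      · by_cases k2 : e.2 ≤ α
        · exact Or.inl ⟨p, e, h1, h2, h3, k1, k2⟩
        · exact Or.inr (Or.inl ⟨p, e, h1, h2, h3, by omega, h5⟩)
      · exact Or.inr (Or.inr ⟨p, e, h1, h2, h3, h4, by omega⟩)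
    have h2 : W α ≤ μ.P (fun O => HEv O a b α b) + μ.P (fun O => HEv O a b α b) := by
      refine (μ.or _ _).trans (add_le_add le_rfl ?_)
      rw [← μ.iR2 (fun O => HEv O a b α b)]
      exact μ.mono fun O => HEv_R2
    linarith [hα.2]
  · intro α' hα'
    by_cases hb' : α' ≤ b
    · by_contra hcon
      have := hmax α' ⟨⟨by omega, hb'⟩, by have := hW α'; simp only [U]; linarith⟩
      omega
    · have h0 : μ.P (fun O => HEv O a b α' b) ≤ 0 := by
        have h1 := μ.nt (fun _ => True)
        rw [μ.tt, sub_self] at h1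
        rw [← h1]
        refine μ.mono fun O h => ?_
        obtain ⟨p, e, h1, h2, h3, h4, h5⟩ := h
        omega
      have h1 : c0 ≤ μ.P (fun O => HEv O a b (-α') α') := hH.trans (μ.mono fun O h => hbd O _ _ h _ _ (by intros; omega))
      linarith

theorem Al.piece {μ : Law} {c0 : ℝ} {b a α : ℤ} (h : Al μ c0 b a α) {i j : ℤ} {c : ℝ} (hc : 0 ≤ c) (hc0 : 0 ≤ c0)
    (hu : c ≤ μ.P (fun O => HEv O a b i j)) : c * c * c0 ≤ μ.P (fun O => PEv O a b i j) := by
  refine μ.fkg' (E := fun O => HEv O a b i j ∧ HEv (R1 ⁻¹' O) a b i j) (F := fun O => VEv O a b)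
    (inc_and (inc_HEv _ _ _ _) (inc_pre (inc_HEv _ _ _ _) R1)) (inc_VEv _ _) (fun O h1 h2 => PEv_of h1.1 h1.2 h2)
    (mul_nonneg hc hc) hc0 ?_ h.v
  exact μ.fkg' (inc_HEv _ _ _ _) (inc_pre (inc_HEv a b i j) R1) (fun O h1 h2 => ⟨h1, h2⟩) hc hc hu
    (hu.trans (μ.iR1 (fun O => HEv O a b i j)).ge)

theorem Al.cross {μ : Law} {c0 : ℝ} {b a α : ℤ} (h : Al μ c0 b a α) (hc0 : 0 ≤ c0) :
    ((c0 / 8) * (c0 / 8)) * ((c0 / 8) * (c0 / 8)) * c0 ≤ μ.P (fun O => XEv O a b α) := by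
  have c8 : 0 ≤ c0 / 8 := by linarith
  have I := inc_HEv a b α b
  refine μ.fkg' (E := fun O => (HEv O a b α b ∧ HEv (R1 ⁻¹' O) a b α b) ∧ (HEv (R2 ⁻¹' O) a b α b ∧ HEv (ng ⁻¹' O) a b α b))
    (F := fun O => VEv O a b) (inc_and (inc_and I (inc_pre I R1)) (inc_and (inc_pre I R2) (inc_pre I ng)))
    (inc_VEv _ _) (fun O h1 h2 => XEv_of h1.1.1 h1.1.2 h1.2.1 h1.2.2 h2) (by positivity) hc0 ?_ h.v
  refine μ.fkg' (inc_and I (inc_pre I R1)) (inc_and (inc_pre I R2) (inc_pre I ng)) (fun O h1 h2 => ⟨h1, h2⟩) (by positivity) (by positivity) ?_ ?_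
  · exact μ.fkg' I (inc_pre I R1) (fun O h1 h2 => ⟨h1, h2⟩) c8 c8 h.w (h.w.trans (μ.iR1 (fun O => HEv O a b α b)).ge)
  · exact μ.fkg' (inc_pre I R2) (inc_pre I ng) (fun O h1 h2 => ⟨h1, h2⟩) c8 c8
      (h.w.trans (μ.iR2 (fun O => HEv O a b α b)).ge) (h.w.trans (μ.ing (fun O => HEv O a b α b)).ge)

theorem CEv_of_Long (μ : Law) {b : ℤ} {c : ℝ} (hc : 0 ≤ c) (h : c ≤ μ.P (fun O => Long O b)) : (c * c) * (c * c) ≤ μ.P (fun O => CEv O (4 * b)) := by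
  have I := inc_Strip (4 * b)
  have hs : c ≤ μ.P (fun O => Strip O (4 * b)) := by
    refine h.trans ?_
    rw [← μ.iT 0 (6 * b) (by omega) (by omega)]
    exact μ.mono fun O => strip_of_long
  have I2 := inc_pre (E := fun O => Strip (sw ⁻¹' O) (4 * b)) (inc_pre I sw) ng
  have k1 := μ.fkg' I (inc_pre I ng) (fun O h1 h2 => (⟨h1, h2⟩ : Strip O (4 * b) ∧ Strip (ng ⁻¹' O) (4 * b))) hc hc hs
    (hs.trans (μ.ing (fun O => Strip O (4 * b))).ge)
  have k2 := μ.fkg' (inc_pre I sw) I2 (fun O h1 h2 => (⟨h1, h2⟩ : Strip (sw ⁻¹' O) (4 * b) ∧ Strip (sw ⁻¹' (ng ⁻¹' O)) (4 * b))) hc hc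
    (hs.trans (μ.isw (fun O => Strip O (4 * b))).ge)
    ((hs.trans (μ.isw (fun O => Strip O (4 * b))).ge).trans (μ.ing (fun O => Strip (sw ⁻¹' O) (4 * b))).ge)
  exact μ.fkg' (inc_and I (inc_pre I ng)) (inc_and (inc_pre I sw) I2) (fun O h1 h2 => ⟨h1.1, h1.2, h2.1, h2.2⟩) (by positivity) (by positivity) k1 k2

/-- Chaining constant. -/
noncomputable def kL (x y : ℝ) : ℝ := (x ^ 49 * y ^ 48) * (x ^ 49 * y ^ 48) * ((x ^ 49 * y ^ 48) * (x ^ 49 * y ^ 48))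

theorem kL_pos {x y : ℝ} (hx : 0 < x) (hy : 0 < y) : 0 < kL x y := by unfold kL; positivity

/-- Second lemma: scales `b' ≪ b` with comparable `α`. -/
theorem good_of_X {μ : Law} {c0 : ℝ} (hc : 0 < c0) {b a α b' a' α' : ℤ} (h : Al μ c0 b a α) (h' : Al μ c0 b' a' α')
    (hb' : 1 ≤ b') (hbb : 64 * b' ≤ b) (hα : α + 1 ≤ 128 * α') (hα' : 4 ≤ α') :
    kL (c0 / 1026 * (c0 / 1026) * c0) (((c0 / 8) * (c0 / 8)) * ((c0 / 8) * (c0 / 8)) * c0) ≤ μ.P (fun O => CEv O (4 * b)) := by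
  have hU : c0 / 2 ≤ μ.P (fun O => HEv O a b (-(α + 1)) (α + 1)) := by
    have := h.u (α + 1) (by omega); have := μ.nonneg (fun O => HEv O a b (α + 1) b); linarith
  obtain ⟨r, hr1, hr2⟩ : ∃ r : ℤ, 4 * r ≤ α' ∧ α' < 4 * r + 4 := ⟨α' / 4, by omega, by omega⟩
  obtain ⟨k, hk1, hk2⟩ : ∃ k : ℕ, k < 513 ∧ c0 / 1026 ≤
      μ.P (fun O => HEv O a b (4 * r * ((k : ℤ) - 256) - α') (4 * r * ((k : ℤ) - 256) + α') ∧ -b ≤ 4 * r * ((k : ℤ) - 256) ∧ 4 * r * ((k : ℤ) - 256) ≤ b) := by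
    by_contra hcon
    push Not at hcon
    have h1 : μ.P (fun O => HEv O a b (-(α + 1)) (α + 1)) ≤ μ.P (fun O => ∃ k : ℕ, k < 513 ∧ (HEv O a b (4 * r * ((k : ℤ) - 256) - α') (4 * r * ((k : ℤ) - 256) + α') ∧
        -b ≤ 4 * r * ((k : ℤ) - 256) ∧ 4 * r * ((k : ℤ) - 256) ≤ b)) := by
      refine μ.mono ?_
      rintro O ⟨p, e, h1, h2, h3, h4, h5⟩
      have hB := h1.right.2
      simp only [HB, Set.mem_ofPred_eq] at hB
      obtain ⟨q, hq1, hq2, hq3, hq4⟩ : ∃ q : ℤ, -256 ≤ q ∧ q ≤ 256 ∧ (0 ≤ 4 * r * q ∧ 4 * r * q ≤ e.2 ∧ e.2 ≤ 4 * r * q + 4 * r ∨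
          4 * r * q ≤ 0 ∧ e.2 ≤ 4 * r * q ∧ 4 * r * q ≤ e.2 + 4 * r) ∧ True := by
        have hr : 0 < r := by omega
        rcases le_total 0 e.2 with hy | hy
        · have e1 := Int.mul_ediv_add_emod e.2 (4 * r)
          have e2 := Int.emod_nonneg e.2 (show 4 * r ≠ 0 by omega)
          have e3 := Int.emod_lt_of_pos e.2 (show 0 < 4 * r by omega)
          have e4 : 0 ≤ e.2 / (4 * r) := Int.ediv_nonneg hy (by omega)
          refine ⟨e.2 / (4 * r), by omega, ?_, Or.inl ⟨by positivity, by omega, by omega⟩, trivial⟩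
          by_contra hq
          nlinarith
        · have e1 := Int.mul_ediv_add_emod (-e.2) (4 * r)
          have e2 := Int.emod_nonneg (-e.2) (show 4 * r ≠ 0 by omega)
          have e3 := Int.emod_lt_of_pos (-e.2) (show 0 < 4 * r by omega)
          have e4 : 0 ≤ (-e.2) / (4 * r) := Int.ediv_nonneg (by omega) (by omega)
          have e5 : 4 * r * (-((-e.2) / (4 * r))) = -(4 * r * ((-e.2) / (4 * r))) := by ring
          have e6 : 0 ≤ 4 * r * ((-e.2) / (4 * r)) := by positivity
          refine ⟨-((-e.2) / (4 * r)), ?_, by omega, Or.inr ⟨by omega, by omega, by omega⟩, trivial⟩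
          by_contra hq
          nlinarith
      refine ⟨(q + 256).toNat, by omega, ?_⟩
      have : (((q + 256).toNat : ℕ) : ℤ) - 256 = q := by omega
      rw [this]
      exact ⟨⟨p, e, h1, h2, h3, by omega, by omega⟩, by omega, by omega⟩
    have h2 := h1.trans (μ.or_list 513 _)
    have h3 : ∑ i ∈ Finset.range 513, μ.P (fun O => HEv O a b (4 * r * ((i : ℤ) - 256) - α') (4 * r * ((i : ℤ) - 256) + α') ∧
        -b ≤ 4 * r * ((i : ℤ) - 256) ∧ 4 * r * ((i : ℤ) - 256) ≤ b) < ∑ i ∈ Finset.range 513, c0 / 1026 :=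
      Finset.sum_lt_sum_of_nonempty ⟨0, by simp⟩ fun i hi => hcon i (Finset.mem_range.1 hi)
    rw [Finset.sum_const, Finset.card_range, nsmul_eq_mul] at h3
    norm_num at h3
    linarith
  set y : ℤ := 4 * r * ((k : ℤ) - 256) with hy
  have hyb : -b ≤ y ∧ y ≤ b := by
    by_contra hcon
    have h1 := μ.nt (fun _ => True)
    rw [μ.tt, sub_self] at h1
    have : μ.P (fun O => HEv O a b (y - α') (y + α') ∧ -b ≤ y ∧ y ≤ b) ≤ 0 := by
      rw [← h1]; exact μ.mono fun O h => absurd h.2 hcon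
    linarith [show 0 < c0 / 1026 by positivity]
  have hk3 : c0 / 1026 ≤ μ.P (fun O => HEv O a b (y - α') (y + α')) := hk2.trans (μ.mono fun O h => h.1)
  have hPc := h.piece (by positivity) hc.le hk3
  have hXc := h'.cross hc.le
  have a4 := h.a4; have a4' := h'.a4
  have y4 : 4 ∣ y := ⟨r * ((k : ℤ) - 256), by rw [hy]; ring⟩
  obtain ⟨g, hg⟩ : ∃ g, a - a' + y = 4 * g := ⟨(a - a' + y) / 4, by omega⟩
  obtain ⟨d, hd⟩ : ∃ d, a - a' = 2 * d := ⟨(a - a') / 2, by omega⟩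
  refine CEv_of_Long μ (by positivity) ?_
  refine μ.fkg' (E := fun O => ∀ n : ℕ, n < 49 → PEv (tr (((n : ℤ) - 24) * (a - a'), 0) ⁻¹' O) a b (y - α') (y + α'))
    (F := fun O => ∀ n : ℕ, n < 48 → XEv (tr (((n : ℤ) - 24) * (a - a') + 2 * g, y) ⁻¹' O) a' b' α') ?_ ?_ ?_ (by positivity) (by positivity) ?_ ?_
  · exact fun O O' hO k n hn => inc_pre (inc_PEv _ _ _ _) _ _ _ hO (k n hn)
  · exact fun O O' hO k n hn => inc_pre (inc_XEv _ _ _) _ _ _ hO (k n hn)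
  · intro O k1 k2
    exact long_of_X hb' hbb h.ba h.ab (by have := h'.ba; omega) h'.ab hyb (by omega) (fun n hn => k1 n (by omega)) k2
  · refine μ.fkg_list 49 (fun n O => PEv (tr (((n : ℤ) - 24) * (a - a'), 0) ⁻¹' O) a b (y - α') (y + α')) (fun n => inc_pre (inc_PEv _ _ _ _) _) (by positivity) fun n _ => ?_
    exact hPc.trans (μ.iT _ 0 (Dvd.dvd.mul_left ⟨d, hd⟩ _) (by omega) (fun O => PEv O a b (y - α') (y + α'))).ge
  · refine μ.fkg_list 48 (fun n O => XEv (tr (((n : ℤ) - 24) * (a - a') + 2 * g, y) ⁻¹' O) a' b' α') (fun n => inc_pre (inc_XEv _ _ _) _) (by positivity) fun n _ => ?_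
    exact hXc.trans (μ.iT _ y (dvd_add (Dvd.dvd.mul_left ⟨d, hd⟩ _) ⟨g, rfl⟩) (by omega) (fun O => XEv O a' b' α')).ge

/-- Third lemma: circuits at a smaller scale give circuits at scale `t` when `α_t` is small. -/
theorem good_of_C {μ : Law} {c0 c : ℝ} (hc0 : 0 < c0) (hc : 0 < c) {t a α b : ℤ} (h : Al μ c0 t a α) (hb : 1 ≤ b) (hbt : 100 * b ≤ t)
    (hα : α + 1 ≤ 4 * b) (hC : c ≤ μ.P (fun O => CEv O (4 * b))) :
    kL (c0 / 2 * (c0 / 2) * c0) c ≤ μ.P (fun O => CEv O (4 * t)) := by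
  have hU : c0 / 2 ≤ μ.P (fun O => HEv O a t (-(α + 1)) (α + 1)) := by
    have := h.u (α + 1) (by omega); have := μ.nonneg (fun O => HEv O a t (α + 1) t); linarith
  have hPc := h.piece (by positivity) hc0.le hU
  have a4 := h.a4
  obtain ⟨g, hg⟩ : ∃ g, a = 4 * g := ⟨a / 4, by omega⟩
  refine CEv_of_Long μ (by positivity) ?_
  refine μ.fkg' (E := fun O => ∀ n : ℕ, n < 49 → PEv (tr (((n : ℤ) - 24) * a, 0) ⁻¹' O) a t (-(α + 1)) (α + 1))
    (F := fun O => ∀ n : ℕ, n < 48 → CEv (tr (((n : ℤ) - 24) * a + 2 * g, 0) ⁻¹' O) (4 * b)) ?_ ?_ ?_ (by positivity) (by positivity) ?_ ?_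
  · exact fun O O' hO k n hn => inc_pre (inc_PEv _ _ _ _) _ _ _ hO (k n hn)
  · exact fun O O' hO k n hn => inc_pre (inc_CEv _) _ _ _ hO (k n hn)
  · intro O k1 k2
    exact long_of_C (by omega) (by omega) h.ba h.ab hα (by omega) (fun n hn => k1 n (by omega)) k2
  · refine μ.fkg_list 49 (fun n O => PEv (tr (((n : ℤ) - 24) * a, 0) ⁻¹' O) a t (-(α + 1)) (α + 1)) (fun n => inc_pre (inc_PEv _ _ _ _) _) (by positivity) fun n _ => ?_
    exact hPc.trans (μ.iT _ 0 (Dvd.dvd.mul_left (by omega) _) (by omega) (fun O => PEv O a t (-(α + 1)) (α + 1))).ge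
  · refine μ.fkg_list 48 (fun n O => CEv (tr (((n : ℤ) - 24) * a + 2 * g, 0) ⁻¹' O) (4 * b)) (fun n => inc_pre (inc_CEv _) _) hc.le fun n _ => ?_
    exact hC.trans (μ.iT _ 0 (dvd_add (Dvd.dvd.mul_left (by omega) _) ⟨g, rfl⟩) (by omega) (fun O => CEv O (4 * b))).ge

end DaC

namespace DaC

def RHyp (μ : Law) (c0 : ℝ) (b1 L : ℤ) : Prop := ∀ b, b1 ≤ b → 1 ≤ b → b ≤ L → ∃ a, 4 ∣ a ∧ b ≤ 2 * a ∧ a ≤ 4 * b ∧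
  c0 ≤ μ.P (fun O => HEv O a b (-b) b) ∧ c0 ≤ μ.P (fun O => VEv O a b)

theorem RHyp.al {μ : Law} {c0 : ℝ} (hc : 0 < c0) {b1 L : ℤ} (h : RHyp μ c0 b1 L) {b : ℤ} (h1 : b1 ≤ b) (h2 : 1 ≤ b) (h3 : b ≤ L) :
    ∃ a α, Al μ c0 b a α := by
  obtain ⟨a, k1, k2, k3, k4, k5⟩ := h b h1 h2 h3
  obtain ⟨α, hα⟩ := exists_Al μ hc (by omega) k1 k2 k3 k4 k5
  exact ⟨a, α, hα⟩

theorem no_circ {μ : Law} {D : ℝ} (hD : 0 ≤ D) {M : ℤ} (hM : Mix μ D M) {c : ℝ} (h8 : 0 ≤ c) (hc1 : c ≤ 1) {τ : ℤ} (hτ : 1 ≤ τ)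
    (n : ℕ) (hn : 160 * 100 ^ n * τ ≤ M) (h : ∀ j < n, c ≤ μ.P (fun O => CEv O (4 * (100 ^ j * τ)))) :
    μ.P (fun O => ∀ j < n, ¬ CEv O (4 * (100 ^ j * τ))) ≤ (1 - c) ^ n + n * (D / τ) := by
  induction n with
  | zero => simp [μ.tt]
  | succ n ih =>
    have hp : (1 : ℤ) ≤ 100 ^ n := one_le_pow₀ (by norm_num)
    have hpp : (1 : ℤ) ≤ 100 ^ n * τ := by nlinarith
    rw [pow_succ] at hn
    have ih' := ih (by nlinarith) (fun j hj => h j (by omega))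
    have hτ' : (1 : ℝ) ≤ τ := by exact_mod_cast hτ
    have key := hM (2 * (100 ^ n * τ)) (by omega) (fun O => ∀ j < n, ¬ CEv O (4 * (100 ^ j * τ))) (fun O => ¬ CEv O (4 * (100 ^ n * τ))) ?_ ?_
    · rw [μ.nt] at key
      have h1 : μ.P (fun O => ∀ j < n + 1, ¬ CEv O (4 * (100 ^ j * τ))) ≤
          μ.P (fun O => (∀ j < n, ¬ CEv O (4 * (100 ^ j * τ))) ∧ ¬ CEv O (4 * (100 ^ n * τ))) :=
        μ.mono fun O k => ⟨fun j hj => k j (by omega), k n (by omega)⟩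
      have h2 : D / ((2 * (100 ^ n * τ) : ℤ) : ℝ) ≤ D / τ := by
        apply div_le_div_of_nonneg_left hD (by linarith)
        push_cast
        have : (1 : ℝ) ≤ 100 ^ n := one_le_pow₀ (by norm_num)
        nlinarith
      have h3 := h n (by omega)
      have h4 : 1 - μ.P (fun O => CEv O (4 * (100 ^ n * τ))) ≤ 1 - c := by linarith
      have h5 := μ.nonneg (fun O => ∀ j < n, ¬ CEv O (4 * (100 ^ j * τ)))
      have h6 : 0 ≤ 1 - c := by linarith
      have h7 : 0 ≤ (n : ℝ) * (D / τ) := by positivity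
      push_cast
      calc _ ≤ _ := h1
        _ ≤ _ := key
        _ ≤ μ.P (fun O => ∀ j < n, ¬ CEv O (4 * (100 ^ j * τ))) * (1 - c) + D / τ := by gcongr
        _ ≤ ((1 - c) ^ n + n * (D / τ)) * (1 - c) + D / τ := by gcongr
        _ ≤ _ := by rw [pow_succ]; nlinarith
    · intro O O' hO k j hj
      have e1 : (100 : ℤ) ^ j * 100 ≤ 100 ^ n := by rw [← pow_succ]; exact pow_le_pow_right₀ (by norm_num) hj
      have e2 : (0 : ℤ) ≤ 100 ^ j * τ := by positivity
      refine loc_not (loc_mono ?_ (loc_CEv (s := 4 * (100 ^ j * τ)) (by omega))) O O' hO (k j hj)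
      intro w hw
      simp only [Set.mem_ofPred_eq] at hw ⊢
      have : 100 ^ j * τ * 100 ≤ 100 ^ n * τ := by nlinarith
      omega
    · refine loc_not (loc_mono ?_ (loc_CEv (s := 4 * (100 ^ n * τ)) (by omega)))
      intro w hw
      simp only [Set.mem_ofPred_eq] at hw ⊢
      exact ⟨by omega, by nlinarith⟩

theorem exists_big {μ : Law} {c0 c D : ℝ} (hc0 : 0 < c0) (hc : 0 < c) (hD : 0 ≤ D) {b1 L M : ℤ} (hLM : 160 * L ≤ M)
    (hM : Mix μ D M) (hR : RHyp μ c0 b1 L) {b τ : ℤ} (hb : 1 ≤ b) (hbτ : 100 * b ≤ τ) (hτ : b1 ≤ τ) (hC : c ≤ μ.P (fun O => CEv O (4 * b)))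
    (n : ℕ) (hn1 : (1 - kL (c0 / 2 * (c0 / 2) * c0) c) ^ n ≤ c0 / 8) (hn2 : n * (D / τ) ≤ c0 / 8) (hL : 800 * 100 ^ n * τ ≤ L) :
    ∃ t a α, τ ≤ t ∧ t ≤ 800 * 100 ^ n * τ ∧ Al μ c0 t a α ∧ 4 * b ≤ α := by
  have hp : (1 : ℤ) ≤ 100 ^ n := one_le_pow₀ (by norm_num)
  by_contra hcon
  push Not at hcon
  have hj : ∀ j < n, kL (c0 / 2 * (c0 / 2) * c0) c ≤ μ.P (fun O => CEv O (4 * (100 ^ j * τ))) := by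
    intro j hj
    have e1 : (100 : ℤ) ^ j ≤ 100 ^ n := pow_le_pow_right₀ (by norm_num) hj.le
    have e2 : (1 : ℤ) ≤ 100 ^ j := one_le_pow₀ (by norm_num)
    have e3 : τ ≤ 100 ^ j * τ := by nlinarith
    have e4 : 100 ^ j * τ ≤ 800 * 100 ^ n * τ := by nlinarith
    obtain ⟨a, α, hA⟩ := hR.al hc0 (b := 100 ^ j * τ) (by omega) (by omega) (by omega)
    have := hcon _ a α e3 e4 hA
    exact good_of_C hc0 hc hA hb (by omega) (by omega) hC
  have hk1 : kL (c0 / 2 * (c0 / 2) * c0) c ≤ 1 := by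
    rcases Nat.eq_zero_or_pos n with h0 | h0
    · subst h0
      have e4 : τ ≤ 800 * 100 ^ 0 * τ := by omega
      obtain ⟨a, α, hA⟩ := hR.al hc0 (b := τ) (by omega) (by omega) (by omega)
      have := hcon _ a α le_rfl e4 hA
      exact (good_of_C hc0 hc hA hb (by omega) (by omega) hC).trans (μ.le_one _)
    · exact (hj 0 h0).trans (μ.le_one _)
  have hnc := no_circ hD hM (kL_pos (by positivity) hc).le hk1 (by omega) n (by nlinarith) hj
  have e4 : τ ≤ 800 * 100 ^ n * τ := by nlinarith
  obtain ⟨a, α, hA⟩ := hR.al hc0 (b := 800 * 100 ^ n * τ) (by omega) (by omega) (by omega)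
  have hα := hcon _ a α e4 le_rfl hA
  have hu := hA.u (4 * b) hα
  obtain ⟨g, hg⟩ := hA.a4
  have h1 : μ.P (fun O => HEv O a (800 * 100 ^ n * τ) (-(4 * b)) (4 * b)) ≤ μ.P (fun O => HEv O a (800 * 100 ^ n * τ) (4 * b) (800 * 100 ^ n * τ)) +
      μ.P (fun O => ∀ j < n, ¬ CEv (tr (2 * g, 0) ⁻¹' O) (4 * (100 ^ j * τ))) := by
    refine le_trans (μ.mono ?_) (μ.or _ _)
    intro O hU
    by_cases hh : ∀ j < n, ¬ CEv (tr (2 * g, 0) ⁻¹' O) (4 * (100 ^ j * τ))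
    · exact Or.inr hh
    · push Not at hh
      obtain ⟨j, hj, hh⟩ := hh
      have e1 : (100 : ℤ) ^ j ≤ 100 ^ n := pow_le_pow_right₀ (by norm_num) hj.le
      have e2 : (1 : ℤ) ≤ 100 ^ j := one_le_pow₀ (by norm_num)
      exact Or.inl (hU.circuit hh (by omega) (by nlinarith) (by omega) (by nlinarith) hA.ba)
  rw [μ.iT (2 * g) 0 (by omega) (by omega) (fun O => ∀ j < n, ¬ CEv O (4 * (100 ^ j * τ)))] at h1
  linarith

noncomputable def kX (c0 : ℝ) : ℝ := kL (c0 / 1026 * (c0 / 1026) * c0) (((c0 / 8) * (c0 / 8)) * ((c0 / 8) * (c0 / 8)) * c0)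

theorem grow {μ : Law} {c0 : ℝ} (hc0 : 0 < c0) {b1 L : ℤ} (hR : RHyp μ c0 b1 L) {b t : ℤ} (hb : 1 ≤ b) (h1t : 1 ≤ t) (ht : b1 ≤ t)
    (n : ℕ) (hn : t < 2 ^ n * b) (hL : 64 ^ n * t ≤ L) {a α : ℤ} (hA : Al μ c0 t a α) (hα : 4 * b ≤ α) :
    ∃ s, t ≤ s ∧ s ≤ 64 ^ n * t ∧ kX c0 ≤ μ.P (fun O => CEv O (4 * s)) := by
  by_contra hcon
  push Not at hcon
  have key : ∀ j ≤ n, ∃ a' α', Al μ c0 (64 ^ j * t) a' α' ∧ 128 ^ j * (4 * b) ≤ α' := by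
    intro j
    induction j with
    | zero => intro _; exact ⟨a, α, by simpa using hA, by simpa using hα⟩
    | succ j ih =>
      intro hj
      obtain ⟨a', α', h1, h2⟩ := ih (by omega)
      have e1 : (64 : ℤ) ^ (j + 1) ≤ 64 ^ n := pow_le_pow_right₀ (by norm_num) hj
      have e2 : (1 : ℤ) ≤ 64 ^ j := one_le_pow₀ (by norm_num)
      have e2' : (1 : ℤ) ≤ 128 ^ j := one_le_pow₀ (by norm_num)
      rw [pow_succ] at e1
      have e3 : t ≤ 64 ^ j * t := by nlinarith
      have e4 : 64 ^ j * 64 * t ≤ 64 ^ n * t := by nlinarith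
      have e6 : 4 * b ≤ 128 ^ j * (4 * b) := by nlinarith
      obtain ⟨a'', α'', h3⟩ := hR.al hc0 (b := 64 ^ j * 64 * t) (by nlinarith) (by nlinarith) (by omega)
      refine ⟨a'', α'', by rw [pow_succ]; exact h3, ?_⟩
      by_contra hlt
      rw [pow_succ] at hlt
      have e5 := good_of_X hc0 h3 h1 (by omega) (by linarith) (by nlinarith) (by omega)
      have := hcon (64 ^ j * 64 * t) (by nlinarith) e4
      unfold kX at this
      linarith
  obtain ⟨a', α', h1, h2⟩ := key n le_rfl
  have h3 := h1.αb
  have e : (128 : ℤ) ^ n = 64 ^ n * 2 ^ n := by rw [← mul_pow]; norm_num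
  have e2 : (1 : ℤ) ≤ 64 ^ n := one_le_pow₀ (by norm_num)
  have e3 : (1 : ℤ) ≤ 2 ^ n := one_le_pow₀ (by norm_num)
  rw [e] at h2
  have : 64 ^ n * (2 ^ n * (4 * b)) ≤ 64 ^ n * t := by nlinarith
  have := le_of_mul_le_mul_left this (by omega)
  nlinarith

theorem kX_pos {c0 : ℝ} (h : 0 < c0) : 0 < kX c0 := kL_pos (by positivity) (by positivity)

/-- `T0` depends only on `c0 c D`; the constant `C` also on `κ`. -/
theorem next (c0 c D : ℝ) (hc0 : 0 < c0) (hc : 0 < c) (hD : 0 ≤ D) : ∃ T0 : ℤ, ∀ κ : ℤ, 1 ≤ κ → ∃ C : ℤ, 1 ≤ C ∧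
    ∀ (μ : Law) (b1 L M b τ : ℤ), 160 * L ≤ M → Mix μ D M → RHyp μ c0 b1 L → 1 ≤ b → 100 * b ≤ τ → b1 ≤ τ → T0 ≤ τ → τ ≤ κ * b →
      C * τ ≤ L → c ≤ μ.P (fun O => CEv O (4 * b)) → ∃ s, τ ≤ s ∧ s ≤ C * τ ∧ kX c0 ≤ μ.P (fun O => CEv O (4 * s)) := by
  obtain ⟨n, hn⟩ : ∃ n : ℕ, ∀ x : ℝ, kL (c0 / 2 * (c0 / 2) * c0) c ≤ x → x ≤ 1 → (1 - kL (c0 / 2 * (c0 / 2) * c0) c) ^ n ≤ c0 / 8 := by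
    by_cases h : kL (c0 / 2 * (c0 / 2) * c0) c ≤ 1
    · have hk := kL_pos (show 0 < c0 / 2 * (c0 / 2) * c0 by positivity) hc
      obtain ⟨n, hn⟩ := exists_pow_lt_of_lt_one (show 0 < c0 / 8 by positivity) (show 1 - kL (c0 / 2 * (c0 / 2) * c0) c < 1 by linarith)
      exact ⟨n, fun _ _ _ => hn.le⟩
    · exact ⟨0, fun x h1 h2 => absurd (h1.trans h2) h⟩
  obtain ⟨T, hT⟩ := exists_nat_gt (n * D / (c0 / 8))
  refine ⟨T + 1, fun κ hκ => ?_⟩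
  obtain ⟨k, hk⟩ : ∃ k : ℕ, 800 * 100 ^ n * κ < (2 : ℤ) ^ k := pow_unbounded_of_one_lt _ (by norm_num)
  have e2 : (1 : ℤ) ≤ 100 ^ n := one_le_pow₀ (by norm_num)
  have e3 : (1 : ℤ) ≤ 64 ^ k := one_le_pow₀ (by norm_num)
  refine ⟨64 ^ k * (800 * 100 ^ n), by nlinarith, ?_⟩
  intro μ b1 L M b τ hLM hM hR hb hbτ h1 hTτ hτκ hL hC
  have hLe : 800 * 100 ^ n * τ ≤ L := by
    have hτ0 : 0 ≤ τ := by omega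
    have : 0 ≤ 800 * 100 ^ n * τ := by positivity
    nlinarith
  by_cases hk1 : kL (c0 / 2 * (c0 / 2) * c0) c ≤ 1
  · have hn1 := hn 1 hk1 le_rfl
    have hn2 : n * (D / τ) ≤ c0 / 8 := by
      have : ((T : ℤ) + 1 : ℝ) ≤ τ := by exact_mod_cast hTτ
      have hτp : (0 : ℝ) < τ := by push_cast at this; linarith [Nat.cast_nonneg (α := ℝ) T]
      rw [← mul_div_assoc, div_le_iff₀ hτp]
      rw [div_lt_iff₀ (by positivity)] at hT
      push_cast at this
      nlinarith
    obtain ⟨t, a, α, k1, k2, k3, k4⟩ := exists_big hc0 hc hD hLM hM hR hb hbτ h1 hC n hn1 hn2 hLe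
    have hlt : t < 2 ^ k * b := by
      have : 800 * 100 ^ n * τ ≤ 800 * 100 ^ n * κ * b := by
        have : 0 ≤ (800 * 100 ^ n : ℤ) := by positivity
        nlinarith
      nlinarith
    have h64 : 64 ^ k * t ≤ 64 ^ k * (800 * 100 ^ n) * τ := by nlinarith
    obtain ⟨s, m1, m2, m3⟩ := grow hc0 hR hb (by omega) (by omega) k hlt (by omega) k3 k4
    exact ⟨s, by omega, by omega, m3⟩
  · exfalso
    by_cases hα : ∃ a α, Al μ c0 τ a α ∧ α + 1 ≤ 4 * b
    · obtain ⟨a, α, hA, hα⟩ := hα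
      exact hk1 ((good_of_C hc0 hc hA hb hbτ hα hC).trans (μ.le_one _))
    · -- if `c, c0 ≤ 1` then the constant is at most one
      have hc1 : c ≤ 1 := hC.trans (μ.le_one _)
      obtain ⟨a, α, hA⟩ := hR.al hc0 (b := τ) (by omega) (by omega) (by nlinarith)
      have hc01 : c0 ≤ 1 := hA.v.trans (μ.le_one _)
      apply hk1
      have hx : c0 / 2 * (c0 / 2) * c0 ≤ 1 := by
        have : c0 / 2 * (c0 / 2) ≤ 1 := mul_le_one₀ (by linarith) (by positivity) (by linarith)
        exact mul_le_one₀ this (by positivity) hc01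
      have hy : (c0 / 2 * (c0 / 2) * c0) ^ 49 * c ^ 48 ≤ 1 := mul_le_one₀ (pow_le_one₀ (by positivity) hx) (by positivity) (pow_le_one₀ hc.le hc1)
      have hz := mul_le_one₀ hy (by positivity) hy
      exact mul_le_one₀ hz (by positivity) hz

/-- The one-arm event (in the complement of `O`). -/
def Arm (r : ℤ) (O : Set V) : Prop := ∃ p e, nrm p ≤ 1 ∧ J Oᶜ p e ∧ r ≤ nrm e

theorem Arm.mono {r r' : ℤ} (h : r' ≤ r) {O : Set V} : Arm r O → Arm r' O := by
  rintro ⟨p, e, h1, h2, h3⟩; exact ⟨p, e, h1, h2, by omega⟩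

theorem Arm.not_C {b : ℤ} (hb : 1 ≤ b) {O : Set V} (h : Arm (8 * b) O) : ¬ CEv O (4 * b) := by
  intro hC
  obtain ⟨p, e, h1, h2, h3⟩ := h
  obtain ⟨g, hg⟩ := hC.ring (by omega)
  obtain ⟨w, hw, hw'⟩ := hg _ p e h2 (by omega) (by omega)
  exact hw.right hw'.right.1

theorem loc_Arm {r : ℤ} (hr : 1 ≤ r) : LocIn {w | nrm w ≤ r} (Arm r) := by
  rintro O O' hO ⟨p, e, h1, h2, h3⟩
  obtain ⟨v, hv, hv'⟩ := h2.first nrm 1 r nrm_step (by omega) h3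
  refine ⟨p, v, h1, hv.mono ?_, hv'⟩
  rintro w ⟨k1, k2⟩ k3
  simp only [Set.mem_ofPred_eq] at k2
  have : w ∈ O' ∩ {w | nrm w ≤ r} := ⟨k3, by simp only [Set.mem_ofPred_eq]; omega⟩
  rw [← hO] at this
  exact k1 this.1

set_option maxHeartbeats 800000 in
theorem one_arm (c0 cB D : ℝ) (b1 : ℤ) (hc0 : 0 < c0) (hcB : 0 < cB) (hD : 0 ≤ D) : ∃ C a : ℝ, 0 < C ∧ 0 < a ∧
    ∀ (μ : Law) (L M : ℤ), 160 * L ≤ M → Mix μ D M → RHyp μ c0 b1 L → cB ≤ μ.P (fun O => CEv O 4) →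
      ∀ n : ℤ, 1 ≤ n → n ≤ L → μ.P (Arm n) ≤ C * (n : ℝ) ^ (-a) := by
  obtain ⟨TB, hTB⟩ := next c0 cB D hc0 hcB hD
  obtain ⟨TX, hTX⟩ := next c0 (kX c0) D hc0 (kX_pos hc0) hD
  obtain ⟨CX, hCX1, hCX⟩ := hTX 100 (by norm_num)
  set τ : ℤ := max (max TB TX) (max b1 100) with hτ
  have t1 : TB ≤ τ := by simp [hτ]
  have t2 : TX ≤ τ := by simp [hτ]
  have t3 : b1 ≤ τ := by simp [hτ]
  have t4 : 100 ≤ τ := by simp [hτ]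
  obtain ⟨CB, hCB1, hCB⟩ := hTB τ (by omega)
  set Q : ℤ := CX * 100 with hQ
  set A0 : ℤ := CB * τ with hA0
  have hA1 : 1 ≤ A0 := by nlinarith
  set θ : ℝ := 1 - min (kX c0) 1 / 2 with hθ
  have hk0 := kX_pos hc0
  have hm : 0 < min (kX c0) 1 := lt_min hk0 one_pos
  have hm1 : min (kX c0) 1 ≤ 1 := min_le_right _ _
  have hθ1 : θ < 1 := by linarith
  have hθ2 : 1 / 2 ≤ θ := by linarith
  set A : ℝ := 1 + 2 * D / min (kX c0) 1 with hA
  have hAp : 1 ≤ A := by have : 0 ≤ 2 * D / min (kX c0) 1 := by positivity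
                         linarith
  have main : ∀ (μ : Law) (L M : ℤ), 160 * L ≤ M → Mix μ D M → RHyp μ c0 b1 L → cB ≤ μ.P (fun O => CEv O 4) →
      ∀ k : ℕ, A0 * Q ^ k ≤ L → ∃ b : ℤ, 100 ^ k ≤ b ∧ τ ≤ b ∧ b ≤ A0 * Q ^ k ∧ kX c0 ≤ μ.P (fun O => CEv O (4 * b)) ∧
        μ.P (Arm (160 * b)) ≤ A * θ ^ k := by
    intro μ L M hLM hM hR hC k
    induction k with
    | zero =>
      intro hL
      obtain ⟨s, h1, h2, h3⟩ := hCB μ b1 L M 1 τ hLM hM hR le_rfl (by omega) t3 t1 (by omega) (by simpa [hA0] using hL) (by simpa using hC)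
      exact ⟨s, by rw [pow_zero]; omega, h1, by simpa [hA0] using h2, h3, by simpa using (μ.le_one _).trans hAp⟩
    | succ k ih =>
      intro hL
      have hQ1 : (1 : ℤ) ≤ Q ^ k := one_le_pow₀ (by omega)
      have hAQ : 0 ≤ A0 * Q ^ k := by positivity
      rw [pow_succ, ← mul_assoc] at hL
      obtain ⟨b, k1, k2, k3, k4, k5⟩ := ih (by nlinarith)
      have hle : CX * (100 * b) ≤ A0 * Q ^ k * Q := by rw [hQ]; nlinarith
      obtain ⟨s, h1, h2, h3⟩ := hCX μ b1 L M b (100 * b) hLM hM hR (by omega) le_rfl (by omega) (by omega) le_rfl (by omega) k4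
      refine ⟨s, by rw [pow_succ]; omega, by omega, by rw [pow_succ, ← mul_assoc]; omega, h3, ?_⟩
      have hs : s ≤ L := by omega
      have key := hM (160 * b) (by omega) (Arm (160 * b)) (fun O => ¬ CEv O (4 * s)) (loc_Arm (by omega))
        (loc_not (loc_mono (by intro w hw; simp only [Set.mem_ofPred_eq] at hw ⊢; omega) (loc_CEv (by omega))))
      rw [μ.nt] at key
      have hb : (1 : ℝ) ≤ b := by exact_mod_cast (show (1 : ℤ) ≤ b by omega)
      have hb' : (100 : ℝ) ^ k ≤ b := by exact_mod_cast k1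
      have e1 : μ.P (Arm (160 * s)) ≤ μ.P (fun O => Arm (160 * b) O ∧ ¬ CEv O (4 * s)) :=
        μ.mono fun O h => ⟨h.mono (by omega), Arm.not_C (by omega) (h.mono (by omega))⟩
      have e2 : D / ((160 * b : ℤ) : ℝ) ≤ D * θ ^ k := by
        push_cast
        rw [div_le_iff₀ (by positivity)]
        have : (1 : ℝ) ≤ θ ^ k * 100 ^ k := by rw [← mul_pow]; exact one_le_pow₀ (by linarith)
        have h2 : 0 ≤ θ ^ k := by positivity
        have : 1 ≤ θ ^ k * (160 * b) := by nlinarith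
        nlinarith
      have e3 : 1 - μ.P (fun O => CEv O (4 * s)) ≤ 1 - min (kX c0) 1 := by linarith [min_le_left (kX c0) 1]
      have e4 := μ.nonneg (Arm (160 * b))
      have e5 : 0 ≤ 1 - min (kX c0) 1 := by linarith
      have e6 : 0 ≤ θ ^ k := by positivity
      calc _ ≤ _ := e1
        _ ≤ _ := key
        _ ≤ μ.P (Arm (160 * b)) * (1 - min (kX c0) 1) + D * θ ^ k := by gcongr
        _ ≤ A * θ ^ k * (1 - min (kX c0) 1) + D * θ ^ k := by gcongr
        _ ≤ A * θ ^ (k + 1) := by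
          rw [pow_succ, hθ, ← hθ]
          have : D ≤ A * (min (kX c0) 1 / 2) := by
            rw [hA]
            have : 2 * D / min (kX c0) 1 * (min (kX c0) 1 / 2) = D := by field_simp
            nlinarith
          have h2 : A * (θ ^ k * θ) = A * θ ^ k * (1 - min (kX c0) 1) + (A * (min (kX c0) 1 / 2)) * θ ^ k := by
            conv_lhs => rw [mul_comm (θ ^ k) θ, ← mul_assoc]
            nth_rewrite 1 [hθ]
            ring
          nlinarith
  have hQ2 : (1 : ℝ) < Q := by exact_mod_cast (show (1 : ℤ) < Q by omega)
  have hθ0 : 0 < θ := by linarith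
  set a : ℝ := Real.log (1 / θ) / Real.log Q with ha
  have hlQ : 0 < Real.log Q := Real.log_pos hQ2
  have ha0 : 0 < a := div_pos (Real.log_pos (by rw [lt_div_iff₀ hθ0]; linarith)) hlQ
  have hQa : (Q : ℝ) ^ a = 1 / θ := by
    rw [Real.rpow_def_of_pos (by linarith), ha, mul_div_cancel₀ _ hlQ.ne', Real.exp_log (by positivity)]
  have hA0r : (1 : ℝ) ≤ A0 := by exact_mod_cast hA1
  set B : ℝ := 160 * A0 * Q with hB
  have hB1 : 1 ≤ B := by nlinarith
  refine ⟨A * B ^ a, a, by positivity, ha0, ?_⟩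
  intro μ L M hLM hM hR hC n hn hnL
  have hnr : (1 : ℝ) ≤ n := by exact_mod_cast hn
  rw [Real.rpow_neg (by linarith), ← div_eq_mul_inv, le_div_iff₀ (by positivity)]
  by_cases hsm : n < 160 * A0
  · have : (n : ℝ) ≤ B := by
      have : (n : ℝ) ≤ 160 * A0 := by exact_mod_cast hsm.le
      nlinarith
    have h1 := Real.rpow_le_rpow (by linarith) this ha0.le
    have h2 := μ.le_one (Arm n)
    have h3 : 0 ≤ (n : ℝ) ^ a := by positivity
    have h4 := μ.nonneg (Arm n)
    calc μ.P (Arm n) * (n : ℝ) ^ a ≤ 1 * (n : ℝ) ^ a := by gcongr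
      _ ≤ 1 * B ^ a := by gcongr
      _ ≤ _ := by gcongr
  · push Not at hsm
    have hex : ∃ k : ℕ, n < 160 * A0 * Q ^ (k + 1) := by
      obtain ⟨k, hk⟩ := pow_unbounded_of_one_lt n (show (1 : ℤ) < Q by omega)
      refine ⟨k, ?_⟩
      rw [pow_succ]
      have h1 : (1 : ℤ) ≤ Q ^ k := one_le_pow₀ (by omega)
      have h2 : Q ^ k ≤ Q ^ k * Q := by nlinarith
      nlinarith
    classical
    let k := Nat.find hex
    have hk : n < 160 * A0 * Q ^ (k + 1) := Nat.find_spec hex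
    have hk' : 160 * A0 * Q ^ k ≤ n := by
      rcases Nat.eq_zero_or_pos k with h0 | h0
      · rw [h0]; simpa using hsm
      · have := Nat.find_min hex (show k - 1 < k by omega)
        rw [show k - 1 + 1 = k by omega] at this
        omega
    have hpos : 0 ≤ A0 * Q ^ k := by positivity
    obtain ⟨b, k1, k2, k3, k4, k5⟩ := main μ L M hLM hM hR hC k (by linarith)
    have h1 : μ.P (Arm n) ≤ A * θ ^ k := (μ.mono fun O h => h.mono (by linarith)).trans k5
    have h2 : (n : ℝ) ≤ B * Q ^ k := by
      have : (n : ℝ) ≤ 160 * A0 * Q ^ (k + 1) := by exact_mod_cast hk.le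
      rw [pow_succ] at this
      rw [hB]; exact this.trans (le_of_eq (by ring))
    have h3 : (n : ℝ) ^ a ≤ B ^ a * (1 / θ) ^ k := by
      refine (Real.rpow_le_rpow (by linarith) h2 ha0.le).trans ?_
      rw [Real.mul_rpow (by linarith) (by positivity), ← hQa, ← Real.rpow_natCast, ← Real.rpow_natCast, ← Real.rpow_mul (by linarith), ← Real.rpow_mul (by linarith), mul_comm a]
    have h4 := μ.nonneg (Arm n)
    have h5 : 0 ≤ (n : ℝ) ^ a := by positivity
    calc μ.P (Arm n) * (n : ℝ) ^ a ≤ (A * θ ^ k) * (B ^ a * (1 / θ) ^ k) := by gcongr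
      _ = A * B ^ a * (θ * (1 / θ)) ^ k := by rw [mul_pow]; ring
      _ = A * B ^ a := by rw [mul_one_div_cancel hθ0.ne']; simp

end DaC

namespace DaC

/-! ### Divide and colour on a general graph -/
section
variable {α β : Type} (en : β → α × α) (idx : α → ℕ)

def inc (e : β) (a b : α) : Prop := en e = (a, b) ∨ en e = (b, a)
def stp (ω : β ⊕ α → Bool) (a b : α) : Prop := ∃ e, ω (.inl e) = true ∧ inc en e a b
def cl (ω : β ⊕ α → Bool) (v : α) : Set α := {w | Relation.ReflTransGen (stp en ω) v w}

variable {en idx}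

theorem inc_symm {e : β} {a b : α} (h : inc en e a b) : inc en e b a := Or.symm h
theorem stp_symm {ω : β ⊕ α → Bool} {a b : α} (h : stp en ω a b) : stp en ω b a := by
  obtain ⟨e, h1, h2⟩ := h; exact ⟨e, h1, inc_symm h2⟩
theorem cl_self (ω : β ⊕ α → Bool) (v : α) : v ∈ cl en ω v := Relation.ReflTransGen.refl
theorem cl_step {ω : β ⊕ α → Bool} {v a b : α} (h : a ∈ cl en ω v) (h' : stp en ω a b) : b ∈ cl en ω v := Relation.ReflTransGen.tail h h'
theorem cl_symm {ω : β ⊕ α → Bool} {v w : α} (h : w ∈ cl en ω v) : v ∈ cl en ω w := by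
  induction h with
  | refl => exact cl_self _ _
  | tail _ h1 ih => exact Relation.ReflTransGen.head (stp_symm h1) ih
theorem cl_trans {ω : β ⊕ α → Bool} {u v w : α} (h : v ∈ cl en ω u) (h' : w ∈ cl en ω v) : w ∈ cl en ω u := Relation.ReflTransGen.trans h h'
theorem cl_eq {ω : β ⊕ α → Bool} {v w : α} (h : w ∈ cl en ω v) : cl en ω w = cl en ω v := by
  ext u; exact ⟨cl_trans h, cl_trans (cl_symm h)⟩
/-- A set containing `v` closed under steps contains the cluster. -/
theorem cl_sub {ω : β ⊕ α → Bool} {v : α} {A : Set α} (hv : v ∈ A) (h : ∀ a b, a ∈ A → stp en ω a b → b ∈ A) : cl en ω v ⊆ A := by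
  intro w hw
  induction hw with
  | refl => exact hv
  | tail _ h1 ih => exact h _ _ ih h1
theorem cl_congr {ω ω' : β ⊕ α → Bool} (h : ∀ e, ω (.inl e) = ω' (.inl e)) (v : α) : cl en ω v = cl en ω' v := by
  unfold cl stp; simp only [h]

/-- Transport of clusters along a local covering map. -/
theorem cl_map {α' β' : Type} {en' : β' → α' × α'} {ω : β ⊕ α → Bool} {ω' : β' ⊕ α' → Bool} (φ : α → α') (v : α)
    (h1 : ∀ a ∈ cl en ω v, ∀ b, stp en ω a b → stp en' ω' (φ a) (φ b))
    (h2 : ∀ a ∈ cl en ω v, ∀ b', stp en' ω' (φ a) b' → ∃ b, stp en ω a b ∧ φ b = b') : cl en' ω' (φ v) = φ '' cl en ω v := by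
  apply Set.Subset.antisymm
  · refine cl_sub ⟨v, cl_self _ _, rfl⟩ ?_
    rintro _ b' ⟨a, ha, rfl⟩ hs
    obtain ⟨b, hb, rfl⟩ := h2 a ha b' hs
    exact ⟨b, cl_step ha hb, rfl⟩
  · rintro _ ⟨w, hw, rfl⟩
    have : w ∈ cl en ω v ∧ φ w ∈ cl en' ω' (φ v) := by
      induction hw with
      | refl => exact ⟨cl_self _ _, cl_self _ _⟩
      | tail hx h ih =>
        exact ⟨cl_step hx h, cl_step ih.2 (h1 _ hx _ h)⟩
    exact this.2

variable (en idx)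
noncomputable def rep (ω : β ⊕ α → Bool) (v : α) : α := Function.argminOn idx (cl en ω v) ⟨v, cl_self ω v⟩
def colS (ω : β ⊕ α → Bool) : Set α := {v | ω (.inr (rep en idx ω v)) = true}
variable {en idx}

theorem rep_mem (ω : β ⊕ α → Bool) (v : α) : rep en idx ω v ∈ cl en ω v := Function.argminOn_mem _ _ _
theorem rep_le {ω : β ⊕ α → Bool} {v w : α} (h : w ∈ cl en ω v) : idx (rep en idx ω v) ≤ idx w := Function.argminOn_le _ _ h
theorem rep_eq (hi : Function.Injective idx) {ω : β ⊕ α → Bool} {v r : α} (h : r ∈ cl en ω v) (h' : ∀ w ∈ cl en ω v, idx r ≤ idx w) :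
    rep en idx ω v = r := hi (le_antisymm (rep_le h) (h' _ (rep_mem ω v)))
theorem rep_cl (hi : Function.Injective idx) {ω : β ⊕ α → Bool} {v w : α} (h : w ∈ cl en ω v) : rep en idx ω w = rep en idx ω v :=
  rep_eq hi (by rw [cl_eq h]; exact rep_mem _ _) (by rw [cl_eq h]; exact fun u hu => rep_le hu)
theorem rep_congr (hi : Function.Injective idx) {ω ω' : β ⊕ α → Bool} {v : α} (h : cl en ω v = cl en ω' v) : rep en idx ω v = rep en idx ω' v :=
  rep_eq hi (h ▸ rep_mem _ _) (fun w hw => rep_le (h ▸ hw))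
theorem col_cl (hi : Function.Injective idx) {ω : β ⊕ α → Bool} {v w : α} (h : w ∈ cl en ω v) : w ∈ colS en idx ω ↔ v ∈ colS en idx ω := by
  simp only [colS, Set.mem_ofPred_eq, rep_cl hi h]

variable [Fintype α] [Fintype β]

theorem st_inl (r : α) (c : Bool) (ω : β ⊕ α → Bool) (e : β) : st (Sum.inr r) c ω (.inl e) = ω (.inl e) := st_ne (by simp) _ _
theorem st_inr (e : β) (c : Bool) (ω : β ⊕ α → Bool) (r : α) : st (Sum.inl e) c ω (.inr r) = ω (.inr r) := st_ne (by simp) _ _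

theorem col_label (hi : Function.Injective idx) (r : α) (c : Bool) (ω : β ⊕ α → Bool) (v : α) :
    v ∈ colS en idx (st (.inr r) c ω) ↔ (rep en idx ω v = r ∧ c = true ∨ rep en idx ω v ≠ r ∧ v ∈ colS en idx ω) := by
  have h : rep en idx (st (.inr r) c ω) v = rep en idx ω v := rep_congr hi (cl_congr (fun e => st_inl r c ω e) v)
  simp only [colS, Set.mem_ofPred_eq, h]
  by_cases hr : rep en idx ω v = r
  · simp [hr, st_same]
  · rw [st_ne (by simpa using hr)]; simp [hr]

theorem stp_mono {ω ω' : β ⊕ α → Bool} (h : ∀ e, ω (.inl e) = true → ω' (.inl e) = true) {a b : α} (hs : stp en ω a b) : stp en ω' a b := by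
  obtain ⟨e, h1, h2⟩ := hs; exact ⟨e, h e h1, h2⟩
theorem cl_mono {ω ω' : β ⊕ α → Bool} (h : ∀ e, ω (.inl e) = true → ω' (.inl e) = true) (v : α) : cl en ω v ⊆ cl en ω' v :=
  cl_sub (cl_self _ _) fun a b ha hs => cl_step ha (stp_mono h hs)

theorem st_open {e : β} {ω : β ⊕ α → Bool} (e' : β) (h : st (.inl e) false ω (.inl e') = true) : st (.inl e) true ω (.inl e') = true := by
  by_cases he : e' = e
  · subst he; rw [st_same]
  · rw [st_ne (by simpa using he)] at h ⊢; exact h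

theorem stp_open {e : β} {a b : α} (hab : inc en e a b) {ω : β ⊕ α → Bool} {u w : α} (h : stp en (st (.inl e) true ω) u w) :
    stp en (st (.inl e) false ω) u w ∨ (u = a ∧ w = b) ∨ (u = b ∧ w = a) := by
  obtain ⟨e', h1, h2⟩ := h
  by_cases he : e' = e
  · subst he
    right
    unfold inc at h2 hab
    rcases h2 with h2 | h2 <;> rcases hab with hab | hab <;> rw [hab] at h2 <;> simp only [Prod.mk.injEq] at h2 <;> tauto
  · left
    refine ⟨e', ?_, h2⟩
    rw [st_ne (by simpa using he)] at h1 ⊢; exact h1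

theorem cl_open {e : β} {a b : α} (hab : inc en e a b) (ω : β ⊕ α → Bool) :
    cl en (st (.inl e) true ω) a = cl en (st (.inl e) false ω) a ∪ cl en (st (.inl e) false ω) b := by
  have hs : stp en (st (.inl e) true ω) a b := ⟨e, st_same _ _ _, hab⟩
  apply Set.Subset.antisymm
  · refine cl_sub (Or.inl (cl_self _ _)) ?_
    intro u w hu hw
    rcases stp_open hab hw with h | ⟨rfl, rfl⟩ | ⟨rfl, rfl⟩
    · exact hu.imp (fun k => cl_step k h) (fun k => cl_step k h)
    · exact Or.inr (cl_self _ _)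
    · exact Or.inl (cl_self _ _)
  · rintro w (hw | hw)
    · exact cl_mono st_open _ hw
    · exact cl_trans (cl_step (cl_self _ _) hs) (cl_mono st_open _ hw)

theorem cl_open' {e : β} {a b : α} (hab : inc en e a b) (ω : β ⊕ α → Bool) {v : α} (h1 : v ∉ cl en (st (.inl e) false ω) a)
    (h2 : v ∉ cl en (st (.inl e) false ω) b) : cl en (st (.inl e) true ω) v = cl en (st (.inl e) false ω) v := by
  refine Set.Subset.antisymm (cl_sub (cl_self _ _) ?_) (cl_mono st_open _)
  intro u w hu hw
  rcases stp_open hab hw with h | ⟨rfl, rfl⟩ | ⟨rfl, rfl⟩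
  · exact cl_step hu h
  · exact absurd (cl_symm hu) h1
  · exact absurd (cl_symm hu) h2

theorem col_open (hi : Function.Injective idx) {e : β} {a b : α} (hab : inc en e a b) (ω : β ⊕ α → Bool)
    (hle : idx (rep en idx (st (.inl e) false ω) a) ≤ idx (rep en idx (st (.inl e) false ω) b)) (v : α) :
    v ∈ colS en idx (st (.inl e) true ω) ↔ (v ∈ cl en (st (.inl e) false ω) b ∧ a ∈ colS en idx (st (.inl e) false ω)) ∨
      (v ∉ cl en (st (.inl e) false ω) b ∧ v ∈ colS en idx (st (.inl e) false ω)) := by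
  set y0 := st (Sum.inl e) false ω with hy0
  set y1 := st (Sum.inl e) true ω with hy1
  have hl : ∀ r, y1 (.inr r) = y0 (.inr r) := fun r => by rw [hy0, hy1, st_inr, st_inr]
  have hC := cl_open hab ω
  rw [← hy0, ← hy1] at hC
  have hr : rep en idx y1 a = rep en idx y0 a := by
    refine rep_eq hi (by rw [hC]; exact Or.inl (rep_mem _ _)) ?_
    rw [hC]
    rintro w (hw | hw)
    · exact rep_le hw
    · exact hle.trans (rep_le hw)
  have ha : a ∈ colS en idx y1 ↔ a ∈ colS en idx y0 := by
    simp only [colS, Set.mem_ofPred_eq, hr, hl]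
  by_cases h2 : v ∈ cl en y0 b
  · have : v ∈ cl en y1 a := by rw [hC]; exact Or.inr h2
    rw [col_cl hi this, ha]
    tauto
  · by_cases h1 : v ∈ cl en y0 a
    · have : v ∈ cl en y1 a := by rw [hC]; exact Or.inl h1
      rw [col_cl hi this, ha, col_cl hi h1]
      tauto
    · have : rep en idx y1 v = rep en idx y0 v := rep_congr hi (cl_open' hab ω h1 h2)
      have : v ∈ colS en idx y1 ↔ v ∈ colS en idx y0 := by simp only [colS, Set.mem_ofPred_eq, this, hl]
      tauto

end
end DaC

namespace DaC
section
variable {α β : Type} {en : β → α × α} {idx : α → ℕ} [Fintype α] [Fintype β]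

/-- Configuration with all unrevealed coordinates off. -/
noncomputable def low (S : Set (β ⊕ α)) (x : β ⊕ α → Bool) : β ⊕ α → Bool := mix S x (fun _ => false)

theorem low_le {S : Set (β ⊕ α)} {x y : β ⊕ α → Bool} (h : Agr S x y) (e : β) (he : low S x (.inl e) = true) : y (.inl e) = true := by
  unfold low at he
  by_cases hS : Sum.inl e ∈ S
  · rw [mix_in _ _ hS] at he; rw [h _ hS, he]
  · rw [mix_out _ _ hS] at he; simp at he

theorem low_cl {S : Set (β ⊕ α)} {x y : β ⊕ α → Bool} (h : Agr S x y) (v : α) : cl en (low S x) v ⊆ cl en y v :=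
  cl_mono (low_le h) v

/-- If all edges at the known cluster are revealed then the cluster is known. -/
theorem low_closed {S : Set (β ⊕ α)} {x y : β ⊕ α → Bool} (h : Agr S x y) {r : α}
    (hc : ∀ e a b, a ∈ cl en (low S x) r → inc en e a b → Sum.inl e ∈ S) : cl en y r = cl en (low S x) r := by
  refine Set.Subset.antisymm (cl_sub (cl_self _ _) ?_) (low_cl h r)
  rintro a b ha ⟨e, h1, h2⟩
  have hS := hc e a b ha h2
  refine cl_step ha ⟨e, ?_, h2⟩
  unfold low
  rw [mix_in _ _ hS, ← h _ hS, h1]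

theorem agr_st {S : Set (β ⊕ α)} {x y : β ⊕ α → Bool} (h : Agr S x y) {i : β ⊕ α} (hi : i ∉ S) (b : Bool) : Agr S x (st i b y) := by
  intro j hj
  rw [st_ne (fun e => hi (by rw [← e]; exact hj)), h j hj]

theorem dac_good (hi : Function.Injective idx) (F G : Set α → ℝ) (hF : Monotone F) (hG : Monotone G) : ∀ (n : ℕ) (S : Set (β ⊕ α)) (x : β ⊕ α → Bool),
    (cof S).card ≤ n → (∀ r, Sum.inr r ∈ S → ∀ y, Agr S x y → rep en idx y r = r) →
    Good (fun ω => F (colS en idx ω)) (fun ω => G (colS en idx ω)) S x := by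
  classical
  intro n
  induction n with
  | zero =>
    intro S x hn _
    refine Good.done fun y hy => ?_
    have : y = x := by
      funext i
      by_contra hne
      have : i ∈ cof S := mem_cof.2 fun hS => hne (hy i hS)
      have := Finset.card_pos.2 ⟨i, this⟩
      omega
    rw [this]
  | succ n ih =>
    intro S x hn hI
    have hcard : ∀ i, i ∉ S → (cof (insert i S)).card ≤ n := by
      intro i hiS
      have : (cof (insert i S)).card < (cof S).card := by
        refine Finset.card_lt_card ⟨fun j hj => ?_, fun hc => ?_⟩
        · rw [mem_cof] at hj ⊢; exact fun h => hj (Set.mem_insert_of_mem _ h)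
        · exact mem_cof.1 (hc (mem_cof.2 hiS)) (Set.mem_insert _ _)
      omega
    have hsub : ∀ i, i ∉ S → ∀ b y, Agr (insert i S) (st i b x) y → Agr S x y := by
      exact fun i hiS b y h => agr_insert hiS h
    by_cases hA : ∃ r e a b, Sum.inr r ∈ S ∧ Sum.inl e ∉ S ∧ inc en e a b ∧ a ∈ cl en (low S x) r
    · obtain ⟨r, e, a, b, hr, he, hab, ha⟩ := hA
      have hI' : ∀ c, ∀ r, Sum.inr r ∈ insert (Sum.inl e) S → ∀ y, Agr (insert (Sum.inl e) S) (st (.inl e) c x) y → rep en idx y r = r := by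
        intro c r hr y hy
        exact hI r (by simpa using hr) y (hsub _ he c y hy)
      refine Good.step (.inl e) he (ih _ _ (hcard _ he) (hI' true)) (ih _ _ (hcard _ he) (hI' false)) ?_
      have key : ∀ y, Agr S x y → ∀ v, v ∈ colS en idx (st (.inl e) true y) ↔ (v ∈ cl en (st (.inl e) false y) b ∧ x (.inr r) = true) ∨
          (v ∉ cl en (st (.inl e) false y) b ∧ v ∈ colS en idx (st (.inl e) false y)) := by
        intro y hy v
        have h0 := agr_st hy he false
        have h1 := agr_st hy he true
        have r0 : rep en idx (st (.inl e) false y) a = r := by rw [rep_cl hi (low_cl h0 r ha), hI r hr _ h0]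
        have r1 : rep en idx (st (.inl e) true y) a = r := by rw [rep_cl hi (low_cl h1 r ha), hI r hr _ h1]
        have hle : idx (rep en idx (st (.inl e) false y) a) ≤ idx (rep en idx (st (.inl e) false y) b) := by
          rw [r0, ← r1]
          refine rep_le ?_
          rw [cl_open hab y]
          exact Or.inr (rep_mem _ _)
        rw [col_open hi hab y hle v]
        have : a ∈ colS en idx (st (.inl e) false y) ↔ x (.inr r) = true := by
          simp only [colS, Set.mem_ofPred_eq, r0]
          rw [h0 _ hr]
        rw [this]
      by_cases hx : x (.inr r) = true
      · left
        intro y hy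
        have : colS en idx (st (.inl e) false y) ≤ colS en idx (st (.inl e) true y) := by
          intro v hv; rw [key y hy v]; tauto
        exact ⟨hF this, hG this⟩
      · right
        intro y hy
        have : colS en idx (st (.inl e) true y) ≤ colS en idx (st (.inl e) false y) := by
          intro v hv; rw [key y hy v] at hv; tauto
        exact ⟨hF this, hG this⟩
    · have hcl : ∀ r, Sum.inr r ∈ S → ∀ y, Agr S x y → cl en y r = cl en (low S x) r := by
        intro r hr y hy
        refine low_closed hy fun e a b ha hab => ?_
        by_contra he
        exact hA ⟨r, e, a, b, hr, he, hab, ha⟩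
      by_cases hB : ∀ v, ∃ r, Sum.inr r ∈ S ∧ v ∈ cl en (low S x) r
      · refine Good.done fun y hy => ?_
        have : ∀ y, Agr S x y → ∀ v, ∀ r, Sum.inr r ∈ S → v ∈ cl en (low S x) r → (v ∈ colS en idx y ↔ x (.inr r) = true) := by
          intro y hy v r hr hv
          rw [col_cl hi (low_cl hy r hv)]
          simp only [colS, Set.mem_ofPred_eq, hI r hr y hy]
          rw [hy _ hr]
        have : colS en idx y = colS en idx x := by
          ext v
          obtain ⟨r, hr, hv⟩ := hB v
          rw [this y hy v r hr hv, this x (fun _ _ => rfl) v r hr hv]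
        simp only [this]
      · push Not at hB
        have hne : {v : α | ∀ r, Sum.inr r ∈ S → v ∉ cl en (low S x) r}.Nonempty := hB
        obtain ⟨v, hv, hmin⟩ : ∃ v, (∀ r, Sum.inr r ∈ S → v ∉ cl en (low S x) r) ∧
            ∀ w, (∀ r, Sum.inr r ∈ S → w ∉ cl en (low S x) r) → idx v ≤ idx w :=
          ⟨Function.argminOn idx _ hne, Function.argminOn_mem idx _ hne, fun w hw => Function.argminOn_le idx {v : α | ∀ r, Sum.inr r ∈ S → v ∉ cl en (low S x) r} hw⟩
        have hvS : Sum.inr v ∉ S := fun h => hv v h (cl_self _ _)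
        have hI' : ∀ c, ∀ r, Sum.inr r ∈ insert (Sum.inr v) S → ∀ y, Agr (insert (Sum.inr v) S) (st (.inr v) c x) y → rep en idx y r = r := by
          intro c r hr y hy
          have hy' := hsub _ hvS c y hy
          rcases hr with hr | hr
          · obtain rfl : r = v := by simpa using hr
            refine rep_eq hi (cl_self _ _) fun w hw => hmin w fun r' hr' hw' => ?_
            rw [← hcl r' hr' y hy'] at hw'
            refine hv r' hr' ?_
            rw [← hcl r' hr' y hy']
            exact cl_trans hw' (cl_symm hw)
          · exact hI r hr y hy'
        refine Good.step (.inr v) hvS (ih _ _ (hcard _ hvS) (hI' true)) (ih _ _ (hcard _ hvS) (hI' false)) (Or.inl fun y hy => ?_)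
        have : colS en idx (st (.inr v) false y) ≤ colS en idx (st (.inr v) true y) := by
          intro w hw
          rw [col_label hi] at hw ⊢
          tauto
        exact ⟨hF this, hG this⟩

theorem dac_fkg (hi : Function.Injective idx) {q : β ⊕ α → ℝ} (hq : Pq q) (F G : Set α → ℝ) (hF : Monotone F) (hG : Monotone G) :
    ex q (fun ω => F (colS en idx ω)) * ex q (fun ω => G (colS en idx ω)) ≤ ex q (fun ω => F (colS en idx ω) * G (colS en idx ω)) := by
  have h := (dac_good (en := en) hi F G hF hG _ ∅ (fun _ => false) le_rfl (fun r hr => absurd hr (Set.notMem_empty _))).fkg hq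
  have e : ∀ y : β ⊕ α → Bool, mix ∅ (fun _ => false) y = y := fun y => funext fun i => mix_out _ _ (Set.notMem_empty i)
  simpa only [e] using h
end
end DaC

namespace DaC
section
variable {α β : Type} {en : β → α × α} {idx idx' : α → ℕ} [Fintype α] [Fintype β]

open Classical in
/-- The law of the colouring does not depend on the choice of representatives. -/
theorem rep_inv (hi : Function.Injective idx) (hi' : Function.Injective idx') {q : β ⊕ α → ℝ} {s : ℝ} (hs : ∀ v, q (.inr v) = s)
    (F : Set α → ℝ) : ex q (fun ω => F (colS en idx ω)) = ex q (fun ω => F (colS en idx' ω)) := by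
  rw [ex_sum_type q, ex_sum_type q]
  refine ex_congr _ fun x => ?_
  set ω : β ⊕ α → Bool := Sum.elim x (fun _ => false) with hω
  let τ : α → α := fun v => Equiv.swap (rep en idx ω v) (rep en idx' ω v) v
  have hmem : ∀ v, τ v ∈ cl en ω v := by
    intro v
    simp only [τ]
    by_cases h1 : v = rep en idx ω v
    · rw [← h1, Equiv.swap_apply_left]; exact rep_mem _ _
    by_cases h2 : v = rep en idx' ω v
    · rw [← h2, Equiv.swap_apply_right]; exact rep_mem _ _
    rw [Equiv.swap_apply_of_ne_of_ne h1 h2]; exact cl_self _ _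
  have hinv : Function.Involutive τ := by
    intro v
    show Equiv.swap (rep en idx ω (τ v)) (rep en idx' ω (τ v)) (τ v) = v
    rw [rep_cl hi (hmem v), rep_cl hi' (hmem v)]
    exact Equiv.swap_apply_self _ _ _
  have hτ : ∀ v, τ (rep en idx ω v) = rep en idx' ω v := by
    intro v
    show Equiv.swap (rep en idx ω (rep en idx ω v)) (rep en idx' ω (rep en idx ω v)) (rep en idx ω v) = rep en idx' ω v
    rw [rep_cl hi (rep_mem ω v), rep_cl hi' (rep_mem ω v), Equiv.swap_apply_left]
  have hc : ∀ (y : α → Bool) v, cl en (Sum.elim x y) v = cl en ω v := fun y v => cl_congr (fun e => rfl) v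
  have e1 : ∀ y : α → Bool, colS en idx' (Sum.elim x y) = colS en idx (Sum.elim x (fun v => y ((Function.Involutive.toPerm τ hinv) v))) := by
    intro y
    ext v
    simp only [colS, Set.mem_ofPred_eq, rep_congr hi (hc _ v), rep_congr hi' (hc _ v), Sum.elim_inr, Function.Involutive.coe_toPerm, hτ]
  simp only [e1]
  rw [ex_equiv (Function.Involutive.toPerm τ hinv) (fun k => q (.inr k)) (fun y => F (colS en idx (Sum.elim x y)))]
  simp only [hs]

/-- Invariance of the law under graph automorphisms. -/
theorem auto_inv (hi : Function.Injective idx) {q : β ⊕ α → ℝ} {s : ℝ} (hs : ∀ v, q (.inr v) = s) (σ : α ≃ α) (τ : β ≃ β)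
    (hστ : ∀ e a b, inc en (τ e) (σ a) (σ b) ↔ inc en e a b) (hqe : ∀ e, q (.inl (τ e)) = q (.inl e)) (F : Set α → ℝ) :
    ex q (fun ω => F (σ ⁻¹' colS en idx ω)) = ex q (fun ω => F (colS en idx ω)) := by
  have hi' : Function.Injective (idx ∘ σ) := hi.comp σ.injective
  rw [rep_inv hi hi' hs F]
  have key : ∀ ω : β ⊕ α → Bool, σ ⁻¹' colS en idx ω = colS en (idx ∘ σ) (fun i => ω ((Equiv.sumCongr τ σ) i)) := by
    intro ω
    have hcl : ∀ v, cl en ω (σ v) = σ '' cl en (fun i => ω ((Equiv.sumCongr τ σ) i)) v := by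
      intro v
      refine cl_map σ v ?_ ?_
      · rintro a _ b ⟨e, h1, h2⟩
        exact ⟨τ e, h1, (hστ _ _ _).2 h2⟩
      · rintro a _ b' ⟨e, h1, h2⟩
        refine ⟨σ.symm b', ⟨τ.symm e, by simpa using h1, ?_⟩, by simp⟩
        rw [← hστ]; simpa using h2
    ext v
    have : rep en idx ω (σ v) = σ (rep en (idx ∘ σ) (fun i => ω ((Equiv.sumCongr τ σ) i)) v) := by
      refine rep_eq hi ?_ ?_
      · rw [hcl]; exact ⟨_, rep_mem _ _, rfl⟩
      · rw [hcl]; rintro _ ⟨w, hw, rfl⟩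
        exact rep_le (idx := idx ∘ σ) hw
    simp only [colS, Set.mem_preimage, Set.mem_ofPred_eq, this, Equiv.sumCongr_apply, Sum.map_inr]
  simp only [key]
  rw [ex_equiv (Equiv.sumCongr τ σ) q (fun ω => F (colS en (idx ∘ σ) ω))]
  congr 1
  funext i
  cases i with
  | inl e => simp [hqe]
  | inr v => simp [hs]

/-! ### Exploration -/
variable (nb : α → α → Prop) (B : Set α)
/-- Union of the components of `X` which meet `B`. -/
def KK (X : Set α) : Set α := {v | ∃ u ∈ B, u ∈ X ∧ Relation.ReflTransGen (fun a b => nb a b ∧ b ∈ X) u v}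
def PP (X : Set α) : Set α := B ∪ {v | ∃ w ∈ KK nb B X, nb w v}
variable (en) in
def QQ (X : (β ⊕ α → Bool) → Set α) (y : β ⊕ α → Bool) : Set (β ⊕ α) :=
  {i | Sum.elim (fun e => ∃ a b, inc en e a b ∧ (cl en y a ∩ PP nb B (X y)).Nonempty) (fun v => (cl en y v ∩ PP nb B (X y)).Nonempty) i}

theorem dac_osss (hi : Function.Injective idx) {q : β ⊕ α → ℝ} (hq : Pq q) (Z : Set α) (f : (β ⊕ α → Bool) → ℝ) (Φ : Set α → ℝ) (hΦ1 : ∀ X, 0 ≤ Φ X ∧ Φ X ≤ 1)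
    (hf : ∀ ω, f ω = Φ (Z ∪ colS en idx ω)) (hΦ : ∀ X, Φ X = Φ (KK nb B X)) :
    |ex q (fun y => f y * f y) - ex q f * ex q f| ≤
      ∑ i, pr q (fun y => i ∈ QQ en nb B (fun ω => Z ∪ colS en idx ω) y) * infl q f i := by
  classical
  refine osss hq f f (fun ω => by rw [hf]; exact hΦ1 _) _ ?_
  intro S x _
  by_contra hcon
  push Not at hcon
  obtain ⟨⟨y0, hy0, hne⟩, hS⟩ := hcon
  set X : (β ⊕ α → Bool) → Set α := fun ω => Z ∪ colS en idx ω with hX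
  have hS' : ∀ i, (∀ y, Agr S x y → i ∈ QQ en nb B X y) → i ∈ S := by
    intro i h
    by_contra hiS
    obtain ⟨y, h1, h2⟩ := hS i hiS
    exact h2 (h y h1)
  have hcol : ∀ v, (∀ y, Agr S x y → v ∈ PP nb B (X y)) → ∀ y, Agr S x y → (v ∈ colS en idx y ↔ v ∈ colS en idx x) := by
    intro v hv y hy
    have hcl : ∀ y, Agr S x y → cl en y v = cl en (low S x) v := by
      intro y hy
      refine low_closed hy fun e a b ha hab => hS' _ fun y' hy' => ?_
      exact ⟨a, b, hab, v, cl_symm (low_cl hy' _ ha), hv y' hy'⟩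
    have hx : Agr S x x := fun _ _ => rfl
    have hr : rep en idx y v = rep en idx x v := rep_congr hi (by rw [hcl y hy, hcl x hx])
    have hrS : Sum.inr (rep en idx x v) ∈ S := by
      refine hS' _ fun y' hy' => ?_
      refine ⟨v, cl_symm ?_, hv y' hy'⟩
      rw [hcl y' hy', ← hcl x hx]; exact rep_mem _ _
    simp only [colS, Set.mem_ofPred_eq, hr, hy _ hrS]
  have hXX : ∀ v, (∀ y, Agr S x y → v ∈ PP nb B (X y)) → ∀ y y', Agr S x y → Agr S x y' → v ∈ X y → v ∈ X y' := by
    intro v hv y y' hy hy' h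
    rcases h with h | h
    · exact Or.inl h
    · exact Or.inr ((hcol v hv y' hy').2 ((hcol v hv y hy).1 h))
  have hK : ∀ y, Agr S x y → ∀ v ∈ KK nb B (X y), ∀ y', Agr S x y' → v ∈ KK nb B (X y') := by
    rintro y hy v ⟨u, huB, huX, hp⟩
    induction hp with
    | refl => exact fun y' hy' => ⟨u, huB, hXX u (fun _ _ => Or.inl huB) y y' hy hy' huX, Relation.ReflTransGen.refl⟩
    | @tail a b _ hab ih =>
      intro y' hy'
      obtain ⟨u', h1, h2, h3⟩ := ih y' hy'
      exact ⟨u', h1, h2, h3.tail ⟨hab.1, hXX b (fun z hz => Or.inr ⟨a, ih z hz, hab.1⟩) y y' hy hy' hab.2⟩⟩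
  apply hne
  rw [hf, hf, hΦ, hΦ (Z ∪ colS en idx x)]
  congr 1
  have hx : Agr S x x := fun _ _ => rfl
  ext v
  exact ⟨fun h => hK y0 hy0 v h x hx, fun h => hK x hx v h y0 hy0⟩

/-! ### Influences -/
noncomputable def piv (f : (β ⊕ α → Bool) → ℝ) (r : α) (ω : β ⊕ α → Bool) : ℝ := |f (st (.inr r) true ω) - f (st (.inr r) false ω)|

theorem piv_bd (f : (β ⊕ α → Bool) → ℝ) (r : α) (ω : β ⊕ α → Bool) (b c : Bool) : |f (st (.inr r) b ω) - f (st (.inr r) c ω)| ≤ piv f r ω := by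
  unfold piv
  cases b <;> cases c <;> simp [abs_sub_comm]

theorem edge_piv (hi : Function.Injective idx) (Φ : Set α → ℝ) {f : (β ⊕ α → Bool) → ℝ} (hf : ∀ ω, f ω = Φ (colS en idx ω)) {e : β} {a b : α} (hab : inc en e a b)
    (ω : β ⊕ α → Bool) : |f (st (.inl e) true ω) - f (st (.inl e) false ω)| ≤
      piv f (rep en idx (st (.inl e) false ω) a) (st (.inl e) false ω) + piv f (rep en idx (st (.inl e) false ω) b) (st (.inl e) false ω) := by
  classical
  have main : ∀ a b : α, inc en e a b → idx (rep en idx (st (.inl e) false ω) a) ≤ idx (rep en idx (st (.inl e) false ω) b) →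
      |f (st (.inl e) true ω) - f (st (.inl e) false ω)| ≤ piv f (rep en idx (st (.inl e) false ω) b) (st (.inl e) false ω) := by
    intro a b hab hle
    have hc := col_open hi hab ω hle
    set y := st (Sum.inl e) false ω with hy
    set r := rep en idx y b with hr
    have hrb : ∀ v, v ∈ cl en y b ↔ rep en idx y v = r := by
      intro v
      constructor
      · intro h; exact rep_cl hi h
      · intro h
        have := rep_mem (en := en) (idx := idx) y v
        rw [h] at this
        exact cl_trans (rep_mem y b) (cl_symm this)
    have h1 : f (st (.inl e) true ω) = f (st (.inr r) (decide (a ∈ colS en idx y)) y) := by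
      rw [hf, hf]
      congr 1
      ext v
      rw [hc v, col_label hi, hrb]
      simp
    have h0 : f y = f (st (.inr r) (y (.inr r)) y) := by rw [st_self]
    rw [h1, h0]
    exact piv_bd _ _ _ _ _
  have n1 : ∀ r y, 0 ≤ piv f r y := fun r y => abs_nonneg _
  rcases le_total (idx (rep en idx (st (.inl e) false ω) a)) (idx (rep en idx (st (.inl e) false ω) b)) with h | h
  · linarith [main a b hab h, n1 (rep en idx (st (.inl e) false ω) a) (st (.inl e) false ω)]
  · linarith [main b a (inc_symm hab) h, n1 (rep en idx (st (.inl e) false ω) b) (st (.inl e) false ω)]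

theorem ex_piv_rep {q : β ⊕ α → ℝ} (hq : Pq q) {f : (β ⊕ α → Bool) → ℝ} (hf1 : ∀ ω, 0 ≤ f ω ∧ f ω ≤ 1) (a : α) (A : Finset α) :
    ex q (fun ω => piv f (rep en idx ω a) ω) ≤ ∑ r ∈ A, ex q (piv f r) + pr q (fun ω => ¬ cl en ω a ⊆ (A : Set α)) := by
  rw [← ex_sum, pr, ← ex_add]
  refine ex_mono hq fun ω => ?_
  by_cases h : cl en ω a ⊆ (A : Set α)
  · have hr : rep en idx ω a ∈ A := h (rep_mem _ _)
    have := Finset.single_le_sum (f := fun r => piv f r ω) (fun r _ => abs_nonneg _) hr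
    linarith [ind_nonneg (¬ cl en ω a ⊆ (A : Set α))]
  · rw [ind_true h]
    have h1 : piv f (rep en idx ω a) ω ≤ 1 := by
      unfold piv; rw [abs_le]
      constructor <;> linarith [(hf1 (st (.inr (rep en idx ω a)) true ω)).1, (hf1 (st (.inr (rep en idx ω a)) true ω)).2, (hf1 (st (.inr (rep en idx ω a)) false ω)).1, (hf1 (st (.inr (rep en idx ω a)) false ω)).2]
    have := Finset.sum_nonneg (s := A) (f := fun r => piv f r ω) (fun r _ => abs_nonneg _)
    linarith

/-- Influence of an edge. -/
theorem edge_infl (hi : Function.Injective idx) {q : β ⊕ α → ℝ} (hq : Pq q) (Φ : Set α → ℝ) {f : (β ⊕ α → Bool) → ℝ} (hf : ∀ ω, f ω = Φ (colS en idx ω))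
    (hf1 : ∀ ω, 0 ≤ f ω ∧ f ω ≤ 1) {e : β} {a b : α} (hab : inc en e a b) (A A' : Finset α) :
    infl q f (.inl e) ≤ ∑ r ∈ A, ex q (piv f r) + ∑ r ∈ A', ex q (piv f r) +
      (pr q (fun ω => ¬ cl en ω a ⊆ (A : Set α)) + pr q (fun ω => ¬ cl en ω b ⊆ (A' : Set α))) := by
  set G : (β ⊕ α → Bool) → ℝ := fun y => piv f (rep en idx y a) y + piv f (rep en idx y b) y with hG
  have hG0 : ∀ y, 0 ≤ G y := fun y => add_nonneg (abs_nonneg _) (abs_nonneg _)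
  have h1 : ex q (fun ω => |f (st (.inl e) true ω) - f (st (.inl e) false ω)|) ≤ ex q (fun ω => G (st (.inl e) false ω)) :=
    ex_mono hq fun ω => edge_piv hi Φ hf hab ω
  have h2 := ex_st q (.inl e) G
  have h3 : 0 ≤ ex q (fun ω => G (st (.inl e) true ω)) := ex_nonneg hq fun _ => hG0 _
  have h4 : 0 ≤ ex q (fun ω => G (st (.inl e) false ω)) := ex_nonneg hq fun _ => hG0 _
  have h5 : ex q G = ex q (fun y => piv f (rep en idx y a) y) + ex q (fun y => piv f (rep en idx y b) y) := ex_add _ _ _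
  have h6 := ex_piv_rep (en := en) (idx := idx) hq hf1 a A
  have h7 := ex_piv_rep (en := en) (idx := idx) hq hf1 b A'
  unfold infl
  have hq0 := (hq (.inl e)).1
  have hq1 : 0 ≤ 1 - q (.inl e) := by linarith [(hq (.inl e)).2]
  have h8 := mul_le_mul_of_nonneg_left h1 hq1
  have h9 : (1 - q (.inl e)) * ex q (fun ω => |f (st (.inl e) true ω) - f (st (.inl e) false ω)|) ≤ ex q G := by
    have := mul_nonneg hq0 h3
    linarith
  have h10 : 0 ≤ (1 - q (.inl e)) * ex q (fun ω => |f (st (.inl e) true ω) - f (st (.inl e) false ω)|) :=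
    mul_nonneg hq1 (ex_nonneg hq fun _ => abs_nonneg _)
  have h11 : q (.inl e) * ((1 - q (.inl e)) * ex q (fun ω => |f (st (.inl e) true ω) - f (st (.inl e) false ω)|)) ≤
      1 * ((1 - q (.inl e)) * ex q (fun ω => |f (st (.inl e) true ω) - f (st (.inl e) false ω)|)) :=
    mul_le_mul_of_nonneg_right (hq (.inl e)).2 h10
  rw [← mul_assoc] at h11
  linarith
end
end DaC

namespace DaC
section
abbrev Vt (N : ℕ) := ZMod N × ZMod N
def pj (N : ℕ) (v : V) : Vt N := ((v.1 : ZMod N), (v.2 : ZMod N))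
def dir : Fin 3 → V := ![(1, 0), (0, 1), (1, 1)]
def enP : V × Fin 3 → V × V := fun e => (e.1, tr (dir e.2) e.1)
def enT (N : ℕ) : Vt N × Fin 3 → Vt N × Vt N := fun e => (e.1, e.1 + pj N (dir e.2))
abbrev It (N : ℕ) := (Vt N × Fin 3) ⊕ Vt N
abbrev Ip := (V × Fin 3) ⊕ V
def pjI (N : ℕ) : Ip → It N := Sum.map (Prod.map (pj N) id) (pj N)
def lft {N : ℕ} (ω : It N → Bool) : Ip → Bool := fun i => ω (pjI N i)

theorem pj_tr (N : ℕ) (z v : V) : pj N (tr z v) = pj N v + pj N z := by simp [pj, tr]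

theorem pj_surj (N : ℕ) (w : Vt N) : ∃ z, pj N z = w := by
  obtain ⟨a, ha⟩ := ZMod.intCast_surjective w.1
  obtain ⟨b, hb⟩ := ZMod.intCast_surjective w.2
  exact ⟨(a, b), by simp [pj, ha, hb]⟩

theorem pj_eq {N : ℕ} {z w : V} : pj N z = pj N w ↔ (N : ℤ) ∣ w.1 - z.1 ∧ (N : ℤ) ∣ w.2 - z.2 := by
  simp only [pj, Prod.mk.injEq, ZMod.intCast_eq_intCast_iff_dvd_sub]

/-- Steps in the lifted graph. -/
theorem stp_dn {N : ℕ} {ω : It N → Bool} {a b : V} (h : stp enP (lft ω) a b) : stp (enT N) ω (pj N a) (pj N b) := by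
  obtain ⟨⟨v, d⟩, h1, h2⟩ := h
  refine ⟨(pj N v, d), h1, ?_⟩
  unfold inc enP at h2; unfold inc enT
  simp only [Prod.mk.injEq] at h2 ⊢
  rcases h2 with ⟨rfl, rfl⟩ | ⟨rfl, rfl⟩
  · left; exact ⟨rfl, by rw [pj_tr]⟩
  · right; exact ⟨rfl, by rw [pj_tr]⟩

theorem stp_up {N : ℕ} {ω : It N → Bool} {a : V} {b' : Vt N} (h : stp (enT N) ω (pj N a) b') : ∃ b, stp enP (lft ω) a b ∧ pj N b = b' := by
  obtain ⟨⟨v, d⟩, h1, h2⟩ := h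
  unfold inc enT at h2
  simp only [Prod.mk.injEq] at h2
  rcases h2 with ⟨rfl, rfl⟩ | ⟨rfl, h2⟩
  · exact ⟨tr (dir d) a, ⟨(a, d), h1, Or.inl rfl⟩, by rw [pj_tr]⟩
  · have e : pj N (tr (ng (dir d)) a) = v := by
      rw [pj_tr, ← h2]; ext <;> simp [pj, ng]
    refine ⟨tr (ng (dir d)) a, ⟨(tr (ng (dir d)) a, d), ?_, Or.inr ?_⟩, e⟩
    · simp only [lft, pjI, Sum.map_inl, Prod.map, e]; exact h1
    · simp [enP, tr, ng]

theorem cl_T {N : ℕ} (ω : It N → Bool) (z : V) : cl (enT N) ω (pj N z) = pj N '' cl enP (lft ω) z :=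
  cl_map (pj N) z (fun _ _ _ h => stp_dn h) (fun _ _ _ h => stp_up h)

variable (N : ℕ) [NeZero N]
noncomputable def idT (v : Vt N) : ℕ := (Fintype.equivFin (Vt N) v : ℕ)
theorem idT_inj : Function.Injective (idT N) := fun a b h => (Fintype.equivFin (Vt N)).injective (Fin.ext h)

def qq (p s : ℝ) : It N → ℝ := Sum.elim (fun _ => p) (fun _ => s)
theorem Pq_qq {p s : ℝ} (hp : 0 ≤ p ∧ p ≤ 1) (hs : 0 ≤ s ∧ s ≤ 1) : Pq (qq N p s) := by
  intro i; cases i <;> simpa [qq]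

def Zt (z : Bool) : Set (Vt N) := {w | z = true ∧ Even w.1 ∧ Even w.2}
variable {N}
/-- The open set in the plane determined by a coloured set of the torus. -/
def Os (z : Bool) (X : Set (Vt N)) : Set V := {v | pj N v ∉ Zt N z ∪ X}
noncomputable def O (z : Bool) (ω : It N → Bool) : Set V := Os z (colS (enT N) (idT N) ω)

theorem even_int (hN : 2 ∣ N) (x : ℤ) : Even ((x : ℤ) : ZMod N) ↔ 2 ∣ x := by
  constructor
  · rintro ⟨y, hy⟩
    obtain ⟨k, rfl⟩ := ZMod.intCast_surjective y
    have h : ((x : ℤ) : ZMod N) = ((k + k : ℤ) : ZMod N) := by rw [hy]; push_cast; rfl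
    rw [ZMod.intCast_eq_intCast_iff_dvd_sub] at h
    have : (2 : ℤ) ∣ k + k - x := dvd_trans (by exact_mod_cast hN) h
    omega
  · rintro ⟨k, rfl⟩
    exact ⟨(k : ZMod N), by push_cast; ring⟩

theorem mem_Zt (hN : 2 ∣ N) {z : Bool} {v : V} : pj N v ∈ Zt N z ↔ z = true ∧ 2 ∣ v.1 ∧ 2 ∣ v.2 := by
  simp only [Zt, pj, Set.mem_ofPred_eq, even_int hN]

theorem mem_O (hN : 2 ∣ N) {z : Bool} {ω : It N → Bool} {v : V} :
    v ∈ O z ω ↔ ¬ (z = true ∧ 2 ∣ v.1 ∧ 2 ∣ v.2) ∧ pj N v ∉ colS (enT N) (idT N) ω := by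
  unfold O Os
  rw [Set.mem_ofPred_eq, Set.mem_union, mem_Zt hN, not_or]

/-- Automorphisms of the torus. -/
structure TAut (f : V → V) (σ : Vt N ≃ Vt N) : Prop where
  pj : ∀ v, pj N (f v) = σ (pj N v)
  ed : ∃ (π : Fin 3 ≃ Fin 3) (sg : Fin 3 → Bool), ∀ v d, σ (v + DaC.pj N (dir d)) = if sg d = true then σ v + DaC.pj N (dir (π d)) else σ v - DaC.pj N (dir (π d))

theorem TAut.edge {f : V → V} {σ : Vt N ≃ Vt N} (h : TAut f σ) : ∃ τ : (Vt N × Fin 3) ≃ (Vt N × Fin 3),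
    ∀ e a b, inc (enT N) (τ e) (σ a) (σ b) ↔ inc (enT N) e a b := by
  obtain ⟨π, sg, hd⟩ := h.ed
  have hd' : ∀ v d, sg d = false → σ v = σ (v + DaC.pj N (dir d)) + DaC.pj N (dir (π d)) := by
    intro v d hs; rw [hd]; simp [hs]
  refine ⟨⟨fun e => (if sg e.2 = true then σ e.1 else σ (e.1 + DaC.pj N (dir e.2)), π e.2),
    fun e => (if sg (π.symm e.2) = true then σ.symm e.1 else σ.symm e.1 - DaC.pj N (dir (π.symm e.2)), π.symm e.2), ?_, ?_⟩, ?_⟩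
  · rintro ⟨v, d⟩
    cases hs : sg d <;> simp [hs]
  · rintro ⟨v, d⟩
    cases hs : sg (π.symm d) <;> simp [hs]
  · rintro ⟨v, d⟩ a b
    cases hs : sg d
    · have := hd' v d hs
      simp only [inc, enT, Equiv.coe_fn_mk, hs, Prod.mk.injEq, ← this, Bool.false_eq_true, if_false, σ.injective.eq_iff]
      tauto
    · have := hd v d
      simp only [hs, if_true] at this
      simp only [inc, enT, Equiv.coe_fn_mk, hs, Prod.mk.injEq, if_true, ← this, σ.injective.eq_iff]

theorem TAut.inv {f : V → V} {σ : Vt N ≃ Vt N} (h : TAut f σ) {z : Bool} (hZ : σ ⁻¹' Zt N z = Zt N z) (p s : ℝ) (E : Set V → Prop) :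
    pr (qq N p s) (fun ω => E (f ⁻¹' O z ω)) = pr (qq N p s) (fun ω => E (O z ω)) := by
  obtain ⟨τ, hτ⟩ := h.edge
  have := auto_inv (en := enT N) (idT_inj N) (q := qq N p s) (s := s) (fun v => rfl) σ τ hτ (fun e => rfl) (fun X => ind (E (Os z X)))
  unfold pr O
  rw [← this]
  refine ex_congr _ fun ω => ?_
  have key : f ⁻¹' Os z (colS (enT N) (idT N) ω) = Os z (σ ⁻¹' colS (enT N) (idT N) ω) := ?_
  · simp only [key]
  ext v
  show DaC.pj N (f v) ∉ Zt N z ∪ _ ↔ DaC.pj N v ∉ Zt N z ∪ _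
  rw [h.pj]
  conv_rhs => rw [← hZ]
  rfl

theorem taut_tr (t : V) : TAut (N := N) (tr t) (Equiv.addRight (pj N t)) where
  pj := fun v => by rw [pj_tr]; rfl
  ed := ⟨Equiv.refl _, fun _ => true, fun v d => by simp; abel⟩

def invEq {A : Type} (f : A → A) (h : ∀ a, f (f a) = a) : A ≃ A := ⟨f, f, h, h⟩

theorem taut_R1 : TAut (N := N) R1 (invEq (fun v => (v.2 - v.1, v.2)) (fun a => by simp)) where
  pj := fun v => by simp [DaC.pj, R1, invEq]
  ed := ⟨Equiv.swap 1 2, ![false, true, true], fun v d => by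
    fin_cases d <;> simp [invEq, dir, DaC.pj, Equiv.swap_apply_def] <;> ring⟩
theorem taut_R2 : TAut (N := N) R2 (invEq (fun v => (v.1 - v.2, -v.2)) (fun a => by simp)) where
  pj := fun v => by simp [DaC.pj, R2, invEq]
  ed := ⟨Equiv.swap 1 2, ![true, false, false], fun v d => by
    fin_cases d <;> simp [invEq, dir, DaC.pj, Equiv.swap_apply_def] <;> (try constructor) <;> ring⟩
theorem taut_sw : TAut (N := N) sw (invEq (fun v => (v.2, v.1)) (fun a => by simp)) where
  pj := fun v => by simp [DaC.pj, sw, invEq]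
  ed := ⟨Equiv.swap 0 1, fun _ => true, fun v d => by
    fin_cases d <;> simp [invEq, dir, DaC.pj, Equiv.swap_apply_def]⟩

theorem Os_anti (z : Bool) {X Y : Set (Vt N)} (h : X ⊆ Y) : Os z Y ⊆ Os z X := fun v hv hc => hv (hc.imp id (fun k => h k))

noncomputable def law (z : Bool) (p s : ℝ) (hp : 0 ≤ p ∧ p ≤ 1) (hs : 0 ≤ s ∧ s ≤ 1) : Law where
  P E := pr (qq N p s) (fun ω => E (O z ω))
  mono h := pr_mono (Pq_qq N hp hs) fun ω => h _
  tt := by unfold pr; simp only [ind_true trivial]; exact ex_const _ _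
  nt E := pr_not _ _
  or E F := pr_or (Pq_qq N hp hs) _ _
  fkg E F hE hF := by
    have := dac_fkg (en := enT N) (idT_inj N) (Pq_qq N hp hs) (fun X => - ind (E (Os z X))) (fun X => - ind (F (Os z X)))
      (fun X Y h => neg_le_neg (ind_mono (hE _ _ (Os_anti z h)))) (fun X Y h => neg_le_neg (ind_mono (hF _ _ (Os_anti z h))))
    simp only [neg_mul_neg, ← ind_and] at this
    have e : ∀ f : (It N → Bool) → ℝ, ex (qq N p s) (fun ω => - f ω) = - ex (qq N p s) f := by
      intro f
      have := ex_mul (qq N p s) (-1) f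
      simpa using this
    rw [e (fun ω => ind (E (Os z (colS (enT N) (idT N) ω)))), e (fun ω => ind (F (Os z (colS (enT N) (idT N) ω)))), neg_mul_neg] at this
    exact this
  iT x y hx hy E := by
    refine (taut_tr (N := N) (x, y)).inv ?_ p s E
    ext w
    obtain ⟨a, ha⟩ := hx; obtain ⟨b, hb⟩ := hy
    have e1 : Even (((x, y) : V).1 : ZMod N) := ⟨(a : ZMod N), by simp [ha]; ring⟩
    have e2 : Even (((x, y) : V).2 : ZMod N) := ⟨(b : ZMod N), by simp [hb]; ring⟩
    simp only [Zt, Set.mem_preimage, Equiv.coe_addRight, pj, Set.mem_ofPred_eq, Prod.fst_add, Prod.snd_add]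
    refine and_congr_right fun _ => and_congr ⟨fun h => ?_, fun h => h.add e1⟩ ⟨fun h => ?_, fun h => h.add e2⟩
    · have := h.sub e1; simpa using this
    · have := h.sub e2; simpa using this
  iR1 E := by
    refine (taut_R1 (N := N)).inv ?_ p s E
    ext w
    simp only [Zt, Set.mem_preimage, invEq, Equiv.coe_fn_mk, Set.mem_ofPred_eq]
    refine and_congr_right fun _ => ⟨fun h => ⟨?_, h.2⟩, fun h => ⟨h.2.sub h.1, h.2⟩⟩
    have := h.2.sub h.1; simpa using this
  iR2 E := by
    refine (taut_R2 (N := N)).inv ?_ p s E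
    ext w
    simp only [Zt, Set.mem_preimage, invEq, Equiv.coe_fn_mk, Set.mem_ofPred_eq]
    refine and_congr_right fun _ => ⟨fun h => ?_, fun h => ⟨h.1.sub h.2, h.2.neg⟩⟩
    have h2 : Even w.2 := by simpa using h.2.neg
    have := h.1.add h2; exact ⟨by simpa using this, h2⟩
  isw E := by
    refine (taut_sw (N := N)).inv ?_ p s E
    ext w
    simp only [Zt, Set.mem_preimage, invEq, Equiv.coe_fn_mk, Set.mem_ofPred_eq]
    tauto
end
end DaC

namespace DaC
section
/-! ### Tails of clusters and mixing -/
noncomputable def bl (r : ℤ) : Finset V := Finset.Icc (-r) r ×ˢ Finset.Icc (-r) r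
theorem mem_bl {r : ℤ} {v : V} : v ∈ bl r ↔ nrm v ≤ r := by
  rw [nrm_le]; simp [bl]
theorem card_bl {r : ℤ} (h : 0 ≤ r) : ((bl r).card : ℝ) = (2 * r + 1) ^ 2 := by
  have : ((2 * r + 1).toNat : ℤ) = 2 * r + 1 := Int.toNat_of_nonneg (by omega)
  have h2 : (((2 * r + 1).toNat : ℕ) : ℝ) = 2 * (r : ℝ) + 1 := by exact_mod_cast congrArg (fun x : ℤ => (x : ℝ)) this
  have e : r + 1 - -r = 2 * r + 1 := by ring
  simp only [bl, Finset.card_product, Int.card_Icc, e]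
  push_cast
  rw [h2]; ring

def df (z w : V) : V := (w.1 - z.1, w.2 - z.2)
theorem nrm_tri (u w : V) : nrm w ≤ nrm u + nrm (df u w) := by
  have h1 := nrm_le.1 (le_refl (nrm u)); have h2 := nrm_le.1 (le_refl (nrm (df u w)))
  rw [nrm_le]; simp only [df] at *; omega
theorem nrm_tri' (u w : V) : nrm u ≤ nrm w + nrm (df u w) := by
  have h1 := nrm_le.1 (le_refl (nrm w)); have h2 := nrm_le.1 (le_refl (nrm (df u w)))
  rw [nrm_le]; simp only [df] at *; omega
theorem nrm_nonneg (u : V) : 0 ≤ nrm u := by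
  have := nrm_le.1 (le_refl (nrm u)); omega

/-- The cluster of `z` has radius at least `m`. -/
def Far (m : ℤ) (z : V) (η : Ip → Bool) : Prop := ∃ w ∈ cl enP η z, m ≤ nrm (df z w)

variable {N : ℕ} [NeZero N]

theorem O_congr {z : Bool} {ω ω' : It N → Bool} {v : V} (h : cl (enT N) ω (pj N v) = cl (enT N) ω' (pj N v))
    (h2 : ∀ r ∈ cl (enT N) ω (pj N v), ω (.inr r) = ω' (.inr r)) : v ∈ O z ω ↔ v ∈ O z ω' := by
  have : pj N v ∈ colS (enT N) (idT N) ω ↔ pj N v ∈ colS (enT N) (idT N) ω' := by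
    simp only [colS, Set.mem_ofPred_eq]
    rw [← rep_congr (idT_inj N) h, h2 _ (rep_mem _ _)]
  show pj N v ∉ Zt N z ∪ _ ↔ pj N v ∉ Zt N z ∪ _
  rw [Set.mem_union, Set.mem_union, this]

/-- Coordinates inside a box. -/
def Sin (N : ℕ) (r : ℤ) : Set (It N) := {i | ∃ j : Ip, pjI N j = i ∧ Sum.elim (fun e : V × Fin 3 => nrm e.1 ≤ r ∧ nrm (tr (dir e.2) e.1) ≤ r) (fun v => nrm v ≤ r) j}

theorem mix_le (S : Set (It N)) (ω : It N → Bool) (i : It N) (h : mix S ω (fun _ => false) i = true) : ω i = true := by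
  by_cases hi : i ∈ S
  · rwa [mix_in _ _ hi] at h
  · rw [mix_out _ _ hi] at h; simp at h

theorem O_in {z : Bool} {ω : It N → Bool} {v : V} {r : ℤ} (h : ∀ w ∈ cl enP (lft ω) v, nrm w ≤ r) :
    v ∈ O z ω ↔ v ∈ O z (mix (Sin N r) ω (fun _ => false)) := by
  set ω' := mix (Sin N r) ω (fun _ => false) with hω'
  have hin : ∀ j : Ip, Sum.elim (fun e : V × Fin 3 => nrm e.1 ≤ r ∧ nrm (tr (dir e.2) e.1) ≤ r) (fun v => nrm v ≤ r) j → ω' (pjI N j) = ω (pjI N j) :=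
    fun j hj => mix_in _ _ ⟨j, rfl, hj⟩
  have hle : cl enP (lft ω') v ⊆ cl enP (lft ω) v :=
    cl_sub (cl_self _ _) fun a b ha hs => cl_step ha (by
      obtain ⟨e, h1, h2⟩ := hs
      exact ⟨e, mix_le (Sin N r) ω _ h1, h2⟩)
  have hge : cl enP (lft ω) v ⊆ cl enP (lft ω') v := by
    have : cl enP (lft ω) v ⊆ {w | w ∈ cl enP (lft ω) v ∧ w ∈ cl enP (lft ω') v} := by
      refine cl_sub ⟨cl_self _ _, cl_self _ _⟩ ?_
      rintro a b ⟨ha, ha'⟩ hs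
      have hb := cl_step ha hs
      refine ⟨hb, cl_step ha' ?_⟩
      obtain ⟨⟨u, d⟩, h1, h2⟩ := hs
      refine ⟨(u, d), ?_, h2⟩
      have : lft ω' (.inl (u, d)) = lft ω (.inl (u, d)) := by
        refine hin (.inl (u, d)) ?_
        unfold inc enP at h2
        simp only [Prod.mk.injEq] at h2
        rcases h2 with ⟨rfl, rfl⟩ | ⟨rfl, rfl⟩
        · exact ⟨h _ ha, h _ hb⟩
        · exact ⟨h _ hb, h _ ha⟩
      rw [this]; exact h1
    exact fun w hw => (this hw).2
  have hcl := Set.Subset.antisymm hle hge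
  refine O_congr (by rw [cl_T, cl_T, hcl]) ?_
  rw [cl_T]
  rintro _ ⟨w, hw, rfl⟩
  exact (hin (.inr w) (h w hw)).symm

theorem mix_out_in {S : Set (It N)} {ω y : It N → Bool} {i : It N} (h : i ∉ S) : mix Sᶜ ω y i = ω i := mix_in _ _ h

theorem O_out {z : Bool} {ω : It N → Bool} {v : V} {r : ℤ} (h : ∀ u, nrm u ≤ r → pj N u ∉ cl (enT N) ω (pj N v)) :
    v ∈ O z ω ↔ v ∈ O z (mix (Sin N r)ᶜ ω (fun _ => false)) := by
  set ω' := mix (Sin N r)ᶜ ω (fun _ => false) with hω'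
  have hle : cl (enT N) ω' (pj N v) ⊆ cl (enT N) ω (pj N v) := cl_mono (fun e he => mix_le _ _ _ he) _
  have hge : cl (enT N) ω (pj N v) ⊆ cl (enT N) ω' (pj N v) := by
    have : cl (enT N) ω (pj N v) ⊆ {w | w ∈ cl (enT N) ω (pj N v) ∧ w ∈ cl (enT N) ω' (pj N v)} := by
      refine cl_sub ⟨cl_self _ _, cl_self _ _⟩ ?_
      rintro a b ⟨ha, ha'⟩ hs
      have hb := cl_step ha hs
      refine ⟨hb, cl_step ha' ?_⟩
      obtain ⟨e, h1, h2⟩ := hs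
      refine ⟨e, ?_, h2⟩
      rw [hω', mix_out_in]
      · exact h1
      rintro ⟨j, hj, hj'⟩
      rcases j with ⟨u, d⟩ | u
      · simp only [pjI, Sum.map_inl, Prod.map, Sum.inl.injEq, id] at hj
        subst hj
        have h2' : pj N u = a ∨ pj N u = b := by
          unfold inc enT at h2; simp only [Prod.mk.injEq] at h2; tauto
        rcases h2' with rfl | rfl
        · exact h u hj'.1 ha
        · exact h u hj'.1 hb
      · simp [pjI] at hj
    exact fun w hw => (this hw).2
  refine O_congr (Set.Subset.antisymm hge hle) ?_
  intro t ht
  rw [hω', mix_out_in]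
  rintro ⟨j, hj, hj'⟩
  rcases j with ⟨u, d⟩ | u
  · simp [pjI] at hj
  · simp only [pjI, Sum.map_inr, Sum.inr.injEq] at hj
    subst hj
    exact h u hj' ht

theorem loc_iff {S : Set V} {E : Set V → Prop} (hE : LocIn S E) {A B : Set V} (h : ∀ v ∈ S, v ∈ A ↔ v ∈ B) : E A ↔ E B := by
  have : A ∩ S = B ∩ S := by
    ext v
    exact ⟨fun k => ⟨(h v k.2).1 k.1, k.2⟩, fun k => ⟨(h v k.2).2 k.1, k.2⟩⟩
  exact ⟨hE _ _ this, hE _ _ this.symm⟩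

theorem pj_inj_small {w w' : V} {M : ℤ} (h : pj N w = pj N w') (h1 : nrm w + nrm w' < N) : w = w' := by
  rw [pj_eq] at h
  have a1 := nrm_le.1 (le_refl (nrm w)); have a2 := nrm_le.1 (le_refl (nrm w'))
  obtain ⟨h2, h3⟩ := h
  have e1 := Int.eq_zero_of_abs_lt_dvd h2 (by rw [abs_lt]; constructor <;> omega)
  have e2 := Int.eq_zero_of_abs_lt_dvd h3 (by rw [abs_lt]; constructor <;> omega)
  ext <;> omega

theorem mix_arith {x y w b d : ℝ} (b0 : 0 ≤ b) (b1 : b ≤ 1) (e1 : y ≤ 1) (f1 : w ≤ 1) (h : x ≤ (y + b) * (w + b) + b) (h9 : 4 * b ≤ d) :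
    x ≤ y * w + d := by
  have h6 : y * b ≤ b := by nlinarith
  have h7 : w * b ≤ b := by nlinarith
  have h8 : b * b ≤ b := by nlinarith
  have : (y + b) * (w + b) = y * w + y * b + w * b + b * b := by ring
  linarith

set_option maxHeartbeats 800000 in
theorem mix_law {z : Bool} {p s : ℝ} (hp : 0 ≤ p ∧ p ≤ 1) (hs : 0 ≤ s ∧ s ≤ 1) {T : ℤ → ℝ} {D : ℝ} {M : ℤ} (hN : 2 * M < (N : ℤ)) (hT0 : ∀ m, 0 ≤ T m)
    (hT : ∀ m : ℤ, 0 ≤ m → 4 * m ≤ (N : ℤ) → ∀ u, pr (qq N p s) (fun ω => Far m u (lft ω)) ≤ T m)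
    (hD : ∀ m : ℤ, 1 ≤ m → 4 * ((4 * (m : ℝ) + 1) ^ 2 * T (m / 2)) ≤ D / m) : Mix (law (N := N) z p s hp hs) D M := by
  intro m hm E F hE hF
  have hq := Pq_qq N hp hs
  set μ := law (N := N) z p s hp hs with hμ
  by_cases hmM : M < 2 * m
  · have hFc : ∀ A B, F A → F B := by
      intro A B h
      refine hF A B ?_ h
      ext v
      simp only [Set.mem_inter_iff, Set.mem_ofPred_eq]
      constructor <;> rintro ⟨_, h1, h2⟩ <;> omega
    have hD0 : 0 ≤ D / m := by
      refine le_trans ?_ (hD m hm)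
      have : 0 ≤ (4 * (m : ℝ) + 1) ^ 2 * T (m / 2) := mul_nonneg (sq_nonneg _) (hT0 _)
      linarith
    by_cases hF0 : ∃ A, F A
    · obtain ⟨A, hA⟩ := hF0
      have h1 : μ.P F = 1 := by
        rw [← μ.tt]; exact le_antisymm (μ.mono fun _ _ => trivial) (μ.mono fun B _ => hFc A B hA)
      rw [h1, mul_one]
      have := μ.mono (E := fun O => E O ∧ F O) (F := E) fun O h => h.1
      linarith
    · push Not at hF0
      have h1 : μ.P (fun O => E O ∧ F O) ≤ μ.P F := μ.mono fun O h => h.2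
      have h2 : μ.P F ≤ 0 := by
        have := μ.nt (fun _ => True)
        rw [μ.tt, sub_self] at this
        rw [← this]; exact μ.mono fun O h => absurd h (hF0 O)
      have h3 := mul_nonneg (μ.nonneg E) (μ.nonneg F)
      linarith
  push Not at hmM
  set k := m / 2 with hk
  set r := m + k with hr
  set S := Sin N r with hS
  set bad : (It N → Bool) → Prop := fun ω => ∃ u ∈ bl (2 * m), Far k u (lft ω) with hbad
  set e : (It N → Bool) → Prop := fun ω => E (O z (mix S ω (fun _ => false))) with he
  set f : (It N → Bool) → Prop := fun ω => F (O z (mix Sᶜ ω (fun _ => false))) with hf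
  have hE' : ∀ ω, ¬ bad ω → (E (O z ω) ↔ e ω) := by
    intro ω hb
    refine loc_iff hE fun v hv => O_in fun w hw => ?_
    have hv' : nrm v ≤ m := hv
    by_contra hc
    refine hb ⟨v, mem_bl.2 (by omega), w, hw, ?_⟩
    have := nrm_tri v w
    omega
  have hF' : ∀ ω, ¬ bad ω → (F (O z ω) ↔ f ω) := by
    intro ω hb
    refine loc_iff hF fun w hw => O_out fun u hu hc => ?_
    have h1 := cl_symm hc
    rw [cl_T] at h1
    obtain ⟨w', hw', hww⟩ := h1
    have hfar : nrm (df u w') < k := by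
      by_contra hcon
      exact hb ⟨u, mem_bl.2 (by omega), w', hw', by omega⟩
    have h2 := nrm_tri u w'
    have hw1 : 2 * m ≤ nrm w := hw.1
    have hw2 : nrm w ≤ M := hw.2
    have := pj_inj_small (M := M) hww (by omega)
    subst this
    omega
  have hPb : pr (qq N p s) bad ≤ (4 * (m : ℝ) + 1) ^ 2 * T k := by
    refine (pr_exists hq _ _).trans ?_
    refine (Finset.sum_le_sum fun u _ => hT k (by omega) (by omega) u).trans ?_
    rw [Finset.sum_const, nsmul_eq_mul, card_bl (by omega)]
    push_cast
    ring_nf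
    exact le_refl _
  have hDe : Dep S e := by
    intro x y h
    have : mix S x (fun _ => false) = mix S y (fun _ => false) := by
      funext i
      by_cases hi : i ∈ S
      · rw [mix_in _ _ hi, mix_in _ _ hi, h i hi]
      · rw [mix_out _ _ hi, mix_out _ _ hi]
    simp only [he, this]
  have hDf : Dep Sᶜ f := by
    intro x y h
    have : mix Sᶜ x (fun _ => false) = mix Sᶜ y (fun _ => false) := by
      funext i
      by_cases hi : i ∈ Sᶜ
      · rw [mix_in _ _ hi, mix_in _ _ hi, h i hi]
      · rw [mix_out _ _ hi, mix_out _ _ hi]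
    simp only [hf, this]
  have hind : pr (qq N p s) (fun ω => e ω ∧ f ω) = pr (qq N p s) e * pr (qq N p s) f := by
    unfold pr
    simp only [ind_and]
    exact ex_indep _ (disjoint_compl_right (a := S)) (fun x y h => by show ind _ = ind _; rw [hDe x y h]) (fun x y h => by show ind _ = ind _; rw [hDf x y h])
  set b := pr (qq N p s) bad with hb
  have b0 : 0 ≤ b := pr_nonneg hq _
  have b1 : b ≤ 1 := pr_le_one hq _
  have h1 : μ.P (fun O => E O ∧ F O) ≤ pr (qq N p s) (fun ω => e ω ∧ f ω) + b := by
    refine le_trans (pr_mono hq (F := fun ω => (e ω ∧ f ω) ∨ bad ω) fun ω h => ?_) (pr_or hq _ _)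
    by_cases hbb : bad ω
    · exact Or.inr hbb
    · exact Or.inl ⟨(hE' ω hbb).1 h.1, (hF' ω hbb).1 h.2⟩
  have h2 : pr (qq N p s) e ≤ μ.P E + b := by
    refine le_trans (pr_mono hq (F := fun ω => E (O z ω) ∨ bad ω) fun ω h => ?_) (pr_or hq _ _)
    by_cases hbb : bad ω
    · exact Or.inr hbb
    · exact Or.inl ((hE' ω hbb).2 h)
  have h3 : pr (qq N p s) f ≤ μ.P F + b := by
    refine le_trans (pr_mono hq (F := fun ω => F (O z ω) ∨ bad ω) fun ω h => ?_) (pr_or hq _ _)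
    by_cases hbb : bad ω
    · exact Or.inr hbb
    · exact Or.inl ((hF' ω hbb).2 h)
  have h4 := hD m hm
  have e0 := μ.nonneg E; have e1 := μ.le_one E; have f0 := μ.nonneg F; have f1 := μ.le_one F
  have h5 : pr (qq N p s) e * pr (qq N p s) f ≤ (μ.P E + b) * (μ.P F + b) := mul_le_mul h2 h3 (pr_nonneg hq _) (by linarith)
  have h6 : μ.P (fun O => E O ∧ F O) ≤ (μ.P E + b) * (μ.P F + b) + b := by rw [hind] at h1; linarith
  have h9 : 4 * b ≤ D / m := by linarith
  generalize μ.P (fun O => E O ∧ F O) = x at h6 ⊢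
  generalize μ.P E = y at *
  generalize μ.P F = w at *
  clear_value b
  exact mix_arith b0 b1 e1 f1 h6 h9
end
end DaC

namespace DaC
section
/-! ### Sprinkling and the crossing hypothesis -/
theorem ex_mono_wt {ι : Type} [Fintype ι] {q : ι → ℝ} (hq : Pq q) {f g : (ι → Bool) → ℝ} (h : ∀ ω, wt q ω ≠ 0 → f ω ≤ g ω) : ex q f ≤ ex q g := by
  unfold ex
  refine Finset.sum_le_sum fun ω _ => ?_
  by_cases h0 : wt q ω = 0
  · simp [h0]
  · exact mul_le_mul_of_nonneg_left (h ω h0) (wt_nonneg hq ω)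

theorem pr_false {ι : Type} [Fintype ι] {q : ι → ℝ} (hq : Pq q) {δ : ℝ} (h0 : 0 ≤ δ) (R : Finset ι) (h : ∀ i ∈ R, δ ≤ 1 - q i) :
    δ ^ R.card ≤ pr q (fun ω => ∀ i ∈ R, ω i = false) := by
  classical
  induction R using Finset.induction_on with
  | empty =>
    unfold pr
    rw [ex_congr _ (g := fun _ => 1) (fun ω => ind_true (by simp)), ex_const]; simp
  | insert a R ha ih =>
    rw [Finset.card_insert_of_notMem ha, pow_succ]
    have e : pr q (fun ω => ∀ i ∈ insert a R, ω i = false) = pr q (fun ω => ∀ i ∈ R, ω i = false) * pr q (fun ω => ω a = false) := by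
      unfold pr
      rw [← ex_indep q (S := ↑R) (T := {a}) (by simpa using ha) (fun x y h => by
          show ind _ = ind _
          exact ind_congr (forall₂_congr fun i hi => by rw [h i hi])) (fun x y h => by
          show ind (x a = false) = ind (y a = false)
          rw [h a rfl])]
      refine ex_congr _ fun ω => ?_
      rw [← ind_and]
      refine ind_congr ?_
      simp only [Finset.mem_insert, forall_eq_or_imp]
      tauto
    have e2 : pr q (fun ω => ω a = false) = 1 - q a := by
      unfold pr
      rw [ex_st q a]
      simp only [st_same, Bool.true_eq_false]
      rw [ex_congr _ (g := fun _ => 0) (fun ω => ind_false (by simp)), ex_congr _ (g := fun _ => 1) (fun ω => ind_true trivial), ex_const, ex_const]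
      ring
    rw [e, e2]
    exact mul_le_mul (ih fun i hi => h i (Finset.mem_insert_of_mem hi)) (h a (Finset.mem_insert_self _ _)) h0 (pr_nonneg hq _)

variable {N : ℕ} [NeZero N]

theorem sprinkle (hN : 2 ∣ N) {z : Bool} {p s s' δ : ℝ} (hp : 0 ≤ p ∧ p ≤ 1) (hs : 0 ≤ s ∧ s ≤ 1) (hδ : 0 ≤ δ ∧ δ ≤ 1) (hs' : 0 ≤ s' ∧ s' ≤ 1)
    (he : s' = s * (1 - δ)) (K : ℕ) {A G : Set V → Prop} (hG : Inc G)
    (h : ∀ O, A O → ∃ R : Finset V, R.card ≤ K ∧ (∀ v ∈ R, ¬ (2 ∣ v.1 ∧ 2 ∣ v.2)) ∧ G (O ∪ ↑R)) :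
    δ ^ K * (law (N := N) z p s hp hs).P A ≤ (law (N := N) z p s' hp hs').P G := by
  classical
  show δ ^ K * pr (qq N p s) (fun ω => A (O z ω)) ≤ pr (qq N p s') (fun ω => G (O z ω))
  have hr : Pq (qq N 1 (1 - δ)) := Pq_qq N ⟨by norm_num, le_refl _⟩ ⟨by linarith [hδ.2], by linarith [hδ.1]⟩
  have e1 : qq N p s' = fun i => qq N p s i * qq N 1 (1 - δ) i := by
    funext i; cases i <;> simp [qq, he]
  unfold pr
  rw [e1, ← ex_and, ← ex_mul]
  refine ex_mono (Pq_qq N hp hs) fun x => ?_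
  by_cases hA : A (O z x)
  swap
  · rw [ind_false hA, mul_zero]; exact ex_nonneg hr fun _ => ind_nonneg _
  rw [ind_true hA, mul_one]
  obtain ⟨R, hR1, hR2, hR3⟩ := h _ hA
  set R' : Finset (It N) := R.image (fun v => .inr (rep (enT N) (idT N) x (pj N v))) with hR'
  have hc : R'.card ≤ K := Finset.card_image_le.trans hR1
  have h1 := pr_false hr hδ.1 R' (by
    intro i hi
    obtain ⟨v, _, rfl⟩ := Finset.mem_image.1 hi
    simp [qq])
  refine (pow_le_pow_of_le_one hδ.1 hδ.2 hc).trans (h1.trans ?_)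
  refine ex_mono_wt hr fun y hy => ind_mono fun hyR => ?_
  refine hG _ _ ?_ hR3
  have hye : ∀ e, y (.inl e) = true := by
    intro e
    by_contra hne
    refine hy (Finset.prod_eq_zero (Finset.mem_univ (Sum.inl e)) ?_)
    simp [hne, qq]
  have hcl : ∀ v, rep (enT N) (idT N) (fun i => x i && y i) v = rep (enT N) (idT N) x v := fun v =>
    rep_congr (idT_inj N) (cl_congr (fun e => by simp [hye e]) v)
  intro v hv
  rw [mem_O hN]
  simp only [colS, Set.mem_ofPred_eq, hcl]
  rcases hv with hv | hv
  · rw [mem_O hN] at hv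
    simp only [colS, Set.mem_ofPred_eq] at hv
    exact ⟨hv.1, by simp [hv.2]⟩
  · have := hyR _ (Finset.mem_image_of_mem _ hv)
    exact ⟨fun h => hR2 v hv h.2, by simp [this]⟩

/-- The points near `e` which are not even-even. -/
noncomputable def Rn (e : V) : Finset V := ((bl 10).image (tr e)).filter (fun v => ¬ (2 ∣ v.1 ∧ 2 ∣ v.2))
theorem mem_Rn {e w : V} : w ∈ Rn e ↔ (-10 ≤ w.1 - e.1 ∧ w.1 - e.1 ≤ 10 ∧ -10 ≤ w.2 - e.2 ∧ w.2 - e.2 ≤ 10) ∧ ¬ (2 ∣ w.1 ∧ 2 ∣ w.2) := by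
  simp only [Rn, Finset.mem_filter, Finset.mem_image, mem_bl, nrm_le, tr]
  refine and_congr_left fun _ => ⟨?_, fun h => ⟨(w.1 - e.1, w.2 - e.2), by simp only; omega, by ext <;> simp⟩⟩
  rintro ⟨a, ha, rfl⟩
  simp only; omega
theorem card_Rn (e : V) : (Rn e).card ≤ 441 :=
  (Finset.card_filter_le _ _).trans (Finset.card_image_le.trans (by simp [bl]))

theorem ray_in {S : Set V} (p d : V) (hd : TriAdj (0, 0) d) (n : ℕ)
    (h : ∀ k : ℤ, 0 ≤ k → k ≤ n → (p.1 + k * d.1, p.2 + k * d.2) ∈ S) : J S p (p.1 + n * d.1, p.2 + n * d.2) :=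
  (ray_path p d hd n).mono <| by
    rintro w ⟨k, h1, h2, h3, h4⟩
    have : w = (p.1 + k * d.1, p.2 + k * d.2) := Prod.ext h3 h4
    rw [this]; exact h k h1 h2

theorem ext_H {e : V} {a b : ℤ} (h1 : a ≤ ell e) (h2 : ell e ≤ a + 1) (h3 : -b ≤ e.2) (h4 : e.2 ≤ b) (hb : 1 ≤ b) (ha : 0 ≤ a) :
    ∃ e', a + 12 ≤ ell e' ∧ J (({e} ∪ ↑(Rn e)) ∩ HB (a + 12) b) e e' := by
  have key : ∀ e0 : V, ¬ 2 ∣ e0.2 → -b ≤ e0.2 → e0.2 ≤ b → a ≤ ell e0 → ell e0 ≤ a + 2 → (-1 ≤ e0.1 - e.1 ∧ e0.1 - e.1 ≤ 1 ∧ -1 ≤ e0.2 - e.2 ∧ e0.2 - e.2 ≤ 1) →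
      ∃ e', a + 12 ≤ ell e' ∧ J (({e} ∪ ↑(Rn e)) ∩ HB (a + 12) b) e0 e' := by
    intro e0 k1 k2 k3 k4 k5 k6
    have hn : ∃ n : ℕ, n ≤ 6 ∧ a + 12 ≤ ell e0 + 2 * n ∧ ell e0 + 2 * n ≤ a + 13 := by
      by_cases h : ell e0 ≤ a + 1
      · exact ⟨6, le_refl _, by push_cast; omega, by push_cast; omega⟩
      · exact ⟨5, by norm_num, by push_cast; omega, by push_cast; omega⟩
    obtain ⟨n, hn0, hn1, hn2⟩ := hn
    unfold ell at *
    refine ⟨_, ?_, ray_in e0 (1, 0) (by rw [tri_iff]; simp) n ?_⟩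
    · simp only; omega
    · intro k hk0 hk1
      refine ⟨Or.inr (mem_Rn.2 ?_), ?_⟩
      · simp only; omega
      · simp only [HB, ell, Set.mem_ofPred_eq]; omega
  by_cases hy : 2 ∣ e.2
  · have hein : e ∈ ({e} ∪ ↑(Rn e) : Set V) ∩ HB (a + 12) b := ⟨Or.inl rfl, by simp only [HB, Set.mem_ofPred_eq]; omega⟩
    by_cases hyb : e.2 + 1 ≤ b
    · unfold ell at h1 h2
      obtain ⟨e', k1, k2⟩ := key (e.1 + 1, e.2 + 1) (by simp only; omega) (by simp only; omega) (by simp only; omega)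
        (by simp only [ell]; omega) (by simp only [ell]; omega) (by simp only; omega)
      exact ⟨e', k1, ((J.refl hein).step (by rw [tri_iff]; simp) k2.left).trans k2⟩
    · unfold ell at h1 h2
      obtain ⟨e', k1, k2⟩ := key (e.1, e.2 - 1) (by simp only; omega) (by simp only; omega) (by simp only; omega)
        (by simp only [ell]; omega) (by simp only [ell]; omega) (by simp only; omega)
      exact ⟨e', k1, ((J.refl hein).step (by rw [tri_iff]; simp) k2.left).trans k2⟩
  · exact key e hy h3 h4 h1 (by omega) (by omega)

theorem ext_V {e : V} {a b : ℤ} (h1 : -a ≤ ell e) (h2 : ell e ≤ a) (h3 : e.2 = b) (hb : 0 ≤ b) (ha : 4 ≤ a) :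
    ∃ e', e'.2 = b + 4 ∧ J (({e} ∪ ↑(Rn e)) ∩ {w | -(a + 3) ≤ ell w ∧ ell w ≤ a + 3 ∧ -(b + 4) ≤ w.2 ∧ w.2 ≤ b + 4}) e e' := by
  have hein : e ∈ ({e} ∪ ↑(Rn e) : Set V) ∩ {w | -(a + 3) ≤ ell w ∧ ell w ≤ a + 3 ∧ -(b + 4) ≤ w.2 ∧ w.2 ≤ b + 4} :=
    ⟨Or.inl rfl, by simp only [Set.mem_ofPred_eq]; omega⟩
  unfold ell at h1 h2
  have run : ∀ (d : V), (d = (1, 1) ∨ d = (0, 1)) → ∀ (n : ℕ) (e0 : V), n ≤ 4 → (-1 ≤ e0.1 - e.1 ∧ e0.1 - e.1 ≤ 1 ∧ -1 ≤ e0.2 - e.2 ∧ e0.2 - e.2 ≤ 1) →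
      e0.2 + n = b + 4 → (∀ k : ℤ, ¬ (2 ∣ e0.1 + k * d.1 ∧ 2 ∣ e0.2 + k * d.2)) → (∀ k : ℤ, 0 ≤ k → k ≤ n → -(a + 3) ≤ 2 * (e0.1 + k * d.1) - (e0.2 + k * d.2) ∧ 2 * (e0.1 + k * d.1) - (e0.2 + k * d.2) ≤ a + 3) →
      ∃ e', e'.2 = b + 4 ∧ J (({e} ∪ ↑(Rn e)) ∩ {w | -(a + 3) ≤ ell w ∧ ell w ≤ a + 3 ∧ -(b + 4) ≤ w.2 ∧ w.2 ≤ b + 4}) e0 e' := by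
    intro d hd n e0 hn k1 k2 k3 k4
    refine ⟨_, ?_, ray_in e0 d (by rw [tri_iff]; rcases hd with rfl | rfl <;> simp) n ?_⟩
    · rcases hd with rfl | rfl <;> simp only <;> omega
    · intro k hk0 hk1
      refine ⟨Or.inr (mem_Rn.2 ⟨?_, k3 k⟩), ?_⟩
      · rcases hd with rfl | rfl <;> simp only <;> omega
      · have := k4 k hk0 hk1
        rcases hd with rfl | rfl <;> simp only [ell, Set.mem_ofPred_eq] at * <;> omega
  by_cases hl : 2 * e.1 - e.2 < 0
  · by_cases hx : 2 ∣ e.1 - e.2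
    · obtain ⟨e', k1, k2⟩ := run (1, 1) (Or.inl rfl) 3 (e.1, e.2 + 1) (by norm_num) (by simp only; omega) (by simp only; push_cast; omega)
        (fun k => by simp only; omega) (fun k hk hk' => by push_cast at hk'; simp only; omega)
      exact ⟨e', k1, ((J.refl hein).step (by rw [tri_iff]; simp) k2.left).trans k2⟩
    · exact run (1, 1) (Or.inl rfl) 4 e (by norm_num) (by omega) (by push_cast; omega) (fun k => by simp only; omega) (fun k hk hk' => by push_cast at hk'; simp only; omega)
  · by_cases hx : 2 ∣ e.1
    · obtain ⟨e', k1, k2⟩ := run (0, 1) (Or.inr rfl) 3 (e.1 + 1, e.2 + 1) (by norm_num) (by simp only; omega) (by simp only; push_cast; omega)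
        (fun k => by simp only; omega) (fun k hk hk' => by push_cast at hk'; simp only; omega)
      exact ⟨e', k1, ((J.refl hein).step (by rw [tri_iff]; simp) k2.left).trans k2⟩
    · exact run (0, 1) (Or.inr rfl) 4 e (by norm_num) (by omega) (by push_cast; omega) (fun k => by simp only; omega) (fun k hk hk' => by push_cast at hk'; simp only; omega)

theorem ng_ell (v : V) : ell (ng v) = - ell v := by simp only [ell, ng]; ring
theorem ng_Rn {e w : V} (h : w ∈ Rn (ng e)) : ng w ∈ Rn e := by
  rw [mem_Rn] at *; simp only [ng] at *; omega

theorem J_ends {O : Set V} {B C : Set V} (hBC : B ⊆ C) {p e : V} {p' e' : V} (h : J (O ∩ B) p e) (h1 : J (({ng p} ∪ ↑(Rn (ng p))) ∩ ng ⁻¹' C) (ng p) p')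
    (h2 : J (({e} ∪ ↑(Rn e)) ∩ C) e e') : ∃ R : Finset V, R.card ≤ 882 ∧ (∀ v ∈ R, ¬ (2 ∣ v.1 ∧ 2 ∣ v.2)) ∧ J ((O ∪ ↑R) ∩ C) (ng p') e' := by
  classical
  refine ⟨Rn p ∪ Rn e, (Finset.card_union_le _ _).trans (by linarith [card_Rn p, card_Rn e]), ?_, ?_⟩
  · intro v hv
    rcases Finset.mem_union.1 hv with h | h <;> exact (mem_Rn.1 h).2
  · have k1 : J ((O ∪ ↑(Rn p ∪ Rn e)) ∩ C) (ng (ng p)) (ng p') := by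
      refine h1.map ng ng_adj ?_
      rintro w ⟨hw, hwC⟩
      refine ⟨?_, hwC⟩
      rcases hw with hw | hw
      · left
        have : w = ng p := hw
        rw [this, ng_ng]; exact h.left.1
      · right; exact Finset.mem_coe.2 (Finset.mem_union_left _ (ng_Rn hw))
    rw [ng_ng] at k1
    have k2 : J ((O ∪ ↑(Rn p ∪ Rn e)) ∩ C) p e := h.mono (fun w hw => Set.mem_inter (Or.inl hw.1) (hBC hw.2))
    have k3 : J ((O ∪ ↑(Rn p ∪ Rn e)) ∩ C) e e' := by
      refine h2.mono ?_
      rintro w ⟨hw, hwC⟩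
      refine ⟨?_, hwC⟩
      rcases hw with hw | hw
      · left
        have : w = e := hw
        rw [this]; exact h.right.1
      · right; exact Finset.mem_coe.2 (Finset.mem_union_right _ hw)
    exact k1.symm.trans (k2.trans k3)

theorem HEv_ext {O : Set V} {a b : ℤ} (hb : 1 ≤ b) (ha : 0 ≤ a) (h : HEv O a b (-b) b) :
    ∃ R : Finset V, R.card ≤ 882 ∧ (∀ v ∈ R, ¬ (2 ∣ v.1 ∧ 2 ∣ v.2)) ∧ HEv (O ∪ ↑R) (a + 12) b (-b) b := by
  obtain ⟨p, e, hJ, hp, he, h1, h2⟩ := h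
  have hpB : p ∈ HB a b := hJ.left.2
  have heB : e ∈ HB a b := hJ.right.2
  simp only [HB, Set.mem_ofPred_eq] at hpB heB
  obtain ⟨e', k1, k2⟩ := ext_H he heB.2.1 h1 h2 hb ha
  obtain ⟨p', l1, l2⟩ := ext_H (e := ng p) (a := a) (b := b) (by rw [ng_ell]; omega) (by rw [ng_ell]; omega) (by simp only [ng]; omega) (by simp only [ng]; omega) hb ha
  have hC : HB (a + 12) b ⊆ ng ⁻¹' HB (a + 12) b := by
    intro w hw
    simp only [HB, Set.mem_preimage, Set.mem_ofPred_eq, ng_ell] at *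
    simp only [ng]; omega
  obtain ⟨R, r1, r2, r3⟩ := J_ends (O := O) (B := HB a b) (C := HB (a + 12) b) (fun w hw => by simp only [HB, Set.mem_ofPred_eq] at *; omega) hJ
    (l2.mono (Set.inter_subset_inter_right _ hC)) k2
  have heC : e' ∈ HB (a + 12) b := r3.right.2
  simp only [HB, Set.mem_ofPred_eq] at heC
  exact ⟨R, r1, r2, ng p', e', r3, by rw [ng_ell]; omega, k1, heC.2.2.1, heC.2.2.2⟩

theorem VEv_ext {O : Set V} {a b : ℤ} (hb : 0 ≤ b) (ha : 4 ≤ a) (h : VEv O a b) :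
    ∃ R : Finset V, R.card ≤ 882 ∧ (∀ v ∈ R, ¬ (2 ∣ v.1 ∧ 2 ∣ v.2)) ∧ VEv (O ∪ ↑R) (a + 3) (b + 4) := by
  obtain ⟨p, e, hJ, hp, he⟩ := h
  have hpB := hJ.left.2
  have heB := hJ.right.2
  simp only [Set.mem_ofPred_eq] at hpB heB
  obtain ⟨e', k1, k2⟩ := ext_V heB.1 heB.2.1 (by omega) hb ha
  obtain ⟨p', l1, l2⟩ := ext_V (e := ng p) (a := a) (b := b) (by rw [ng_ell]; omega) (by rw [ng_ell]; omega) (by simp only [ng]; omega) hb ha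
  set C : Set V := {w | -(a + 3) ≤ ell w ∧ ell w ≤ a + 3 ∧ -(b + 4) ≤ w.2 ∧ w.2 ≤ b + 4} with hCdef
  have hC : C ⊆ ng ⁻¹' C := by
    intro w hw
    simp only [hCdef, Set.mem_preimage, Set.mem_ofPred_eq, ng_ell] at *
    simp only [ng]; omega
  obtain ⟨R, r1, r2, r3⟩ := J_ends (O := O) (C := C) (fun w hw => by simp only [hCdef, Set.mem_ofPred_eq] at *; omega) hJ
    (l2.mono (Set.inter_subset_inter_right _ hC)) k2
  exact ⟨R, r1, r2, ng p', e', r3, by simp only [ng]; omega, by omega⟩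

theorem HV_hex (O : Set V) {a b : ℤ} (ha : 0 ≤ a) (hb : 0 ≤ b) (h : ¬ HEv O a b (-b) b) : VEv Oᶜ (a + 1) b := by
  have hl : ∀ v, lf 2 v = ell v := fun v => by simp only [lf, ell]; ring
  rcases hex O 2 (-(a + 1)) (a + 1) (-b) b (Or.inr rfl) (by omega) (by omega) with ⟨p, e, h1, h2, h3⟩ | ⟨u, v, h1, h2, h3⟩
  · simp only [hl] at h1 h2 h3
    have he := h1.right.2
    simp only [Set.mem_ofPred_eq] at he
    exact absurd ⟨p, e, h1, by omega, by omega, he.2.2.1, he.2.2.2⟩ h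
  · simp only [hl] at h1
    exact ⟨u, v, h1, h2, h3⟩

theorem HV_sw {O : Set V} {b : ℤ} (hb : 0 ≤ b) (h : HEv O (3 * b) b (-b) b) : VEv (sw ⁻¹' O) (3 * b) b := by
  obtain ⟨p, e, hJ, hp, he, h1, h2⟩ := h
  have hpB := hJ.left.2
  simp only [HB, Set.mem_ofPred_eq] at hpB
  unfold ell at hp he
  obtain ⟨u, v, -, k2, k3, k4⟩ := hJ.strip (fun w => w.1) 1 (-b) b (fun u v h => by rw [tri_iff] at h; omega) (le_refl _) (by omega) (by omega) (by omega)
  refine ⟨sw u, sw v, ?_, by simp only [sw]; omega, by simp only [sw]; omega⟩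
  refine k2.map sw sw_adj ?_
  rintro w ⟨⟨hw1, hw2⟩, hw3⟩
  refine ⟨by simpa [sw_sw] using hw1, ?_⟩
  simp only [HB, Set.mem_ofPred_eq, ell, sw] at *
  omega

theorem VH_sw {O : Set V} {b : ℤ} (hb : 6 ≤ b) (h : VEv O (b - 1) (b - 4)) : HEv (sw ⁻¹' O) (b - 6) b (-b) b := by
  obtain ⟨u, v, hJ, hu, hv⟩ := h
  have hJ' : J (sw ⁻¹' O ∩ {w | -b ≤ w.2 ∧ w.2 ≤ b}) (sw u) (sw v) := by
    refine hJ.map sw sw_adj ?_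
    rintro w ⟨hw1, hw2⟩
    refine ⟨by simpa [sw_sw] using hw1, ?_⟩
    simp only [Set.mem_ofPred_eq, ell, sw] at *
    omega
  have huB := hJ.left.2
  have hvB := hJ.right.2
  simp only [Set.mem_ofPred_eq, ell] at huB hvB
  obtain ⟨u', v', -, k2, k3, k4⟩ := hJ'.strip ell 2 (-(b - 6) - 1) (b - 6) (fun u v h => ell_step h) (by norm_num) (by omega)
    (by simp only [ell, sw]; omega) (by simp only [ell, sw]; omega)
  have hv'B := k2.right
  simp only [Set.mem_inter_iff, Set.mem_ofPred_eq] at hv'B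
  refine ⟨u', v', k2.mono ?_, by omega, k4, hv'B.1.2.1, hv'B.1.2.2⟩
  rintro w ⟨⟨hw1, hw2⟩, hw3⟩
  refine ⟨hw1, ?_⟩
  simp only [HB, Set.mem_ofPred_eq] at *
  omega


/-- Crossing duality. -/
def Dual (μ : Law) (K : ℤ) : Prop := ∀ a b : ℤ, 8 ≤ a → 8 ≤ b → a ≤ K → b ≤ K →
  μ.P (fun O => VEv Oᶜ a b) ≤ μ.P (fun O => VEv O (a + 4) (b - 4))

theorem VEv_shrink {O : Set V} {a b a' b' : ℤ} (ha : a ≤ a') (hb : b' ≤ b) (hb' : 0 ≤ b') (h : VEv O a b) : VEv O a' b' := by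
  obtain ⟨u, v, hJ, hu, hv⟩ := h
  obtain ⟨u', v', -, k2, k3, k4⟩ := hJ.strip (fun w => w.2) 1 (-b') b' (fun u v h => by rw [tri_iff] at h; omega) (le_refl _) (by omega) (by omega) (by omega)
  refine ⟨u', v', k2.mono ?_, by omega, k4⟩
  rintro w ⟨⟨hw1, hw2⟩, hw3⟩
  refine ⟨hw1, ?_⟩
  simp only [Set.mem_ofPred_eq] at *
  omega

theorem step_max {P : ℤ → Prop} (a0 : ℤ) (n : ℕ) (h : P a0) : P (a0 + 4 * n) ∨ ∃ k : ℕ, k < n ∧ P (a0 + 4 * k) ∧ ¬ P (a0 + 4 * k + 4) := by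
  induction n with
  | zero => left; simpa using h
  | succ n ih =>
    rcases ih with ih | ⟨k, h1, h2⟩
    · by_cases h' : P (a0 + 4 * n + 4)
      · left; push_cast; rwa [show a0 + 4 * ((n : ℤ) + 1) = a0 + 4 * n + 4 by ring]
      · exact Or.inr ⟨n, by omega, ih, h'⟩
    · exact Or.inr ⟨k, by omega, h2⟩

theorem rhyp_law (hN : 2 ∣ N) {z : Bool} {p s s' δ : ℝ} (hp : 0 ≤ p ∧ p ≤ 1) (hs : 0 ≤ s ∧ s ≤ 1) (hδ : 0 ≤ δ ∧ δ ≤ 1) (hs' : 0 ≤ s' ∧ s' ≤ 1)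
    (he : s' = s * (1 - δ)) {L : ℤ} (hd : Dual (law (N := N) z p s hp hs) (5 * L)) :
    RHyp (law (N := N) z p s' hp hs') (δ ^ 882 / 4) 32 L := by
  intro b hb _ hbL
  set μ := law (N := N) z p s hp hs with hμ
  set μ' := law (N := N) z p s' hp hs' with hμ'
  have hδ1 : δ ^ 882 ≤ 1 := pow_le_one₀ hδ.1 hδ.2
  have hδ0 : 0 ≤ δ ^ 882 := pow_nonneg hδ.1 _
  have mono' : ∀ {A : Set V → Prop}, Inc A → μ.P A ≤ μ'.P A := by
    intro A hA
    have := sprinkle (N := N) hN (z := z) hp hs hδ hs' he 0 hA (A := A) fun O h => ⟨∅, by simp, by simp, by simpa using h⟩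
    simpa using this
  have hd1 : ∀ a b, 7 ≤ a → 8 ≤ b → a ≤ 5 * L - 1 → b ≤ 5 * L → 1 ≤ μ.P (fun O => HEv O a b (-b) b) + μ.P (fun O => VEv O (a + 5) (b - 4)) := by
    intro a b h1 h2 h3 h4
    have k1 := hd (a + 1) b (by omega) h2 (by omega) h4
    rw [show a + 1 + 4 = a + 5 by ring] at k1
    have k2 := μ.nt (fun O => HEv O a b (-b) b)
    have k3 : μ.P (fun O => ¬ HEv O a b (-b) b) ≤ μ.P (fun O => VEv Oᶜ (a + 1) b) := μ.mono fun O h => HV_hex O (by omega) (by omega) h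
    linarith
  have hv : 1 / 2 ≤ μ.P (fun O => VEv O (3 * b + 17) b) := by
    have k1 := hd1 (3 * (b + 4)) (b + 4) (by omega) (by omega) (by omega) (by omega)
    have k2 : μ.P (fun O => HEv O (3 * (b + 4)) (b + 4) (-(b + 4)) (b + 4)) ≤ μ.P (fun O => VEv O (3 * b + 17) b) := by
      rw [← μ.isw (fun O => VEv O (3 * b + 17) b)]
      exact μ.mono fun O h => VEv_shrink (by omega) (by omega) (by omega) (HV_sw (by omega) h)
    rw [show 3 * (b + 4) + 5 = 3 * b + 17 by ring, show b + 4 - 4 = b by ring] at k1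
    linarith
  have hh : 1 / 2 ≤ μ.P (fun O => HEv O (b - 6) b (-b) b) := by
    have k1 := hd1 (b - 6) b (by omega) (by omega) (by omega) (by omega)
    have k2 : μ.P (fun O => VEv O (b - 1) (b - 4)) ≤ μ.P (fun O => HEv O (b - 6) b (-b) b) := by
      rw [← μ.isw (fun O => HEv O (b - 6) b (-b) b)]
      exact μ.mono fun O h => VH_sw (by omega) h
    rw [show b - 6 + 5 = b - 1 by ring] at k1
    linarith
  obtain ⟨a0, ha0⟩ : ∃ a0, a0 = 4 * ((b - 6) / 4) := ⟨_, rfl⟩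
  obtain ⟨n, hn⟩ : ∃ n : ℕ, (n : ℤ) = (3 * b + 20) / 4 - (b - 6) / 4 := Int.eq_ofNat_of_zero_le (by omega) |>.imp fun _ h => h.symm
  have hP0 : 1 / 4 ≤ μ.P (fun O => HEv O a0 b (-b) b) := by
    refine le_trans (by linarith) (hh.trans (μ.mono fun O h => ?_))
    obtain ⟨p, e, hJ, h1, h2, -, -⟩ := h
    by_cases hab : a0 = b - 6
    · have heB := hJ.right.2
      simp only [HB, Set.mem_ofPred_eq] at heB
      rw [hab]; exact ⟨p, e, hJ, h1, h2, heB.2.2⟩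
    obtain ⟨u, v, -, k2, k3, k4⟩ := hJ.strip ell 2 (-a0 - 1) a0 (fun u v h => ell_step h) (by norm_num) (by omega) (by omega) (by omega)
    have hvB := k2.right
    simp only [HB, Set.mem_inter_iff, Set.mem_ofPred_eq] at hvB
    refine ⟨u, v, k2.mono ?_, by omega, k4, hvB.1.2.2.2⟩
    rintro w ⟨⟨hw1, hw2⟩, hw3⟩
    refine ⟨hw1, ?_⟩
    simp only [HB, Set.mem_ofPred_eq] at *
    omega
  rcases step_max (P := fun a => 1 / 4 ≤ μ.P (fun O => HEv O a b (-b) b)) a0 n hP0 with h | ⟨k, hk, h1, h2⟩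
  · refine ⟨a0 + 4 * n, by omega, by omega, by omega, ?_, ?_⟩
    · exact le_trans (by linarith) (h.trans (mono' (inc_HEv _ _ _ _)))
    · refine le_trans (b := 1 / 2) (by linarith) (hv.trans ((μ.mono fun O h => ?_).trans (mono' (inc_VEv _ _))))
      exact VEv_shrink (by omega) (le_refl _) (by omega) h
  · refine ⟨a0 + 4 * k + 12, by omega, by omega, by omega, ?_, ?_⟩
    · have := sprinkle (N := N) hN (z := z) hp hs hδ hs' he 882 (inc_HEv (a0 + 4 * k + 12) b (-b) b) (A := fun O => HEv O (a0 + 4 * k) b (-b) b)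
        fun O h => HEv_ext (by omega) (by omega) h
      refine le_trans ?_ this
      have := mul_le_mul_of_nonneg_left h1 hδ0
      linarith
    · have := sprinkle (N := N) hN (z := z) hp hs hδ hs' he 882 (inc_VEv (a0 + 4 * k + 12) b) (A := fun O => VEv O (a0 + 4 * k + 9) (b - 4))
        fun O h => by
          have := VEv_ext (by omega) (by omega) h
          rwa [show a0 + 4 * k + 9 + 3 = a0 + 4 * k + 12 by ring, show b - 4 + 4 = b by ring] at this
      refine le_trans ?_ this
      have k1 := hd1 (a0 + 4 * k + 4) b (by omega) (by omega) (by omega) (by omega)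
      rw [show a0 + 4 * k + 4 + 5 = a0 + 4 * k + 9 by ring] at k1
      have h3 : 1 / 4 ≤ μ.P (fun O => VEv O (a0 + 4 * k + 9) (b - 4)) := by linarith
      have := mul_le_mul_of_nonneg_left h3 hδ0
      linarith

theorem base_law (hN : 2 ∣ N) {z : Bool} {p s s' δ : ℝ} (hp : 0 ≤ p ∧ p ≤ 1) (hs : 0 ≤ s ∧ s ≤ 1) (hδ : 0 ≤ δ ∧ δ ≤ 1) (hs' : 0 ≤ s' ∧ s' ≤ 1)
    (he : s' = s * (1 - δ)) : δ ^ 882 ≤ (law (N := N) z p s' hp hs').P (fun O => CEv O 4) := by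
  have := sprinkle (N := N) hN (z := z) hp hs hδ hs' he 882 (inc_CEv 4) (A := fun _ => True) ?_
  · rwa [Law.tt, mul_one] at this
  intro O _
  refine ⟨Rn 0, (card_Rn _).trans (by norm_num), fun v hv => (mem_Rn.1 hv).2, ?_⟩
  have row : ∀ (U : Set V), (∀ w : V, -10 ≤ w.1 → w.1 ≤ 10 → w.2 = 5 → w ∈ U) → Strip U 4 := by
    intro U hU
    refine ⟨(-8, 5), _, ray_in (-8, 5) (1, 0) (by rw [tri_iff]; simp) 16 ?_, by norm_num, by norm_num⟩
    intro k h1 h2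
    push_cast at h2
    refine ⟨hU _ (by simp only; omega) (by simp only; omega) (by simp), ?_⟩
    simp only [Set.mem_ofPred_eq]; omega
  have z1 : (0 : V).1 = 0 := rfl
  have z2 : (0 : V).2 = 0 := rfl
  refine ⟨row _ ?_, row _ ?_, row _ ?_, row _ ?_⟩ <;> intro w h1 h2 h3 <;> refine Or.inr (mem_Rn.2 ?_) <;> rw [z1, z2] <;> (try simp only [ng, sw]) <;> omega
end
end DaC

namespace DaC
section
/-! ### The exploration of arms on the torus -/
variable {N : ℕ}
def nbT (N : ℕ) (a b : Vt N) : Prop := ∃ u v, TriAdj u v ∧ pj N u = a ∧ pj N v = b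
def Bk (N : ℕ) (k : ℤ) : Set (Vt N) := pj N '' {u | nrm u = k}

theorem nb_lift {a : Vt N} {w : V} (h : nbT N a (pj N w)) : ∃ w', pj N w' = a ∧ TriAdj w' w := by
  obtain ⟨u, v, h1, h2, h3⟩ := h
  refine ⟨tr (df v w) u, ?_, ?_⟩
  · rw [pj_tr, h2]
    have : pj N (df v w) = pj N w - pj N v := by simp [pj, df]
    rw [this, h3]; simp
  · have := tr_adj (df v w) u v h1
    have e : tr (df v w) v = w := by simp [tr, df]
    rwa [e] at this

theorem path_lift {X : Set (Vt N)} {u0 v : Vt N} (hu : u0 ∈ X) (h : Relation.ReflTransGen (fun a b => nbT N a b ∧ b ∈ X) u0 v) :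
    ∀ w, pj N w = v → ∃ u, pj N u = u0 ∧ J (pj N ⁻¹' X) u w := by
  induction h with
  | refl => exact fun w hw => ⟨w, hw, J.refl (by rw [Set.mem_preimage, hw]; exact hu)⟩
  | tail _ h2 ih =>
    rintro w rfl
    obtain ⟨w', h3, h4⟩ := nb_lift h2.1
    obtain ⟨u, h5, h6⟩ := ih w' h3
    exact ⟨u, h5, h6.step h4 h2.2⟩

theorem PP_lift {X : Set (Vt N)} {k : ℤ} {w : V} (h : pj N w ∈ PP (nbT N) (Bk N k) X) :
    ∃ u0 u w', nrm u0 = k ∧ pj N u0 = pj N u ∧ (u = w ∨ (nrm (df w w') ≤ 1 ∧ J (pj N ⁻¹' X) w' u)) := by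
  rcases h with ⟨u0, hu0, h⟩ | ⟨w1, ⟨b, ⟨u0, hu0, rfl⟩, h2, h3⟩, h4⟩
  · exact ⟨u0, w, w, hu0, h, Or.inl rfl⟩
  · obtain ⟨w', h5, h6⟩ := nb_lift h4
    obtain ⟨u, h7, h8⟩ := path_lift h2 h3 w' h5
    refine ⟨u0, u, w', hu0, h7.symm, Or.inr ⟨?_, h8.symm⟩⟩
    rw [nrm_le]; rw [tri_iff] at h6; simp only [df]; omega

theorem Arm_KK {X : Set (Vt N)} {k n : ℤ} (hk : 1 ≤ k) (hkn : k ≤ n) : Arm n (pj N ⁻¹' Xᶜ) ↔ Arm n (pj N ⁻¹' (KK (nbT N) (Bk N k) X)ᶜ) := by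
  have hKX : KK (nbT N) (Bk N k) X ⊆ X := by
    rintro v ⟨u, _, hu, h⟩
    induction h with
    | refl => exact hu
    | tail _ h _ => exact h.2
  constructor
  · rintro ⟨p, e, h1, h2, h3⟩
    refine ⟨p, e, h1, ?_, h3⟩
    simp only [← Set.preimage_compl, compl_compl] at h2 ⊢
    obtain ⟨v, hv, hv'⟩ := h2.first nrm 1 k nrm_step (by omega) (by omega)
    have hvk : nrm v = k := by
      have := hv.right.2; simp only [Set.mem_ofPred_eq] at this; omega
    have hv1 : J (pj N ⁻¹' X) p v := hv.mono Set.inter_subset_left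
    refine h2.comp.mono fun w hw => ?_
    have hvw : J (pj N ⁻¹' X) v w := hv1.symm.trans hw
    refine ⟨pj N v, ⟨v, hvk, rfl⟩, hv1.right, ?_⟩
    exact Relation.ReflTransGen.lift (pj N) (fun a b h => (⟨⟨a, b, h.1, rfl, rfl⟩, h.2⟩ : nbT N (pj N a) (pj N b) ∧ pj N b ∈ X)) v w hvw.2
  · rintro ⟨p, e, h1, h2, h3⟩
    refine ⟨p, e, h1, h2.mono ?_, h3⟩
    simp only [← Set.preimage_compl, compl_compl]
    exact Set.preimage_mono hKX

variable [NeZero N]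
/-- Probability that a point has a long arm. -/
theorem arm_at {z : Bool} {p s : ℝ} (hp : 0 ≤ p ∧ p ≤ 1) (hs : 0 ≤ s ∧ s ≤ 1) {R : ℤ} {α : ℝ} (hα : (law (N := N) z p s hp hs).P (Arm (R - 2)) ≤ α) (w : V) :
    pr (qq N p s) (fun ω => ∃ w' u, nrm (df w w') ≤ 1 ∧ J (O z ω)ᶜ w' u ∧ R ≤ nrm (df w u)) ≤ 9 * α := by
  have hq := Pq_qq N hp hs
  have key : ∀ t : V, pr (qq N p s) (fun ω => ∃ u, J (O z ω)ᶜ (tr t w) u ∧ R - 1 ≤ nrm (df (tr t w) u)) ≤ α := by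
    intro t
    set c : V := (2 * ((tr t w).1 / 2), 2 * ((tr t w).2 / 2)) with hc
    refine le_trans ?_ hα
    rw [← (law (N := N) z p s hp hs).iT c.1 c.2 ⟨_, rfl⟩ ⟨_, rfl⟩]
    refine pr_mono hq fun ω ⟨u, h1, h2⟩ => ?_
    refine ⟨df c (tr t w), df c u, ?_, ?_, ?_⟩
    · rw [nrm_le]; simp only [df, hc]; omega
    · refine h1.map (df c) (fun a b h => ?_) ?_
      · rw [tri_iff] at *; simp only [df]; omega
      · intro v hv
        have : tr (c.1, c.2) (df c v) = v := by simp [tr, df]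
        show ¬ (tr (c.1, c.2) (df c v) ∈ O z ω)
        rw [this]; exact hv
    · have e1 : nrm (df c (tr t w)) ≤ 1 := by rw [nrm_le]; simp only [df, hc]; omega
      have e2 := nrm_tri' (df (tr t w) u) (df c u)
      have e3 : df (df (tr t w) u) (df c u) = df c (tr t w) := by simp [df]
      rw [e3] at e2; omega
  have h9 : ((bl 1).card : ℝ) = 9 := by rw [card_bl (by norm_num)]; norm_num
  calc _ ≤ pr (qq N p s) (fun ω => ∃ t ∈ bl 1, ∃ u, J (O z ω)ᶜ (tr t w) u ∧ R - 1 ≤ nrm (df (tr t w) u)) := by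
        refine pr_mono hq fun ω ⟨w', u, h1, h2, h3⟩ => ⟨df w w', mem_bl.2 h1, u, ?_, ?_⟩
        · have : tr (df w w') w = w' := by simp [tr, df]
          rwa [this]
        · have : tr (df w w') w = w' := by simp [tr, df]
          rw [this]
          have e2 := nrm_tri' (df w u) (df w' u)
          have e3 : df (df w u) (df w' u) = df w' w := by simp [df]
          have e4 : nrm (df w' w) ≤ 1 := by rw [nrm_le] at *; simp only [df] at *; omega
          rw [e3] at e2; omega
    _ ≤ ∑ t ∈ bl 1, α := (pr_exists hq _ _).trans (Finset.sum_le_sum fun t _ => key t)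
    _ = 9 * α := by rw [Finset.sum_const, nsmul_eq_mul, h9]

theorem compl_O (z : Bool) (ω : It N → Bool) : (O z ω)ᶜ = pj N ⁻¹' (Zt N z ∪ colS (enT N) (idT N) ω) := by
  ext v
  show ¬ ¬ _ ↔ _
  rw [not_not]; rfl

theorem PP_prob {z : Bool} {p s : ℝ} (hp : 0 ≤ p ∧ p ≤ 1) (hs : 0 ≤ s ∧ s ≤ 1) {R : ℤ} {α : ℝ} (hα : (law (N := N) z p s hp hs).P (Arm (R - 2)) ≤ α)
    {n k : ℤ} {w : V} (hR1 : 1 ≤ R) (hkn : k ≤ n) (hw : nrm w + R + n ≤ N) :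
    pr (qq N p s) (fun ω => pj N w ∈ PP (nbT N) (Bk N k) (Zt N z ∪ colS (enT N) (idT N) ω)) ≤ ind (nrm w - R < k ∧ k < nrm w + R) + 9 * α := by
  have hq := Pq_qq N hp hs
  have h9 := arm_at hp hs hα w
  have hα0 : 0 ≤ α := le_trans ((law (N := N) z p s hp hs).nonneg _) hα
  by_cases hc : nrm w - R < k ∧ k < nrm w + R
  · rw [ind_true hc]
    linarith [pr_le_one hq (fun ω => pj N w ∈ PP (nbT N) (Bk N k) (Zt N z ∪ colS (enT N) (idT N) ω))]
  · rw [ind_false hc, zero_add]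
    refine le_trans (pr_mono hq fun ω h => ?_) h9
    obtain ⟨u0, u, w', h1, h2, h3⟩ := PP_lift h
    have hR : R ≤ nrm (df w u) := by
      by_contra hcon
      have e1 := nrm_tri w u
      have := pj_inj_small (M := 0) h2 (by omega)
      subst this
      have e2 := nrm_tri' w u0
      omega
    rw [compl_O]
    rcases h3 with rfl | ⟨h3, h4⟩
    · have : nrm (df u u) = 0 := by simp [df, nrm]
      omega
    · exact ⟨w', u, h3, h4, hR⟩
end
end DaC

namespace DaC
section
variable {N : ℕ} [NeZero N]

theorem small_rep (x : Vt N) : ∃ w : V, pj N w = x ∧ 2 * nrm w ≤ N := by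
  refine ⟨(x.1.valMinAbs, x.2.valMinAbs), by simp [pj], ?_⟩
  have h1 := ZMod.natAbs_valMinAbs_le x.1
  have h2 := ZMod.natAbs_valMinAbs_le x.2
  have : nrm (x.1.valMinAbs, x.2.valMinAbs) ≤ N / 2 := by
    rw [nrm_le]; simp only; omega
  omega

theorem sum_ind (a R : ℤ) (hR : 1 ≤ R) (s : Finset ℤ) : ∑ k ∈ s, ind (a - R < k ∧ k < a + R) ≤ 2 * R := by
  classical
  have : ∑ k ∈ s, ind (a - R < k ∧ k < a + R) ≤ ((Finset.Ioo (a - R) (a + R)).card : ℝ) := by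
    have e : ∑ k ∈ s, ind (a - R < k ∧ k < a + R) = ((s.filter (fun k => a - R < k ∧ k < a + R)).card : ℝ) := by
      rw [Finset.card_filter]; push_cast
      refine Finset.sum_congr rfl fun k _ => ?_
      by_cases h : a - R < k ∧ k < a + R <;> simp [ind, h]
    rw [e]
    exact_mod_cast Finset.card_le_card fun k hk => by
      rw [Finset.mem_filter] at hk; rw [Finset.mem_Ioo]; exact hk.2
  refine this.trans ?_
  rw [Int.card_Ioo]
  have h2 : ((a + R - (a - R) - 1).toNat : ℤ) ≤ 2 * R := by omega
  exact_mod_cast h2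

def Rev (z : Bool) (k : ℤ) (x : Vt N) (y : It N → Bool) : Prop :=
  (cl (enT N) y x ∩ PP (nbT N) (Bk N k) (Zt N z ∪ colS (enT N) (idT N) y)).Nonempty

theorem rev_sum {z : Bool} {p s : ℝ} (hp : 0 ≤ p ∧ p ≤ 1) (hs : 0 ≤ s ∧ s ≤ 1) {R m n : ℤ} {α τ : ℝ}
    (hα : (law (N := N) z p s hp hs).P (Arm (R - 2)) ≤ α) (hτ : ∀ u, pr (qq N p s) (fun ω => Far m u (lft ω)) ≤ τ)
    (hR1 : 1 ≤ R) (hm : 0 ≤ m) (hn : 1 ≤ n) (hN : 2 * (m + R + n) ≤ N) (x : Vt N) :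
    ∑ k ∈ Finset.Icc 1 n, pr (qq N p s) (Rev z k x) ≤ n * τ + (2 * m + 1) ^ 2 * (2 * R + 9 * n * α) := by
  have hq := Pq_qq N hp hs
  obtain ⟨w, rfl, hw⟩ := small_rep x
  have key : ∀ k ∈ Finset.Icc 1 n, pr (qq N p s) (Rev z k (pj N w)) ≤
      τ + ∑ t ∈ bl m, (ind (nrm (tr t w) - R < k ∧ k < nrm (tr t w) + R) + 9 * α) := by
    intro k hk
    rw [Finset.mem_Icc] at hk
    have h1 : pr (qq N p s) (Rev z k (pj N w)) ≤ pr (qq N p s) (fun ω => Far m w (lft ω) ∨ ∃ t ∈ bl m, pj N (tr t w) ∈ PP (nbT N) (Bk N k) (Zt N z ∪ colS (enT N) (idT N) ω)) := by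
      refine pr_mono hq ?_
      rintro ω ⟨x, hx, hx'⟩
      rw [cl_T] at hx
      obtain ⟨w', hw', rfl⟩ := hx
      by_cases hf : m ≤ nrm (df w w')
      · exact Or.inl ⟨w', hw', hf⟩
      · refine Or.inr ⟨df w w', mem_bl.2 (by omega), ?_⟩
        have : tr (df w w') w = w' := by simp [tr, df]
        rwa [this]
    refine h1.trans ((pr_or hq _ _).trans (add_le_add (hτ w) ((pr_exists hq _ _).trans (Finset.sum_le_sum fun t ht => ?_))))
    refine PP_prob hp hs hα (n := n) hR1 hk.2 ?_
    have e1 := nrm_tri w (tr t w)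
    have e2 : df w (tr t w) = t := by simp [df, tr]
    rw [e2] at e1
    have := mem_bl.1 ht
    omega
  refine (Finset.sum_le_sum key).trans ?_
  have hcard : ((Finset.Icc 1 n).card : ℝ) = n := by
    rw [Int.card_Icc]; have : ((n + 1 - 1).toNat : ℤ) = n := by omega
    exact_mod_cast this
  rw [Finset.sum_add_distrib, Finset.sum_const, nsmul_eq_mul, hcard, Finset.sum_comm]
  have : ∑ t ∈ bl m, ∑ k ∈ Finset.Icc 1 n, (ind (nrm (tr t w) - R < k ∧ k < nrm (tr t w) + R) + 9 * α) ≤ ∑ t ∈ bl m, (2 * R + 9 * n * α : ℝ) := by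
    refine Finset.sum_le_sum fun t _ => ?_
    rw [Finset.sum_add_distrib, Finset.sum_const, nsmul_eq_mul, hcard]
    have := sum_ind (nrm (tr t w)) R hR1 (Finset.Icc 1 n)
    linarith
  rw [Finset.sum_const, nsmul_eq_mul, card_bl hm] at this
  linarith

noncomputable def fA (z : Bool) (n : ℤ) (ω : It N → Bool) : ℝ := ind (Arm n (O z ω))

theorem fA_01 (z : Bool) (n : ℤ) (ω : It N → Bool) : 0 ≤ fA z n ω ∧ fA z n ω ≤ 1 := ⟨ind_nonneg _, ind_le_one _⟩

theorem osss_avg {z : Bool} {p s : ℝ} (hp : 0 ≤ p ∧ p ≤ 1) (hs : 0 ≤ s ∧ s ≤ 1) {R m n : ℤ} {α τ : ℝ}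
    (hα : (law (N := N) z p s hp hs).P (Arm (R - 2)) ≤ α) (hτ : ∀ u, pr (qq N p s) (fun ω => Far m u (lft ω)) ≤ τ)
    (hR1 : 1 ≤ R) (hm : 0 ≤ m) (hn : 1 ≤ n) (hN : 2 * (m + R + n) ≤ N) :
    n * (ex (qq N p s) (fA z n) - ex (qq N p s) (fA z n) * ex (qq N p s) (fA z n)) ≤
      2 * (n * τ + (2 * m + 1) ^ 2 * (2 * R + 9 * n * α)) * ∑ i, infl (qq N p s) (fA z n) i := by
  classical
  have hq := Pq_qq N hp hs
  set Δ : ℝ := n * τ + (2 * m + 1) ^ 2 * (2 * R + 9 * n * α)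
  have hrev := rev_sum (N := N) hp hs hα hτ hR1 hm hn hN
  have hcard : ((Finset.Icc 1 n).card : ℝ) = n := by
    rw [Int.card_Icc]; have : ((n + 1 - 1).toNat : ℤ) = n := by omega
    exact_mod_cast this
  have h1 : ∀ k ∈ Finset.Icc 1 n, ex (qq N p s) (fA z n) - ex (qq N p s) (fA z n) * ex (qq N p s) (fA z n) ≤
      ∑ i, pr (qq N p s) (fun y => i ∈ QQ (enT N) (nbT N) (Bk N k) (fun ω => Zt N z ∪ colS (enT N) (idT N) ω) y) * infl (qq N p s) (fA z n) i := by
    intro k hk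
    rw [Finset.mem_Icc] at hk
    have := dac_osss (en := enT N) (nbT N) (Bk N k) (idT_inj N) hq (Zt N z) (fA z n) (fun X => ind (Arm n (pj N ⁻¹' Xᶜ)))
      (fun X => ⟨ind_nonneg _, ind_le_one _⟩) (fun ω => rfl) (fun X => ind_congr (Arm_KK hk.1 hk.2))
    have e : (fun y : It N → Bool => fA z n y * fA z n y) = fA z n := by
      funext y
      unfold fA; rw [← ind_and]; exact ind_congr (and_self_iff)
    rw [e] at this
    exact (le_abs_self _).trans this
  have h2 := Finset.sum_le_sum h1
  rw [Finset.sum_const, nsmul_eq_mul, hcard, Finset.sum_comm] at h2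
  refine h2.trans ?_
  rw [Finset.mul_sum]
  refine Finset.sum_le_sum fun i _ => ?_
  rw [← Finset.sum_mul]
  refine mul_le_mul_of_nonneg_right ?_ (infl_nonneg hq _ _)
  have hΔ : 0 ≤ Δ := le_trans (Finset.sum_nonneg fun k _ => pr_nonneg hq _) (hrev 0)
  cases i with
  | inr v =>
    have : ∑ k ∈ Finset.Icc 1 n, pr (qq N p s) (fun y => Sum.inr v ∈ QQ (enT N) (nbT N) (Bk N k) (fun ω => Zt N z ∪ colS (enT N) (idT N) ω) y) ≤ Δ := hrev v
    linarith
  | inl e =>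
    have : ∀ k ∈ Finset.Icc 1 n, pr (qq N p s) (fun y => Sum.inl e ∈ QQ (enT N) (nbT N) (Bk N k) (fun ω => Zt N z ∪ colS (enT N) (idT N) ω) y) ≤
        pr (qq N p s) (Rev z k (enT N e).1) + pr (qq N p s) (Rev z k (enT N e).2) := by
      intro k _
      refine le_trans (pr_mono hq ?_) (pr_or hq _ _)
      rintro ω ⟨a, b, hab, h⟩
      rcases hab with hab | hab
      · left; rw [hab]; exact h
      · right; rw [hab]; exact h
    have h3 := Finset.sum_le_sum this
    rw [Finset.sum_add_distrib] at h3
    linarith [hrev (enT N e).1, hrev (enT N e).2]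

theorem fA_mono (z : Bool) (n : ℤ) (v : Vt N) (ω : It N → Bool) : fA z n (st (.inr v) false ω) ≤ fA z n (st (.inr v) true ω) := by
  refine ind_mono fun h => ?_
  obtain ⟨p, e, h1, h2, h3⟩ := h
  refine ⟨p, e, h1, h2.mono ?_, h3⟩
  rw [compl_O, compl_O]
  refine Set.preimage_mono (Set.union_subset_union_right _ fun x hx => ?_)
  have hcl : ∀ c, cl (enT N) (st (.inr v) c ω) x = cl (enT N) ω x := fun c => cl_congr (fun e => st_inl _ _ _ _) x
  have hr : rep (enT N) (idT N) (st (.inr v) true ω) x = rep (enT N) (idT N) (st (.inr v) false ω) x :=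
    rep_congr (idT_inj N) (by rw [hcl, hcl])
  simp only [colS, Set.mem_ofPred_eq] at hx ⊢
  rw [hr]
  by_cases hv : rep (enT N) (idT N) (st (.inr v) false ω) x = v
  · rw [hv, st_same]
  · rw [st_ne (by simpa using hv)] at hx ⊢; exact hx

theorem infl_sum {z : Bool} {p s : ℝ} (hp : 0 ≤ p ∧ p ≤ 1) (hs : 0 ≤ s ∧ s ≤ 1) {m n : ℤ} {τ : ℝ}
    (hτ : ∀ u, pr (qq N p s) (fun ω => Far m u (lft ω)) ≤ τ) (hm : 0 ≤ m) :
    ∑ i, infl (qq N p s) (fA (N := N) z n) i ≤ (1 + 6 * (2 * m + 1) ^ 2) * (∑ v, ex (qq N p s) (piv (fA z n) v)) + 6 * N ^ 2 * τ := by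
  classical
  have hq := Pq_qq N hp hs
  set f := fA (N := N) z n
  set π : Vt N → ℝ := fun v => ex (qq N p s) (piv f v) with hπ
  have hπ0 : ∀ v, 0 ≤ π v := fun v => ex_nonneg hq fun _ => abs_nonneg _
  let A : Vt N → Finset (Vt N) := fun x => (bl m).image (fun t => x + pj N t)
  have hA : ∀ x, pr (qq N p s) (fun ω => ¬ cl (enT N) ω x ⊆ (A x : Set (Vt N))) ≤ τ := by
    intro x
    obtain ⟨u, rfl⟩ := pj_surj N x
    refine le_trans (pr_mono hq fun ω h => ?_) (hτ u)
    rw [Set.not_subset] at h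
    obtain ⟨y, hy, hyA⟩ := h
    rw [cl_T] at hy
    obtain ⟨w, hw, rfl⟩ := hy
    refine ⟨w, hw, ?_⟩
    by_contra hc
    refine hyA (Finset.mem_coe.2 (Finset.mem_image.2 ⟨df u w, mem_bl.2 (by omega), ?_⟩))
    simp [pj, df]
  have hAs : ∀ x, ∑ r ∈ A x, π r ≤ ∑ t ∈ bl m, π (x + pj N t) := fun x =>
    Finset.sum_image_le_of_nonneg (fun _ _ => hπ0 _)
  have hsh : ∀ c : Vt N, ∑ x : Vt N, ∑ t ∈ bl m, π (x + c + pj N t) = (2 * m + 1) ^ 2 * ∑ v, π v := by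
    intro c
    rw [Finset.sum_comm]
    have : ∀ t ∈ bl m, ∑ x : Vt N, π (x + c + pj N t) = ∑ v, π v := by
      intro t _
      have := Equiv.sum_comp (Equiv.addRight (c + pj N t)) π
      simp only [Equiv.coe_addRight, ← add_assoc] at this
      exact this
    rw [Finset.sum_congr rfl this, Finset.sum_const, nsmul_eq_mul, card_bl hm]
  have hE : ∀ e : Vt N × Fin 3, infl (qq N p s) f (.inl e) ≤ ∑ t ∈ bl m, π (e.1 + 0 + pj N t) + ∑ t ∈ bl m, π (e.1 + pj N (dir e.2) + pj N t) + 2 * τ := by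
    intro e
    have := edge_infl (en := enT N) (idT_inj N) hq (fun X => ind (Arm n (Os z X))) (f := f) (fun ω => rfl) (fA_01 z n) (e := e) (Or.inl rfl)
      (A (enT N e).1) (A (enT N e).2)
    refine this.trans ?_
    have h1 := hAs (enT N e).1
    have h2 := hAs (enT N e).2
    have h3 := hA (enT N e).1
    have h4 := hA (enT N e).2
    simp only [enT, add_zero] at *
    linarith
  have hV : ∀ v, infl (qq N p s) f (.inr v) ≤ π v := by
    intro v
    have h0 := hπ0 v
    have : infl (qq N p s) f (.inr v) = s * (1 - s) * π v := rfl
    rw [this]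
    nlinarith [mul_nonneg hs.1 (sub_nonneg.2 hs.2), sq_nonneg s]
  rw [Fintype.sum_sum_type]
  have e1 : ∑ e, infl (qq N p s) f (.inl e) ≤ 6 * (2 * m + 1) ^ 2 * ∑ v, π v + 6 * N ^ 2 * τ := by
    refine (Finset.sum_le_sum fun e _ => hE e).trans ?_
    rw [Fintype.sum_prod_type_right]
    have : ∀ d : Fin 3, ∑ x : Vt N, (∑ t ∈ bl m, π (x + 0 + pj N t) + ∑ t ∈ bl m, π (x + pj N (dir d) + pj N t) + 2 * τ) =
        2 * ((2 * m + 1) ^ 2 * ∑ v, π v) + N ^ 2 * (2 * τ) := by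
      intro d
      rw [Finset.sum_add_distrib, Finset.sum_add_distrib, hsh, hsh, Finset.sum_const, nsmul_eq_mul]
      simp [Finset.card_univ, ZMod.card, Fintype.card_prod]; ring
    simp only [this]
    rw [Finset.sum_const, nsmul_eq_mul]
    simp; linarith
  have e2 : ∑ v, infl (qq N p s) f (.inr v) ≤ ∑ v, π v := Finset.sum_le_sum fun v _ => hV v
  have e3 : ∑ v, π v = ∑ v, ex (qq N p s) (piv f v) := rfl
  linarith

theorem fA_deriv (z : Bool) (p s : ℝ) (n : ℤ) :
    HasDerivAt (fun t => ex (qq N p t) (fA z n)) (∑ v, ex (qq N p s) (piv (fA (N := N) z n) v)) s := by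
  have := russo (fun t => qq N p t) (Sum.elim (fun _ => 0) (fun _ => 1)) s (fun i => by
    cases i with
    | inl e => exact hasDerivAt_const _ _
    | inr v => exact hasDerivAt_id _) (fA (N := N) z n)
  rw [Fintype.sum_sum_type] at this
  simp only [Sum.elim_inl, Sum.elim_inr, zero_mul, one_mul, Finset.sum_const_zero, zero_add] at this
  have e : ∀ v, ex (qq N p s) (piv (fA (N := N) z n) v) = ex (qq N p s) (fun ω => fA z n (st (.inr v) true ω) - fA z n (st (.inr v) false ω)) := fun v =>
    ex_congr (qq N p s) fun ω => abs_of_nonneg (sub_nonneg.2 (fA_mono z n v ω))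
  simp only [e]
  exact this
end
end DaC

namespace DaC
section

theorem ode {θ θ' : ℝ → ℝ} {s s1 A e : ℝ} (hs : s ≤ s1) (hA : 0 < A) (he : 0 ≤ e) (hd : ∀ t, HasDerivAt θ (θ' t) t)
    (h : ∀ t ∈ Set.Icc s s1, θ t ≤ A * θ' t + e) (h1 : θ s1 ≤ 1) : θ s ≤ e + Real.exp (-(s1 - s) / A) := by
  have hg : ∀ t, HasDerivAt (fun t => (θ t - e) * Real.exp (-t / A)) ((θ' t - (θ t - e) / A) * Real.exp (-t / A)) t := by
    intro t
    have h1 : HasDerivAt (fun t => Real.exp (-t / A)) (Real.exp (-t / A) * (-1 / A)) t :=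
      (((hasDerivAt_id t).neg).div_const A).exp
    have := ((hd t).sub_const e).mul h1
    refine this.congr_deriv ?_
    field_simp
    ring
  have hm : MonotoneOn (fun t => (θ t - e) * Real.exp (-t / A)) (Set.Icc s s1) := by
    refine monotoneOn_of_deriv_nonneg (convex_Icc _ _) (fun t _ => (hg t).continuousAt.continuousWithinAt) (fun t _ => (hg t).differentiableAt.differentiableWithinAt) ?_
    intro t ht
    rw [interior_Icc] at ht
    rw [(hg t).deriv]
    have := h t ⟨ht.1.le, ht.2.le⟩
    refine mul_nonneg ?_ (Real.exp_pos _).le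
    rw [sub_nonneg, div_le_iff₀ hA]; linarith
  have := hm (Set.left_mem_Icc.2 hs) (Set.right_mem_Icc.2 hs) hs
  simp only at this
  have e1 : (θ s1 - e) * Real.exp (-s1 / A) ≤ Real.exp (-s1 / A) := by
    have := (Real.exp_pos (-s1 / A)).le
    nlinarith
  have e2 : Real.exp (-(s1 - s) / A) * Real.exp (-s / A) = Real.exp (-s1 / A) := by
    rw [← Real.exp_add]; congr 1; ring
  have e3 : (θ s - e) * Real.exp (-s / A) ≤ Real.exp (-(s1 - s) / A) * Real.exp (-s / A) := by rw [e2]; linarith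
  have := le_of_mul_le_mul_right e3 (Real.exp_pos _)
  linarith

variable {N : ℕ} [NeZero N]

theorem piv_sum_nonneg {z : Bool} {p s : ℝ} (hp : 0 ≤ p ∧ p ≤ 1) (hs : 0 ≤ s ∧ s ≤ 1) (n : ℤ) :
    0 ≤ ∑ v, ex (qq N p s) (piv (fA (N := N) z n) v) :=
  Finset.sum_nonneg fun v _ => ex_nonneg (Pq_qq N hp hs) fun _ => abs_nonneg _

theorem theta_mono {z : Bool} {p s t : ℝ} (hp : 0 ≤ p ∧ p ≤ 1) (hs : 0 ≤ s) (hst : s ≤ t) (ht : t ≤ 1) (n : ℤ) :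
    ex (qq N p s) (fA z n) ≤ ex (qq N p t) (fA z n) := by
  have hm : MonotoneOn (fun t => ex (qq N p t) (fA z n)) (Set.Icc 0 1) := by
    refine monotoneOn_of_deriv_nonneg (convex_Icc _ _) (fun t _ => (fA_deriv z p t n).continuousAt.continuousWithinAt) (fun t _ => (fA_deriv z p t n).differentiableAt.differentiableWithinAt) ?_
    intro t ht
    rw [interior_Icc] at ht
    rw [(fA_deriv z p t n).deriv]
    exact piv_sum_nonneg hp ⟨ht.1.le, ht.2.le⟩ n
  exact hm ⟨hs, hst.trans ht⟩ ⟨hs.trans hst, ht⟩ hst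

noncomputable def dl (C a : ℝ) (T : ℤ → ℝ) (m R n : ℤ) : ℝ := T m + (2 * m + 1) ^ 2 * (2 * R / n + 9 * (C * ((R : ℝ) - 2) ^ (-a)))

theorem core {z : Bool} {p s s1 : ℝ} (hp : 0 ≤ p ∧ p ≤ 1) (hs : 0 ≤ s) (hs1 : s ≤ s1) (hs2 : s1 ≤ 1) {C a : ℝ} {T : ℤ → ℝ} (hC : 0 < C) (hT0 : ∀ m, 0 ≤ T m)
    {n m R : ℤ} (hm : 1 ≤ m) (hmn : m ≤ n) (hR : 3 ≤ R) (hRn : R ≤ n) (hN : (N : ℤ) = 400 * n)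
    (hT : ∀ t, 0 ≤ t → t ≤ 1 → ∀ u, pr (qq N p t) (fun ω => Far m u (lft ω)) ≤ T m)
    (hA : ∀ j : ℤ, 1 ≤ j → j ≤ n → ex (qq N p s1) (fA z j) ≤ C * (j : ℝ) ^ (-a)) (hh : C * (n : ℝ) ^ (-a) ≤ 1 / 2) :
    ex (qq N p s) (fA z n) ≤ 24 * dl C a T m R n * (400 * n) ^ 2 * T m + Real.exp (-(s1 - s) / (4 * (1 + 6 * (2 * m + 1) ^ 2) * dl C a T m R n)) := by
  have hnR : (0 : ℝ) < n := by exact_mod_cast (by omega : 0 < n)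
  have hRR : (3 : ℝ) ≤ R := by exact_mod_cast hR
  have hmR : (1 : ℝ) ≤ m := by exact_mod_cast hm
  set α : ℝ := C * ((R : ℝ) - 2) ^ (-a) with hα
  have hα0 : 0 < α := mul_pos hC (Real.rpow_pos_of_pos (by linarith) _)
  set δ := dl C a T m R n with hδ
  have hδe : δ = T m + (2 * m + 1) ^ 2 * (2 * R / n + 9 * α) := rfl
  have hδ0 : 0 < δ := by
    rw [hδe]
    have h1 : 0 ≤ 2 * (R : ℝ) / n := by positivity
    have h2 : (0 : ℝ) < (2 * m + 1) ^ 2 := by positivity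
    have := mul_pos h2 (by linarith : 0 < 2 * (R : ℝ) / n + 9 * α)
    linarith [hT0 m]
  have hNR : (N : ℝ) = 400 * n := by exact_mod_cast hN
  refine ode (θ' := fun t => ∑ v, ex (qq N p t) (piv (fA (N := N) z n) v)) hs1 (by positivity) ?_ (fun t => fA_deriv z p t n) ?_ ?_
  · have := hT0 m; positivity
  · intro t ht
    have ht' : 0 ≤ t ∧ t ≤ 1 := ⟨hs.trans ht.1, ht.2.trans hs2⟩
    have hαt : (law (N := N) z p t hp ht').P (Arm (R - 2)) ≤ α := by
      have h1 := theta_mono (N := N) (z := z) hp ht'.1 ht.2 hs2 (R - 2)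
      have h2 := hA (R - 2) (by omega) (by omega)
      push_cast at h2
      exact h1.trans h2
    have h1 := osss_avg (n := n) (τ := T m) hp ht' hαt (hT t ht'.1 ht'.2) (by omega) (by omega) (by omega) (by omega)
    have h2 := infl_sum (n := n) (z := z) hp ht' (hT t ht'.1 ht'.2) (by omega)
    set θ := ex (qq N p t) (fA (N := N) z n)
    set Pv := ∑ v, ex (qq N p t) (piv (fA (N := N) z n) v)
    have hθ0 : 0 ≤ θ := ex_nonneg (Pq_qq N hp ht') fun ω => (fA_01 z n ω).1
    have hθ1 : θ ≤ 1 / 2 := (theta_mono (N := N) (z := z) hp ht'.1 ht.2 hs2 n).trans ((hA n (by omega) le_rfl).trans hh)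
    have e0 : n * T m + (2 * m + 1) ^ 2 * (2 * R + 9 * n * α) = n * δ := by
      rw [hδe]; field_simp
    rw [e0] at h1
    have h3 : n * (θ - θ * θ) ≤ n * (2 * δ * ((1 + 6 * (2 * m + 1) ^ 2) * Pv + 6 * N ^ 2 * T m)) := by
      refine h1.trans ?_
      have : 2 * (n * δ) * ∑ i, infl (qq N p t) (fA z n) i ≤ 2 * (n * δ) * ((1 + 6 * (2 * m + 1) ^ 2) * Pv + 6 * N ^ 2 * T m) :=
        mul_le_mul_of_nonneg_left h2 (by positivity)
      linarith
    have h4 := le_of_mul_le_mul_left h3 hnR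
    rw [hNR] at h4
    have h5 : θ * θ ≤ θ * (1 / 2) := mul_le_mul_of_nonneg_left hθ1 hθ0
    show θ ≤ 4 * (1 + 6 * (2 * m + 1) ^ 2) * δ * Pv + _
    linarith
  · exact (hA n (by omega) le_rfl).trans (by linarith)

/-! ### Super-polynomial decay -/
def SP (T : ℤ → ℝ) : Prop := ∀ k : ℕ, ∃ C, 0 ≤ C ∧ ∀ n : ℤ, 1 ≤ n → T n * (n : ℝ) ^ k ≤ C

theorem exp_bd (x : ℝ) (hx : 0 < x) (k : ℕ) : Real.exp (-x) ≤ k.factorial / x ^ k := by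
  have := Real.pow_div_factorial_le_exp x hx.le k
  rw [Real.exp_neg, inv_le_comm₀ (Real.exp_pos _) (by positivity), inv_div]
  exact this

theorem root_exists (Q : ℕ) (hQ : 1 ≤ Q) (n : ℤ) (hn : 1 ≤ n) : ∃ m : ℤ, 1 ≤ m ∧ m ^ Q ≤ n ∧ n < (m + 1) ^ Q := by
  lift n to ℕ using by omega
  have h1 : ∃ m : ℕ, n < (m + 1) ^ Q := ⟨n, lt_of_lt_of_le (Nat.lt_succ_self n) (Nat.le_self_pow (by omega) _)⟩
  classical
  have h2 := Nat.find_spec h1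
  have h0 : Nat.find h1 ≠ 0 := by
    intro h; rw [h] at h2; simp at h2; omega
  have h3 := Nat.find_min h1 (Nat.sub_lt (Nat.pos_of_ne_zero h0) one_pos)
  rw [show Nat.find h1 - 1 + 1 = Nat.find h1 by omega] at h3
  exact ⟨Nat.find h1, by omega, by exact_mod_cast not_lt.1 h3, by exact_mod_cast h2⟩

set_option maxHeartbeats 1600000 in
theorem analytic {C a x : ℝ} {T : ℤ → ℝ} (hC : 0 < C) (ha : 0 < a) (hx : 0 < x) (hT0 : ∀ m, 0 ≤ T m) (hT : SP T) (k : ℕ) :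
    ∃ K, 0 ≤ K ∧ ∀ (n : ℤ) (θ : ℝ), 1 ≤ n → 0 ≤ θ → θ ≤ 1 →
      (∀ m R : ℤ, 1 ≤ m → m ≤ n → 3 ≤ R → R ≤ n → C * (n : ℝ) ^ (-a) ≤ 1 / 2 →
        θ ≤ 24 * dl C a T m R n * (400 * n) ^ 2 * T m + Real.exp (-x / (4 * (1 + 6 * (2 * m + 1) ^ 2) * dl C a T m R n))) →
      θ * (n : ℝ) ^ k ≤ K := by
  obtain ⟨Q, hQ⟩ : ∃ Q : ℕ, 8 ≤ Q ∧ 8 ≤ a * Q := by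
    obtain ⟨Q, hQ⟩ := exists_nat_ge (max 8 (8 / a))
    refine ⟨Q, by exact_mod_cast (le_max_left _ _).trans hQ, ?_⟩
    have := (le_max_right _ _).trans hQ
    rw [div_le_iff₀ ha] at this; linarith
  obtain ⟨C6, hC6, hT6⟩ := hT 6
  obtain ⟨Cj, hCj, hTj⟩ := hT (2 * Q * (k + 2))
  -- constants
  set D : ℝ := C6 + 9 * (2 + 9 * (C * 2 ^ a)) with hD
  have h2a : (0 : ℝ) < 2 ^ a := Real.rpow_pos_of_pos (by norm_num) _
  have hD0 : 0 < D := by positivity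
  set n1 : ℝ := (2 * C) ^ (1 / a) with hn1
  set n0 : ℝ := max n1 (2 ^ (2 * Q)) with hn0
  have hn00 : 0 ≤ n0 := le_trans (by positivity) (le_max_right _ _)
  set j := 2 * Q * k with hj
  set K1 : ℝ := 24 * D * 400 ^ 2 * (2 ^ (2 * Q * (k + 2)) * Cj) + 2 ^ j * (j.factorial / (x / (220 * D)) ^ j) with hK1
  have hK10 : 0 ≤ K1 := by positivity
  refine ⟨n0 ^ k + K1, by positivity, fun n θ hn hθ0 hθ1 h => ?_⟩
  have hnR : (1 : ℝ) ≤ n := by exact_mod_cast hn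
  rcases le_total (n : ℝ) n0 with hsm | hlg
  · have : (n : ℝ) ^ k ≤ n0 ^ k := pow_le_pow_left₀ (by linarith) hsm k
    have : θ * (n : ℝ) ^ k ≤ 1 * n0 ^ k := mul_le_mul hθ1 this (by positivity) (by norm_num)
    linarith
  have hhalf : C * (n : ℝ) ^ (-a) ≤ 1 / 2 := by
    have h1 : n1 ≤ n := (le_max_left _ _).trans hlg
    have h2 : n1 ^ a ≤ (n : ℝ) ^ a := Real.rpow_le_rpow (by positivity) h1 ha.le
    rw [hn1, ← Real.rpow_mul (by positivity), one_div_mul_cancel ha.ne', Real.rpow_one] at h2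
    rw [Real.rpow_neg (by linarith), ← div_eq_mul_inv, div_le_iff₀ (by positivity)]
    linarith
  obtain ⟨m, hm1, hm2, hm3⟩ := root_exists (2 * Q) (by omega) n hn
  have hm2' : 2 ≤ m := by
    by_contra hc
    have : m = 1 := by omega
    subst this
    have h4 : (2 : ℝ) ^ (2 * Q) ≤ n := (le_max_right _ _).trans hlg
    have h5 : (n : ℝ) < (1 + 1) ^ (2 * Q) := by exact_mod_cast hm3
    norm_num at h5; linarith
  have hmR : (2 : ℝ) ≤ m := by exact_mod_cast hm2'
  have hm0 : (0 : ℝ) < m := by linarith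
  have hRR : (4 : ℝ) ≤ (m : ℝ) ^ Q := by
    calc (4 : ℝ) = 2 ^ 2 := by norm_num
      _ ≤ (m : ℝ) ^ 2 := by gcongr
      _ ≤ (m : ℝ) ^ Q := pow_le_pow_right₀ (by linarith) (by omega)
  have hR4 : 4 ≤ m ^ Q := by exact_mod_cast hRR
  have hm2R : ((m : ℝ) ^ Q) * (m : ℝ) ^ Q ≤ n := by
    rw [← pow_add, ← two_mul]; exact_mod_cast hm2
  have hRn : m ^ Q ≤ n := by
    have : (m : ℝ) ^ Q ≤ n := by nlinarith
    exact_mod_cast this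
  have hmn : m ≤ n := le_trans (le_self_pow₀ (by omega) (by omega)) hRn
  have hmain := h m (m ^ Q) hm1 hmn (by omega) hRn hhalf
  set δ := dl C a T m (m ^ Q) n with hδ
  have hδ1 : δ ≤ D / (m : ℝ) ^ 6 := by
    have e1 : T m ≤ C6 / (m : ℝ) ^ 6 := by rw [le_div_iff₀ (by positivity)]; exact hT6 m hm1
    have e8 : (m : ℝ) ^ 8 ≤ (m : ℝ) ^ Q := pow_le_pow_right₀ (by linarith) hQ.1
    have e2 : 2 * ((m ^ Q : ℤ) : ℝ) / n ≤ 2 / (m : ℝ) ^ 8 := by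
      push_cast
      rw [div_le_div_iff₀ (by linarith) (by positivity)]
      have := mul_le_mul_of_nonneg_left e8 (by positivity : 0 ≤ (m : ℝ) ^ Q)
      nlinarith
    have e3 : (((m ^ Q : ℤ) : ℝ) - 2) ^ (-a) ≤ 2 ^ a / (m : ℝ) ^ 8 := by
      push_cast
      have f1 : ((m : ℝ) ^ Q - 2) ^ (-a) ≤ ((m : ℝ) ^ Q / 2) ^ (-a) :=
        Real.rpow_le_rpow_of_nonpos (by positivity) (by linarith) (by linarith)
      have f2 : ((m : ℝ) ^ Q / 2) ^ (-a) = 2 ^ a / ((m : ℝ) ^ Q) ^ a := by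
        rw [Real.rpow_neg (by positivity), Real.div_rpow (by positivity) (by norm_num), inv_div]
      have f3 : (m : ℝ) ^ 8 ≤ ((m : ℝ) ^ Q) ^ a := by
        rw [← Real.rpow_natCast (m : ℝ) Q, ← Real.rpow_mul hm0.le, ← Real.rpow_natCast (m : ℝ) 8]
        refine Real.rpow_le_rpow_of_exponent_le (by linarith) ?_
        push_cast; linarith [hQ.2]
      rw [f2] at f1
      exact f1.trans (div_le_div_of_nonneg_left h2a.le (by positivity) f3)
    have e4 : (2 * (m : ℝ) + 1) ^ 2 ≤ 9 * m ^ 2 := by nlinarith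
    have e5 : 2 * ((m ^ Q : ℤ) : ℝ) / n + 9 * (C * (((m ^ Q : ℤ) : ℝ) - 2) ^ (-a)) ≤ (2 + 9 * (C * 2 ^ a)) / (m : ℝ) ^ 8 := by
      have := mul_le_mul_of_nonneg_left e3 hC.le
      have e6 : (2 + 9 * (C * 2 ^ a)) / (m : ℝ) ^ 8 = 2 / (m : ℝ) ^ 8 + 9 * (C * (2 ^ a / (m : ℝ) ^ 8)) := by ring
      rw [e6]; linarith
    have e7 : (2 * (m : ℝ) + 1) ^ 2 * (2 * ((m ^ Q : ℤ) : ℝ) / n + 9 * (C * (((m ^ Q : ℤ) : ℝ) - 2) ^ (-a))) ≤ 9 * m ^ 2 * ((2 + 9 * (C * 2 ^ a)) / (m : ℝ) ^ 8) := by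
      refine mul_le_mul e4 e5 ?_ (by positivity)
      have g1 : (0 : ℝ) ≤ (((m ^ Q : ℤ) : ℝ) - 2) ^ (-a) := Real.rpow_nonneg (by push_cast; linarith) _
      have g2 : (0 : ℝ) ≤ 2 * ((m ^ Q : ℤ) : ℝ) / n := by push_cast; positivity
      have := mul_nonneg hC.le g1
      linarith
    have e9 : D / (m : ℝ) ^ 6 = C6 / (m : ℝ) ^ 6 + 9 * m ^ 2 * ((2 + 9 * (C * 2 ^ a)) / (m : ℝ) ^ 8) := by
      rw [hD]; field_simp
    rw [e9, hδ, dl]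
    linarith
  have hδ0 : 0 < δ := by
    rw [hδ, dl]
    have h1 : 0 < 2 * ((m ^ Q : ℤ) : ℝ) / n := by push_cast; positivity
    have g1 : (0 : ℝ) ≤ (((m ^ Q : ℤ) : ℝ) - 2) ^ (-a) := Real.rpow_nonneg (by push_cast; linarith) _
    have h2 : (0 : ℝ) < (2 * m + 1) ^ 2 := by positivity
    have := mul_pos h2 (by linarith [mul_nonneg hC.le g1] : 0 < 2 * ((m ^ Q : ℤ) : ℝ) / n + 9 * (C * (((m ^ Q : ℤ) : ℝ) - 2) ^ (-a)))
    linarith [hT0 m]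
  have hm6 : (1 : ℝ) ≤ (m : ℝ) ^ 6 := one_le_pow₀ (by linarith)
  have hnm : (n : ℝ) ≤ (2 * m) ^ (2 * Q) := by
    have h5 : (n : ℝ) < (m + 1) ^ (2 * Q) := by exact_mod_cast hm3
    refine h5.le.trans (pow_le_pow_left₀ (by linarith) (by linarith) _)
  -- first term
  have t1 : 24 * δ * (400 * (n : ℝ)) ^ 2 * T m * (n : ℝ) ^ k ≤ 24 * D * 400 ^ 2 * (2 ^ (2 * Q * (k + 2)) * Cj) := by
    have f1 : δ ≤ D := hδ1.trans (div_le_self hD0.le hm6)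
    have f2 : (n : ℝ) ^ (k + 2) * T m ≤ 2 ^ (2 * Q * (k + 2)) * Cj := by
      have : (n : ℝ) ^ (k + 2) ≤ ((2 * m) ^ (2 * Q)) ^ (k + 2) := pow_le_pow_left₀ (by linarith) hnm _
      rw [← pow_mul, mul_pow] at this
      calc (n : ℝ) ^ (k + 2) * T m ≤ (2 ^ (2 * Q * (k + 2)) * (m : ℝ) ^ (2 * Q * (k + 2))) * T m := mul_le_mul_of_nonneg_right this (hT0 m)
        _ = 2 ^ (2 * Q * (k + 2)) * (T m * (m : ℝ) ^ (2 * Q * (k + 2))) := by ring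
        _ ≤ _ := mul_le_mul_of_nonneg_left (hTj m hm1) (by positivity)
    calc _ = 24 * 400 ^ 2 * (δ * ((n : ℝ) ^ (k + 2) * T m)) := by ring
      _ ≤ 24 * 400 ^ 2 * (D * (2 ^ (2 * Q * (k + 2)) * Cj)) := by
        refine mul_le_mul_of_nonneg_left (mul_le_mul f1 f2 (mul_nonneg (by positivity) (hT0 m)) hD0.le) (by norm_num)
      _ = _ := by ring
  -- second term
  have t2 : Real.exp (-x / (4 * (1 + 6 * (2 * m + 1) ^ 2) * δ)) * (n : ℝ) ^ k ≤ 2 ^ j * (j.factorial / (x / (220 * D)) ^ j) := by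
    have f0 : 4 * (1 + 6 * (2 * (m : ℝ) + 1) ^ 2) * δ ≤ 220 * D / m := by
      have e4 : 4 * (1 + 6 * (2 * (m : ℝ) + 1) ^ 2) ≤ 220 * m ^ 2 := by nlinarith
      calc _ ≤ 220 * (m : ℝ) ^ 2 * (D / (m : ℝ) ^ 6) := mul_le_mul e4 hδ1 hδ0.le (by positivity)
        _ = 220 * D / (m : ℝ) ^ 4 := by field_simp
        _ ≤ 220 * D / m := div_le_div_of_nonneg_left (by positivity) hm0 (le_self_pow₀ (by linarith) (by norm_num))
    have f1 : x / (220 * D) * m ≤ x / (4 * (1 + 6 * (2 * (m : ℝ) + 1) ^ 2) * δ) := by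
      have : x / (220 * D) * m = x / (220 * D / m) := by field_simp
      rw [this]
      exact div_le_div_of_nonneg_left hx.le (by positivity) f0
    have f2 : Real.exp (-x / (4 * (1 + 6 * (2 * m + 1) ^ 2) * δ)) ≤ Real.exp (-(x / (220 * D) * m)) := by
      rw [Real.exp_le_exp, neg_div]; linarith
    have f3 := exp_bd (x / (220 * D) * m) (by positivity) j
    have f4 : (n : ℝ) ^ k ≤ (2 * m) ^ j := by
      have : (n : ℝ) ^ k ≤ ((2 * m) ^ (2 * Q)) ^ k := pow_le_pow_left₀ (by linarith) hnm _
      rwa [← pow_mul] at this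
    calc _ ≤ (j.factorial / (x / (220 * D) * m) ^ j) * (2 * m) ^ j := mul_le_mul (f2.trans f3) f4 (by positivity) (by positivity)
      _ = _ := by rw [mul_pow, mul_pow]; field_simp
  have hnk : (0 : ℝ) ≤ (n : ℝ) ^ k := by positivity
  have := mul_le_mul_of_nonneg_right hmain hnk
  have : (0 : ℝ) ≤ n0 ^ k := by positivity
  linarith [add_mul (24 * δ * (400 * (n : ℝ)) ^ 2 * T m) (Real.exp (-x / (4 * (1 + 6 * (2 * m + 1) ^ 2) * δ))) ((n : ℝ) ^ k)]
end
end DaC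

namespace DaC
section

theorem master {z : Bool} {p s0 s : ℝ} (hp : 0 ≤ p ∧ p ≤ 1) (hs0 : 0 ≤ s0 ∧ s0 ≤ 1) (hs : 0 ≤ s) (hss : s < s0) {T : ℤ → ℝ} (hT0 : ∀ m, 0 ≤ T m) (hT : SP T)
    (hTN : ∀ (N : ℕ) [NeZero N], 2 ∣ N → ∀ m : ℤ, 0 ≤ m → 4 * m ≤ N → ∀ t, 0 ≤ t → t ≤ 1 → ∀ u, pr (qq N p t) (fun ω => Far m u (lft ω)) ≤ T m)
    (hdual : ∀ n : ℤ, 1 ≤ n → ∀ (N : ℕ) [NeZero N], (N : ℤ) = 400 * n → Dual (law (N := N) z p s0 hp hs0) (5 * n)) (k : ℕ) :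
    ∃ K, 0 ≤ K ∧ ∀ n : ℤ, 1 ≤ n → ∀ (N : ℕ) [NeZero N], (N : ℤ) = 400 * n → ex (qq N p s) (fA z n) * (n : ℝ) ^ k ≤ K := by
  -- choice of the intermediate parameter
  set δ : ℝ := (s0 - s) / (2 * s0) with hδ
  have hs0' : 0 < s0 := by linarith
  have hδ0 : 0 < δ := div_pos (by linarith) (by linarith)
  have hδ1 : δ ≤ 1 := by rw [hδ, div_le_one (by linarith)]; linarith
  set s1 : ℝ := s0 * (1 - δ) with hs1
  have hs1e : s1 = (s0 + s) / 2 := by rw [hs1, hδ]; field_simp; ring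
  have hs1' : 0 ≤ s1 ∧ s1 ≤ 1 := by rw [hs1e]; constructor <;> linarith
  obtain ⟨C3, hC3, hT3⟩ := hT 3
  set D : ℝ := 2700 * C3 + 100 * T 0 with hD
  have hD0 : 0 ≤ D := by have := hT0 0; positivity
  have hDm : ∀ m : ℤ, 1 ≤ m → 4 * ((4 * (m : ℝ) + 1) ^ 2 * T (m / 2)) ≤ D / m := by
    intro m hm
    have hmR : (1 : ℝ) ≤ m := by exact_mod_cast hm
    rw [le_div_iff₀ (by linarith)]
    have e1 : 4 * ((4 * (m : ℝ) + 1) ^ 2 * T (m / 2)) * m ≤ 100 * (m : ℝ) ^ 3 * T (m / 2) := by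
      have : (4 * (m : ℝ) + 1) ^ 2 ≤ 25 * m ^ 2 := by nlinarith
      have := mul_le_mul_of_nonneg_right this (mul_nonneg (hT0 (m / 2)) (by linarith : (0 : ℝ) ≤ 4 * m))
      linarith
    refine e1.trans ?_
    rcases hm.eq_or_lt with rfl | hm2
    · norm_num [hD]; linarith
    · have h3 : m ≤ 3 * (m / 2) := by omega
      have h3R : (m : ℝ) ≤ 3 * ((m / 2 : ℤ) : ℝ) := by exact_mod_cast h3
      have h4 : (m : ℝ) ^ 3 ≤ (3 * ((m / 2 : ℤ) : ℝ)) ^ 3 := pow_le_pow_left₀ (by linarith) h3R 3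
      have h5 := hT3 (m / 2) (by omega)
      have h6 := mul_le_mul_of_nonneg_right h4 (hT0 (m / 2))
      have := hT0 0
      rw [mul_pow] at h6
      linarith
  have hd882 : 0 < δ ^ 882 := by positivity
  obtain ⟨C, a, hC, ha, harm⟩ := one_arm (δ ^ 882 / 4) (δ ^ 882) D 32 (by positivity) hd882 hD0
  obtain ⟨K, hK, hKn⟩ := analytic (x := s1 - s) hC ha (by rw [hs1e]; linarith) hT0 hT k
  refine ⟨K, hK, fun n hn N _ hN => ?_⟩
  have h2N : 2 ∣ N := by omega
  have hTN' := hTN N h2N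
  have hmix : Mix (law (N := N) z p s1 hp hs1') D (160 * n) :=
    mix_law hp hs1' (by omega) hT0 (fun m h1 h2 u => hTN' m h1 h2 s1 hs1'.1 hs1'.2 u) hDm
  have hrh := rhyp_law (L := n) h2N hp hs0 ⟨hδ0.le, hδ1⟩ hs1' hs1 (hdual n hn N hN)
  have hb := base_law (N := N) (z := z) h2N hp hs0 ⟨hδ0.le, hδ1⟩ hs1' hs1
  have harm' := harm _ n (160 * n) le_rfl hmix hrh hb
  refine hKn n _ hn (ex_nonneg (Pq_qq N hp ⟨hs, by linarith⟩) fun ω => (fA_01 z n ω).1) ?_ ?_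
  · exact pr_le_one (Pq_qq N hp ⟨hs, by linarith⟩) _
  · intro m R hm hmn hR hRn hhalf
    exact core hp hs (by rw [hs1e]; linarith) hs1'.2 hC hT0 hm hmn hR hRn hN
      (fun t h1 h2 u => hTN' m (by omega) (by omega) t h1 h2 u) harm' hhalf
end
end DaC

namespace DaC
section
/-! ### Star-triangle duality -/
def EE (t : V) : Prop := 2 ∣ t.1 ∧ 2 ∣ t.2
abbrev B3 := Bool × Bool × Bool
def sB (x : B3) : B3 := (x.1 || (x.2.1 && x.2.2), x.2.1 || (x.1 && x.2.2), x.2.2 || (x.1 && x.2.1))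
def sW (x : B3) : B3 := (!x.2.1 && !x.2.2, !x.2.2 && !x.1, !x.2.1 && !x.1)
def mids (X : V → Bool) (v : V) : B3 := (X (v.1 + 1, v.2), X (v.1 + 2, v.2 + 1), X (v.1 + 1, v.2 + 1))

def Bh (Y : V → B3) (t t' : V) : Prop := ∃ v, EE v ∧ (((Y v).1 = true ∧ t = v ∧ t' = (v.1 + 2, v.2)) ∨
  ((Y v).2.1 = true ∧ t = (v.1 + 2, v.2) ∧ t' = (v.1 + 2, v.2 + 2)) ∨ ((Y v).2.2 = true ∧ t = v ∧ t' = (v.1 + 2, v.2 + 2)))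
def Bj (Y : V → B3) (t t' : V) : Prop := Bh Y t t' ∨ Bh Y t' t
def inE (a : ℤ) (t : V) : Prop := -a ≤ ell t ∧ ell t ≤ a
def BE (Y : V → B3) (a b : ℤ) : Prop := ∃ t0 t1, inE (a + 2) t0 ∧
  Relation.ReflTransGen (fun t t' => Bj Y t t' ∧ inE (a + 2) t') t0 t1 ∧ t0.2 ≤ -b + 1 ∧ b - 1 ≤ t1.2

theorem Bj.symm {Y : V → B3} {t t' : V} (h : Bj Y t t') : Bj Y t' t := Or.symm h

def Ends (w t : V) : Prop := EE t ∧ (t = w ∨ TriAdj w t)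

theorem ends_ex (w : V) : ∃ t, Ends w t := by
  refine ⟨(2 * (w.1 / 2), 2 * (w.2 / 2)), ⟨⟨_, rfl⟩, ⟨_, rfl⟩⟩, ?_⟩
  rw [tri_iff, Prod.ext_iff]; simp only; omega

def N7 (a b : ℤ) : Bool := (a, b) ∈ ([(0, 0), (1, 0), (-1, 0), (0, 1), (0, -1), (1, 1), (-1, -1)] : List (ℤ × ℤ))

theorem ends_N7 {x y a b : ℤ} (h : N7 a b = true) (h1 : 2 ∣ x + a) (h2 : 2 ∣ y + b) : Ends (x, y) (x + a, y + b) := by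
  refine ⟨⟨h1, h2⟩, ?_⟩
  simp only [N7, List.mem_cons, Prod.mk.injEq, List.not_mem_nil, or_false, decide_eq_true_eq] at h
  rw [tri_iff, Prod.mk.injEq]
  rcases h with ⟨rfl, rfl⟩ | ⟨rfl, rfl⟩ | ⟨rfl, rfl⟩ | ⟨rfl, rfl⟩ | ⟨rfl, rfl⟩ | ⟨rfl, rfl⟩ | ⟨rfl, rfl⟩ <;> simp <;> omega

theorem ends_common {w w' : V} (h : TriAdj w w') : ∃ c, Ends w c ∧ Ends w' c := by
  obtain ⟨x, y⟩ := w
  obtain ⟨x', y'⟩ := w'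
  have key : ∀ a b dx dy : ℤ, x' = x + dx → y' = y + dy → N7 a b = true → N7 (a - dx) (b - dy) = true → 2 ∣ x + a → 2 ∣ y + b →
      ∃ c, Ends (x, y) c ∧ Ends (x', y') c := by
    intro a b dx dy h1 h2 h3 h4 h5 h6
    refine ⟨(x + a, y + b), ends_N7 h3 h5 h6, ?_⟩
    have := ends_N7 (x := x') (y := y') h4 (by omega) (by omega)
    convert this using 2 <;> omega
  have key2 : ∀ dx dy : ℤ, x' = x + dx → y' = y + dy → (∀ i j : Fin 2, ∃ a b : Fin 3, N7 ((a : ℕ) - 1) ((b : ℕ) - 1) = true ∧ N7 ((a : ℕ) - 1 - dx) ((b : ℕ) - 1 - dy) = true ∧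
      (2 : ℤ) ∣ (i : ℕ) + ((a : ℕ) - 1) ∧ (2 : ℤ) ∣ (j : ℕ) + ((b : ℕ) - 1)) →
      ∃ c, Ends (x, y) c ∧ Ends (x', y') c := by
    intro dx dy h1 h2 H
    obtain ⟨i, hi⟩ : ∃ i : Fin 2, 2 ∣ x - (i : ℕ) := by
      rcases Int.emod_two_eq_zero_or_one x with h | h
      · exact ⟨0, by simp only [Fin.val_zero]; omega⟩
      · exact ⟨1, by simp only [Fin.val_one]; omega⟩
    obtain ⟨j, hj⟩ : ∃ i : Fin 2, 2 ∣ y - (i : ℕ) := by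
      rcases Int.emod_two_eq_zero_or_one y with h | h
      · exact ⟨0, by simp only [Fin.val_zero]; omega⟩
      · exact ⟨1, by simp only [Fin.val_one]; omega⟩
    obtain ⟨a, b, h3, h4, h5, h6⟩ := H i j
    exact key _ _ dx dy h1 h2 h3 h4 (by omega) (by omega)
  rw [tri_iff] at h
  simp only at h
  rcases h with ⟨h1, h2⟩ | ⟨h1, h2⟩ | ⟨h1, h2⟩ | ⟨h1, h2⟩ | ⟨h1, h2⟩ | ⟨h1, h2⟩
  all_goals
    first
      | exact key2 1 0 (by omega) (by omega) (by decide)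
      | exact key2 (-1) 0 (by omega) (by omega) (by decide)
      | exact key2 0 1 (by omega) (by omega) (by decide)
      | exact key2 0 (-1) (by omega) (by omega) (by decide)
      | exact key2 1 1 (by omega) (by omega) (by decide)
      | exact key2 (-1) (-1) (by omega) (by omega) (by decide)

theorem sB_mono (x : B3) : (x.1 = true → (sB x).1 = true) ∧ (x.2.1 = true → (sB x).2.1 = true) ∧ (x.2.2 = true → (sB x).2.2 = true) := by
  simp only [sB, Bool.or_eq_true]; tauto

/-- Both ends of an open edge are joined. -/
theorem ends_join {X : V → Bool} {w c t : V} (hw : EE w ∨ X w = true) (hc : Ends w c) (ht : Ends w t) :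
    c = t ∨ Bj (fun v => sB (mids X v)) c t := by
  by_cases hE : EE w
  · left
    have key : ∀ d, Ends w d → d = w := by
      rintro ⟨d1, d2⟩ ⟨h1, h2⟩
      refine h2.resolve_right fun h => ?_
      rw [tri_iff] at h; simp only [EE] at *; omega
    rw [key c hc, key t ht]
  have hX := hw.resolve_left hE
  by_cases hct : c = t
  · exact Or.inl hct
  right
  -- order the two ends
  have main : ∀ c t : V, Ends w c → Ends w t → c.1 + c.2 < t.1 + t.2 → Bh (fun v => sB (mids X v)) c t := by
    rintro ⟨c1, c2⟩ ⟨t1, t2⟩ ⟨hc1, hc2⟩ ⟨ht1, ht2⟩ hlt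
    obtain ⟨w1, w2⟩ := w
    have hc2 : c1 = w1 ∧ c2 = w2 ∨ TriAdj (w1, w2) (c1, c2) := by rwa [Prod.mk.injEq] at hc2
    have ht2 : t1 = w1 ∧ t2 = w2 ∨ TriAdj (w1, w2) (t1, t2) := by rwa [Prod.mk.injEq] at ht2
    rw [tri_iff] at hc2 ht2
    simp only [EE] at *
    obtain ⟨i, hi⟩ := hc1.1
    obtain ⟨j, hj⟩ := hc1.2
    obtain ⟨k, hk⟩ := ht1.1
    obtain ⟨l, hl⟩ := ht1.2
    have hcase : (t1 = c1 + 2 ∧ t2 = c2 ∧ w1 = c1 + 1 ∧ w2 = c2) ∨ (t1 = c1 ∧ t2 = c2 + 2 ∧ w1 = c1 ∧ w2 = c2 + 1) ∨ (t1 = c1 + 2 ∧ t2 = c2 + 2 ∧ w1 = c1 + 1 ∧ w2 = c2 + 1) := by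
      clear hX hw
      rcases hc2 with h | h | h | h | h | h | h <;> rcases ht2 with g | g | g | g | g | g | g <;> omega
    rcases hcase with ⟨e1, e2, e3, e4⟩ | ⟨e1, e2, e3, e4⟩ | ⟨e1, e2, e3, e4⟩
    · rw [e3, e4] at hX
      rw [e1, e2]
      exact ⟨(c1, c2), hc1, Or.inl ⟨(sB_mono _).1 hX, rfl, rfl⟩⟩
    · rw [e3, e4] at hX
      rw [e1, e2]
      refine ⟨(c1 - 2, c2), ⟨by simp only; omega, hc1.2⟩, Or.inr (Or.inl ⟨(sB_mono _).2.1 ?_, ?_, ?_⟩)⟩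
      · simpa [mids] using hX
      · simp
      · simp
    · rw [e3, e4] at hX
      rw [e1, e2]
      exact ⟨(c1, c2), hc1, Or.inr (Or.inr ⟨(sB_mono _).2.2 hX, rfl, rfl⟩)⟩
  rcases lt_trichotomy (c.1 + c.2) (t.1 + t.2) with h | h | h
  · exact Or.inl (main c t hc ht h)
  · exfalso
    obtain ⟨hc1, hc2⟩ := hc
    obtain ⟨ht1, ht2⟩ := ht
    have : ¬ (c.1 = t.1 ∧ c.2 = t.2) := fun hh => hct (Prod.ext hh.1 hh.2)
    rw [Prod.ext_iff, tri_iff] at hc2 ht2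
    simp only [EE] at *
    obtain ⟨i, hi⟩ := hc1.1
    obtain ⟨j, hj⟩ := hc1.2
    obtain ⟨k, hk⟩ := ht1.1
    obtain ⟨l, hl⟩ := ht1.2
    clear hX hw
    rcases hc2 with h | h | h | h | h | h | h <;> rcases ht2 with g | g | g | g | g | g | g <;> omega
  · exact Or.inr (main t c ht hc h)

theorem ends_near {w t : V} (h : Ends w t) : ell w - 2 ≤ ell t ∧ ell t ≤ ell w + 2 ∧ w.2 - 1 ≤ t.2 ∧ t.2 ≤ w.2 + 1 := by
  obtain ⟨-, h⟩ := h
  rw [Prod.ext_iff, tri_iff] at h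
  simp only [ell]; omega

theorem blk {X : V → Bool} {a b : ℤ} (h : VEv {w | EE w ∨ X w = true} a b) : BE (fun v => sB (mids X v)) a b := by
  obtain ⟨u, v, hJ, hu, hv⟩ := h
  obtain ⟨t0, ht0⟩ := ends_ex u
  have hin : ∀ w ∈ {w : V | EE w ∨ X w = true} ∩ {w : V | -a ≤ ell w ∧ ell w ≤ a ∧ -b ≤ w.2 ∧ w.2 ≤ b}, ∀ t, Ends w t → inE (a + 2) t := by
    rintro w ⟨-, h1, h2, -⟩ t ht
    have := ends_near ht
    simp only [inE]; omega
  have key : ∀ t, Ends v t → Relation.ReflTransGen (fun t t' => Bj (fun v => sB (mids X v)) t t' ∧ inE (a + 2) t') t0 t := by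
    obtain ⟨hu', hJ⟩ := hJ
    clear hv
    induction hJ with
    | refl =>
      intro t ht
      rcases ends_join hu'.1 ht0 ht with rfl | h
      · exact Relation.ReflTransGen.refl
      · exact Relation.ReflTransGen.single ⟨h, hin _ hu' t ht⟩
    | @tail w w' hw hww ih =>
      intro t ht
      obtain ⟨c, hc1, hc2⟩ := ends_common hww.1
      have h1 : Relation.ReflTransGen (fun t t' => Bj (fun v => sB (mids X v)) t t' ∧ inE (a + 2) t') t0 c := by
        exact ih c hc1
      rcases ends_join hww.2.1 hc2 ht with rfl | h
      · exact h1
      · exact h1.tail ⟨h, hin _ hww.2 t ht⟩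
  obtain ⟨t1, ht1⟩ := ends_ex v
  have e0 := ends_near ht0
  have e1 := ends_near ht1
  exact ⟨t0, t1, hin u hJ.1 t0 ht0, key t1 ht1, by omega, by omega⟩
end
end DaC

namespace DaC
section
/-! ### The white side of the star-triangle relation -/
def InD (t w : V) : Prop := w = (-t.1, -t.2 + 1) ∨ w = (-t.1 + 1, -t.2 + 2) ∨ w = (-t.1 + 1, -t.2 + 1)

def Wh (X : V → Bool) : Set V := {w | ¬ EE w ∧ X w = false}

def rfl2 (v : V) : V := (-v.1 - 2, -v.2)

theorem wh_step_h {X : V → Bool} {t t' : V} (h : Bh (fun v => sW (mids X (rfl2 v))) t t') :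
    ∃ w w', InD t w ∧ InD t' w' ∧ w ∈ Wh X ∧ w' ∈ Wh X ∧ TriAdj w w' := by
  obtain ⟨⟨x, y⟩, ⟨⟨i, hi⟩, ⟨j, hj⟩⟩, h⟩ := h
  simp only at hi hj
  subst hi hj
  simp only [sW, mids, rfl2, Bool.and_eq_true, Bool.not_eq_true'] at h
  have m1 : X (-(2 * i) - 2 + 1, -(2 * j)) = false → ((-(2 * i) - 2 + 1, -(2 * j)) : V) ∈ Wh X := fun h => ⟨fun h => by have := h.1; simp only at this; omega, h⟩
  have m2 : X (-(2 * i) - 2 + 2, -(2 * j) + 1) = false → ((-(2 * i) - 2 + 2, -(2 * j) + 1) : V) ∈ Wh X := fun h => ⟨fun h => by have := h.2; simp only at this; omega, h⟩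
  have m3 : X (-(2 * i) - 2 + 1, -(2 * j) + 1) = false → ((-(2 * i) - 2 + 1, -(2 * j) + 1) : V) ∈ Wh X := fun h => ⟨fun h => by have := h.2; simp only at this; omega, h⟩
  rcases h with ⟨⟨h1, h2⟩, rfl, rfl⟩ | ⟨⟨h1, h2⟩, rfl, rfl⟩ | ⟨⟨h1, h2⟩, rfl, rfl⟩
  · refine ⟨_, _, ?_, ?_, m2 h1, m3 h2, ?_⟩
    · left; ext <;> simp
    · right; right; ext <;> simp <;> ring
    · rw [tri_iff]; simp; try omega
  · refine ⟨_, _, ?_, ?_, m3 h1, m1 h2, ?_⟩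
    · right; right; ext <;> simp <;> ring
    · right; left; ext <;> simp <;> ring
    · rw [tri_iff]; simp; try omega
  · refine ⟨_, _, ?_, ?_, m2 h1, m1 h2, ?_⟩
    · left; ext <;> simp
    · right; left; ext <;> simp <;> ring
    · rw [tri_iff]; simp; try omega

theorem wh_step {X : V → Bool} {t t' : V} (h : Bj (fun v => sW (mids X (rfl2 v))) t t') :
    ∃ w w', InD t w ∧ InD t' w' ∧ w ∈ Wh X ∧ w' ∈ Wh X ∧ TriAdj w w' := by
  rcases h with h | h
  · exact wh_step_h h
  · obtain ⟨w, w', h1, h2, h3, h4, h5⟩ := wh_step_h h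
    exact ⟨w', w, h2, h1, h4, h3, tri_symm h5⟩

theorem InD_adj {t w w' : V} (h : InD t w) (h' : InD t w') : w = w' ∨ TriAdj w w' := by
  obtain ⟨x, y⟩ := t
  rw [tri_iff]
  rcases h with rfl | rfl | rfl <;> rcases h' with rfl | rfl | rfl <;> simp <;> omega

theorem InD_near {t w : V} (h : InD t w) : -ell t - 1 ≤ ell w ∧ ell w ≤ -ell t + 1 ∧ -t.2 + 1 ≤ w.2 ∧ w.2 ≤ -t.2 + 2 := by
  obtain ⟨x, y⟩ := t
  rcases h with rfl | rfl | rfl <;> simp only [ell] <;> omega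

theorem wht {X : V → Bool} {a b : ℤ} (hb : 8 ≤ b) (h : BE (fun v => sW (mids X (rfl2 v))) a b) : VEv (Wh X) (a + 4) (b - 4) := by
  obtain ⟨t0, t1, h0, hc, e0, e1⟩ := h
  have key : inE (a + 2) t1 ∧ (t1 = t0 ∨ ∃ u w, InD t0 u ∧ InD t1 w ∧ J (Wh X ∩ {w | -(a + 4) ≤ ell w ∧ ell w ≤ a + 4}) u w) := by
    clear e1
    have hin : ∀ t w, inE (a + 2) t → InD t w → w ∈ Wh X → w ∈ Wh X ∩ {w | -(a + 4) ≤ ell w ∧ ell w ≤ a + 4} := by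
      intro t w h1 h2 h3
      have := InD_near h2
      obtain ⟨h4, h5⟩ := h1
      exact ⟨h3, by show _ ∧ _; constructor <;> omega⟩
    induction hc with
    | refl => exact ⟨h0, Or.inl rfl⟩
    | @tail t t' _ hs ih =>
      obtain ⟨i1, i2⟩ := ih
      obtain ⟨x, x', x1, x2, x3, x4, x5⟩ := wh_step hs.1
      have k1 := hin _ _ i1 x1 x3
      have k2 := hin _ _ hs.2 x2 x4
      refine ⟨hs.2, Or.inr ?_⟩
      rcases i2 with rfl | ⟨u, w, g1, g2, g3⟩
      · exact ⟨x, x', x1, x2, (J.refl k1).step x5 k2⟩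
      · refine ⟨u, x', g1, x2, ?_⟩
        rcases InD_adj g2 x1 with rfl | h
        · exact g3.step x5 k2
        · exact (g3.step h k1).step x5 k2
  rcases key.2 with h | ⟨u, w, h1, h2, h3⟩
  · rw [h] at e1; omega
  have n1 := InD_near h1
  have n2 := InD_near h2
  obtain ⟨u', v', -, k2, k3, k4⟩ := h3.symm.strip (fun w => w.2) 1 (-(b - 4)) (b - 4) (fun u v h => by rw [tri_iff] at h; omega) (le_refl _) (by omega) (by omega) (by omega)
  refine ⟨u', v', k2.mono ?_, by omega, k4⟩
  rintro w ⟨⟨hw1, hw2, hw2'⟩, hw3, hw4⟩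
  exact ⟨hw1, by show _ ∧ _ ∧ _ ∧ _; refine ⟨hw2, hw2', hw3, ?_⟩; omega⟩
end
end DaC

namespace DaC
section
/-! ### The star-triangle law -/
theorem BE_congr {Y Y' : V → B3} {a b : ℤ} (h : ∀ v, EE v → Y v = Y' v) (hB : BE Y a b) : BE Y' a b := by
  obtain ⟨t0, t1, h0, hc, h1⟩ := hB
  refine ⟨t0, t1, h0, ?_, h1⟩
  have key : ∀ t t', Bh Y t t' → Bh Y' t t' := by
    rintro t t' ⟨v, hv, hh⟩
    rw [h v hv] at hh
    exact ⟨v, hv, hh⟩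
  refine Relation.ReflTransGen.mono ?_ _ _ hc
  rintro t t' ⟨hh, h2⟩
  exact ⟨hh.imp (key _ _) (key _ _), h2⟩

def w3 (p : ℝ) (x : B3) : ℝ := (if x.1 then p else 1 - p) * (if x.2.1 then p else 1 - p) * (if x.2.2 then p else 1 - p)

theorem star_law {p : ℝ} (hp : p ^ 3 - 3 * p + 1 = 0) (y : B3) :
    (∑ a, if sB a = y then w3 p a else 0) = ∑ a, if sW a = y then w3 p a else 0 := by
  obtain ⟨y1, y2, y3⟩ := y
  simp only [Fintype.sum_prod_type, Fintype.sum_bool, sB, sW, w3]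
  cases y1 <;> cases y2 <;> cases y3 <;> simp <;> linarith

variable {ι : Type} [Fintype ι]

def eqv3 (ι : Type) : (ι × Fin 3 → Bool) ≃ (ι → B3) where
  toFun z i := (z (i, 0), z (i, 1), z (i, 2))
  invFun x k := ![(x k.1).1, (x k.1).2.1, (x k.1).2.2] k.2
  left_inv z := by
    funext ⟨i, k⟩
    fin_cases k <;> rfl
  right_inv x := rfl

open Classical in
theorem ex_eqv3 (p : ℝ) (F : (ι → B3) → ℝ) :
    ex (fun _ : ι × Fin 3 => p) (fun z => F (eqv3 ι z)) = ∑ x : ι → B3, (∏ i, w3 p (x i)) * F x := by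
  rw [ex_def]
  refine Fintype.sum_equiv (eqv3 ι) _ _ fun z => ?_
  congr 1
  unfold wt
  rw [Fintype.prod_prod_type]
  refine Finset.prod_congr rfl fun i _ => ?_
  rw [Fin.prod_univ_three]
  rfl

theorem star_ex {p : ℝ} (hp : p ^ 3 - 3 * p + 1 = 0) (F : (ι → B3) → ℝ) :
    ex (fun _ : ι × Fin 3 => p) (fun z => F (fun i => sB (eqv3 ι z i))) = ex (fun _ : ι × Fin 3 => p) (fun z => F (fun i => sW (eqv3 ι z i))) := by
  classical
  rw [ex_eqv3 p (fun x => F (fun i => sB (x i))), ex_eqv3 p (fun x => F (fun i => sW (x i)))]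
  rw [push_sum (fun _ => w3 p) (fun _ => sB), push_sum (fun _ => w3 p) (fun _ => sW)]
  simp only [star_law hp]

variable {N : ℕ} [NeZero N]

abbrev Ev (N : ℕ) : Type := {v : Vt N // Even v.1 ∧ Even v.2}
def off3 : Fin 3 → V := ![(1, 0), (2, 1), (1, 1)]
def j3 (i : Ev N × Fin 3) : Vt N := i.1.1 + pj N (off3 i.2)

theorem j3_inj (hN : 2 ∣ N) : Function.Injective (j3 (N := N)) := by
  have hN' : (2 : ℤ) ∣ N := by exact_mod_cast hN
  rintro ⟨⟨i, hi⟩, k⟩ ⟨⟨i', hi'⟩, k'⟩ h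
  simp only [j3] at h
  obtain ⟨v, rfl⟩ := pj_surj N i
  obtain ⟨v', rfl⟩ := pj_surj N i'
  simp only [pj, even_int hN] at hi hi'
  have h0 := h
  rw [← pj_tr, ← pj_tr, pj_eq] at h
  have h1 := hN'.trans h.1
  have h2 := hN'.trans h.2
  have hk : k = k' := by
    simp only [tr] at h1 h2
    fin_cases k <;> fin_cases k' <;> simp [off3] at h1 h2 ⊢ <;> omega
  subst hk
  have := add_right_cancel h0
  simp only [Prod.mk.injEq, Subtype.mk.injEq, and_true]
  exact this

def rho (i : Ev N) : Ev N := ⟨(-i.1.1 - 2, -i.1.2), by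
  obtain ⟨⟨a, b⟩, ha, hb⟩ := i
  exact ⟨ha.neg.sub even_two, hb.neg⟩⟩

theorem rho_inj : Function.Injective (rho (N := N)) := by
  rintro ⟨⟨a, b⟩, ha⟩ ⟨⟨a', b'⟩, ha'⟩ h
  simp only [rho, Subtype.mk.injEq, Prod.mk.injEq, sub_left_inj, neg_inj] at h
  simp only [Subtype.mk.injEq, Prod.mk.injEq]
  exact h

open Classical in
noncomputable def extE (Y : Ev N → B3) (v : V) : B3 := if h : Even (pj N v).1 ∧ Even (pj N v).2 then Y ⟨pj N v, h⟩ else (false, false, false)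

theorem ext_even (hN : 2 ∣ N) {v : V} (h : EE v) : Even (pj N v).1 ∧ Even (pj N v).2 := by
  simp only [pj, even_int hN]; exact h

theorem ex_zero {κ : Type} [Fintype κ] (F : (κ → Bool) → ℝ) : ex (fun _ => 0) F = F (fun _ => false) := by
  classical
  rw [ex_def, Finset.sum_eq_single (fun _ => false)]
  · simp [wt]
  · intro ω _ h
    obtain ⟨i, hi⟩ := Function.ne_iff.1 h
    rw [wt, Finset.prod_eq_zero (Finset.mem_univ i), zero_mul]
    simp at hi; simp [hi]
  · simp

theorem pr_zero (s : ℝ) (E : (It N → Bool) → Prop) :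
    pr (qq N 0 s) E = pr (fun _ : Vt N => s) (fun y => E (Sum.elim (fun _ => false) y)) := by
  unfold pr
  rw [ex_sum_type]
  exact ex_zero _

theorem cl_zero {α β : Type} {en : β → α × α} {ω : β ⊕ α → Bool} (h : ∀ e, ω (.inl e) = false) (v : α) : cl en ω v = {v} := by
  apply Set.Subset.antisymm
  · refine cl_sub rfl ?_
    rintro a b - ⟨e, he, -⟩
    rw [h e] at he; simp at he
  · rintro _ rfl; exact cl_self _ _

theorem col_zero (y : Vt N → Bool) (v : Vt N) : v ∈ colS (enT N) (idT N) (Sum.elim (fun _ => false) y) ↔ y v = true := by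
  have h := rep_mem (en := enT N) (idx := idT N) (Sum.elim (fun _ => false) y) v
  rw [cl_zero (fun e => rfl)] at h
  rw [Set.mem_singleton_iff] at h
  unfold colS
  rw [Set.mem_ofPred_eq, h]
  rfl

theorem O_zero (hN : 2 ∣ N) (y : Vt N → Bool) : O true (Sum.elim (fun _ => false) y) = Wh (fun v => y (pj N v)) := by
  ext v
  rw [mem_O hN, col_zero]
  simp [Wh, EE]

theorem dual_star (hN : 2 ∣ N) {p : ℝ} (hp : p ^ 3 - 3 * p + 1 = 0) (h0 : (0 : ℝ) ≤ 0 ∧ (0 : ℝ) ≤ 1) (hp' : 0 ≤ p ∧ p ≤ 1) (K : ℤ) :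
    Dual (law (N := N) true 0 p h0 hp') K := by
  intro a b ha hb _ _
  show pr (qq N 0 p) _ ≤ pr (qq N 0 p) _
  rw [pr_zero, pr_zero]
  simp only [O_zero hN]
  have hq : Pq (fun _ : Vt N => p) := fun _ => hp'
  have e1 : pr (fun _ : Vt N => p) (fun y => VEv (Wh (fun v => y (pj N v)))ᶜ a b) ≤
      ex (fun _ : Vt N => p) (fun y => ind (BE (extE (fun i : Ev N => sB (eqv3 (Ev N) (fun k => y (j3 k)) i))) a b)) := by
    refine ex_mono hq fun y => ind_mono fun h => ?_
    have h2 : VEv {w | EE w ∨ y (pj N w) = true} a b := by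
      convert h using 1
      ext w; simp [Wh]; tauto
    refine BE_congr ?_ (blk h2)
    intro v hv
    rw [extE, dif_pos (ext_even hN hv)]
    show sB (mids _ v) = sB (y (pj N v + pj N (off3 0)), y (pj N v + pj N (off3 1)), y (pj N v + pj N (off3 2)))
    simp only [mids, ← pj_tr]
    simp [tr, off3]
  have e2 : ex (fun _ : Vt N => p) (fun y => ind (BE (extE (fun i : Ev N => sW (eqv3 (Ev N) (fun k => y (j3 (rho k.1, k.2))) i))) a b)) ≤
      pr (fun _ : Vt N => p) (fun y => VEv (Wh (fun v => y (pj N v))) (a + 4) (b - 4)) := by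
    refine ex_mono hq fun y => ind_mono fun h => ?_
    refine wht hb (BE_congr ?_ h)
    intro v hv
    rw [extE, dif_pos (ext_even hN hv)]
    have e : ((-(pj N v).1 - 2, -(pj N v).2) : Vt N) = pj N (rfl2 v) := by simp [pj, rfl2]
    show sW (y ((-(pj N v).1 - 2, -(pj N v).2) + pj N (off3 0)), y ((-(pj N v).1 - 2, -(pj N v).2) + pj N (off3 1)), y ((-(pj N v).1 - 2, -(pj N v).2) + pj N (off3 2))) = sW (mids _ (rfl2 v))
    rw [e]
    simp only [mids, ← pj_tr]
    simp [tr, off3]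
  refine e1.trans (le_of_eq_of_le ?_ e2)
  haveI : Fintype (Ev N) := Fintype.ofFinite _
  rw [ex_inj j3 (j3_inj hN) (fun _ => p) (fun z => ind (BE (extE (fun i : Ev N => sB (eqv3 (Ev N) z i))) a b))]
  have hj : Function.Injective (fun k : Ev N × Fin 3 => j3 (rho k.1, k.2)) := by
    rintro ⟨i, k⟩ ⟨i', k'⟩ h
    have := j3_inj hN h
    simp only [Prod.mk.injEq] at this ⊢
    exact ⟨rho_inj this.1, this.2⟩
  rw [ex_inj _ hj (fun _ => p) (fun z => ind (BE (extE (fun i : Ev N => sW (eqv3 (Ev N) z i))) a b))]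
  exact star_ex hp (fun Y => ind (BE (extE Y) a b))

theorem p0_root : (2 * Real.sin (Real.pi / 18)) ^ 3 - 3 * (2 * Real.sin (Real.pi / 18)) + 1 = 0 := by
  have h := Real.sin_three_mul (Real.pi / 18)
  rw [show 3 * (Real.pi / 18) = Real.pi / 6 by ring, Real.sin_pi_div_six] at h
  linarith

theorem p0_mem : 0 ≤ 2 * Real.sin (Real.pi / 18) ∧ 2 * Real.sin (Real.pi / 18) ≤ 1 := by
  have hpi := Real.pi_pos
  refine ⟨by have := Real.sin_nonneg_of_nonneg_of_le_pi (x := Real.pi / 18) (by positivity) (by linarith); linarith, ?_⟩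
  have : Real.sin (Real.pi / 18) ≤ Real.sin (Real.pi / 6) := Real.sin_le_sin_of_le_of_le_pi_div_two (by linarith) (by linarith) (by linarith)
  rw [Real.sin_pi_div_six] at this
  linarith
end
end DaC

namespace DaC
section
/-! ### Colour symmetry at density one half -/
theorem ex_flip {κ : Type} [Fintype κ] (F : (κ → Bool) → ℝ) : ex (fun _ => (1 / 2 : ℝ)) (fun y => F (fun i => !(y i))) = ex (fun _ => (1 / 2 : ℝ)) F := by
  classical
  rw [ex_def, ex_def]
  let e : (κ → Bool) ≃ (κ → Bool) := ⟨fun y i => !(y i), fun y i => !(y i), fun y => by simp, fun y => by simp⟩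
  refine Fintype.sum_equiv e _ _ fun y => ?_
  congr 1
  unfold wt
  refine Finset.prod_congr rfl fun i _ => ?_
  have : (1 : ℝ) - 1 / 2 = 1 / 2 := by norm_num
  rw [this, ite_self, ite_self]

variable {N : ℕ} [NeZero N]

theorem O_flip (x : Vt N × Fin 3 → Bool) (y : Vt N → Bool) :
    O false (Sum.elim x (fun i => !(y i))) = (O false (Sum.elim x y))ᶜ := by
  have hcl : ∀ v, cl (enT N) (Sum.elim x (fun i => !(y i))) v = cl (enT N) (Sum.elim x y) v := fun v => cl_congr (fun e => rfl) v
  have h : ∀ (ω : It N → Bool) v, v ∈ O false ω ↔ pj N v ∉ colS (enT N) (idT N) ω := by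
    intro ω v
    simp [O, Os, Zt]
  ext v
  rw [Set.mem_compl_iff, h, h, not_not]
  unfold colS
  rw [Set.mem_ofPred_eq, Set.mem_ofPred_eq, rep_congr (idT_inj N) (hcl _)]
  simp

theorem dual_half {p : ℝ} (hp : 0 ≤ p ∧ p ≤ 1) (hs : (0 : ℝ) ≤ 1 / 2 ∧ (1 / 2 : ℝ) ≤ 1) (K : ℤ) : Dual (law (N := N) false p (1 / 2) hp hs) K := by
  intro a b ha hb _ _
  have hq := Pq_qq N hp hs
  refine le_trans (le_of_eq ?_) (pr_mono hq (E := fun ω => VEv (O false ω) a b) fun ω h => VEv_shrink (by omega) (by omega) (by omega) h)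
  show pr (qq N p (1 / 2)) (fun ω => VEv (O false ω)ᶜ a b) = _
  unfold pr
  rw [ex_sum_type, ex_sum_type]
  refine ex_congr _ fun x => ?_
  simp only [← O_flip]
  exact ex_flip (fun y => ind (VEv (O false (Sum.elim x y)) a b))

/-! ### Locality of the radius of a cluster -/
theorem dir_adj (d : Fin 3) (v : V) : TriAdj v (tr (dir d) v) := by
  rw [tri_iff]; fin_cases d <;> simp [dir, tr]

theorem df_adj {u a b : V} (h : TriAdj a b) : TriAdj (df u a) (df u b) := by
  rw [tri_iff] at *; simp only [df]; omega

theorem inc_adj {e : V × Fin 3} {a b : V} (h : inc enP e a b) : TriAdj a b ∧ (e.1 = a ∨ e.1 = b) := by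
  have h0 := dir_adj e.2 e.1
  rcases h with h | h <;> simp only [enP, Prod.mk.injEq] at h <;> obtain ⟨rfl, rfl⟩ := h
  · exact ⟨h0, Or.inl rfl⟩
  · exact ⟨tri_symm h0, Or.inr rfl⟩

theorem far_local {m : ℤ} {u : V} {η : Ip → Bool} (P : V → V → Prop)
    (hP : ∀ a b e, η (.inl e) = true → nrm (df u e.1) ≤ m → inc enP e a b → P a b) (h : Far m u η) :
    ∃ w, m ≤ nrm (df u w) ∧ Relation.ReflTransGen P u w := by
  obtain ⟨w, hw, hm⟩ := h
  have key : (∃ w, m ≤ nrm (df u w) ∧ Relation.ReflTransGen P u w) ∨ Relation.ReflTransGen P u w := by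
    clear hm
    induction hw with
    | refl => exact Or.inr .refl
    | @tail a b _ hs ih =>
      rcases ih with ih | ih
      · exact Or.inl ih
      · by_cases ha : m ≤ nrm (df u a)
        · exact Or.inl ⟨a, ha, ih⟩
        · right
          obtain ⟨e, he, hi⟩ := hs
          refine ih.tail (hP a b e he ?_ hi)
          obtain ⟨h1, h2⟩ := inc_adj hi
          have h3 := nrm_step _ _ (df_adj (u := u) h1)
          rcases h2 with h2 | h2 <;> rw [h2] <;> omega
  rcases key with h | h
  · exact h
  · exact ⟨w, hm, h⟩

abbrev We (m : ℤ) : Type := {v // v ∈ bl m} × Fin 3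

open Classical in
noncomputable def extW {m : ℤ} (x : We m → Bool) : Ip → Bool := fun i =>
  Sum.elim (fun e : V × Fin 3 => if h : e.1 ∈ bl m then x (⟨e.1, h⟩, e.2) else false) (fun _ => false) i

noncomputable def tailA (p : ℝ) (m : ℤ) : ℝ := pr (fun _ : We m => p) (fun x => Far m (0, 0) (extW x))

theorem df_tr (u v : V) : df u (tr u v) = v := by ext <;> simp [df, tr]
theorem tr_df (u v : V) : tr u (df u v) = v := by ext <;> simp [df, tr]
theorem df_zero (v : V) : df (0, 0) v = v := by ext <;> simp [df]

theorem inc_df {u a b : V} {e : V × Fin 3} (h : inc enP e a b) : inc enP (df u e.1, e.2) (df u a) (df u b) := by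
  have : ∀ c d, enP e = (c, d) → enP (df u e.1, e.2) = (df u c, df u d) := by
    intro c d h
    simp only [enP, Prod.mk.injEq] at h ⊢
    obtain ⟨rfl, rfl⟩ := h
    exact ⟨rfl, by ext <;> simp [df, tr] <;> ring⟩
  exact h.imp (this _ _) (this _ _)

theorem far_shift {m : ℤ} {u : V} {η : Ip → Bool} (h : Far m u η) :
    Far m (0, 0) (extW (fun k : We m => η (.inl (tr u k.1.1, k.2)))) := by
  obtain ⟨w, h1, h2⟩ := far_local (fun a b => stp enP (extW (fun k : We m => η (.inl (tr u k.1.1, k.2)))) (df u a) (df u b)) (by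
    intro a b e he hn hi
    refine ⟨(df u e.1, e.2), ?_, inc_df hi⟩
    have hb : df u e.1 ∈ bl m := mem_bl.2 hn
    simp only [extW, Sum.elim_inl, dif_pos hb, tr_df]
    exact he) h
  refine ⟨df u w, ?_, by rwa [df_zero]⟩
  have : Relation.ReflTransGen (stp enP (extW (fun k : We m => η (.inl (tr u k.1.1, k.2))))) (df u u) (df u w) := Relation.ReflTransGen.lift (p := stp enP (extW (fun k : We m => η (.inl (tr u k.1.1, k.2))))) (df u) (fun a b h => h) u w h2
  have e : df u u = (0, 0) := by simp [df]
  rw [e] at this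
  exact this

theorem tail_torus {p t : ℝ} (hp : 0 ≤ p ∧ p ≤ 1) (ht : 0 ≤ t ∧ t ≤ 1) {m : ℤ} (hm : 2 * m < N) (u : V) :
    pr (qq N p t) (fun ω => Far m u (lft ω)) ≤ tailA p m := by
  refine (pr_mono (Pq_qq N hp ht) (fun ω h => far_shift h)).trans (le_of_eq ?_)
  let j : We m → It N := fun k => .inl (pj N (tr u k.1.1), k.2)
  have hj : Function.Injective j := by
    rintro ⟨⟨a, ha⟩, d⟩ ⟨⟨b, hb⟩, d'⟩ h
    simp only [j, Sum.inl.injEq, Prod.mk.injEq, pj_tr, _root_.add_left_inj] at h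
    obtain ⟨h1, rfl⟩ := h
    rw [mem_bl] at ha hb
    have := pj_inj_small (N := N) (w := a) (w' := b) (M := 0) h1 (by omega)
    subst this; rfl
  exact ex_inj j hj (qq N p t) (fun x => ind (Far m (0, 0) (extW x)))

def dbl (v : V) : V := (2 * v.1, 2 * v.2)

theorem far_arm (hN : 2 ∣ N) {m : ℤ} {y : Vt N → Bool} (h : Far m (0, 0) (extW (fun k : We m => y (pj N (tr (dir k.2) (dbl k.1.1)))))) :
    Arm (2 * m) (O true (Sum.elim (fun _ => false) y)) := by
  obtain ⟨w, hw, hm⟩ := h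
  rw [df_zero] at hm
  refine ⟨(0, 0), dbl w, by decide, ?_, ?_⟩
  · rw [O_zero hN]
    have hd : ∀ v, dbl v ∈ (Wh (fun v => y (pj N v)))ᶜ := fun v h => h.1 ⟨⟨_, rfl⟩, ⟨_, rfl⟩⟩
    clear hm
    induction hw with
    | refl => exact J.refl (hd (0, 0))
    | @tail a b _ hs ih =>
      obtain ⟨e, he, hi⟩ := hs
      have hmid : tr (dir e.2) (dbl e.1) ∈ (Wh (fun v => y (pj N v)))ᶜ := by
        intro hc
        have h2 : y (pj N (tr (dir e.2) (dbl e.1))) = false := hc.2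
        simp only [extW, Sum.elim_inl] at he
        split_ifs at he with hb
        rw [h2] at he; simp at he
      refine (ih.step ?_ hmid).step ?_ (hd b)
      · rcases hi with hi | hi <;> simp only [enP, Prod.mk.injEq] at hi <;> obtain ⟨rfl, rfl⟩ := hi
        · exact dir_adj _ _
        · generalize e.2 = d; generalize e.1 = v
          rw [tri_iff]; fin_cases d <;> simp [dir, tr, dbl] <;> omega
      · rcases hi with hi | hi <;> simp only [enP, Prod.mk.injEq] at hi <;> obtain ⟨rfl, rfl⟩ := hi
        · generalize e.2 = d; generalize e.1 = v
          rw [tri_iff]; fin_cases d <;> simp [dir, tr, dbl] <;> omega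
        · exact tri_symm (dir_adj _ _)
  · rw [le_nrm] at *; simp only [dbl]; omega

theorem tail_arm (hN : 2 ∣ N) {p : ℝ} (hp : 0 ≤ p ∧ p ≤ 1) {m : ℤ} (hm0 : 0 ≤ m) (hm : 4 * m + 2 < N) :
    tailA p m ≤ ex (qq N 0 p) (fA true (2 * m)) := by
  show _ ≤ pr (qq N 0 p) (fun ω => Arm (2 * m) (O true ω))
  rw [pr_zero]
  refine le_trans (le_of_eq ?_) (pr_mono (fun _ => hp) fun y h => far_arm hN h)
  let j : We m → Vt N := fun k => pj N (tr (dir k.2) (dbl k.1.1))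
  have hj : Function.Injective j := by
    rintro ⟨⟨a, ha⟩, d⟩ ⟨⟨b, hb⟩, d'⟩ h
    have h : pj N (tr (dir d) (dbl a)) = pj N (tr (dir d') (dbl b)) := h
    have hnr : ∀ (v : V) (d : Fin 3), v ∈ bl m → nrm (tr (dir d) (dbl v)) ≤ 2 * m + 1 := by
      intro v d hv
      rw [mem_bl, nrm_le] at hv
      rw [nrm_le]
      fin_cases d <;> simp [dir, tr, dbl] <;> omega
    have e := pj_inj_small (M := 0) h (by have := hnr a d ha; have := hnr b d' hb; omega)
    have e1 := congrArg Prod.fst e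
    have e2 := congrArg Prod.snd e
    obtain ⟨a1, a2⟩ := a
    obtain ⟨b1, b2⟩ := b
    have key : d = d' ∧ a1 = b1 ∧ a2 = b2 := by
      fin_cases d <;> fin_cases d' <;> simp [dir, tr, dbl] at e1 e2 ⊢ <;> omega
    obtain ⟨rfl, rfl, rfl⟩ := key
    rfl
  exact (ex_inj j hj (fun _ => p) (fun x => ind (Far m (0, 0) (extW x)))).symm
end
end DaC

namespace DaC
section

theorem far_zero_tail (N : ℕ) [NeZero N] (m : ℤ) (t : ℝ) (ht : 0 ≤ t ∧ t ≤ 1) (u : V) :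
    pr (qq N 0 t) (fun ω => Far m u (lft ω)) ≤ if m ≤ 0 then 1 else 0 := by
  split_ifs with hm
  · exact pr_le_one (Pq_qq N ⟨le_rfl, zero_le_one⟩ ht) _
  · rw [pr_zero]
    refine le_of_eq ?_
    rw [pr, show (0 : ℝ) = ex (fun _ : Vt N => t) (fun _ => 0) from (ex_const _ _).symm]
    refine ex_congr _ fun y => ind_false ?_
    rintro ⟨w, hw, h⟩
    rw [cl_zero (fun e => rfl)] at hw
    rw [Set.mem_singleton_iff.1 hw] at h
    have : nrm (df u u) = 0 := by simp [df, nrm]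
    omega

noncomputable def tailB (p : ℝ) (m : ℤ) : ℝ := if m ≤ 0 then 1 else tailA p m

theorem tailB_nonneg {p : ℝ} (hp : 0 ≤ p ∧ p ≤ 1) (m : ℤ) : 0 ≤ tailB p m := by
  unfold tailB
  split_ifs
  · exact zero_le_one
  · exact pr_nonneg (fun _ => hp) _

theorem tailB_SP {p : ℝ} (hp0 : 0 ≤ p) (hp : p < 2 * Real.sin (Real.pi / 18)) : SP (tailB p) := by
  intro k
  have h1 : 0 ≤ p ∧ p ≤ 1 := ⟨hp0, hp.le.trans p0_mem.2⟩
  obtain ⟨K, hK, h⟩ := master (z := true) (p := 0) (s := p) ⟨le_rfl, zero_le_one⟩ p0_mem hp0 hp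
    (T := fun m => if m ≤ 0 then 1 else 0) (fun m => by positivity)
    (fun k => ⟨0, le_rfl, fun n hn => by beta_reduce; rw [if_neg (by omega), zero_mul]⟩)
    (fun N _ _ m _ _ t h0 h1 u => far_zero_tail N m t ⟨h0, h1⟩ u)
    (fun n hn N _ hN => dual_star (by omega) p0_root _ _ _) k
  refine ⟨K, hK, fun n hn => ?_⟩
  have hN : ((800 * n.toNat : ℕ) : ℤ) = 400 * (2 * n) := by push_cast; omega
  haveI : NeZero (800 * n.toNat) := ⟨by omega⟩
  have h2 := h (2 * n) (by omega) (800 * n.toNat) hN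
  have h3 := tail_arm (N := 800 * n.toNat) (by omega) h1 (m := n) (by omega) (by omega)
  rw [tailB, if_neg (by omega)]
  refine le_trans ?_ h2
  have hn' : (1 : ℝ) ≤ n := by exact_mod_cast hn
  refine mul_le_mul h3 (pow_le_pow_left₀ (by linarith) (by push_cast; linarith) k) (by positivity) ?_
  exact (pr_nonneg (fun _ => h1) _).trans h3

theorem white_decay {p s : ℝ} (hp0 : 0 ≤ p) (hp : p < 2 * Real.sin (Real.pi / 18)) (hs : 0 ≤ s) (hs2 : s < 1 / 2) (k : ℕ) :
    ∃ K, 0 ≤ K ∧ ∀ n : ℤ, 1 ≤ n → ∀ (N : ℕ) [NeZero N], (N : ℤ) = 400 * n → ex (qq N p s) (fA false n) * (n : ℝ) ^ k ≤ K := by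
  have h1 : 0 ≤ p ∧ p ≤ 1 := ⟨hp0, hp.le.trans p0_mem.2⟩
  refine master (z := false) (s0 := 1 / 2) h1 (by norm_num) hs hs2 (T := tailB p) (tailB_nonneg h1) (tailB_SP hp0 hp) ?_
    (fun n hn N _ hN => dual_half _ _ _) k
  intro N _ _ m h0 hm t ht0 ht1 u
  unfold tailB
  split_ifs with h
  · exact pr_le_one (Pq_qq N h1 ⟨ht0, ht1⟩) _
  · exact tail_torus h1 ⟨ht0, ht1⟩ (by omega) u
end
end DaC

namespace DaC
section

abbrev enc : V → ℕ := Encodable.encode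

/-- A long arm of the coloured set from `v`, in absence of large clusters near `v`. -/
def Bad (n : ℤ) (v : V) (η : Ip → Bool) : Prop :=
  (∃ e, J (colS enP enc η) v e ∧ n ≤ nrm (df v e)) ∧ ∀ z, nrm (df v z) ≤ n → ¬ Far n z η

abbrev Ww (m : ℤ) : Type := We m ⊕ {v // v ∈ bl m}
def wI {m : ℤ} (v : V) : Ww m → Ip := Sum.elim (fun k => .inl (tr v k.1.1, k.2)) (fun k => .inr (tr v k.1))

variable {N : ℕ} [NeZero N]

theorem exists_idx (n : ℤ) (hN : 4 * n < N) (v : V) : ∃ idx : Vt N → ℕ, Function.Injective idx ∧ ∀ w, nrm (df v w) ≤ 2 * n → idx (pj N w) = enc w := by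
  classical
  have : ∀ t : Vt N, ∃ z, pj N z = t ∧ ((∃ w, pj N w = t ∧ nrm (df v w) ≤ 2 * n) → nrm (df v z) ≤ 2 * n) := by
    intro t
    by_cases h : ∃ w, pj N w = t ∧ nrm (df v w) ≤ 2 * n
    · obtain ⟨w, h1, h2⟩ := h
      exact ⟨w, h1, fun _ => h2⟩
    · obtain ⟨z, hz⟩ := pj_surj N t
      exact ⟨z, hz, fun h' => absurd h' h⟩
  choose l h1 h2 using this
  refine ⟨fun t => enc (l t), fun a b h => ?_, fun w hw => ?_⟩
  · rw [← h1 a, ← h1 b, Encodable.encode_injective h]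
  · have h3 := h2 (pj N w) ⟨w, rfl, hw⟩
    have h4 := h1 (pj N w)
    have h5 : pj N (df v (l (pj N w))) = pj N (df v w) := by
      have e : ∀ u, pj N (df v u) = pj N u - pj N v := by intro u; simp [pj, df]
      rw [e, e, h4]
    have h6 := pj_inj_small (M := 0) h5 (by omega)
    show enc (l (pj N w)) = enc w
    rw [← tr_df v (l (pj N w)), h6, tr_df]

theorem bad_torus {n : ℤ} (hn : 1 ≤ n) {v : V} {η : Ip → Bool} {ω : It N → Bool} {idx : Vt N → ℕ} (hi : Function.Injective idx)
    (hidx : ∀ w, nrm (df v w) ≤ 2 * n → idx (pj N w) = enc w)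
    (h : ∀ k : Ww (3 * n), η (wI v k) = lft ω (wI v k)) (hb : Bad n v η) :
    ∃ e, J (pj N ⁻¹' colS (enT N) idx ω) v e ∧ n ≤ nrm (df v e) := by
  obtain ⟨⟨e, h1, h2⟩, h3⟩ := hb
  have h0 : nrm (df v v) = 0 := by simp [df, nrm]
  obtain ⟨e', h4, h5⟩ := h1.first (fun w => nrm (df v w)) 1 n (fun a b hab => nrm_step _ _ (df_adj hab)) (by omega) h2
  refine ⟨e', h4.mono ?_, h5⟩
  rintro z ⟨hz, hz'⟩
  have hz' : nrm (df v z) ≤ n := by have : nrm (df v z) ≤ n + 1 - 1 := hz'; omega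
  have hE : ∀ e : V × Fin 3, nrm (df v e.1) ≤ 3 * n → η (.inl e) = lft ω (.inl e) := by
    intro e he
    have := h (.inl (⟨df v e.1, mem_bl.2 he⟩, e.2))
    simpa [wI, tr_df] using this
  have hL : ∀ w : V, nrm (df v w) ≤ 3 * n → η (.inr w) = lft ω (.inr w) := by
    intro w hw
    have := h (.inr ⟨df v w, mem_bl.2 hw⟩)
    simpa [wI, tr_df] using this
  have hcl : ∀ w ∈ cl enP η z, nrm (df v w) < 2 * n := by
    intro w hw
    have h6 : ¬ n ≤ nrm (df z w) := fun h7 => h3 z hz' ⟨w, hw, h7⟩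
    have h7 := nrm_tri (df v z) (df v w)
    have h8 : df (df v z) (df v w) = df z w := by ext <;> simp [df]
    rw [h8] at h7; omega
  have hs : ∀ a ∈ cl enP η z, ∀ b, stp enP η a b ↔ stp enP (lft ω) a b := by
    intro a ha b
    have ha' := hcl a ha
    have : ∀ e, inc enP e a b → η (.inl e) = lft ω (.inl e) := by
      intro e he
      apply hE
      obtain ⟨q1, q2⟩ := inc_adj he
      have := nrm_step _ _ (df_adj (u := v) q1)
      rcases q2 with q | q <;> rw [q] <;> omega
    constructor <;> rintro ⟨e, q1, q2⟩ <;> refine ⟨e, ?_, q2⟩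
    · rwa [← this e q2]
    · rwa [this e q2]
  have hc : cl enP (lft ω) z = cl enP η z := by
    have := cl_map (en := enP) (en' := enP) (ω := η) (ω' := lft ω) id z (fun a ha b hb => (hs a ha b).1 hb)
      (fun a ha b hb => ⟨b, (hs a ha b).2 hb, rfl⟩)
    simpa using this
  have hT := cl_T ω z
  rw [hc] at hT
  have hr : rep (enT N) idx ω (pj N z) = pj N (rep enP enc η z) := by
    refine rep_eq hi (by rw [hT]; exact ⟨_, rep_mem _ _, rfl⟩) ?_
    rw [hT]
    rintro _ ⟨w, hw, rfl⟩
    rw [hidx w (hcl w hw).le, hidx _ (hcl _ (rep_mem _ _)).le]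
    exact rep_le hw
  show ω (.inr (rep (enT N) idx ω (pj N z))) = true
  rw [hr]
  have q : η (.inr (rep enP enc η z)) = true := hz
  rw [hL _ (by have := hcl _ (rep_mem (idx := enc) η z); omega)] at q
  exact q

theorem bad_pr {p s : ℝ} (hp : 0 ≤ p ∧ p ≤ 1) (hs : 0 ≤ s ∧ s ≤ 1) {n : ℤ} (hn : 1 ≤ n) (hN : (N : ℤ) = 400 * n) (v : V) :
    pr (Sum.elim (fun _ => p) (fun _ => s)) (fun x : Ww (3 * n) → Bool => ∃ η, (∀ k, η (wI v k) = x k) ∧ Bad n v η)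
      ≤ ex (qq N p s) (fA false n) := by
  let j : Ww (3 * n) → It N := fun k => pjI N (wI v k)
  have hj : Function.Injective j := by
    have key : ∀ a b : {v // v ∈ bl (3 * n)}, pj N (tr v a.1) = pj N (tr v b.1) → a = b := by
      rintro ⟨a, ha⟩ ⟨b, hb⟩ h
      simp only [pj_tr, _root_.add_left_inj] at h
      rw [mem_bl] at ha hb
      have := pj_inj_small (N := N) (w := a) (w' := b) (M := 0) h (by omega)
      subst this; rfl
    rintro (⟨a, d⟩ | a) (⟨b, d'⟩ | b) h
    · simp only [j, wI, pjI, Sum.elim_inl, Sum.map_inl, Prod.map_apply, id, Sum.inl.injEq, Prod.mk.injEq] at h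
      rw [key a b h.1, h.2]
    · simp [j, wI, pjI] at h
    · simp [j, wI, pjI] at h
    · simp only [j, wI, pjI, Sum.elim_inr, Sum.map_inr, Sum.inr.injEq] at h
      rw [key a b h]
  have e1 := ex_inj j hj (qq N p s) (fun x => ind (∃ η, (∀ k, η (wI v k) = x k) ∧ Bad n v η))
  have e2 : (fun i => qq N p s (j i)) = Sum.elim (fun _ => p) (fun _ => s) := by
    funext i; cases i <;> rfl
  rw [e2] at e1
  rw [pr, ← e1]
  obtain ⟨idx, hi, hidx⟩ := exists_idx (N := N) n (by omega) v
  have hq := Pq_qq N hp hs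
  have e3 := rep_inv (en := enT N) hi (idT_inj N) (q := qq N p s) (s := s) (fun _ => rfl)
    (fun X => ind (∃ e, J (pj N ⁻¹' X) v e ∧ n ≤ nrm (df v e)))
  have e4 := (taut_tr (N := N) v).inv (z := false) (by ext; simp [Zt]) p s (Arm n)
  refine le_trans ?_ (le_of_eq e4)
  refine le_trans (ex_mono hq fun ω => ind_mono ?_) (le_trans (le_of_eq e3) (ex_mono hq fun ω => ind_mono ?_))
  · rintro ⟨η, h1, h2⟩
    exact bad_torus hn hi hidx h1 h2
  · rintro ⟨e, h1, h2⟩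
    refine ⟨df v v, df v e, by simp [df, nrm], ?_, h2⟩
    refine h1.map (df v) (fun a b h => df_adj h) ?_
    intro u hu
    have hu' : u ∈ (O false ω)ᶜ := by rw [compl_O]; exact Or.inr hu
    intro h
    apply hu'
    have h : tr v (df v u) ∈ O false ω := h
    rwa [tr_df] at h
end
end DaC

open MeasureTheory ENNReal
namespace DaC
section

theorem boolOf_iff {P : Prop} : boolOf P = true ↔ P := by simp [boolOf]

theorem meas_boolOf {α : Type} [MeasurableSpace α] {P : α → Prop} (h : MeasurableSet {x | P x}) : Measurable (fun x => boolOf (P x)) := by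
  refine measurable_to_bool ?_
  have : (fun x => boolOf (P x)) ⁻¹' {true} = {x | P x} := by ext x; simp [boolOf]
  rwa [this]

theorem meas_bit (n : ℕ) : Measurable (bit n) := by
  unfold bit
  refine meas_boolOf ?_
  have h : Measurable (fun x : ℝ => ⌊x * 2 ^ (n + 1)⌋) := Int.measurable_floor.comp (measurable_id.mul_const _)
  exact h (t := {m : ℤ | m % 2 = 1}) trivial

noncomputable def coin : Measure Bool := (2⁻¹ : ℝ≥0∞) • Measure.dirac false + (2⁻¹ : ℝ≥0∞) • Measure.dirac true

instance : IsProbabilityMeasure coin := ⟨by simp [coin, ENNReal.inv_two_add_inv_two]⟩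
instance : IsProbabilityMeasure base := ⟨by simp [base]⟩

theorem base_split {A : Set ℝ} (hA : MeasurableSet A) :
    base A = 2⁻¹ * base {x | x / 2 ∈ A} + 2⁻¹ * base {x | (x + 1) / 2 ∈ A} := by
  have h1 : MeasurableSet {x : ℝ | x / 2 ∈ A} := measurable_id.div_const 2 hA
  have h2 : MeasurableSet {x : ℝ | (x + 1) / 2 ∈ A} := (measurable_id.add_const 1).div_const 2 hA
  simp only [base]
  rw [Measure.restrict_apply hA, Measure.restrict_apply h1, Measure.restrict_apply h2]
  have e0 : A ∩ Set.Ioc 0 1 = (A ∩ Set.Ioc 0 (1 / 2)) ∪ (A ∩ Set.Ioc (1 / 2) 1) := by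
    rw [← Set.inter_union_distrib_left, Set.Ioc_union_Ioc_eq_Ioc (by norm_num) (by norm_num)]
  have hd : Disjoint (A ∩ Set.Ioc (0 : ℝ) (1 / 2)) (A ∩ Set.Ioc (1 / 2) 1) :=
    (Set.Ioc_disjoint_Ioc_of_le le_rfl).mono Set.inter_subset_right Set.inter_subset_right
  have e1 : {x : ℝ | x / 2 ∈ A} ∩ Set.Ioc 0 1 = (fun x => (1 / 2) * x) ⁻¹' (A ∩ Set.Ioc 0 (1 / 2)) := by
    ext x
    simp only [Set.mem_inter_iff, Set.mem_ofPred_eq, Set.mem_preimage, Set.mem_Ioc]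
    rw [show x / 2 = 1 / 2 * x by ring]
    exact and_congr_right fun _ => ⟨fun h => ⟨by linarith, by linarith⟩, fun h => ⟨by linarith, by linarith⟩⟩
  have e2 : {x : ℝ | (x + 1) / 2 ∈ A} ∩ Set.Ioc 0 1 = (fun x => x + 1) ⁻¹' ((fun x => (1 / 2) * x) ⁻¹' (A ∩ Set.Ioc (1 / 2) 1)) := by
    ext x
    simp only [Set.mem_inter_iff, Set.mem_ofPred_eq, Set.mem_preimage, Set.mem_Ioc]
    rw [show (x + 1) / 2 = 1 / 2 * (x + 1) by ring]
    exact and_congr_right fun _ => ⟨fun h => ⟨by linarith, by linarith⟩, fun h => ⟨by linarith, by linarith⟩⟩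
  rw [e0, measure_union hd (hA.inter measurableSet_Ioc), e1, e2, measure_preimage_add_right,
    Real.volume_preimage_mul_left (by norm_num), Real.volume_preimage_mul_left (by norm_num)]
  have : ENNReal.ofReal |(1 / 2 : ℝ)⁻¹| = 2 := by norm_num
  rw [this, ← mul_assoc, ← mul_assoc, ENNReal.inv_mul_cancel (by norm_num) (by norm_num), one_mul, one_mul]

theorem bit_half0 {x : ℝ} (h : x ∈ Set.Ioo (0 : ℝ) 1) : bit 0 (x / 2) = false ∧ bit 0 ((x + 1) / 2) = true := by
  have e1 : ⌊x / 2 * 2 ^ (0 + 1)⌋ = 0 := by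
    rw [Int.floor_eq_iff]; constructor <;> norm_num <;> linarith [h.1, h.2]
  have e2 : ⌊(x + 1) / 2 * 2 ^ (0 + 1)⌋ = 1 := by
    rw [Int.floor_eq_iff]; constructor <;> norm_num <;> linarith [h.1, h.2]
  simp only [bit, e1, e2]
  simp [boolOf]

theorem bit_half (n : ℕ) (x : ℝ) : bit (n + 1) (x / 2) = bit n x ∧ bit (n + 1) ((x + 1) / 2) = bit n x := by
  have e1 : x / 2 * 2 ^ (n + 1 + 1) = x * 2 ^ (n + 1) := by ring
  have e2 : (x + 1) / 2 * 2 ^ (n + 1 + 1) = x * 2 ^ (n + 1) + ((2 ^ (n + 1) : ℤ) : ℝ) := by push_cast; ring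
  simp only [bit, e1, e2, Int.floor_add_intCast]
  refine ⟨trivial, ?_⟩
  congr 2
  rw [pow_succ]; omega

theorem base_Ioo : ∀ᵐ x ∂base, x ∈ Set.Ioo (0 : ℝ) 1 := by
  unfold base
  rw [← restrict_Ioo_eq_restrict_Ioc]
  exact ae_restrict_mem measurableSet_Ioo

theorem bits_cyl (n : ℕ) : ∀ t : ℕ → Set Bool, base {x | ∀ i < n, bit i x ∈ t i} = ∏ i ∈ Finset.range n, coin (t i) := by
  induction n with
  | zero => intro t; simp
  | succ n ih =>
    intro t
    have hm : MeasurableSet {x | ∀ i < n + 1, bit i x ∈ t i} := by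
      have : {x | ∀ i < n + 1, bit i x ∈ t i} = ⋂ i ∈ Finset.range (n + 1), bit i ⁻¹' t i := by ext x; simp
      rw [this]
      exact Finset.measurableSet_biInter _ fun i _ => meas_bit i trivial
    rw [base_split hm, Finset.prod_range_succ']
    have ih' := ih (fun i => t (i + 1))
    rw [← ih']
    set P := base {x | ∀ i < n, bit i x ∈ t (i + 1)}
    have key : ∀ (f : ℝ → ℝ) (b : Bool), (∀ x ∈ Set.Ioo (0 : ℝ) 1, bit 0 (f x) = b) → (∀ i x, bit (i + 1) (f x) = bit i x) →
        base {x | f x ∈ {x | ∀ i < n + 1, bit i x ∈ t i}} = P * Measure.dirac b (t 0) := by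
      intro f b h0 h1
      by_cases hb : b ∈ t 0
      · rw [Measure.dirac_apply_of_mem hb, mul_one]
        refine measure_congr ?_
        filter_upwards [base_Ioo] with x hx
        refine propext ⟨fun h i hi => ?_, fun h i hi => ?_⟩
        · rw [← h1]; exact h (i + 1) (by omega)
        · cases i with
          | zero => rw [h0 x hx]; exact hb
          | succ i => rw [h1]; exact h i (by omega)
      · rw [Measure.dirac_apply' _ (MeasurableSet.of_discrete), Set.indicator_of_notMem hb, mul_zero]
        rw [measure_eq_zero_iff_ae_notMem]
        filter_upwards [base_Ioo] with x hx h
        apply hb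
        rw [← h0 x hx]
        exact h 0 (by omega)
    rw [key (fun x => x / 2) false (fun x hx => (bit_half0 hx).1) (fun i x => (bit_half i x).1),
      key (fun x => (x + 1) / 2) true (fun x hx => (bit_half0 hx).2) (fun i x => (bit_half i x).2)]
    simp only [coin, Measure.add_apply, Measure.smul_apply, smul_eq_mul]
    ring

theorem bits_law : base.map (fun x n => bit n x) = Measure.infinitePi (fun _ : ℕ => coin) := by
  classical
  have hm : Measurable (fun x n => bit n x) := measurable_pi_iff.2 meas_bit
  refine Measure.eq_infinitePi _ fun s t ht => ?_
  rw [Measure.map_apply hm (MeasurableSet.pi s.countable_toSet fun i _ => ht i)]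
  obtain ⟨n, hn⟩ := s.exists_nat_subset_range
  have e : (fun x n => bit n x) ⁻¹' (Set.pi s t) = {x | ∀ i < n, bit i x ∈ (if i ∈ s then t i else Set.univ)} := by
    ext x
    simp only [Set.mem_preimage, Set.mem_pi, Finset.mem_coe, Set.mem_ofPred_eq]
    constructor
    · intro h i _
      split_ifs with hi
      · exact h i hi
      · trivial
    · intro h i hi
      have := h i (Finset.mem_range.1 (hn hi))
      rwa [if_pos hi] at this
  rw [e, bits_cyl]
  rw [← Finset.prod_subset hn (fun i _ hi => by rw [if_neg hi, measure_univ])]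
  exact Finset.prod_congr rfl fun i hi => by rw [if_pos hi]

noncomputable def phi (b : ℕ → Bool) : ℝ := ∑' k : ℕ, if b k then ((2 : ℝ)⁻¹) ^ (k + 1) else 0

theorem meas_phi : Measurable phi := by
  have : Continuous phi := by
    unfold phi
    refine continuous_tsum (u := fun k => ((2 : ℝ)⁻¹) ^ (k + 1)) (fun k => ?_) ?_ ?_
    · exact (continuous_of_discreteTopology (f := fun b : Bool => if b then ((2 : ℝ)⁻¹) ^ (k + 1) else 0)).comp (continuous_apply k)
    · exact (summable_nat_add_iff 1).2 (summable_geometric_of_lt_one (by norm_num) (by norm_num))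
    · intro k b
      split_ifs <;> simp
  exact this.measurable

theorem phi_bits {x : ℝ} (hx : x ∈ Set.Ioo (0 : ℝ) 1) : phi (fun n => bit n x) = x := by
  have h := Real.ofDigits_digits (b := 2) (by norm_num) (x := x) ⟨hx.1.le, hx.2⟩
  refine Eq.trans ?_ h
  unfold phi Real.ofDigits
  refine tsum_congr fun k => ?_
  simp only [Real.ofDigitsTerm, Real.digits, bit, boolOf_iff]
  have h0 : 0 ≤ ⌊x * 2 ^ (k + 1)⌋ := Int.floor_nonneg.2 (by have := hx.1; positivity)
  have h1 : ((⌊x * 2 ^ (k + 1)⌋₊ : ℕ) : ℤ) = ⌊x * 2 ^ (k + 1)⌋ := by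
    rw [← Int.floor_toNat, Int.toNat_of_nonneg h0]
  rw [← h1]
  simp only [Fin.val_ofNat, Nat.cast_ofNat]
  rcases Nat.mod_two_eq_zero_or_one ⌊x * 2 ^ (k + 1)⌋₊ with h | h
  · rw [if_neg (by omega), h]; simp
  · rw [if_pos (by omega), h]; simp

theorem phi_law : (Measure.infinitePi (fun _ : ℕ => coin)).map phi = base := by
  have hm : Measurable (fun x n => bit n x) := measurable_pi_iff.2 meas_bit
  rw [← bits_law, Measure.map_map meas_phi hm]
  refine Eq.trans (Measure.map_congr ?_) Measure.map_id
  filter_upwards [base_Ioo] with x hx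
  exact phi_bits hx

theorem meas_unif (i : ℕ) : Measurable (unif i) :=
  meas_phi.comp (measurable_pi_iff.2 fun k => meas_bit (Nat.pair i k))

theorem unif_law : base.map (fun x i => unif i x) = Measure.infinitePi (fun _ : ℕ => base) := by
  have hm : Measurable (fun x n => bit n x) := measurable_pi_iff.2 meas_bit
  have hp : Function.Injective (fun q : ℕ × ℕ => Nat.pair q.1 q.2) := by
    rintro ⟨a, b⟩ ⟨c, d⟩ h
    exact Prod.ext (Nat.pair_eq_pair.1 h).1 (Nat.pair_eq_pair.1 h).2
  have h1 := Measure.map_infinitePi_infinitePi_of_inj (P := fun _ : ℕ => coin) hp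
  have h2 := Measure.infinitePi_map_curry (fun _ _ : ℕ => coin)
  have h3 := Measure.infinitePi_map_pi (μ := fun _ : ℕ => Measure.infinitePi (fun _ : ℕ => coin)) (f := fun _ => phi) (fun _ => meas_phi)
  simp only [phi_law] at h3
  rw [← h3, ← h2, ← h1, ← bits_law]
  have q1 : Measurable (fun (b : ℕ → ℕ → Bool) (i : ℕ) => phi (b i)) := measurable_pi_iff.2 fun i => meas_phi.comp (measurable_pi_apply i)
  have q2 : Measurable (fun (ω : ℕ → Bool) (i : ℕ × ℕ) => ω (Nat.pair i.1 i.2)) := measurable_pi_iff.2 fun i => measurable_pi_apply _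
  have q3 : Measurable (MeasurableEquiv.curry ℕ ℕ Bool) := MeasurableEquiv.measurable _
  rw [Measure.map_map q3 q2, Measure.map_map (q3.comp q2) hm, Measure.map_map q1 ((q3.comp q2).comp hm)]
  rfl
end
end DaC

open MeasureTheory ENNReal
namespace DaC
section

variable {κ : Type} [Fintype κ]

theorem unif_law_inj (j : κ → ℕ) (hj : Function.Injective j) :
    base.map (fun x i => unif (j i) x) = Measure.infinitePi (fun _ : κ => base) := by
  have h := Measure.map_infinitePi_infinitePi_of_inj (P := fun _ : ℕ => base) hj
  rw [← h, ← unif_law, Measure.map_map]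
  · rfl
  · exact measurable_pi_iff.2 fun i => measurable_pi_apply _
  · exact measurable_pi_iff.2 meas_unif

/-- Finite joint law of the labels. -/
theorem joint (j : κ → ℕ) (hj : Function.Injective j) (D : κ → Set ℝ) (hD : ∀ i, MeasurableSet (D i)) (q : κ → ℝ) (hq : Pq q)
    (hDq : ∀ i, base (D i) = ENNReal.ofReal (q i)) (E : (κ → Bool) → Prop) :
    base {x | E (fun i => boolOf (unif (j i) x ∈ D i))} = ENNReal.ofReal (pr q E) := by
  classical
  have hm : Measurable (fun x (i : κ) => unif (j i) x) := measurable_pi_iff.2 fun i => meas_unif _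
  let B : (κ → Bool) → κ → Set ℝ := fun b i => if b i then D i else (D i)ᶜ
  have hB : ∀ b i, MeasurableSet (B b i) := by
    intro b i
    simp only [B]
    split_ifs
    · exact hD i
    · exact (hD i).compl
  let At : (κ → Bool) → Set ℝ := fun b => (fun x (i : κ) => unif (j i) x) ⁻¹' (Set.pi (Finset.univ : Finset κ) (B b))
  have hAt : ∀ b x, x ∈ At b ↔ (fun i => boolOf (unif (j i) x ∈ D i)) = b := by
    intro b x
    rw [funext_iff]
    simp only [At, Set.mem_preimage, Set.mem_pi, Finset.coe_univ, Set.mem_univ, true_implies]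
    refine forall_congr' fun i => ?_
    by_cases h : unif (j i) x ∈ D i <;> cases hb : b i <;> simp [B, hb, h, boolOf]
  have hmA : ∀ b, MeasurableSet (At b) := fun b =>
    hm (MeasurableSet.pi (Finset.univ : Finset κ).countable_toSet fun i _ => hB b i)
  have hAm : ∀ b, base (At b) = ENNReal.ofReal (wt q b) := by
    intro b
    simp only [At]
    rw [← Measure.map_apply hm (MeasurableSet.pi (Finset.univ : Finset κ).countable_toSet fun i _ => hB b i), unif_law_inj j hj,
      Measure.infinitePi_pi (fun _ : κ => base) (fun i _ => hB b i), wt, ENNReal.ofReal_prod_of_nonneg]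
    · refine Finset.prod_congr rfl fun i _ => ?_
      simp only [B]
      split_ifs
      · exact hDq i
      · rw [prob_compl_eq_one_sub (hD i), hDq i, ENNReal.ofReal_sub _ (hq i).1, ENNReal.ofReal_one]
    · intro i _
      have := hq i
      split_ifs <;> linarith
  have e : {x | E (fun i => boolOf (unif (j i) x ∈ D i))} = ⋃ b ∈ Finset.univ.filter E, At b := by
    ext x
    simp only [Set.mem_ofPred_eq, Set.mem_iUnion, Finset.mem_filter, Finset.mem_univ, true_and, hAt]
    constructor
    · intro h; exact ⟨_, h, rfl⟩
    · rintro ⟨b, h, h'⟩; rw [h']; exact h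
  rw [e, measure_biUnion_finset _ (fun b _ => hmA b)]
  · simp only [hAm]
    rw [← ENNReal.ofReal_sum_of_nonneg (fun b _ => wt_nonneg hq b), pr, ex_def, Finset.sum_filter]
    congr 1
    refine Finset.sum_congr rfl fun b _ => ?_
    by_cases hb : E b
    · rw [if_pos hb, ind_true hb, mul_one]
    · rw [if_neg hb, ind_false hb, mul_zero]
  · intro b _ b' _ hbb
    refine Set.disjoint_left.2 fun x h h' => hbb ?_
    rw [hAt] at h h'
    exact h.symm.trans h'

theorem base_Iio {t : ℝ} (h : 0 ≤ t ∧ t ≤ 1) : base (Set.Iio t) = ENNReal.ofReal t := by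
  rw [base, ← restrict_Ioo_eq_restrict_Ioc, Measure.restrict_apply measurableSet_Iio]
  have : Set.Iio t ∩ Set.Ioo 0 1 = Set.Ioo 0 t := by
    ext x; simp only [Set.mem_inter_iff, Set.mem_Iio, Set.mem_Ioo]
    exact ⟨fun h => ⟨h.2.1, h.1⟩, fun h' => ⟨h'.2, h'.1, h'.2.trans_le h.2⟩⟩
  rw [this, Real.volume_Ioo, sub_zero]

theorem base_Ici {t : ℝ} (h : 0 ≤ t) : base (Set.Ici t) = ENNReal.ofReal (max 0 (1 - t)) := by
  rw [base, Measure.restrict_apply measurableSet_Ici]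
  rcases lt_or_ge 0 t with h0 | h0
  · have : Set.Ici t ∩ Set.Ioc 0 1 = Set.Icc t 1 := by
      ext x; simp only [Set.mem_inter_iff, Set.mem_Ici, Set.mem_Ioc, Set.mem_Icc]
      exact ⟨fun h => ⟨h.1, h.2.2⟩, fun h' => ⟨h'.1, h0.trans_le h'.1, h'.2⟩⟩
    rw [this, Real.volume_Icc]
    rcases le_total 0 (1 - t) with h1 | h1
    · rw [max_eq_right h1]
    · rw [max_eq_left h1, ENNReal.ofReal_of_nonpos h1, ENNReal.ofReal_zero]
  · have : t = 0 := le_antisymm h0 h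
    subst this
    have : Set.Ici (0 : ℝ) ∩ Set.Ioc 0 1 = Set.Ioc 0 1 := by
      ext x; simp only [Set.mem_inter_iff, Set.mem_Ici, Set.mem_Ioc]
      exact ⟨fun h => h.2, fun h => ⟨h.1.le, h⟩⟩
    rw [this, Real.volume_Ioc]; norm_num

noncomputable def uIdx : Ip → ℕ := Sum.elim (fun e => 2 * eIdx e.1 (tr (dir e.2) e.1)) (fun v => 2 * enc v + 1)
def Dst (p r : ℝ) : Ip → Set ℝ := Sum.elim (fun _ => Set.Iio p) (fun _ => Set.Ici r)
noncomputable def cfg (p r x : ℝ) : Ip → Bool := fun i => boolOf (unif (uIdx i) x ∈ Dst p r i)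

theorem eIdx_inj {u v a b : V} (h : eIdx u v = eIdx a b) : (u = a ∧ v = b) ∨ (u = b ∧ v = a) := by
  unfold eIdx at h
  have key : ∀ s t s' t' : V, Encodable.encode (s, t) = Encodable.encode (s', t') → s = s' ∧ t = t' := by
    intro s t s' t' h; exact Prod.mk.injEq _ _ _ _ ▸ Encodable.encode_injective h
  rcases min_choice (Encodable.encode (u, v)) (Encodable.encode (v, u)) with h1 | h1 <;>
  rcases min_choice (Encodable.encode (a, b)) (Encodable.encode (b, a)) with h2 | h2 <;>
  rw [h1, h2] at h <;> have := key _ _ _ _ h <;> tauto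

theorem uIdx_inj : Function.Injective uIdx := by
  rintro (⟨u, d⟩ | u) (⟨v, d'⟩ | v) h <;> simp only [uIdx, Sum.elim_inl, Sum.elim_inr] at h
  · rcases eIdx_inj (show eIdx u (tr (dir d) u) = eIdx v (tr (dir d') v) by omega) with ⟨h1, h2⟩ | ⟨h1, h2⟩
    · subst h1
      have e1 := congrArg Prod.fst h2; have e2 := congrArg Prod.snd h2
      have : d = d' := by
        fin_cases d <;> fin_cases d' <;> simp [dir, tr] at e1 e2 ⊢
      rw [this]
    · exfalso
      obtain ⟨u1, u2⟩ := u; obtain ⟨v1, v2⟩ := v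
      have a1 := congrArg Prod.fst h1; have a2 := congrArg Prod.snd h1
      have e1 := congrArg Prod.fst h2; have e2 := congrArg Prod.snd h2
      fin_cases d <;> fin_cases d' <;> simp [dir, tr] at a1 a2 e1 e2 <;> omega
  · omega
  · omega
  · have : enc u = enc v := by omega
    rw [Encodable.encode_injective this]

/-- Law of finitely many coordinates of the configuration. -/
theorem cfg_law {p r : ℝ} (hp : 0 ≤ p ∧ p ≤ 1) (hr : 0 ≤ r) (w : κ → Ip) (hw : Function.Injective w) (E : (κ → Bool) → Prop) :
    base {x | E (fun i => cfg p r x (w i))} = ENNReal.ofReal (pr (fun i => Sum.elim (fun _ => p) (fun _ => max 0 (1 - r)) (w i)) E) := by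
  refine joint (fun i => uIdx (w i)) (uIdx_inj.comp hw) (fun i => Dst p r (w i)) ?_ _ ?_ ?_ E
  · intro i; cases w i
    · exact measurableSet_Iio
    · exact measurableSet_Ici
  · intro i; beta_reduce; cases w i
    · exact hp
    · exact ⟨le_max_left _ _, max_le zero_le_one (sub_le_self _ hr)⟩
  · intro i; cases w i
    · exact base_Iio hp
    · exact base_Ici hr

theorem cfg_far {p r : ℝ} (hp : 0 ≤ p ∧ p ≤ 1) (hr : 0 ≤ r) (m : ℤ) (z : V) :
    base {x | Far m z (cfg p r x)} ≤ ENNReal.ofReal (tailA p m) := by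
  have h := cfg_law hp hr (fun k : We m => (.inl (tr z k.1.1, k.2) : Ip)) (by
    rintro ⟨⟨a, ha⟩, d⟩ ⟨⟨b, hb⟩, d'⟩ h
    simp only [Sum.inl.injEq, Prod.mk.injEq] at h
    have : a = b := by rw [← df_tr z a, h.1, df_tr]
    subst this
    rw [h.2]) (fun x => Far m (0, 0) (extW x))
  refine (measure_mono ?_).trans (le_of_eq h)
  intro x hx
  exact far_shift hx

theorem cfg_bad {p r : ℝ} (hp : 0 ≤ p ∧ p ≤ 1) (hr : 0 ≤ r) {n : ℤ} (hn : 1 ≤ n) {N : ℕ} [NeZero N] (hN : (N : ℤ) = 400 * n) (v : V) :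
    base {x | Bad n v (cfg p r x)} ≤ ENNReal.ofReal (ex (qq N p (max 0 (1 - r))) (fA false n)) := by
  have h := cfg_law hp hr (wI (m := 3 * n) v) (by
    have key : ∀ a b : {v // v ∈ bl (3 * n)}, tr v a.1 = tr v b.1 → a = b := by
      intro a b h
      exact Subtype.ext (by rw [← df_tr v a.1, h, df_tr])
    rintro (⟨a, d⟩ | a) (⟨b, d'⟩ | b) h
    · simp only [wI, Sum.elim_inl, Sum.inl.injEq, Prod.mk.injEq] at h
      rw [key a b h.1, h.2]
    · simp [wI] at h
    · simp [wI] at h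
    · simp only [wI, Sum.elim_inr, Sum.inr.injEq] at h
      rw [key a b h]) (fun x => ∃ η, (∀ k, η (wI v k) = x k) ∧ Bad n v η)
  refine (measure_mono ?_).trans ((le_of_eq h).trans (ENNReal.ofReal_le_ofReal ?_))
  · intro x hx
    exact ⟨cfg p r x, fun _ => rfl, hx⟩
  · have e : (fun i : Ww (3 * n) => Sum.elim (fun _ => p) (fun _ => max 0 (1 - r)) (wI v i)) = Sum.elim (fun _ => p) (fun _ => max 0 (1 - r)) := by
      funext i; cases i <;> rfl
    rw [e]
    exact bad_pr hp ⟨le_max_left _ _, max_le zero_le_one (by linarith)⟩ hn hN v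
end
end DaC

open MeasureTheory ENNReal
namespace DaC
section

theorem edge_stp (p r x : ℝ) (a b : V) : edgeCfg TriAdj p x a b = true ↔ stp enP (cfg p r x) a b := by
  have hs : ∀ a b, edgeU a b x = edgeU b a x := by intro a b; simp only [edgeU, eIdx, min_comm]
  have hc : ∀ v d, cfg p r x (.inl (v, d)) = true ↔ edgeU v (tr (dir d) v) x < p := by
    intro v d
    simp only [cfg, boolOf_iff, Dst, uIdx, Sum.elim_inl, Set.mem_Iio, edgeU]
  simp only [edgeCfg, Bool.and_eq_true, boolOf_iff]
  constructor
  · rintro ⟨h1, h2⟩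
    have key : ∀ a b d, edgeU a b x < p → tr (dir d) a = b → stp enP (cfg p r x) a b := by
      intro a b d h e
      exact ⟨(a, d), (hc a d).2 (by rw [e]; exact h), Or.inl (by simp [enP, e])⟩
    obtain ⟨a1, a2⟩ := a; obtain ⟨b1, b2⟩ := b
    rw [tri_iff] at h1
    have h3 := h2
    rw [hs] at h3
    rcases h1 with ⟨h, h'⟩ | ⟨h, h'⟩ | ⟨h, h'⟩ | ⟨h, h'⟩ | ⟨h, h'⟩ | ⟨h, h'⟩ <;> simp only at h h'
    · exact key _ _ 0 h2 (by ext <;> simp [dir, tr] <;> omega)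
    · exact stp_symm (key _ _ 0 h3 (by ext <;> simp [dir, tr] <;> omega))
    · exact key _ _ 1 h2 (by ext <;> simp [dir, tr] <;> omega)
    · exact stp_symm (key _ _ 1 h3 (by ext <;> simp [dir, tr] <;> omega))
    · exact key _ _ 2 h2 (by ext <;> simp [dir, tr] <;> omega)
    · exact stp_symm (key _ _ 2 h3 (by ext <;> simp [dir, tr] <;> omega))
  · rintro ⟨⟨v, d⟩, h1, h2⟩
    refine ⟨(inc_adj h2).1, ?_⟩
    rw [hc] at h1
    rcases h2 with h2 | h2 <;> simp only [enP, Prod.mk.injEq] at h2 <;> obtain ⟨rfl, rfl⟩ := h2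
    · exact h1
    · rw [hs]; exact h1

theorem pCluster_eq (p r x : ℝ) (v : V) : pCluster (edgeCfg TriAdj p x) v = cl enP (cfg p r x) v := by
  have : (fun a b => edgeCfg TriAdj p x a b = true) = stp enP (cfg p r x) := by
    funext a b; exact propext (edge_stp p r x a b)
  unfold pCluster Conn cl
  rw [this]

theorem clusterRep_eq (p r x : ℝ) (v : V) : clusterRep (edgeCfg TriAdj p x) v = rep enP enc (cfg p r x) v := by
  unfold clusterRep
  rw [pCluster_eq p r x]
  obtain ⟨w, hw, he⟩ := Nat.sInf_mem (s := enc '' cl enP (cfg p r x) v) ⟨_, v, cl_self _ _, rfl⟩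
  rw [← he, Encodable.encodek, Option.getD_some]
  refine (rep_eq Encodable.encode_injective hw fun u hu => ?_).symm
  exact he.le.trans (Nat.sInf_le ⟨u, hu, rfl⟩)

theorem colour_eq (p r x : ℝ) (v : V) : colourCfg TriAdj p r x v = true ↔ v ∉ colS enP enc (cfg p r x) := by
  unfold colourCfg
  rw [boolOf_iff, clusterRep_eq p r x]
  show _ ↔ ¬ (cfg p r x (.inr (rep enP enc (cfg p r x) v)) = true)
  generalize rep enP enc (cfg p r x) v = w
  simp only [cfg, boolOf_iff, Dst, uIdx, Sum.elim_inr, Set.mem_Ici, vtxU, not_le]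

theorem meas_edge (p : ℝ) (a b : V) : Measurable (fun x => edgeCfg TriAdj p x a b) := by
  have h : MeasurableSet {x | TriAdj a b ∧ edgeU a b x < p} :=
    (MeasurableSet.const _).inter (meas_unif _ measurableSet_Iio)
  have e : (fun x => edgeCfg TriAdj p x a b) = fun x => boolOf (TriAdj a b ∧ edgeU a b x < p) := by
    funext x
    rw [Bool.eq_iff_iff, boolOf_iff]
    simp only [edgeCfg, Bool.and_eq_true, boolOf_iff]
  rw [e]
  exact meas_boolOf h

theorem meas_cl (p : ℝ) (v w : V) : MeasurableSet {x | w ∈ pCluster (edgeCfg TriAdj p x) v} := by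
  let S : ℕ → V → Set ℝ := fun n => Nat.rec (fun w => {x | w = v}) (fun _ A w => ⋃ u, A u ∩ {x | edgeCfg TriAdj p x u w = true}) n
  have hS : ∀ n w, MeasurableSet (S n w) := by
    intro n
    induction n with
    | zero => intro w; exact MeasurableSet.const _
    | succ n ih => intro w; exact MeasurableSet.iUnion fun u => (ih u).inter (meas_edge p u w (measurableSet_singleton true))
  have e : {x | w ∈ pCluster (edgeCfg TriAdj p x) v} = ⋃ n, S n w := by
    ext x
    rw [Set.mem_iUnion]
    constructor
    · intro h
      change Relation.ReflTransGen (fun a b => edgeCfg TriAdj p x a b = true) v w at h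
      induction h with
      | refl => exact ⟨0, rfl⟩
      | @tail a b _ hs ih =>
        obtain ⟨n, hn⟩ := ih
        exact ⟨n + 1, Set.mem_iUnion.2 ⟨a, hn, hs⟩⟩
    · rintro ⟨n, hn⟩
      show Relation.ReflTransGen (fun a b => edgeCfg TriAdj p x a b = true) v w
      induction n generalizing w with
      | zero => have : w = v := hn
                rw [this]
      | succ n ih =>
        obtain ⟨u, h1, h2⟩ := Set.mem_iUnion.1 hn
        exact (ih u h1).tail h2
  rw [e]
  exact MeasurableSet.iUnion fun n => hS n w

theorem meas_colour (p r : ℝ) (v : V) : Measurable (fun x => colourCfg TriAdj p r x v) := by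
  unfold colourCfg
  refine meas_boolOf ?_
  have e : {x | vtxU (clusterRep (edgeCfg TriAdj p x) v) x < r} =
      ⋃ w, ({x | w ∈ pCluster (edgeCfg TriAdj p x) v} ∩ ⋂ u, ({x | u ∈ pCluster (edgeCfg TriAdj p x) v}ᶜ ∪ {x | enc w ≤ enc u})) ∩ {x | vtxU w x < r} := by
    ext x
    simp only [Set.mem_iUnion, Set.mem_inter_iff, Set.mem_iInter, Set.mem_union, Set.mem_compl_iff, Set.mem_ofPred_eq]
    rw [clusterRep_eq p r x, pCluster_eq p r x]
    constructor
    · intro h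
      refine ⟨_, ⟨rep_mem _ _, fun u => ?_⟩, h⟩
      by_cases hu : u ∈ cl enP (cfg p r x) v
      · exact Or.inr (rep_le hu)
      · exact Or.inl hu
    · rintro ⟨w, ⟨h1, h2⟩, h3⟩
      rwa [rep_eq Encodable.encode_injective h1 fun u hu => (h2 u).resolve_left fun h => h hu]
  rw [e]
  refine MeasurableSet.iUnion fun w => ((meas_cl p v w).inter (MeasurableSet.iInter fun u => (meas_cl p v u).compl.union (MeasurableSet.const _))).inter ?_
  exact meas_unif _ measurableSet_Iio

theorem meas_cfg (p r : ℝ) : Measurable (fun x => (edgeCfg TriAdj p x, colourCfg TriAdj p r x)) :=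
  (measurable_pi_iff.2 fun a => measurable_pi_iff.2 fun b => meas_edge p a b).prodMk (measurable_pi_iff.2 fun v => meas_colour p r v)

theorem J_path {S : Set V} {v w : V} (h : J S v w) : ∃ (k : ℕ) (g : ℕ → V), g 0 = v ∧ g k = w ∧ (∀ i ≤ k, g i ∈ S) ∧ ∀ i < k, TriAdj (g i) (g (i + 1)) := by
  obtain ⟨h0, h⟩ := h
  induction h with
  | refl => exact ⟨0, fun _ => v, rfl, rfl, fun _ _ => h0, fun i hi => by omega⟩
  | @tail a b _ hs ih =>
    obtain ⟨k, g, h1, h2, h3, h4⟩ := ih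
    refine ⟨k + 1, fun i => if i ≤ k then g i else b, by simp [h1], by simp, fun i hi => ?_, fun i hi => ?_⟩
    · beta_reduce
      split_ifs with h
      · exact h3 i h
      · exact hs.2
    · beta_reduce
      rw [if_pos (by omega)]
      split_ifs with h
      · exact h4 i (by omega)
      · have : i = k := by omega
        rw [this, h2]; exact hs.1

/-- Deterministic step: no black vertical crossing forces a bad event at the left side. -/
theorem no_cross {p r x : ℝ} {n : ℕ} (hn : 1 ≤ n) (h : colourCfg TriAdj p r x ∉ VertBC TriAdj n (3 * n)) :
    ∃ y ∈ Finset.range (3 * n + 1), Bad n (0, (y : ℤ)) (cfg p r x) ∨ ∃ z ∈ bl n, Far n (tr (0, (y : ℤ)) z) (cfg p r x) := by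
  rcases hex (colS enP enc (cfg p r x)) 1 0 n 0 (3 * n) (Or.inl rfl) (by omega) (by omega) with ⟨a, e, h1, h2, h3⟩ | ⟨u, v, h1, h2, h3⟩
  · obtain ⟨a1, a2⟩ := a
    have ha := h1.left.2
    simp only [lf, Set.mem_ofPred_eq] at ha h2 h3
    have e1 : a1 = 0 := by omega
    have e2 : (a2.toNat : ℤ) = a2 := by omega
    subst e1
    refine ⟨a2.toNat, Finset.mem_range.2 (by omega), ?_⟩
    rw [e2]
    by_cases hF : ∃ z ∈ bl n, Far n (tr (0, a2) z) (cfg p r x)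
    · exact Or.inr hF
    · left
      refine ⟨⟨e, h1.mono Set.inter_subset_left, ?_⟩, fun z hz hf => hF ⟨df (0, a2) z, mem_bl.2 hz, by rwa [tr_df]⟩⟩
      rw [le_nrm]
      simp only [df]; omega
  · exfalso
    apply h
    have h1 := h1.symm
    obtain ⟨k, g, g0, gk, gS, gA⟩ := J_path h1
    have gR : ∀ i ≤ k, g i ∈ Rect n (3 * n) := by
      intro i hi
      have := (gS i hi).2
      simp only [lf, Set.mem_ofPred_eq] at this
      simp only [Rect, Set.mem_ofPred_eq]
      push_cast
      omega
    refine ⟨k, fun i => g i, fun i => ⟨gR i (by omega), (colour_eq p r x _).2 (gS i (by omega)).1⟩, fun i => gA i i.2, ?_, ?_⟩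
    · have := gR 0 (by omega)
      refine ⟨this, ?_⟩
      have h5 := this.2.2.2
      show (g 0).2 = _
      rw [g0] at h5 ⊢
      push_cast at h5 ⊢
      omega
    · have := gR k le_rfl
      refine ⟨this, ?_⟩
      have h5 := this.2.2.1
      show (g k).2 = _
      rw [gk] at h5 ⊢
      omega

theorem cross_bound {p r : ℝ} (hp : 0 ≤ p ∧ p ≤ 1) (hr : 0 ≤ r) {n : ℕ} (hn : 1 ≤ n) {N : ℕ} [NeZero N] (hN : (N : ℤ) = 400 * n) :
    1 ≤ DaCMeasure TriAdj p r (colourEvent (VertBC TriAdj n (3 * n))) +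
      ENNReal.ofReal ((3 * n + 1) * (ex (qq N p (max 0 (1 - r))) (fA false n) + (2 * n + 1) ^ 2 * tailA p n)) := by
  have hs : 0 ≤ max 0 (1 - r) ∧ max 0 (1 - r) ≤ 1 := ⟨le_max_left _ _, max_le zero_le_one (by linarith)⟩
  have hq := Pq_qq N hp hs
  set A := ex (qq N p (max 0 (1 - r))) (fA false n) with hA
  have hA0 : 0 ≤ A := ex_nonneg hq fun ω => ind_nonneg _
  have hT0 : 0 ≤ tailA p n := pr_nonneg (fun _ => hp) _
  have hc : ((bl (n : ℤ)).card : ℝ≥0∞) = ENNReal.ofReal ((2 * n + 1) ^ 2) := by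
    have h := card_bl (r := (n : ℤ)) (by omega)
    rw [Int.cast_natCast] at h
    rw [← h, ENNReal.ofReal_natCast]
  have hd : ((3 * n + 1 : ℕ) : ℝ≥0∞) = ENNReal.ofReal (3 * n + 1) := by
    have h : ((3 * n + 1 : ℕ) : ℝ) = 3 * n + 1 := by norm_cast
    rw [← h, ENNReal.ofReal_natCast]
  have h31 : (0 : ℝ) ≤ 3 * n + 1 := by positivity
  let G : Set ℝ := {x | colourCfg TriAdj p r x ∈ VertBC TriAdj n (3 * n)}
  have h1 : base G ≤ DaCMeasure TriAdj p r (colourEvent (VertBC TriAdj n (3 * n))) :=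
    Measure.le_map_apply (meas_cfg p r).aemeasurable _
  have h2 : base Gᶜ ≤ ENNReal.ofReal ((3 * n + 1) * (A + (2 * n + 1) ^ 2 * tailA p n)) := by
    have hsub : Gᶜ ⊆ ⋃ y ∈ Finset.range (3 * n + 1), ({x | Bad n (0, (y : ℤ)) (cfg p r x)} ∪ ⋃ z ∈ bl n, {x | Far n (tr (0, (y : ℤ)) z) (cfg p r x)}) := by
      intro x hx
      obtain ⟨y, hy, h⟩ := no_cross hn hx
      refine Set.mem_iUnion₂.2 ⟨y, hy, ?_⟩
      rcases h with h | ⟨z, hz, h⟩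
      · exact Or.inl h
      · exact Or.inr (Set.mem_iUnion₂.2 ⟨z, hz, h⟩)
    refine (measure_mono hsub).trans ((measure_biUnion_finset_le _ _).trans ?_)
    have hy : ∀ y ∈ Finset.range (3 * n + 1), base ({x | Bad n (0, (y : ℤ)) (cfg p r x)} ∪ ⋃ z ∈ bl n, {x | Far n (tr (0, (y : ℤ)) z) (cfg p r x)})
        ≤ ENNReal.ofReal (A + (2 * n + 1) ^ 2 * tailA p n) := by
      intro y _
      refine (measure_union_le _ _).trans ?_
      rw [ENNReal.ofReal_add hA0 (mul_nonneg (sq_nonneg _) hT0)]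
      refine add_le_add (cfg_bad hp hr (by omega) hN _) ?_
      have hf : ∀ z ∈ bl n, base {x | Far n (tr (0, (y : ℤ)) z) (cfg p r x)} ≤ ENNReal.ofReal (tailA p n) := fun z _ => cfg_far hp hr _ _
      refine (measure_biUnion_finset_le _ _).trans ((Finset.sum_le_sum hf).trans ?_)
      rw [Finset.sum_const, nsmul_eq_mul, hc, ← ENNReal.ofReal_mul (sq_nonneg _)]
    refine (Finset.sum_le_sum hy).trans ?_
    rw [Finset.sum_const, nsmul_eq_mul, Finset.card_range, hd, ← ENNReal.ofReal_mul h31]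
  calc (1 : ℝ≥0∞) = base Set.univ := measure_univ.symm
    _ ≤ base (G ∪ Gᶜ) := by rw [Set.union_compl_self]
    _ ≤ base G + base Gᶜ := measure_union_le _ _
    _ ≤ _ := add_le_add h1 h2

theorem main_aux (p : ℝ) (hp0 : 0 ≤ p) (hp : p < 2 * Real.sin (Real.pi / 18)) (ε : ℝ) (hε : 0 < ε) :
    Filter.limsup (fun n : ℕ => DaCMeasure TriAdj p (1 / 2 + ε) (colourEvent (VertBC TriAdj n (3 * n)))) Filter.atTop = 1 := by
  have hp1 : 0 ≤ p ∧ p ≤ 1 := ⟨hp0, hp.le.trans p0_mem.2⟩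
  set r := 1 / 2 + ε with hr
  obtain ⟨K, hK, hK'⟩ := white_decay (s := max 0 (1 - r)) hp0 hp (le_max_left _ _) (max_lt (by norm_num) (by rw [hr]; linarith)) 2
  obtain ⟨C, hC, hC'⟩ := tailB_SP hp0 hp 4
  have key : ∀ n : ℕ, 1 ≤ n → 1 - ENNReal.ofReal ((4 * K + 36 * C) / n) ≤ DaCMeasure TriAdj p r (colourEvent (VertBC TriAdj n (3 * n))) := by
    intro n hn
    haveI : NeZero (400 * n) := ⟨by omega⟩
    have h1 := cross_bound hp1 (r := r) (by rw [hr]; linarith) hn (N := 400 * n) (by push_cast; ring)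
    have h2 := hK' n (by omega) (400 * n) (by push_cast; ring)
    have h3 := hC' n (by omega)
    rw [tailB, if_neg (by omega)] at h3
    have hn' : (1 : ℝ) ≤ n := by exact_mod_cast hn
    rw [tsub_le_iff_right]
    refine h1.trans (add_le_add_right (ENNReal.ofReal_le_ofReal ?_) _)
    have hA0 : 0 ≤ ex (qq (400 * n) p (max 0 (1 - r))) (fA false n) :=
      ex_nonneg (Pq_qq _ hp1 ⟨le_max_left _ _, max_le zero_le_one (by rw [hr]; linarith)⟩) fun ω => ind_nonneg _
    have hT0 : 0 ≤ tailA p n := pr_nonneg (fun _ => hp1) _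
    generalize ex (qq (400 * n) p (max 0 (1 - r))) (fA false n) = A at *
    generalize tailA p n = T at *
    push_cast at h2 h3
    rw [le_div_iff₀ (by linarith)]
    have e1 : (3 * (n : ℝ) + 1) ≤ 4 * n := by linarith
    have e2 : (2 * (n : ℝ) + 1) ^ 2 ≤ 9 * n ^ 2 := by nlinarith
    calc (3 * (n : ℝ) + 1) * (A + (2 * n + 1) ^ 2 * T) * n ≤ (4 * n) * (A + (9 * n ^ 2) * T) * n := by gcongr
      _ = 4 * (A * n ^ 2) + 36 * (T * n ^ 4) := by ring
      _ ≤ _ := by linarith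
  have hle : ∀ n : ℕ, DaCMeasure TriAdj p r (colourEvent (VertBC TriAdj n (3 * n))) ≤ 1 := by
    intro n
    haveI : IsProbabilityMeasure (DaCMeasure TriAdj p r) := Measure.isProbabilityMeasure_map (meas_cfg p r).aemeasurable
    exact prob_le_one
  have hlim : Filter.Tendsto (fun n : ℕ => 1 - ENNReal.ofReal ((4 * K + 36 * C) / n)) Filter.atTop (nhds 1) := by
    have h1 : Filter.Tendsto (fun n : ℕ => ENNReal.ofReal ((4 * K + 36 * C) / n)) Filter.atTop (nhds 0) := by
      have := ENNReal.tendsto_ofReal (tendsto_const_div_atTop_nhds_zero_nat (4 * K + 36 * C))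
      rwa [ENNReal.ofReal_zero] at this
    have := ENNReal.Tendsto.sub (tendsto_const_nhds (x := (1 : ℝ≥0∞))) h1 (Or.inl ENNReal.one_ne_top)
    rwa [tsub_zero] at this
  refine Filter.Tendsto.limsup_eq (tendsto_of_tendsto_of_tendsto_of_le_of_le' hlim tendsto_const_nhds ?_ (Filter.Eventually.of_forall hle))
  filter_upwards [Filter.eventually_ge_atTop 1] with n hn using key n hn
end
end DaC

namespace DaC

/-- **Theorem 5.3.** On the triangular lattice, for every subcritical
`p < 2 sin(π/18)` and every `ε > 0`,
`limsup_{n→∞} ℙ_{p,1/2+ε}(V^b_{n,3n}) = 1`. -/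
theorem tri_crossing_limsup_one (p : ℝ) (hp0 : 0 ≤ p)
    (hp : p < 2 * Real.sin (Real.pi / 18)) (ε : ℝ) (hε : 0 < ε) :
    Filter.limsup
        (fun n : ℕ =>
          DaCMeasure TriAdj p (1 / 2 + ε) (colourEvent (VertBC TriAdj n (3 * n))))
        Filter.atTop = 1 := by
  exact main_aux p hp0 hp ε hε

end DaC
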